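/- Suppose n ∈ S^{d−1} satisfies the Diophantine condition with constant ϰ > 0, and let T ∈ ℝ^d be a constant vector with T·n = 0 and |T| ≤ 1, and φ ∈ C^∞(𝕋^d;ℝ^m). Then the lifted Neumann problem has a smooth solution U, unique up to an additive constant among solutions with U ∈ L^∞(𝕋^d×ℝ₊) and ∇_θ U, ∂_t U ∈ L²(𝕋^d×ℝ₊). Moreover: (i) for every multi-index α and integer j ≥ 0, ∫_0^∞ ∫_{𝕋^d} (|N^T∇_θ ∂_θ^α ∂_t^j U|² + |∂_θ^α ∂_t^{1+j} U|²) dθ dt ≤ C ‖φ‖²_{C^{|α|+j+1}(𝕋^d)}, with C depending only on d, m, |α|, j and A; (ii) there exists a constant vector U_∞ such that for all multi-indices α and integers j, ℓ ≥ 0, |N^T∇_θ ∂_θ^α ∂_t^j U| + |∂_θ^α ∂_t^{1+j} U| + ϰ|∂_θ^α(U − U_∞)| ≤ C_ℓ ‖φ‖_{C^k(𝕋^d)} (1+ϰt)^{−ℓ}, where k = k(|α|, j, ℓ, d) and C_ℓ depends only on d, m, |α|, j, ℓ and A. -/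

import Mathlib

open MeasureTheory
open scoped BigOperators Topology

noncomputable section

/-- `ℝ^d` with the Euclidean norm. -/
abbrev Euc (d : ℕ) := EuclideanSpace ℝ (Fin d)

/-- The dot product on `ℝ^d`. -/
def dotp {d : ℕ} (x y : Euc d) : ℝ := ∑ i, x i * y i

/-- The partial derivative `∂f/∂x_i`. -/
def pder {d : ℕ} (i : Fin d) (f : Euc d → ℝ) (x : Euc d) : ℝ :=
  fderiv ℝ f x (EuclideanSpace.single i 1)

/-- An integer vector, viewed as an element of `ℝ^d`. -/
def zvec {d : ℕ} (z : Fin d → ℤ) : Euc d :=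
  (WithLp.equiv 2 (∀ _ : Fin d, ℝ)).symm fun k => (z k : ℝ)

/-- A coefficient tensor `A = (a_{ij}^{αβ})` that is smooth, 1-periodic and uniformly
elliptic with ellipticity constant `lam`. -/
structure Coeffs (d m : ℕ) : Type where
  a : Fin d → Fin d → Fin m → Fin m → Euc d → ℝ
  lam : ℝ
  lam_pos : 0 < lam
  smooth : ∀ i j α β, ContDiff ℝ (⊤ : ℕ∞) (a i j α β)
  periodic : ∀ i j α β (x : Euc d) (z : Fin d → ℤ), a i j α β (x + zvec z) = a i j α β x
  ell_low : ∀ (x : Euc d) (ξ : Fin m → Fin d → ℝ),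
    lam * (∑ α, ∑ i, ξ α i ^ 2) ≤ ∑ i, ∑ j, ∑ α, ∑ β, a i j α β x * ξ α i * ξ β j
  ell_up : ∀ (x : Euc d) (ξ : Fin m → Fin d → ℝ),
    ∑ i, ∑ j, ∑ α, ∑ β, a i j α β x * ξ α i * ξ β j ≤ lam⁻¹ * (∑ α, ∑ i, ξ α i ^ 2)

/-- The adjoint coefficients `a*_{ij}^{αβ} = a_{ji}^{βα}`. -/
def astar {d m : ℕ} (A : Coeffs d m) : Fin d → Fin d → Fin m → Fin m → Euc d → ℝ :=
  fun i j α β => A.a j i β α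

/-- `u` solves the second order elliptic system `-∂_i (c_{ij}^{αβ} ∂_j u^β) = 0` in `Ω`. -/
def IsSolOf {d m : ℕ} (c : Fin d → Fin d → Fin m → Fin m → Euc d → ℝ)
    (Ω : Set (Euc d)) (u : Euc d → Fin m → ℝ) : Prop :=
  ∀ x ∈ Ω, ∀ α : Fin m,
    ∑ i, pder i (fun y => ∑ j, ∑ β, c i j α β y * pder j (fun w => u w β) y) x = 0

/-- The half-space `ℍ^d_n(s) = {x : x·n < -s}`. -/
def halfSpace {d : ℕ} (n : Euc d) (s : ℝ) : Set (Euc d) := {x | dotp x n < -s}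

/-- The hyperplane `{x : x·n = -s}`, the boundary of `ℍ^d_n(s)`. -/
def hyperplane {d : ℕ} (n : Euc d) (s : ℝ) : Set (Euc d) := {x | dotp x n = -s}

/-- A (componentwise) bounded `ℝ^m`-valued function. -/
def IsBddFn {d m : ℕ} (u : Euc d → Fin m → ℝ) : Prop := ∃ C : ℝ, ∀ x α, |u x α| ≤ C

/-- `u` is a solution of the Dirichlet problem in the half-space `ℍ^d_n(s)` with boundary
data `φ`, for the operator with coefficients `c`:  it is smooth inside, continuous up to the
boundary, solves the system inside and attains the boundary value `φ`. -/
def IsDirSol {d m : ℕ} (c : Fin d → Fin d → Fin m → Fin m → Euc d → ℝ)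
    (n : Euc d) (s : ℝ) (φ u : Euc d → Fin m → ℝ) : Prop :=
  ContDiffOn ℝ (⊤ : ℕ∞) u (halfSpace n s) ∧ ContinuousOn u (closure (halfSpace n s)) ∧
    IsSolOf c (halfSpace n s) u ∧ ∀ x ∈ hyperplane n s, u x = φ x

/-- The index `d-1`, the "last" coordinate direction, corresponding to the `t` variable in
the lifted problems. -/
def lastIdx (d : ℕ) (hd : 0 < d) : Fin d := ⟨d - 1, Nat.sub_lt hd Nat.one_pos⟩

/-- The matrix `M` has orthonormal columns. -/
def IsOrtho {d : ℕ} (M : Fin d → Fin d → ℝ) : Prop :=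
  ∀ k l, ∑ i, M i k * M i l = (if k = l then (1 : ℝ) else 0)

/-- The last column of `M` is `-n`, i.e. `M = (N, -n)`. -/
def LastColNeg {d : ℕ} (hd : 0 < d) (n : Euc d) (M : Fin d → Fin d → ℝ) : Prop :=
  ∀ i, M i (lastIdx d hd) = -(n i)

/-- The `k`-th component of the lifted gradient `(Nᵀ∇_θ, ∂_t)`: for `k ≠ d-1` it is the
`k`-th entry of `Nᵀ∇_θ` (where `N` consists of the first `d-1` columns of `M`), and for
`k = d-1` it is `∂_t`. -/
def liftD {d : ℕ} (hd : 0 < d) (M : Fin d → Fin d → ℝ) (k : Fin d)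
    (f : Euc d → ℝ → ℝ) (θ : Euc d) (t : ℝ) : ℝ :=
  if k = lastIdx d hd then deriv (f θ) t
  else ∑ i, M i k * pder i (fun θ' => f θ' t) θ

/-- The coefficients `B_n(θ,t) = Mᵀ A*(θ - tn) M` of the lifted problem. -/
def liftB {d m : ℕ} (A : Coeffs d m) (n : Euc d) (M : Fin d → Fin d → ℝ)
    (k l : Fin d) (α β : Fin m) (θ : Euc d) (t : ℝ) : ℝ :=
  ∑ i, ∑ j, M i k * astar A i j α β (θ - t • n) * M j l

/-- The α-component of `(Nᵀ∇_θ, ∂_t) · B_n (Nᵀ∇_θ, ∂_t) V` at `(θ,t)`. -/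
def liftOp {d m : ℕ} (hd : 0 < d) (A : Coeffs d m) (n : Euc d) (M : Fin d → Fin d → ℝ)
    (V : Euc d → ℝ → Fin m → ℝ) (α : Fin m) (θ : Euc d) (t : ℝ) : ℝ :=
  ∑ k, liftD hd M k
    (fun a b => ∑ l, ∑ β, liftB A n M k l α β a b * liftD hd M l (fun a' b' => V a' b' β) a b)
    θ t

/-- `V` solves the lifted Dirichlet problem in `𝕋^d × (0,∞)` with Dirichlet data `φ`:
`-(Nᵀ∇_θ, ∂_t) · B_n (Nᵀ∇_θ, ∂_t) V = 0` for `t > 0` and `V(θ,0) = φ(θ)`.  (Functions on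
`𝕋^d` are identified with `ℤ^d`-periodic functions on `ℝ^d`; the solution, which is smooth
up to the boundary, is represented by a smooth function on `ℝ^d × ℝ`.) -/
structure IsLiftedDirSol {d m : ℕ} (hd : 0 < d) (A : Coeffs d m) (n : Euc d)
    (M : Fin d → Fin d → ℝ) (φ : Euc d → Fin m → ℝ) (V : Euc d → ℝ → Fin m → ℝ) : Prop where
  smooth : ContDiff ℝ (⊤ : ℕ∞) (fun p : Euc d × ℝ => V p.1 p.2)
  periodic : ∀ (θ : Euc d) (z : Fin d → ℤ) (t : ℝ), V (θ + zvec z) t = V θ t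
  eqn : ∀ (θ : Euc d) (t : ℝ), 0 < t → ∀ α, liftOp hd A n M V α θ t = 0
  bc : ∀ θ, V θ 0 = φ θ

/-- `U` solves the lifted Neumann problem in `𝕋^d × (0,∞)` with Neumann data `g`:
`-(Nᵀ∇_θ, ∂_t) · B_n (Nᵀ∇_θ, ∂_t) U = 0` for `t > 0` and
`-e_{d+1} · B_n (Nᵀ∇_θ, ∂_t) U = g` at `t = 0`. -/
structure IsLiftedNeuSol {d m : ℕ} (hd : 0 < d) (A : Coeffs d m) (n : Euc d)
    (M : Fin d → Fin d → ℝ) (g : Euc d → Fin m → ℝ) (U : Euc d → ℝ → Fin m → ℝ) : Prop where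
  smooth : ContDiff ℝ (⊤ : ℕ∞) (fun p : Euc d × ℝ => U p.1 p.2)
  periodic : ∀ (θ : Euc d) (z : Fin d → ℤ) (t : ℝ), U (θ + zvec z) t = U θ t
  eqn : ∀ (θ : Euc d) (t : ℝ), 0 < t → ∀ α, liftOp hd A n M U α θ t = 0
  bc : ∀ (θ : Euc d) (α : Fin m),
    -(∑ l, ∑ β, liftB A n M (lastIdx d hd) l α β θ 0 *
        liftD hd M l (fun a b => U a b β) θ 0) = g θ α

/-- `j`-th derivative in `t`. -/
def dtj {d : ℕ} (j : ℕ) (f : Euc d → ℝ → ℝ) : Euc d → ℝ → ℝ := fun θ t => deriv^[j] (f θ) t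

/-- partial derivative in `θ_i`. -/
def dth {d : ℕ} (i : Fin d) (f : Euc d → ℝ → ℝ) : Euc d → ℝ → ℝ :=
  fun θ t => pder i (fun a => f a t) θ

/-- iterated partial derivative `∂_θ^α` for the multi-index given by the list `l`. -/
def dthMulti {d : ℕ} (l : List (Fin d)) (f : Euc d → ℝ → ℝ) : Euc d → ℝ → ℝ := l.foldr dth f

/-- The `C^k(𝕋^d)` norm of a (periodic) function. -/
def CkNorm {d m : ℕ} (k : ℕ) (φ : Euc d → Fin m → ℝ) : ℝ :=
  ∑ j ∈ Finset.range (k + 1), ⨆ x : Euc d, ‖iteratedFDeriv ℝ j φ x‖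

/-- The fundamental cell `[0,1)^d` of `𝕋^d = ℝ^d/ℤ^d`. -/
def unitCell (d : ℕ) : Set (Euc d) := {θ | ∀ i, 0 ≤ θ i ∧ θ i < 1}

/-- `n` satisfies the Diophantine condition `|(I - n⊗n)ξ| ≥ κ|ξ|^{-2}` for all
`ξ ∈ ℤ^d \ {0}` (stated in squared form), with constant `κ > 0`. -/
def IsDioph {d : ℕ} (n : Euc d) (κ : ℝ) : Prop :=
  0 < κ ∧ ∀ ξ : Fin d → ℤ, ξ ≠ 0 →
    κ ^ 2 * ((∑ i, ((ξ i : ℝ)) ^ 2) ^ 2)⁻¹ ≤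
      ∑ i, ((ξ i : ℝ) - (∑ j, (ξ j : ℝ) * n j) * n i) ^ 2

/-- The "tangential" index set: all lifted directions except the last (`t`) direction;
these correspond to the components of `Nᵀ∇_θ`. -/
def tanIdx (d : ℕ) (hd : 0 < d) : Finset (Fin d) :=
  Finset.univ.filter fun k => k ≠ lastIdx d hd


section
open scoped Pointwise
set_option linter.all false

/-! ## Part 1: Fourier analysis on the torus -/

/-- exponential monomial -/
def ec {d : ℕ} (ξ : Fin d → ℤ) (θ : Euc d) : ℂ :=
  Complex.exp (2 * Real.pi * Complex.I * ((∑ i, (ξ i : ℝ) * θ i : ℝ) : ℂ))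

def Per {d : ℕ} {F : Type*} (f : Euc d → F) : Prop := ∀ (θ : Euc d) (z : Fin d → ℤ), f (θ + zvec z) = f θ

/-- Fourier coefficient -/
def fc {d : ℕ} (f : Euc d → ℂ) (ξ : Fin d → ℤ) : ℂ := ∫ θ in unitCell d, ec (-ξ) θ * f θ

/-- Japanese bracket -/
def jb {d : ℕ} (ξ : Fin d → ℤ) : ℝ := 1 + ∑ i, |(ξ i : ℝ)|

/-- the frequency pairing -/
def zdot {d : ℕ} (ξ : Fin d → ℤ) (v : Euc d) : ℝ := ∑ i, (ξ i : ℝ) * v i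

theorem zvec_apply {d : ℕ} (z : Fin d → ℤ) (i : Fin d) : zvec z i = (z i : ℝ) := rfl

theorem ec_eq {d : ℕ} (ξ : Fin d → ℤ) (θ : Euc d) :
    ec ξ θ = Complex.exp ((2 * Real.pi * zdot ξ θ : ℝ) * Complex.I) := by
  unfold ec zdot; congr 1; push_cast; ring

theorem norm_ec {d : ℕ} (ξ : Fin d → ℤ) (θ : Euc d) : ‖ec ξ θ‖ = 1 := by
  rw [ec_eq, Complex.norm_exp_ofReal_mul_I]

theorem zdot_add_right {d : ℕ} (ξ : Fin d → ℤ) (v w : Euc d) : zdot ξ (v + w) = zdot ξ v + zdot ξ w := by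
  simp [zdot, mul_add, Finset.sum_add_distrib]

theorem zdot_smul_right {d : ℕ} (ξ : Fin d → ℤ) (c : ℝ) (v : Euc d) : zdot ξ (c • v) = c * zdot ξ v := by
  simp only [zdot, PiLp.smul_apply, smul_eq_mul, Finset.mul_sum]
  exact Finset.sum_congr rfl fun i _ => by ring

theorem zdot_sub_right {d : ℕ} (ξ : Fin d → ℤ) (v w : Euc d) : zdot ξ (v - w) = zdot ξ v - zdot ξ w := by
  simp [zdot, mul_sub, Finset.sum_sub_distrib]

theorem zdot_add_left {d : ℕ} (ξ η : Fin d → ℤ) (v : Euc d) : zdot (ξ + η) v = zdot ξ v + zdot η v := by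
  simp [zdot, add_mul, Finset.sum_add_distrib]

theorem zdot_sub_left {d : ℕ} (ξ η : Fin d → ℤ) (v : Euc d) : zdot (ξ - η) v = zdot ξ v - zdot η v := by
  simp [zdot, sub_mul, Finset.sum_sub_distrib]

theorem zdot_neg_left {d : ℕ} (ξ : Fin d → ℤ) (v : Euc d) : zdot (-ξ) v = - zdot ξ v := by
  simp [zdot]

theorem zdot_zero_left {d : ℕ} (v : Euc d) : zdot (0 : Fin d → ℤ) v = 0 := by
  simp [zdot]

theorem ec_add_left {d : ℕ} (ξ η : Fin d → ℤ) (θ : Euc d) : ec (ξ + η) θ = ec ξ θ * ec η θ := by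
  simp only [ec_eq, zdot_add_left, ← Complex.exp_add]; congr 1; push_cast; ring

theorem ec_add_right {d : ℕ} (ξ : Fin d → ℤ) (θ h : Euc d) : ec ξ (θ + h) = ec ξ θ * ec ξ h := by
  simp only [ec_eq, zdot_add_right, ← Complex.exp_add]; congr 1; push_cast; ring

theorem ec_zero {d : ℕ} (θ : Euc d) : ec (0 : Fin d → ℤ) θ = 1 := by simp [ec_eq, zdot_zero_left]

theorem ec_neg {d : ℕ} (ξ : Fin d → ℤ) (θ : Euc d) : ec (-ξ) θ = (starRingEnd ℂ) (ec ξ θ) := by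
  rw [ec_eq, ec_eq, zdot_neg_left, ← Complex.exp_conj]
  congr 1
  rw [map_mul, Complex.conj_ofReal, Complex.conj_I]; push_cast; ring

theorem ec_zvec {d : ℕ} (ξ z : Fin d → ℤ) : ec ξ (zvec z) = 1 := by
  rw [ec_eq, Complex.exp_eq_one_iff]
  refine ⟨∑ i, ξ i * z i, ?_⟩
  simp only [zdot, zvec_apply]; push_cast; ring

theorem ec_per {d : ℕ} (ξ : Fin d → ℤ) : Per (ec ξ) := fun θ z => by
  rw [ec_add_right, ec_zvec, mul_one]

/-- zdot as continuous linear map -/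
def zdotL {d : ℕ} (ξ : Fin d → ℤ) : Euc d →L[ℝ] ℝ :=
  ∑ i, (ξ i : ℝ) • (EuclideanSpace.proj i : Euc d →L[ℝ] ℝ)

theorem zdotL_apply {d : ℕ} (ξ : Fin d → ℤ) (v : Euc d) : zdotL ξ v = zdot ξ v := by
  simp [zdotL, zdot]

theorem ec_contDiff {d : ℕ} (ξ : Fin d → ℤ) {n : WithTop ℕ∞} : ContDiff ℝ n (ec ξ) := by
  have : ec ξ = fun θ => Complex.exp ((2 * Real.pi * zdotL ξ θ : ℝ) * Complex.I) := by
    ext θ; rw [ec_eq, zdotL_apply]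
  rw [this]
  have h1 : ContDiff ℝ n (fun θ : Euc d => (2 * Real.pi * zdotL ξ θ : ℝ)) :=
    contDiff_const.mul (zdotL ξ).contDiff
  exact ((Complex.ofRealCLM.contDiff.comp h1).mul contDiff_const).cexp

theorem ec_continuous {d : ℕ} (ξ : Fin d → ℤ) : Continuous (ec ξ) := (ec_contDiff ξ (n := 0)).continuous

theorem ec_hasFDerivAt {d : ℕ} (ξ : Fin d → ℤ) (θ v : Euc d) :
    fderiv ℝ (ec ξ) θ v = (2 * Real.pi * Complex.I * zdot ξ v) * ec ξ θ := by
  have hd : DifferentiableAt ℝ (ec ξ) θ := (ec_contDiff ξ (n := 1)).differentiable (by simp) θ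
  have h0 : HasDerivAt (fun s : ℝ => θ + s • v) v 0 := by
    simpa using ((hasDerivAt_id (0:ℝ)).smul_const v).const_add θ
  have h1 : HasDerivAt (fun s : ℝ => ec ξ (θ + s • v)) (fderiv ℝ (ec ξ) θ v) 0 := by
    have hd' : HasFDerivAt (ec ξ) (fderiv ℝ (ec ξ) θ) (θ + (0:ℝ) • v) := by simpa using hd.hasFDerivAt
    exact hd'.comp_hasDerivAt 0 h0
  have h2 : HasDerivAt (fun s : ℝ => ec ξ (θ + s • v)) ((2 * Real.pi * Complex.I * zdot ξ v) * ec ξ θ) 0 := by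
    have e1 : (fun s : ℝ => ec ξ (θ + s • v)) =
        fun s : ℝ => ec ξ θ * Complex.exp ((2 * Real.pi * Complex.I * zdot ξ v) * (s : ℂ)) := by
      ext s
      rw [ec_add_right, ec_eq ξ (s • v), zdot_smul_right]; congr 2; push_cast; ring
    rw [e1]
    have h3 : HasDerivAt (fun s : ℝ => (2 * Real.pi * Complex.I * zdot ξ v) * (s : ℂ))
        ((2 * Real.pi * Complex.I * zdot ξ v) * 1) 0 := (Complex.ofRealCLM.hasDerivAt).const_mul _
    have := (h3.cexp).const_mul (ec ξ θ)
    refine this.congr_deriv ?_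
    rw [Complex.ofReal_zero, mul_zero, Complex.exp_zero]; ring
  exact h1.unique h2

/-! cell -/

theorem unitCell_eq {d : ℕ} : unitCell d = ZSpan.fundamentalDomain (EuclideanSpace.basisFun (Fin d) ℝ).toBasis := by
  ext θ
  simp [unitCell, ZSpan.mem_fundamentalDomain]

theorem unitCell_meas {d : ℕ} : MeasurableSet (unitCell d) := by
  rw [unitCell_eq]; exact ZSpan.fundamentalDomain_measurableSet _

theorem unitCell_bdd {d : ℕ} : Bornology.IsBounded (unitCell d) := by
  rw [unitCell_eq]; exact ZSpan.fundamentalDomain_isBounded _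

theorem unitCell_vol {d : ℕ} : (volume : Measure (Euc d)) (unitCell d) = 1 := by
  rw [unitCell_eq, ZSpan.measure_fundamentalDomain _ volume (EuclideanSpace.basisFun (Fin d) ℝ).toBasis]
  rw [← ZSpan.measure_fundamentalDomain _ volume (EuclideanSpace.basisFun (Fin d) ℝ).toBasis]
  rw [measure_congr (ZSpan.fundamentalDomain_ae_parallelepiped _ volume)]
  exact (EuclideanSpace.basisFun (Fin d) ℝ).volume_parallelepiped

instance cellProb {d : ℕ} : IsProbabilityMeasure ((volume : Measure (Euc d)).restrict (unitCell d)) :=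
  ⟨by simp [unitCell_vol]⟩

theorem zvec_mem {d : ℕ} (x : Euc d)
    (hx : x ∈ Submodule.span ℤ (Set.range (EuclideanSpace.basisFun (Fin d) ℝ).toBasis)) :
    ∃ z : Fin d → ℤ, x = zvec z := by
  rw [Module.Basis.mem_span_iff_repr_mem] at hx
  choose z hz using hx
  refine ⟨z, ?_⟩
  ext i
  have := hz i
  simpa [zvec_apply] using this.symm

theorem cell_translate {d : ℕ} {F : Type*} [NormedAddCommGroup F] [NormedSpace ℝ F]
    (f : Euc d → F) (hf : Per f) (h : Euc d) :
    ∫ θ in unitCell d, f (θ + h) = ∫ θ in unitCell d, f θ := by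
  have hfd := ZSpan.isAddFundamentalDomain' (EuclideanSpace.basisFun (Fin d) ℝ).toBasis (volume : Measure (Euc d))
  have hm : MeasurePreserving (fun θ : Euc d => h + θ) volume volume := measurePreserving_add_left volume h
  have he : MeasurableEmbedding (fun θ : Euc d => h + θ) := measurableEmbedding_addLeft h
  have hS := hfd.vadd_of_comm h
  rw [← unitCell_eq] at hfd hS
  have e1 : ∫ θ in (h +ᵥ unitCell d), f θ = ∫ θ in unitCell d, f (h + θ) :=
    hm.setIntegral_image_emb he f (unitCell d)
  simp_rw [add_comm _ h]
  rw [← e1]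
  have : Countable (Submodule.span ℤ (Set.range (EuclideanSpace.basisFun (Fin d) ℝ).toBasis)).toAddSubgroup :=
    inferInstanceAs (Countable (Submodule.span ℤ (Set.range (EuclideanSpace.basisFun (Fin d) ℝ).toBasis)))
  refine hS.setIntegral_eq hfd ?_
  intro g x
  obtain ⟨z, hz⟩ := zvec_mem g.1 g.2
  have : g +ᵥ x = x + zvec z := by rw [← hz, add_comm]; rfl
  rw [this, hf]

end

section
open scoped Pointwise
set_option linter.all false

theorem cell_isCompact {d : ℕ} : IsCompact (closure (unitCell d)) :=
  Metric.isCompact_of_isClosed_isBounded isClosed_closure unitCell_bdd.closure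

theorem cell_integrable {d : ℕ} {F : Type*} [NormedAddCommGroup F] {f : Euc d → F}
    (hf : Continuous f) : IntegrableOn f (unitCell d) :=
  (hf.continuousOn.integrableOn_compact cell_isCompact).mono_set subset_closure

theorem cell_rep {d : ℕ} (θ : Euc d) : ∃ z : Fin d → ℤ, θ + zvec z ∈ unitCell d := by
  refine ⟨fun i => -⌊θ i⌋, fun i => ?_⟩
  have h1 := Int.floor_le (θ i)
  have h2 := Int.lt_floor_add_one (θ i)
  simp only [PiLp.add_apply, zvec_apply]
  push_cast
  constructor <;> linarith

theorem per_bdd {d : ℕ} {F : Type*} [NormedAddCommGroup F] {f : Euc d → F}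
    (hf : Continuous f) (hp : Per f) : ∃ C, ∀ θ, ‖f θ‖ ≤ C := by
  obtain ⟨C, hC⟩ := cell_isCompact.exists_bound_of_continuousOn (hf.continuousOn (s := closure (unitCell d)))
  refine ⟨C, fun θ => ?_⟩
  obtain ⟨z, hz⟩ := cell_rep θ
  rw [← hp θ z]; exact hC _ (subset_closure hz)

theorem cell_hasDerivAt {d : ℕ} {F : Type*} [NormedAddCommGroup F] [NormedSpace ℝ F] [CompleteSpace F]
    (f f' : Euc d → ℝ → F) (hf : Continuous (fun x : Euc d × ℝ => f x.1 x.2))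
    (hf' : Continuous (fun x : Euc d × ℝ => f' x.1 x.2)) (hd : ∀ θ t, HasDerivAt (f θ) (f' θ t) t) (t : ℝ) :
    HasDerivAt (fun t => ∫ θ in unitCell d, f θ t) (∫ θ in unitCell d, f' θ t) t := by
  have hK : IsCompact (closure (unitCell d) ×ˢ Metric.closedBall t 1) :=
    cell_isCompact.prod (isCompact_closedBall t 1)
  obtain ⟨C, hC⟩ := hK.exists_bound_of_continuousOn hf'.continuousOn
  have hc : ∀ s, Continuous fun θ => f θ s := fun s => hf.comp (by fun_prop : Continuous fun θ : Euc d => (θ, s))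
  have hc' : ∀ s, Continuous fun θ => f' θ s := fun s => hf'.comp (by fun_prop : Continuous fun θ : Euc d => (θ, s))
  refine (hasDerivAt_integral_of_dominated_loc_of_deriv_le (F := fun s θ => f θ s) (F' := fun s θ => f' θ s)
    (bound := fun _ => C) (s := Metric.ball t 1) (Metric.ball_mem_nhds t one_pos) ?_ ?_ ?_ ?_ ?_ ?_).2
  · exact Filter.Eventually.of_forall fun s => (hc s).aestronglyMeasurable
  · exact cell_integrable (hc t)
  · exact (hc' t).aestronglyMeasurable
  · refine (ae_restrict_iff' unitCell_meas).2 (Filter.Eventually.of_forall fun θ hθ s hs => ?_)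
    exact hC (θ, s) ⟨subset_closure hθ, Metric.ball_subset_closedBall hs⟩
  · exact integrable_const C
  · exact Filter.Eventually.of_forall fun θ s _ => hd θ s

theorem line_hasDerivAt {d : ℕ} {F : Type*} [NormedAddCommGroup F] [NormedSpace ℝ F]
    {f : Euc d → F} (hf : Differentiable ℝ f) (θ v : Euc d) (s : ℝ) :
    HasDerivAt (fun s : ℝ => f (θ + s • v)) (fderiv ℝ f (θ + s • v) v) s := by
  have h0 : HasDerivAt (fun s : ℝ => θ + s • v) v s := by
    simpa using ((hasDerivAt_id s).smul_const v).const_add θ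
  exact (hf _).hasFDerivAt.comp_hasDerivAt s h0

theorem per_fderiv {d : ℕ} {F : Type*} [NormedAddCommGroup F] [NormedSpace ℝ F]
    {f : Euc d → F} (hp : Per f) : Per (fderiv ℝ f) := fun θ z => by
  have : (fun x => f (x + zvec z)) = f := funext fun x => hp x z
  rw [← fderiv_comp_add_right, this]

theorem cell_fderiv_zero {d : ℕ} {F : Type*} [NormedAddCommGroup F] [NormedSpace ℝ F] [CompleteSpace F]
    {f : Euc d → F} (hf : ContDiff ℝ 1 f) (hp : Per f) (v : Euc d) :
    ∫ θ in unitCell d, fderiv ℝ f θ v = 0 := by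
  have hdf := hf.differentiable (by simp)
  have hcf := hf.continuous_fderiv (by simp)
  have h1 := cell_hasDerivAt (fun θ s => f (θ + s • v)) (fun θ s => fderiv ℝ f (θ + s • v) v)
    (hf.continuous.comp (by fun_prop)) ((hcf.comp (by fun_prop)).clm_apply continuous_const)
    (fun θ s => line_hasDerivAt hdf θ v s) 0
  have h2 : (fun s : ℝ => ∫ θ in unitCell d, f (θ + s • v)) = fun _ => ∫ θ in unitCell d, f θ :=
    funext fun s => cell_translate f hp _
  rw [h2] at h1
  have := h1.unique (hasDerivAt_const 0 _)
  simpa using this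

theorem fc_fderiv {d : ℕ} {f : Euc d → ℂ} (hf : ContDiff ℝ 1 f) (hp : Per f) (ξ : Fin d → ℤ) (v : Euc d) :
    fc (fun θ => fderiv ℝ f θ v) ξ = (2 * Real.pi * Complex.I * zdot ξ v) * fc f ξ := by
  have h := cell_fderiv_zero (f := fun θ => ec (-ξ) θ * f θ) ((ec_contDiff _).mul hf)
    (fun θ z => by simp only [ec_per _ θ z, hp θ z]) v
  have hcf := hf.continuous_fderiv (by simp)
  have e : ∀ θ, fderiv ℝ (fun θ => ec (-ξ) θ * f θ) θ v =
      ec (-ξ) θ * fderiv ℝ f θ v - (2 * Real.pi * Complex.I * zdot ξ v) * (ec (-ξ) θ * f θ) := by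
    intro θ
    rw [fderiv_fun_mul ((ec_contDiff (-ξ) (n := 1)).differentiable (by simp) θ) (hf.differentiable (by simp) θ)]
    simp only [add_apply, smul_apply, smul_eq_mul, ec_hasFDerivAt,
      zdot_neg_left]
    push_cast; ring
  simp_rw [e] at h
  have hi1 : IntegrableOn (fun θ => ec (-ξ) θ * fderiv ℝ f θ v) (unitCell d) :=
    cell_integrable ((ec_continuous _).mul (hcf.clm_apply continuous_const))
  have hi2 : IntegrableOn (fun θ => (2 * Real.pi * Complex.I * zdot ξ v) * (ec (-ξ) θ * f θ)) (unitCell d) :=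
    cell_integrable (continuous_const.mul ((ec_continuous _).mul hf.continuous))
  rw [integral_sub hi1 hi2, integral_const_mul] at h
  exact sub_eq_zero.1 h

/-! torus bridge -/

section torus
attribute [local instance] instMeasureSpaceUnitAddCircle
attribute [local instance] instIsProbabilityMeasureUnitAddCircleVolume

theorem mFourier_ec {d : ℕ} (ξ : Fin d → ℤ) (x : Euc d) :
    UnitAddTorus.mFourier ξ (fun i => ((x i : ℝ) : AddCircle (1:ℝ))) = ec ξ x := by
  rw [ec_eq]
  simp only [UnitAddTorus.mFourier, ContinuousMap.coe_mk, fourier_coe_apply]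
  rw [← Complex.exp_sum]
  congr 1
  simp only [zdot]; push_cast
  rw [Finset.mul_sum, Finset.sum_mul]
  exact Finset.sum_congr rfl fun i _ => by ring

/-- the function on the torus -/
def torF {d : ℕ} (f : Euc d → ℂ) (y : UnitAddTorus (Fin d)) : ℂ :=
  f (WithLp.toLp 2 fun i => ((AddCircle.equivIco 1 0 (y i)).1))

theorem torF_apply {d : ℕ} {f : Euc d → ℂ} (hp : Per f) (x : Euc d) :
    torF f (fun i => ((x i : ℝ) : AddCircle (1:ℝ))) = f x := by
  have : (WithLp.toLp 2 fun i => ((AddCircle.equivIco (1:ℝ) 0 ((x i : ℝ) : AddCircle (1:ℝ))).1) : Euc d)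
      = x + zvec (fun i => -⌊x i⌋) := by
    ext i
    simp only [PiLp.add_apply, zvec_apply]
    rw [AddCircle.coe_equivIco_mk_apply]
    simp only [div_one, one_mul, mul_one, sub_zero, Int.fract]; push_cast; ring
  rw [torF, this, hp]

theorem torF_cont {d : ℕ} {f : Euc d → ℂ} (hf : Continuous f) (hp : Per f) : Continuous (torF f) := by
  have hq : IsOpenQuotientMap (fun x : Fin d → ℝ => (fun i => ((x i : ℝ) : AddCircle (1:ℝ)) : UnitAddTorus (Fin d))) :=
    IsOpenQuotientMap.piMap fun _ => QuotientAddGroup.isOpenQuotientMap_mk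
  rw [hq.isQuotientMap.continuous_iff]
  have : (torF f ∘ fun x : Fin d → ℝ => (fun i => ((x i : ℝ) : AddCircle (1:ℝ)) : UnitAddTorus (Fin d)))
      = fun x : Fin d → ℝ => f (WithLp.toLp 2 x) := by
    ext x; exact torF_apply hp (WithLp.toLp 2 x)
  rw [this]
  exact hf.comp (PiLp.continuous_toLp 2 _)

theorem cell_eq_torus {d : ℕ} {f : Euc d → ℂ} (hp : Per f) :
    ∫ y, torF f y = ∫ θ in unitCell d, f θ := by
  have h := UnitAddTorus.integral_preimage (torF f) (0 : Fin d → ℝ)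
  rw [h]
  have h1 : ∀ x : Fin d → ℝ, torF f (fun i => ((x i : ℝ) : AddCircle (1:ℝ))) = f (WithLp.toLp 2 x) :=
    fun x => torF_apply hp (WithLp.toLp 2 x)
  simp_rw [h1]
  have hm := EuclideanSpace.volume_preserving_symm_measurableEquiv_toLp (Fin d)
  have e2 := hm.symm.setIntegral_preimage_emb (MeasurableEquiv.measurableEmbedding _) f (unitCell d)
  rw [← e2]
  have e3 : {x : Fin d → ℝ | ∀ i, x i ∈ Set.Ioc ((0 : Fin d → ℝ) i) ((0 : Fin d → ℝ) i + 1)} =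
      Set.pi Set.univ fun i => Set.Ioc ((0 : Fin d → ℝ) i) ((1 : Fin d → ℝ) i) := by
    ext x; simp
  have e4 : ((MeasurableEquiv.toLp 2 (Fin d → ℝ)) ⁻¹' (unitCell d)) =
      Set.pi Set.univ fun i => Set.Ico ((0 : Fin d → ℝ) i) ((1 : Fin d → ℝ) i) := by
    ext x; simp [unitCell]
  have e5 : (Set.pi Set.univ fun i => Set.Ioc ((0 : Fin d → ℝ) i) ((1 : Fin d → ℝ) i)) =ᵐ[volume]
     (Set.pi Set.univ fun i => Set.Ico ((0 : Fin d → ℝ) i) ((1 : Fin d → ℝ) i)) :=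
    Measure.univ_pi_Ioc_ae_eq_Icc.trans Measure.univ_pi_Ico_ae_eq_Icc.symm
  rw [e3, setIntegral_congr_set e5]
  erw [e4]
  rfl

theorem torF_coeff {d : ℕ} {f : Euc d → ℂ} (hp : Per f) (ξ : Fin d → ℤ) :
    UnitAddTorus.mFourierCoeff (torF f) ξ = fc f ξ := by
  have h : (fun y => UnitAddTorus.mFourier (-ξ) y • torF f y) = torF (fun θ => ec (-ξ) θ * f θ) := by
    ext y
    simp only [torF, smul_eq_mul, ← mFourier_ec]
    congr 2
    ext i
    simp
  rw [UnitAddTorus.mFourierCoeff, h]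
  exact cell_eq_torus (fun θ z => by simp only [ec_per _ θ z, hp θ z])

theorem fourier_inversion {d : ℕ} {f : Euc d → ℂ} (hf : Continuous f) (hp : Per f)
    (hs : Summable (fun ξ => fc f ξ)) (θ : Euc d) : HasSum (fun ξ => fc f ξ * ec ξ θ) (f θ) := by
  have h := UnitAddTorus.hasSum_mFourier_series_apply_of_summable
    (f := (⟨torF f, torF_cont hf hp⟩ : C(UnitAddTorus (Fin d), ℂ)))
    (by
      have : UnitAddTorus.mFourierCoeff (torF f) = fun ξ => fc f ξ := funext (torF_coeff hp)
      simpa [this] using hs) (fun i => ((θ i : ℝ) : AddCircle (1:ℝ)))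
  simpa [torF_coeff hp, torF_apply hp, mFourier_ec] using h

theorem parseval {d : ℕ} {f : Euc d → ℂ} (hf : Continuous f) (hp : Per f) :
    HasSum (fun ξ => ‖fc f ξ‖ ^ 2) (∫ θ in unitCell d, ‖f θ‖ ^ 2) := by
  have h := UnitAddTorus.hasSum_sq_mFourierCoeff (d := Fin d)
    (ContinuousMap.toLp 2 volume ℂ (⟨torF f, torF_cont hf hp⟩ : C(UnitAddTorus (Fin d), ℂ)))
  have h2 : ∀ ξ, UnitAddTorus.mFourierCoeff (ContinuousMap.toLp 2 volume ℂ (⟨torF f, torF_cont hf hp⟩ : C(UnitAddTorus (Fin d), ℂ))) ξ = fc f ξ := by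
    intro ξ; rw [UnitAddTorus.mFourierCoeff_toLp]; exact torF_coeff hp ξ
  simp_rw [h2] at h
  have e : ∫ t, ‖(ContinuousMap.toLp 2 volume ℂ (⟨torF f, torF_cont hf hp⟩ : C(UnitAddTorus (Fin d), ℂ))) t‖ ^ 2
     = ∫ θ in unitCell d, ‖f θ‖ ^ 2 := by
    have hae := ContinuousMap.coeFn_toLp (p := 2) (𝕜 := ℂ) (volume : Measure (UnitAddTorus (Fin d))) (⟨torF f, torF_cont hf hp⟩ : C(UnitAddTorus (Fin d), ℂ))
    have e1 : ∫ t, ‖(ContinuousMap.toLp 2 volume ℂ (⟨torF f, torF_cont hf hp⟩ : C(UnitAddTorus (Fin d), ℂ))) t‖ ^ 2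
      = ∫ t, ‖torF f t‖ ^ 2 := by
      refine integral_congr_ae ?_
      filter_upwards [hae] with t ht
      rw [ht]; rfl
    rw [e1]
    have e2 := cell_eq_torus (f := fun θ => ((‖f θ‖ ^ 2 : ℝ) : ℂ)) (fun θ z => by simp only [hp θ z])
    have e3 : ∀ y, torF (fun θ => ((‖f θ‖ ^ 2 : ℝ) : ℂ)) y = ((‖torF f y‖ ^ 2 : ℝ) : ℂ) := fun y => rfl
    simp_rw [e3] at e2
    rw [integral_complex_ofReal, integral_complex_ofReal] at e2
    exact_mod_cast e2
  rw [e] at h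
  exact h

end torus

end

section
open scoped Pointwise
set_option linter.all false

theorem jb_one_le {d : ℕ} (ξ : Fin d → ℤ) : 1 ≤ jb ξ := by
  unfold jb; have : 0 ≤ ∑ i, |(ξ i : ℝ)| := Finset.sum_nonneg fun i _ => abs_nonneg _
  linarith

theorem jb_pos {d : ℕ} (ξ : Fin d → ℤ) : 0 < jb ξ := lt_of_lt_of_le one_pos (jb_one_le ξ)

theorem jb_abs_le {d : ℕ} (ξ : Fin d → ℤ) (i : Fin d) : 1 + |(ξ i : ℝ)| ≤ jb ξ := by
  unfold jb
  have := Finset.single_le_sum (f := fun i => |(ξ i : ℝ)|) (fun i _ => abs_nonneg _) (Finset.mem_univ i)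
  linarith

theorem jb_neg {d : ℕ} (ξ : Fin d → ℤ) : jb (-ξ) = jb ξ := by simp [jb]

theorem jb_zero {d : ℕ} : jb (0 : Fin d → ℤ) = 1 := by simp [jb]

theorem jb_add_le' {d : ℕ} (ξ η : Fin d → ℤ) : jb (ξ + η) + 1 ≤ jb ξ + jb η := by
  unfold jb
  have : ∑ i, |(((ξ + η) i : ℤ) : ℝ)| ≤ ∑ i, |(ξ i : ℝ)| + ∑ i, |(η i : ℝ)| := by
    rw [← Finset.sum_add_distrib]
    refine Finset.sum_le_sum fun i _ => ?_
    simp only [Pi.add_apply]; push_cast; exact abs_add_le _ _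
  linarith

theorem jb_add_le {d : ℕ} (ξ η : Fin d → ℤ) : jb (ξ + η) ≤ jb ξ * jb η := by
  have h := jb_add_le' ξ η
  nlinarith [jb_one_le ξ, jb_one_le η]

theorem jb_le_sub {d : ℕ} (ξ η : Fin d → ℤ) : jb ξ ≤ jb (ξ - η) * jb η := by
  have := jb_add_le (ξ - η) η; rwa [sub_add_cancel] at this

theorem jb_sub_comm {d : ℕ} (ξ η : Fin d → ℤ) : jb (ξ - η) = jb (η - ξ) := by
  rw [← jb_neg, neg_sub]

theorem zdot_le {d : ℕ} (ξ : Fin d → ℤ) (v : Euc d) : |zdot ξ v| ≤ jb ξ * ‖v‖ := by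
  unfold zdot
  refine (Finset.abs_sum_le_sum_abs _ _).trans ?_
  have : ∀ i ∈ Finset.univ, |(ξ i : ℝ) * v i| ≤ |(ξ i : ℝ)| * ‖v‖ := fun i _ => by
    rw [abs_mul]; gcongr; exact PiLp.norm_apply_le v i
  refine (Finset.sum_le_sum this).trans ?_
  rw [← Finset.sum_mul]; gcongr; unfold jb; linarith

theorem summable_int_sq : Summable (fun k : ℤ => ((1 + |(k : ℝ)|) ^ 2)⁻¹) := by
  have h : Summable (fun n : ℕ => ((1 + |((n : ℤ) : ℝ)|) ^ 2)⁻¹) := by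
    have := (summable_nat_add_iff 1).2 (Real.summable_nat_pow_inv.2 (show 1 < 2 by norm_num))
    refine this.congr fun n => ?_
    simp [add_comm]
  refine Summable.of_nat_of_neg h ?_
  simpa using h

theorem jb_summable0 {d : ℕ} : Summable (fun ξ : Fin d → ℤ => (jb ξ ^ (2 * d))⁻¹) := by
  obtain ⟨s, hs⟩ : ∃ s : ℝ, ∀ u : Finset ℤ, ∑ k ∈ u, ((1 + |(k : ℝ)|) ^ 2)⁻¹ ≤ s :=
    ⟨_, fun u => summable_int_sq.sum_le_tsum u (fun k _ => by positivity)⟩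
  refine summable_of_sum_le (c := s ^ d) (fun ξ => by have := jb_pos ξ; positivity) fun u => ?_
  classical
  let t : Fin d → Finset ℤ := fun i => u.image (fun ξ => ξ i)
  have hsub : u ⊆ Fintype.piFinset t := fun ξ hξ => by
    rw [Fintype.mem_piFinset]; exact fun i => Finset.mem_image_of_mem _ hξ
  calc ∑ ξ ∈ u, (jb ξ ^ (2 * d))⁻¹ ≤ ∑ ξ ∈ u, ∏ i, ((1 + |(ξ i : ℝ)|) ^ 2)⁻¹ := by
        refine Finset.sum_le_sum fun ξ _ => ?_
        rw [Finset.prod_inv_distrib]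
        refine inv_anti₀ (Finset.prod_pos fun i _ => by positivity) ?_
        calc ∏ i : Fin d, (1 + |(ξ i : ℝ)|) ^ 2 ≤ ∏ i : Fin d, jb ξ ^ 2 :=
              Finset.prod_le_prod (fun i _ => by positivity) fun i _ => by
                gcongr; exact jb_abs_le ξ i
          _ = jb ξ ^ (2 * d) := by simp [pow_mul]
    _ ≤ ∑ ξ ∈ Fintype.piFinset t, ∏ i, ((1 + |(ξ i : ℝ)|) ^ 2)⁻¹ :=
        Finset.sum_le_sum_of_subset_of_nonneg hsub fun ξ _ _ => Finset.prod_nonneg fun i _ => by positivity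
    _ = ∏ i, ∑ k ∈ t i, ((1 + |(k : ℝ)|) ^ 2)⁻¹ := (Finset.prod_univ_sum t (fun _ k => ((1 + |(k : ℝ)|) ^ 2)⁻¹)).symm
    _ ≤ ∏ i : Fin d, s := Finset.prod_le_prod (fun i _ => Finset.sum_nonneg fun k _ => by positivity) fun i _ => hs _
    _ = s ^ d := by simp

theorem jb_summable {d : ℕ} {k : ℕ} (hk : 2 * d ≤ k) : Summable (fun ξ : Fin d → ℤ => (jb ξ ^ k)⁻¹) :=
  jb_summable0.of_nonneg_of_le (fun ξ => by have := jb_pos ξ; positivity) fun ξ => by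
    have := jb_pos ξ
    exact inv_anti₀ (by positivity) (pow_le_pow_right₀ (jb_one_le ξ) hk)

/-- pure iterated derivative -/
def pit {d : ℕ} (v : Euc d) (f : Euc d → ℂ) : ℕ → Euc d → ℂ
  | 0 => f
  | k + 1 => fun θ => fderiv ℝ (pit v f k) θ v

theorem pit_smooth {d : ℕ} (v : Euc d) {f : Euc d → ℂ} (hf : ContDiff ℝ (⊤ : ℕ∞) f) (k : ℕ) :
    ContDiff ℝ (⊤ : ℕ∞) (pit v f k) := by
  induction k with
  | zero => exact hf
  | succ k ih => exact (ih.fderiv_right (m := (⊤ : ℕ∞)) (by simp)).clm_apply contDiff_const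

theorem pit_per {d : ℕ} (v : Euc d) {f : Euc d → ℂ} (hf : Per f) (k : ℕ) : Per (pit v f k) := by
  induction k with
  | zero => exact hf
  | succ k ih => intro θ z; simp only [pit]; rw [per_fderiv ih]

theorem pit_fc {d : ℕ} (v : Euc d) {f : Euc d → ℂ} (hf : ContDiff ℝ (⊤ : ℕ∞) f) (hp : Per f) (k : ℕ)
    (ξ : Fin d → ℤ) : fc (pit v f k) ξ = (2 * Real.pi * Complex.I * zdot ξ v) ^ k * fc f ξ := by
  induction k with
  | zero => simp [pit]
  | succ k ih =>
    have h1 : ContDiff ℝ 1 (pit v f k) := (pit_smooth v hf k).of_le (by exact_mod_cast le_top)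
    have := fc_fderiv h1 (pit_per v hp k) ξ v
    simp only [pit]; rw [this, ih]; ring

theorem pit_eq {d : ℕ} (v : Euc d) {f : Euc d → ℂ} (hf : ContDiff ℝ (⊤ : ℕ∞) f) (k : ℕ) (θ : Euc d) :
    pit v f k θ = iteratedFDeriv ℝ k f θ (fun _ => v) := by
  induction k generalizing θ with
  | zero => simp [pit]
  | succ k ih =>
    have h0 : pit v f k = fun θ => iteratedFDeriv ℝ k f θ (fun _ => v) := funext ih
    have h1 : DifferentiableAt ℝ (iteratedFDeriv ℝ k f) θ :=
      hf.differentiable_iteratedFDeriv (by exact_mod_cast (WithTop.coe_lt_top k)) θ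
    simp only [pit]
    rw [h0, iteratedFDeriv_succ_apply_left]
    have h2 : HasFDerivAt (fun θ => iteratedFDeriv ℝ k f θ (fun _ => v))
        ((ContinuousMultilinearMap.apply ℝ (fun _ : Fin k => Euc d) ℂ (fun _ => v)).comp
          (fderiv ℝ (iteratedFDeriv ℝ k f) θ)) θ :=
      (ContinuousMultilinearMap.apply ℝ (fun _ : Fin k => Euc d) ℂ (fun _ => v)).hasFDerivAt.comp θ h1.hasFDerivAt
    rw [h2.fderiv]; rfl

theorem pit_le {d : ℕ} (i : Fin d) {f : Euc d → ℂ} (hf : ContDiff ℝ (⊤ : ℕ∞) f) (k : ℕ) (θ : Euc d) :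
    ‖pit (EuclideanSpace.single i 1) f k θ‖ ≤ ‖iteratedFDeriv ℝ k f θ‖ := by
  rw [pit_eq _ hf]
  refine (ContinuousMultilinearMap.le_opNorm _ _).trans ?_
  simp

theorem jb_pow_le {d : ℕ} (ξ : Fin d → ℤ) (k : ℕ) :
    jb ξ ^ k ≤ ((d : ℝ) + 1) ^ k * (1 + ∑ i, |(ξ i : ℝ)| ^ k) := by
  have key : ∃ μ : ℝ, 1 ≤ μ ∧ (∀ i, |(ξ i : ℝ)| ≤ μ) ∧ μ ^ k ≤ 1 + ∑ i, |(ξ i : ℝ)| ^ k := by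
    have hS : 0 ≤ ∑ i, |(ξ i : ℝ)| ^ k := Finset.sum_nonneg fun i _ => by positivity
    by_cases h : ∀ i, |(ξ i : ℝ)| ≤ 1
    · exact ⟨1, le_rfl, h, by rw [one_pow]; linarith⟩
    · push Not at h
      obtain ⟨i0, hi0⟩ := h
      obtain ⟨j, -, hj⟩ := Finset.exists_max_image Finset.univ (fun i => |(ξ i : ℝ)|) ⟨i0, Finset.mem_univ _⟩
      refine ⟨|(ξ j : ℝ)|, (hi0.trans_le (hj i0 (Finset.mem_univ _))).le, fun i => hj i (Finset.mem_univ _), ?_⟩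
      have := Finset.single_le_sum (f := fun i => |(ξ i : ℝ)| ^ k) (fun i _ => by positivity) (Finset.mem_univ j)
      linarith
  obtain ⟨μ, h1, h2, h3⟩ := key
  have h4 : jb ξ ≤ ((d : ℝ) + 1) * μ := by
    unfold jb
    have := Finset.sum_le_card_nsmul Finset.univ (fun i => |(ξ i : ℝ)|) μ (fun i _ => h2 i)
    simp only [Finset.card_univ, Fintype.card_fin, nsmul_eq_mul] at this
    linarith
  calc jb ξ ^ k ≤ (((d : ℝ) + 1) * μ) ^ k := pow_le_pow_left₀ (jb_pos ξ).le h4 k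
    _ = ((d : ℝ) + 1) ^ k * μ ^ k := mul_pow _ _ _
    _ ≤ _ := by gcongr

/-- weighted Bessel inequality -/
theorem fc_sobolev {d : ℕ} {f : Euc d → ℂ} (hf : ContDiff ℝ (⊤ : ℕ∞) f) (hp : Per f) (k : ℕ) (B : ℝ)
    (h0 : ∀ θ, ‖f θ‖ ≤ B) (hk : ∀ θ, ‖iteratedFDeriv ℝ k f θ‖ ≤ B) (u : Finset (Fin d → ℤ)) :
    ∑ ξ ∈ u, jb ξ ^ (2 * k) * ‖fc f ξ‖ ^ 2 ≤ ((d : ℝ) + 1) ^ (2 * k + 1) * B ^ 2 := by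
  have bessel : ∀ g : Euc d → ℂ, Continuous g → Per g → (∀ θ, ‖g θ‖ ≤ B) → ∑ ξ ∈ u, ‖fc g ξ‖ ^ 2 ≤ B ^ 2 := by
    intro g hg hgp hgB
    have h := parseval hg hgp
    refine (sum_le_hasSum u (fun ξ _ => by positivity) h).trans ?_
    calc ∫ θ in unitCell d, ‖g θ‖ ^ 2 ≤ ∫ θ in unitCell d, B ^ 2 := by
          refine integral_mono (cell_integrable (by fun_prop)) (integrable_const _) fun θ => ?_
          exact pow_le_pow_left₀ (norm_nonneg _) (hgB θ) 2
      _ = B ^ 2 := by simp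
  have h1 := bessel f hf.continuous hp h0
  have h2 : ∀ i, ∑ ξ ∈ u, |(ξ i : ℝ)| ^ (2 * k) * ‖fc f ξ‖ ^ 2 ≤ B ^ 2 := by
    intro i
    refine le_trans (Finset.sum_le_sum fun ξ _ => ?_)
      (bessel (pit (EuclideanSpace.single i 1) f k) (pit_smooth _ hf k).continuous (pit_per _ hp k)
        fun θ => (pit_le i hf k θ).trans (hk θ))
    rw [pit_fc _ hf hp, norm_mul, mul_pow, norm_pow, ← pow_mul, mul_comm k 2]
    gcongr
    have : zdot ξ (EuclideanSpace.single i 1) = ξ i := by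
      simp [zdot]
    rw [this]
    simp only [norm_mul, Complex.norm_real, Complex.norm_I, Real.norm_eq_abs, abs_of_pos Real.pi_pos]
    have h2p : (1:ℝ) ≤ 2 * Real.pi := by linarith [Real.pi_gt_three]
    simp only [Complex.norm_ofNat, mul_one]
    nlinarith [abs_nonneg (ξ i : ℝ)]
  calc ∑ ξ ∈ u, jb ξ ^ (2 * k) * ‖fc f ξ‖ ^ 2
      ≤ ∑ ξ ∈ u, (((d : ℝ) + 1) ^ (2 * k) * (1 + ∑ i, |(ξ i : ℝ)| ^ (2 * k))) * ‖fc f ξ‖ ^ 2 := by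
        refine Finset.sum_le_sum fun ξ _ => ?_
        gcongr; exact jb_pow_le ξ (2 * k)
    _ = ((d : ℝ) + 1) ^ (2 * k) * (∑ ξ ∈ u, ‖fc f ξ‖ ^ 2 + ∑ i, ∑ ξ ∈ u, |(ξ i : ℝ)| ^ (2 * k) * ‖fc f ξ‖ ^ 2) := by
        rw [Finset.sum_comm, ← Finset.sum_add_distrib, Finset.mul_sum]
        refine Finset.sum_congr rfl fun ξ _ => ?_
        rw [← Finset.sum_mul]; ring
    _ ≤ ((d : ℝ) + 1) ^ (2 * k) * (B ^ 2 + ∑ i : Fin d, B ^ 2) := by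
        gcongr with i _; exact h2 i
    _ = _ := by simp; ring

theorem fc_rapid {d : ℕ} {f : Euc d → ℂ} (hf : ContDiff ℝ (⊤ : ℕ∞) f) (hp : Per f) (k : ℕ) :
    ∃ C, ∀ ξ, jb ξ ^ k * ‖fc f ξ‖ ≤ C := by
  obtain ⟨B0, hB0⟩ := per_bdd hf.continuous hp
  have hpk : Per (iteratedFDeriv ℝ k f) := fun θ z => by
    have : (fun x => f (x + zvec z)) = f := funext fun x => hp x z
    rw [← iteratedFDeriv_comp_add_right, this]
  obtain ⟨B1, hB1⟩ := per_bdd (hf.continuous_iteratedFDeriv (m := k) (by exact_mod_cast le_top)) hpk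
  set B := max B0 B1
  set C := ((d : ℝ) + 1) ^ (2 * k + 1) * B ^ 2
  refine ⟨Real.sqrt C, fun ξ => ?_⟩
  have h := fc_sobolev hf hp k B (fun θ => (hB0 θ).trans (le_max_left _ _)) (fun θ => (hB1 θ).trans (le_max_right _ _)) {ξ}
  rw [Finset.sum_singleton] at h
  refine Real.le_sqrt_of_sq_le ?_
  rw [mul_pow, ← pow_mul, mul_comm k 2]; exact h

theorem summable_of_rapid {d : ℕ} {F : Type*} [NormedAddCommGroup F] [CompleteSpace F] {b : (Fin d → ℤ) → F} {C : ℝ}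
    (h : ∀ ξ, jb ξ ^ (2 * d) * ‖b ξ‖ ≤ C) : Summable (fun ξ => ‖b ξ‖) := by
  refine Summable.of_nonneg_of_le (fun ξ => norm_nonneg _) (fun ξ => ?_) (jb_summable0.mul_left C)
  have := jb_pos ξ
  rw [← div_eq_mul_inv, le_div_iff₀ (by positivity), mul_comm]; exact h ξ

theorem cell_ec {d : ℕ} (ζ : Fin d → ℤ) : ∫ θ in unitCell d, ec ζ θ = if ζ = 0 then 1 else 0 := by
  split_ifs with h
  · subst h; simp [ec_zero]
  · obtain ⟨i, hi⟩ := Function.ne_iff.1 h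
    have h1 := cell_fderiv_zero (f := ec ζ) (ec_contDiff ζ) (ec_per ζ) (EuclideanSpace.single i 1)
    simp_rw [ec_hasFDerivAt] at h1
    rw [integral_const_mul] at h1
    have : zdot ζ (EuclideanSpace.single i 1) = ζ i := by simp [zdot]
    rw [this] at h1
    rcases mul_eq_zero.1 h1 with h2 | h2
    · exfalso
      simp [Real.pi_ne_zero] at h2
      exact hi h2
    · exact h2

theorem fser_fc {d : ℕ} {b : (Fin d → ℤ) → ℂ} (hb : Summable (fun ξ => ‖b ξ‖)) (ξ : Fin d → ℤ) :
    fc (fun θ => ∑' η, b η * ec η θ) ξ = b ξ := by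
  unfold fc
  have e : ∀ θ, ec (-ξ) θ * (∑' η, b η * ec η θ) = ∑' η, b η * ec (η - ξ) θ := by
    intro θ
    rw [← tsum_mul_left]
    refine tsum_congr fun η => ?_
    rw [sub_eq_add_neg, ec_add_left]; ring
  simp_rw [e]
  have hs := hasSum_integral_of_summable_integral_norm (μ := volume.restrict (unitCell d))
    (F := fun η θ => b η * ec (η - ξ) θ)
    (fun η => cell_integrable (continuous_const.mul (ec_continuous _)))
    (by simpa [norm_ec] using hb)
  rw [← hs.tsum_eq, tsum_eq_single ξ]
  · rw [integral_const_mul, cell_ec]; simp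
  · intro η hη
    rw [integral_const_mul, cell_ec, if_neg (sub_ne_zero.2 hη), mul_zero]

theorem fser_cont {d : ℕ} {b : (Fin d → ℤ) → ℂ} (hb : Summable (fun ξ => ‖b ξ‖)) :
    Continuous (fun θ => ∑' η, b η * ec η θ) :=
  continuous_tsum (fun η => continuous_const.mul (ec_continuous _)) hb fun η θ => by simp [norm_ec]

theorem fser_per {d : ℕ} {b : (Fin d → ℤ) → ℂ} : Per (fun θ => ∑' η, b η * ec η θ) := fun θ z => by
  simp only [ec_per _ θ z]

theorem fser_parseval {d : ℕ} {b : (Fin d → ℤ) → ℂ} (hb : Summable (fun ξ => ‖b ξ‖)) :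
    HasSum (fun ξ => ‖b ξ‖ ^ 2) (∫ θ in unitCell d, ‖∑' η, b η * ec η θ‖ ^ 2) := by
  have := parseval (fser_cont hb) fser_per
  simpa only [fser_fc hb] using this

end

section
open scoped Pointwise
set_option linter.all false

/-- abstract system -/
structure Sys (d : ℕ) (W E : Type) [NormedAddCommGroup W] [InnerProductSpace ℂ W] [FiniteDimensional ℂ W]
    [NormedAddCommGroup E] [InnerProductSpace ℂ E] [FiniteDimensional ℂ E] where
  τ : Euc d →ₗ[ℝ] W →L[ℂ] E
  K : (Fin d → ℤ) → E →L[ℂ] E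
  lam : ℝ
  lam_pos : 0 < lam
  hτ : ∀ v v' w w', inner ℂ (τ v w) (τ v' w') = ((inner ℝ v v' : ℝ) : ℂ) * inner ℂ w w'
  decay : ∀ k : ℕ, ∃ C, ∀ ζ, jb ζ ^ k * ‖K ζ‖ ≤ C
  coer : ∀ (Λ : Finset (Fin d → ℤ)) (p : (Fin d → ℤ) → E),
    lam * ∑ ξ ∈ Λ, ‖p ξ‖ ^ 2 ≤ (∑ ξ ∈ Λ, ∑ η ∈ Λ, inner ℂ (p ξ) (K (ξ - η) (p η))).re

/-- truncated convolution -/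
def Sys.cv {d : ℕ} {W E : Type} [NormedAddCommGroup W] [InnerProductSpace ℂ W] [FiniteDimensional ℂ W]
    [NormedAddCommGroup E] [InnerProductSpace ℂ E] [FiniteDimensional ℂ E] (S : Sys d W E)
    (Λ : Finset (Fin d → ℤ)) (p : (Fin d → ℤ) → E) (ξ : Fin d → ℤ) : E := ∑ η ∈ Λ, S.K (ξ - η) (p η)

/-- weighted norm -/
def Ns {d : ℕ} {F : Type*} [NormedAddCommGroup F] (Λ : Finset (Fin d → ℤ)) (s : ℕ) (p : (Fin d → ℤ) → F) : ℝ :=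
  ∑ ξ ∈ Λ, jb ξ ^ (2 * s) * ‖p ξ‖ ^ 2

theorem Ns_nonneg {d : ℕ} {F : Type*} [NormedAddCommGroup F] (Λ : Finset (Fin d → ℤ)) (s : ℕ)
    (p : (Fin d → ℤ) → F) : 0 ≤ Ns Λ s p :=
  Finset.sum_nonneg fun ξ _ => by have := jb_pos ξ; positivity

theorem Ns_mono {d : ℕ} {F : Type*} [NormedAddCommGroup F] (Λ : Finset (Fin d → ℤ)) {s s' : ℕ} (h : s ≤ s')
    (p : (Fin d → ℤ) → F) : Ns Λ s p ≤ Ns Λ s' p :=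
  Finset.sum_le_sum fun ξ _ => by
    gcongr
    exact jb_one_le ξ

theorem Ns_le_of {d : ℕ} {F G : Type*} [NormedAddCommGroup F] [NormedAddCommGroup G] {Λ : Finset (Fin d → ℤ)}
    {s k : ℕ} {p : (Fin d → ℤ) → F} {q : (Fin d → ℤ) → G} {C : ℝ}
    (h : ∀ ξ ∈ Λ, ‖p ξ‖ ≤ C * (jb ξ ^ k * ‖q ξ‖)) : Ns Λ s p ≤ C ^ 2 * Ns Λ (s + k) q := by
  unfold Ns
  rw [Finset.mul_sum]
  refine Finset.sum_le_sum fun ξ hξ => ?_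
  have h1 := pow_le_pow_left₀ (norm_nonneg _) (h ξ hξ) 2
  have := jb_pos ξ
  calc jb ξ ^ (2 * s) * ‖p ξ‖ ^ 2 ≤ jb ξ ^ (2 * s) * (C * (jb ξ ^ k * ‖q ξ‖)) ^ 2 := by gcongr
    _ = _ := by ring

theorem Ns_add_le {d : ℕ} {F : Type*} [NormedAddCommGroup F] (Λ : Finset (Fin d → ℤ)) (s : ℕ)
    (p q : (Fin d → ℤ) → F) : Ns Λ s (fun ξ => p ξ + q ξ) ≤ 2 * (Ns Λ s p + Ns Λ s q) := by
  unfold Ns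
  rw [← Finset.sum_add_distrib, Finset.mul_sum]
  refine Finset.sum_le_sum fun ξ hξ => ?_
  have h1 := pow_le_pow_left₀ (norm_nonneg _) (norm_add_le (p ξ) (q ξ)) 2
  have := jb_pos ξ
  have h2 : (‖p ξ‖ + ‖q ξ‖) ^ 2 ≤ 2 * (‖p ξ‖ ^ 2 + ‖q ξ‖ ^ 2) := by nlinarith [sq_nonneg (‖p ξ‖ - ‖q ξ‖)]
  calc jb ξ ^ (2 * s) * ‖p ξ + q ξ‖ ^ 2 ≤ jb ξ ^ (2 * s) * (2 * (‖p ξ‖ ^ 2 + ‖q ξ‖ ^ 2)) := by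
        gcongr; exact h1.trans h2
    _ = _ := by ring

theorem Ns_sub_le {d : ℕ} {F : Type*} [NormedAddCommGroup F] (Λ : Finset (Fin d → ℤ)) (s : ℕ)
    (p q : (Fin d → ℤ) → F) : Ns Λ s (fun ξ => p ξ - q ξ) ≤ 2 * (Ns Λ s p + Ns Λ s q) := by
  have h := Ns_add_le Λ s p (fun ξ => - q ξ)
  simpa [Ns, sub_eq_add_neg] using h

theorem schur {d : ℕ} (Λ : Finset (Fin d → ℤ)) (k : (Fin d → ℤ) → ℝ) (hk : ∀ ζ, 0 ≤ k ζ) (κ : ℝ)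
    (hκ : ∀ u : Finset (Fin d → ℤ), ∑ ζ ∈ u, k ζ ≤ κ) (x y : (Fin d → ℤ) → ℝ) :
    ∑ ξ ∈ Λ, ∑ η ∈ Λ, k (ξ - η) * (y ξ * x η) ≤ κ / 2 * (∑ ξ ∈ Λ, x ξ ^ 2 + ∑ ξ ∈ Λ, y ξ ^ 2) := by
  have h1 : ∀ ξ, ∑ η ∈ Λ, k (ξ - η) ≤ κ := fun ξ => by
    have := hκ (Λ.map ⟨fun η => ξ - η, sub_right_injective⟩)
    rwa [Finset.sum_map] at this
  have h2 : ∀ η, ∑ ξ ∈ Λ, k (ξ - η) ≤ κ := fun η => by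
    have := hκ (Λ.map ⟨fun ξ => ξ - η, sub_left_injective⟩)
    rwa [Finset.sum_map] at this
  have h3 : ∑ ξ ∈ Λ, ∑ η ∈ Λ, k (ξ - η) * (y ξ * x η) ≤
      ∑ ξ ∈ Λ, ∑ η ∈ Λ, (k (ξ - η) * (x η ^ 2 / 2) + k (ξ - η) * (y ξ ^ 2 / 2)) := by
    refine Finset.sum_le_sum fun ξ _ => Finset.sum_le_sum fun η _ => ?_
    rw [← mul_add]
    refine mul_le_mul_of_nonneg_left ?_ (hk _)
    nlinarith [sq_nonneg (y ξ - x η)]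
  refine h3.trans ?_
  simp_rw [Finset.sum_add_distrib]
  rw [Finset.sum_comm]
  have h4 : ∑ η ∈ Λ, ∑ ξ ∈ Λ, k (ξ - η) * (x η ^ 2 / 2) ≤ ∑ η ∈ Λ, κ * (x η ^ 2 / 2) := by
    refine Finset.sum_le_sum fun η _ => ?_
    rw [← Finset.sum_mul]; exact mul_le_mul_of_nonneg_right (h2 η) (by positivity)
  have h5 : ∑ ξ ∈ Λ, ∑ η ∈ Λ, k (ξ - η) * (y ξ ^ 2 / 2) ≤ ∑ ξ ∈ Λ, κ * (y ξ ^ 2 / 2) := by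
    refine Finset.sum_le_sum fun η _ => ?_
    rw [← Finset.sum_mul]; exact mul_le_mul_of_nonneg_right (h1 η) (by positivity)
  refine (add_le_add h4 h5).trans (le_of_eq ?_)
  rw [← Finset.mul_sum, ← Finset.mul_sum, ← Finset.sum_div, ← Finset.sum_div]; ring

section
variable {d : ℕ} {W E : Type} [NormedAddCommGroup W] [InnerProductSpace ℂ W] [FiniteDimensional ℂ W]
    [NormedAddCommGroup E] [InnerProductSpace ℂ E] [FiniteDimensional ℂ E] (S : Sys d W E)

theorem Sys.kernel_sum (k : ℕ) : ∃ κ : ℝ, 0 < κ ∧ ∀ u : Finset (Fin d → ℤ), ∑ ζ ∈ u, jb ζ ^ k * ‖S.K ζ‖ ≤ κ := by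
  obtain ⟨C, hC⟩ := S.decay (2 * d + k)
  have hsum := summable_of_rapid (b := fun ζ => jb ζ ^ k * ‖S.K ζ‖) (C := C) (fun ζ => by
    have := jb_pos ζ
    rw [Real.norm_of_nonneg (by positivity), ← mul_assoc, ← pow_add]; exact hC ζ)
  refine ⟨(∑' ζ, ‖jb ζ ^ k * ‖S.K ζ‖‖) + 1, by positivity, fun u => ?_⟩
  have h := hsum.sum_le_tsum u (fun _ _ => norm_nonneg _)
  have h2 : ∑ ζ ∈ u, jb ζ ^ k * ‖S.K ζ‖ ≤ ∑ ζ ∈ u, ‖jb ζ ^ k * ‖S.K ζ‖‖ :=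
    Finset.sum_le_sum fun _ _ => le_abs_self _
  linarith

theorem Sys.cv_bound (s : ℕ) : ∃ C : ℝ, 0 < C ∧ ∀ Λ p, Ns Λ s (S.cv Λ p) ≤ C * Ns Λ s p := by
  obtain ⟨κ, hκ0, hκ⟩ := S.kernel_sum s
  refine ⟨κ ^ 2, by positivity, fun Λ p => ?_⟩
  have h1 := schur Λ (fun ζ => jb ζ ^ s * ‖S.K ζ‖) (fun ζ => by have := jb_pos ζ; positivity) κ hκ
    (fun η => κ * (jb η ^ s * ‖p η‖)) (fun ξ => jb ξ ^ s * ‖S.cv Λ p ξ‖)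
  have h2 : κ * Ns Λ s (S.cv Λ p) ≤ ∑ ξ ∈ Λ, ∑ η ∈ Λ, (jb (ξ - η) ^ s * ‖S.K (ξ - η)‖) *
      ((jb ξ ^ s * ‖S.cv Λ p ξ‖) * (κ * (jb η ^ s * ‖p η‖))) := by
    unfold Ns
    rw [Finset.mul_sum]
    refine Finset.sum_le_sum fun ξ _ => ?_
    have hξ := jb_pos ξ
    have h3 : ‖S.cv Λ p ξ‖ ≤ ∑ η ∈ Λ, ‖S.K (ξ - η)‖ * ‖p η‖ :=
      (norm_sum_le _ _).trans (Finset.sum_le_sum fun η _ => (S.K (ξ - η)).le_opNorm _)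
    have h4 : jb ξ ^ s * ‖S.cv Λ p ξ‖ ≤ ∑ η ∈ Λ, (jb (ξ - η) ^ s * ‖S.K (ξ - η)‖) * (jb η ^ s * ‖p η‖) := by
      calc jb ξ ^ s * ‖S.cv Λ p ξ‖ ≤ jb ξ ^ s * ∑ η ∈ Λ, ‖S.K (ξ - η)‖ * ‖p η‖ := by gcongr
        _ = ∑ η ∈ Λ, jb ξ ^ s * (‖S.K (ξ - η)‖ * ‖p η‖) := Finset.mul_sum _ _ _
        _ ≤ ∑ η ∈ Λ, (jb (ξ - η) * jb η) ^ s * (‖S.K (ξ - η)‖ * ‖p η‖) := by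
            refine Finset.sum_le_sum fun η _ => ?_
            gcongr; exact jb_le_sub ξ η
        _ = _ := Finset.sum_congr rfl fun η _ => by ring
    calc κ * (jb ξ ^ (2 * s) * ‖S.cv Λ p ξ‖ ^ 2)
        = (κ * (jb ξ ^ s * ‖S.cv Λ p ξ‖)) * (jb ξ ^ s * ‖S.cv Λ p ξ‖) := by ring
      _ ≤ (κ * (jb ξ ^ s * ‖S.cv Λ p ξ‖)) * ∑ η ∈ Λ, (jb (ξ - η) ^ s * ‖S.K (ξ - η)‖) * (jb η ^ s * ‖p η‖) := by
          gcongr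
      _ = _ := by rw [Finset.mul_sum]; exact Finset.sum_congr rfl fun η _ => by ring
  have h5 : ∑ ξ ∈ Λ, (κ * (jb ξ ^ s * ‖p ξ‖)) ^ 2 = κ ^ 2 * Ns Λ s p := by
    unfold Ns; rw [Finset.mul_sum]; exact Finset.sum_congr rfl fun η _ => by ring
  have h6 : ∑ ξ ∈ Λ, (jb ξ ^ s * ‖S.cv Λ p ξ‖) ^ 2 = Ns Λ s (S.cv Λ p) := by
    unfold Ns; exact Finset.sum_congr rfl fun η _ => by ring
  rw [h5, h6] at h1
  have h7 := h2.trans h1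
  have h8 : κ * Ns Λ s (S.cv Λ p) ≤ κ * (κ ^ 2 * Ns Λ s p) := by linarith
  exact le_of_mul_le_mul_left h8 hκ0

theorem weight_diff {x y δ z : ℝ} (hx : 1 ≤ x) (hy : 1 ≤ y) (hz : 1 ≤ z) (hδ : 0 ≤ δ) (hδ1 : δ ≤ 1)
    (h : |x - y| ≤ δ * z) (s : ℕ) : |x ^ s - y ^ s| ≤ δ * s * (2 * z) ^ (s + 1) * y ^ s := by
  have h1 := abs_pow_sub_pow_le x y s
  rw [abs_of_pos (by linarith : 0 < x), abs_of_pos (by linarith : 0 < y)] at h1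
  have h2 : max x y ≤ 2 * z * y := by
    rw [abs_le] at h
    refine max_le ?_ ?_ <;> nlinarith
  have h3 : max x y ^ (s - 1) ≤ (2 * z * y) ^ s := by
    have : 1 ≤ 2 * z * y := by nlinarith
    exact (pow_le_pow_left₀ (by positivity) h2 _).trans (pow_le_pow_right₀ this (Nat.sub_le _ _))
  calc |x ^ s - y ^ s| ≤ |x - y| * s * max x y ^ (s - 1) := h1
    _ ≤ (δ * z) * s * (2 * z * y) ^ s := by gcongr
    _ ≤ (δ * (2 * z)) * s * (2 * z * y) ^ s := by gcongr; linarith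
    _ = _ := by rw [mul_pow]; ring

theorem Sys.wcoer (s : ℕ) : ∃ (w : (Fin d → ℤ) → ℝ) (c C : ℝ), 0 < c ∧ 0 < C ∧
    (∀ ξ, 0 < w ξ ∧ w ξ ≤ C * jb ξ ^ (2 * s)) ∧
    ∀ Λ (p : (Fin d → ℤ) → E), c * Ns Λ s p ≤ (∑ ξ ∈ Λ, (w ξ : ℂ) * inner ℂ (p ξ) (S.cv Λ p ξ)).re := by
  obtain ⟨κ, hκ0, hκ⟩ := S.kernel_sum (s + 1)
  have hl := S.lam_pos
  set κ' : ℝ := 2 ^ (s + 1) * κ * (s + 1) with hκ'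
  have hκ'0 : 0 < κ' := by positivity
  set δ : ℝ := min 1 (S.lam / (2 * κ')) with hδ
  have hδ0 : 0 < δ := by positivity
  have hδ1 : δ ≤ 1 := min_le_left _ _
  have hδ2 : δ * κ' ≤ S.lam / 2 := by
    have : δ ≤ S.lam / (2 * κ') := min_le_right _ _
    calc δ * κ' ≤ S.lam / (2 * κ') * κ' := by gcongr
      _ = S.lam / 2 := by field_simp
  set X : (Fin d → ℤ) → ℝ := fun ξ => 1 + δ * jb ξ with hX
  have hX1 : ∀ ξ, 1 ≤ X ξ := fun ξ => by
    have := jb_pos ξ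
    have : 0 ≤ δ * jb ξ := by positivity
    simp only [hX]; linarith
  set ω : (Fin d → ℤ) → ℝ := fun ξ => X ξ ^ s with hω
  have hω0 : ∀ ξ, 0 < ω ξ := fun ξ => pow_pos (lt_of_lt_of_le one_pos (hX1 ξ)) _
  have hdiff : ∀ ξ η, |ω ξ - ω η| ≤ δ * s * (2 * jb (ξ - η)) ^ (s + 1) * ω η := fun ξ η => by
    refine weight_diff (hX1 ξ) (hX1 η) (jb_one_le _) hδ0.le hδ1 ?_ s
    have e : X ξ - X η = δ * (jb ξ - jb η) := by simp only [hX]; ring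
    rw [e, abs_mul, abs_of_pos hδ0]
    gcongr
    have h1 := jb_add_le' (ξ - η) η
    have h2 := jb_add_le' (η - ξ) ξ
    rw [sub_add_cancel] at h1 h2
    rw [jb_sub_comm] at h2
    rw [abs_le]; constructor <;> linarith
  refine ⟨fun ξ => ω ξ ^ 2, S.lam / 2 * δ ^ (2 * s), 2 ^ (2 * s), by positivity, by positivity, ?_, ?_⟩
  · refine fun ξ => ⟨by have := hω0 ξ; positivity, ?_⟩
    simp only [hω]
    rw [← pow_mul, mul_comm s 2, ← mul_pow]
    refine pow_le_pow_left₀ (by linarith [hX1 ξ]) ?_ _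
    have := jb_one_le ξ
    simp only [hX]; nlinarith
  · intro Λ p
    have hsum : (∑ ξ ∈ Λ, ((ω ξ ^ 2 : ℝ) : ℂ) * inner ℂ (p ξ) (S.cv Λ p ξ)).re =
        (∑ ξ ∈ Λ, ∑ η ∈ Λ, inner ℂ ((ω ξ : ℂ) • p ξ) (S.K (ξ - η) ((ω η : ℂ) • p η))).re +
        (∑ ξ ∈ Λ, ∑ η ∈ Λ, ((ω ξ * (ω ξ - ω η) : ℝ) : ℂ) * inner ℂ (p ξ) (S.K (ξ - η) (p η))).re := by
      rw [← Complex.add_re, ← Finset.sum_add_distrib]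
      congr 1
      refine Finset.sum_congr rfl fun ξ _ => ?_
      rw [Sys.cv, inner_sum, Finset.mul_sum, ← Finset.sum_add_distrib]
      refine Finset.sum_congr rfl fun η _ => ?_
      rw [map_smul, inner_smul_left, inner_smul_right, Complex.conj_ofReal]
      push_cast; ring
    have h1 := S.coer Λ (fun ξ => (ω ξ : ℂ) • p ξ)
    have h2 : -((∑ ξ ∈ Λ, ∑ η ∈ Λ, ((ω ξ * (ω ξ - ω η) : ℝ) : ℂ) * inner ℂ (p ξ) (S.K (ξ - η) (p η))).re) ≤
        ∑ ξ ∈ Λ, ∑ η ∈ Λ, (δ * s * 2 ^ (s + 1)) * ((jb (ξ - η) ^ (s + 1) * ‖S.K (ξ - η)‖) * ((ω ξ * ‖p ξ‖) * (ω η * ‖p η‖))) := by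
      refine (neg_le_abs _).trans ((Complex.abs_re_le_norm _).trans ((norm_sum_le _ _).trans ?_))
      refine Finset.sum_le_sum fun ξ _ => (norm_sum_le _ _).trans (Finset.sum_le_sum fun η _ => ?_)
      rw [norm_mul, Complex.norm_real, Real.norm_eq_abs, abs_mul, abs_of_pos (hω0 ξ)]
      have h3 : ‖(inner ℂ (p ξ) (S.K (ξ - η) (p η)) : ℂ)‖ ≤ ‖p ξ‖ * (‖S.K (ξ - η)‖ * ‖p η‖) :=
        (norm_inner_le_norm _ _).trans (by gcongr; exact (S.K (ξ - η)).le_opNorm _)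
      have h4 := hdiff ξ η
      have := hω0 ξ
      have := hω0 η
      have := jb_pos (ξ - η)
      calc ω ξ * |ω ξ - ω η| * ‖(inner ℂ (p ξ) (S.K (ξ - η) (p η)) : ℂ)‖
          ≤ ω ξ * (δ * s * (2 * jb (ξ - η)) ^ (s + 1) * ω η) * (‖p ξ‖ * (‖S.K (ξ - η)‖ * ‖p η‖)) := by
            gcongr
        _ = _ := by rw [mul_pow]; ring
    simp_rw [← Finset.mul_sum] at h2
    have h5 := schur Λ (fun ζ => jb ζ ^ (s + 1) * ‖S.K ζ‖) (fun ζ => by have := jb_pos ζ; positivity) κ hκ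
      (fun η => ω η * ‖p η‖) (fun ξ => ω ξ * ‖p ξ‖)
    have h6 : ∑ ξ ∈ Λ, ‖(ω ξ : ℂ) • p ξ‖ ^ 2 = ∑ ξ ∈ Λ, (ω ξ * ‖p ξ‖) ^ 2 := by
      refine Finset.sum_congr rfl fun ξ _ => ?_
      rw [norm_smul, Complex.norm_real, Real.norm_of_nonneg (hω0 ξ).le]
    rw [h6] at h1
    set Q := ∑ ξ ∈ Λ, (ω ξ * ‖p ξ‖) ^ 2 with hQ
    have hQ0 : 0 ≤ Q := Finset.sum_nonneg fun _ _ => sq_nonneg _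
    have h7 : -((∑ ξ ∈ Λ, ∑ η ∈ Λ, ((ω ξ * (ω ξ - ω η) : ℝ) : ℂ) * inner ℂ (p ξ) (S.K (ξ - η) (p η))).re) ≤
        S.lam / 2 * Q := by
      refine h2.trans ?_
      refine (mul_le_mul_of_nonneg_left h5 (by positivity)).trans ?_
      calc δ * s * 2 ^ (s + 1) * (κ / 2 * (Q + Q)) = δ * (2 ^ (s + 1) * κ * s) * Q := by ring
        _ ≤ δ * κ' * Q := by
            gcongr
            rw [hκ']
            gcongr
            linarith
        _ ≤ _ := by gcongr
    have h8 : δ ^ (2 * s) * Ns Λ s p ≤ Q := by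
      unfold Ns
      rw [hQ, Finset.mul_sum]
      refine Finset.sum_le_sum fun ξ _ => ?_
      rw [mul_pow, ← mul_assoc, ← mul_pow]
      gcongr
      simp only [hω]
      rw [← pow_mul, mul_comm s 2]
      have := jb_pos ξ
      refine pow_le_pow_left₀ (by positivity) ?_ _
      simp only [hX]; linarith
    rw [hsum]
    have h9 : S.lam / 2 * (δ ^ (2 * s) * Ns Λ s p) ≤ S.lam / 2 * Q := by gcongr
    linarith

theorem Sys.norm_τ (v : Euc d) (w : W) : ‖S.τ v w‖ = ‖v‖ * ‖w‖ := by
  have h := S.hτ v v w w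
  rw [real_inner_self_eq_norm_sq, inner_self_eq_norm_sq_to_K, inner_self_eq_norm_sq_to_K] at h
  have h2 : ‖S.τ v w‖ ^ 2 = (‖v‖ * ‖w‖) ^ 2 := by
    rw [mul_pow]
    have h3 : ((‖S.τ v w‖ ^ 2 : ℝ) : ℂ) = ((‖v‖ ^ 2 * ‖w‖ ^ 2 : ℝ) : ℂ) := by
      push_cast; simpa using h
    exact_mod_cast h3
  exact (pow_left_inj₀ (norm_nonneg _) (by positivity) two_ne_zero).1 h2

/-- adjoint of τ -/
def Sys.τa (v : Euc d) : E →L[ℂ] W := ContinuousLinearMap.adjoint (S.τ v)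

theorem Sys.inner_τa (v : Euc d) (w : W) (e : E) : inner ℂ w (S.τa v e) = inner ℂ (S.τ v w) e :=
  ContinuousLinearMap.adjoint_inner_right _ _ _

theorem Sys.norm_τa_le (v : Euc d) (e : E) : ‖S.τa v e‖ ≤ ‖v‖ * ‖e‖ := by
  have h1 : ‖S.τa v‖ ≤ ‖v‖ := by
    unfold Sys.τa
    rw [LinearIsometryEquiv.norm_map]
    exact ContinuousLinearMap.opNorm_le_bound _ (norm_nonneg _) fun w => (S.norm_τ v w).le
  exact ((S.τa v).le_opNorm e).trans (by gcongr)

theorem Sys.ncoer (s : ℕ) : ∃ C : ℝ, 0 < C ∧ ∀ (n : Euc d), ‖n‖ = 1 → ∀ Λ (z : (Fin d → ℤ) → W),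
    Ns Λ s z ≤ C * Ns Λ s (fun ξ => S.τa n (S.cv Λ (fun η => S.τ n (z η)) ξ)) := by
  obtain ⟨w, c, C, hc, hC, hw, hco⟩ := S.wcoer s
  refine ⟨(C / c) ^ 2, by positivity, fun n hn Λ z => ?_⟩
  set r := fun ξ => S.τa n (S.cv Λ (fun η => S.τ n (z η)) ξ) with hr
  have h1 := hco Λ (fun η => S.τ n (z η))
  have h2 : Ns Λ s (fun η => S.τ n (z η)) = Ns Λ s z := by
    unfold Ns; exact Finset.sum_congr rfl fun ξ _ => by rw [S.norm_τ, hn, one_mul]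
  rw [h2] at h1
  have h3 : (∑ ξ ∈ Λ, (w ξ : ℂ) * inner ℂ (S.τ n (z ξ)) (S.cv Λ (fun η => S.τ n (z η)) ξ)).re ≤
      ∑ ξ ∈ Λ, C * jb ξ ^ (2 * s) * (‖z ξ‖ * ‖r ξ‖) := by
    refine (Complex.re_le_norm _).trans ((norm_sum_le _ _).trans (Finset.sum_le_sum fun ξ _ => ?_))
    rw [norm_mul, Complex.norm_real, Real.norm_of_nonneg (hw ξ).1.le, ← S.inner_τa]
    have := jb_pos ξ
    gcongr
    · exact (hw ξ).2
    · exact norm_inner_le_norm _ _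
  have h4 : ∑ ξ ∈ Λ, C * jb ξ ^ (2 * s) * (‖z ξ‖ * ‖r ξ‖) ≤ c / 2 * Ns Λ s z + C ^ 2 / (2 * c) * Ns Λ s r := by
    unfold Ns
    rw [Finset.mul_sum, Finset.mul_sum, ← Finset.sum_add_distrib]
    refine Finset.sum_le_sum fun ξ _ => ?_
    have := jb_pos ξ
    have e : c / 2 * (jb ξ ^ (2 * s) * ‖z ξ‖ ^ 2) + C ^ 2 / (2 * c) * (jb ξ ^ (2 * s) * ‖r ξ‖ ^ 2) -
       C * jb ξ ^ (2 * s) * (‖z ξ‖ * ‖r ξ‖) = jb ξ ^ (2 * s) * ((c * ‖z ξ‖ - C * ‖r ξ‖) ^ 2 / (2 * c)) := by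
      field_simp; ring
    have : 0 ≤ jb ξ ^ (2 * s) * ((c * ‖z ξ‖ - C * ‖r ξ‖) ^ 2 / (2 * c)) := by positivity
    linarith
  have h5 : c / 2 * Ns Λ s z ≤ C ^ 2 / (2 * c) * Ns Λ s r := by linarith [h1.trans h3]
  have h6 : c / 2 * Ns Λ s z ≤ c / 2 * ((C / c) ^ 2 * Ns Λ s r) := by
    refine h5.trans (le_of_eq ?_); field_simp
  exact le_of_mul_le_mul_left h6 (by positivity)
end

end

section
open scoped Pointwise
set_option linter.all false

/-- perpendicular part -/
def perp {d : ℕ} (n : Euc d) (ξ : Fin d → ℤ) : Euc d := zvec ξ - zdot ξ n • n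

theorem inner_zvec {d : ℕ} (n : Euc d) (ξ : Fin d → ℤ) : inner ℝ n (zvec ξ) = zdot ξ n := by
  simp [PiLp.inner_apply, zvec_apply, zdot]

theorem inner_perp {d : ℕ} (n : Euc d) (hn : ‖n‖ = 1) (ξ : Fin d → ℤ) : inner ℝ (perp n ξ) n = 0 := by
  unfold perp
  rw [inner_sub_left, inner_smul_left, real_inner_self_eq_norm_sq, hn, real_inner_comm, inner_zvec]
  simp

section
variable {d : ℕ} {W E : Type} [NormedAddCommGroup W] [InnerProductSpace ℂ W] [FiniteDimensional ℂ W]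
    [NormedAddCommGroup E] [InnerProductSpace ℂ E] [FiniteDimensional ℂ E] (S : Sys d W E)

/-- the constant two pi i -/
def tpi : ℂ := 2 * Real.pi * Complex.I

theorem norm_tpi : ‖tpi‖ = 2 * Real.pi := by
  unfold tpi; simp [abs_of_pos Real.pi_pos]

theorem conj_tpi : (starRingEnd ℂ) tpi = - tpi := by
  unfold tpi
  rw [map_mul, map_mul, Complex.conj_I, Complex.conj_ofReal, Complex.conj_ofNat]; ring

/-- lifted gradient, static version -/
def Sys.pv (n : Euc d) (ξ : Fin d → ℤ) (a b : W) : E := tpi • S.τ (zvec ξ) a - S.τ n b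

theorem Sys.pv_eq (n : Euc d) (ξ : Fin d → ℤ) (a b : W) :
    S.pv n ξ a b = S.τ (perp n ξ) (tpi • a) - S.τ n (b - (tpi * zdot ξ n) • a) := by
  unfold Sys.pv perp
  simp only [map_sub, map_smul, sub_apply, smul_apply, mul_smul]
  rw [Complex.coe_smul, smul_sub]; abel

theorem Sys.pv_norm (n : Euc d) (hn : ‖n‖ = 1) (ξ : Fin d → ℤ) (a b : W) :
    ‖S.pv n ξ a b‖ ^ 2 = (2 * Real.pi * ‖perp n ξ‖ * ‖a‖) ^ 2 + ‖b - (tpi * zdot ξ n) • a‖ ^ 2 := by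
  rw [S.pv_eq, @norm_sub_sq ℂ, S.hτ, inner_perp n hn, S.norm_τ, S.norm_τ, norm_smul, norm_tpi, hn]
  simp; ring

theorem Sys.pv_norm1 (n : Euc d) (hn : ‖n‖ = 1) (ξ : Fin d → ℤ) (a b : W) :
    2 * Real.pi * ‖perp n ξ‖ * ‖a‖ ≤ ‖S.pv n ξ a b‖ := by
  have := S.pv_norm n hn ξ a b
  have := Real.pi_pos
  refine abs_le_of_sq_le_sq' ?_ (norm_nonneg _) |>.2
  nlinarith [sq_nonneg ‖b - (tpi * zdot ξ n) • a‖]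

theorem Sys.pv_norm2 (n : Euc d) (hn : ‖n‖ = 1) (ξ : Fin d → ℤ) (a b : W) :
    ‖b - (tpi * zdot ξ n) • a‖ ≤ ‖S.pv n ξ a b‖ := by
  have := S.pv_norm n hn ξ a b
  refine abs_le_of_sq_le_sq' ?_ (norm_nonneg _) |>.2
  nlinarith [sq_nonneg (2 * Real.pi * ‖perp n ξ‖ * ‖a‖)]

theorem Sys.cv_add (Λ : Finset (Fin d → ℤ)) (p q : (Fin d → ℤ) → E) (ξ) :
    S.cv Λ (fun η => p η + q η) ξ = S.cv Λ p ξ + S.cv Λ q ξ := by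
  simp [Sys.cv, Finset.sum_add_distrib]
theorem Sys.cv_sub (Λ : Finset (Fin d → ℤ)) (p q : (Fin d → ℤ) → E) (ξ) :
    S.cv Λ (fun η => p η - q η) ξ = S.cv Λ p ξ - S.cv Λ q ξ := by
  simp [Sys.cv]
theorem Sys.cv_smul (Λ : Finset (Fin d → ℤ)) (c : ℂ) (p : (Fin d → ℤ) → E) (ξ) :
    S.cv Λ (fun η => c • p η) ξ = c • S.cv Λ p ξ := by
  simp [Sys.cv, Finset.smul_sum]
theorem Sys.cv_congr {Λ : Finset (Fin d → ℤ)} {p q : (Fin d → ℤ) → E} (h : ∀ η ∈ Λ, p η = q η) (ξ) :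
    S.cv Λ p ξ = S.cv Λ q ξ := Finset.sum_congr rfl fun η hη => by rw [h η hη]

theorem clm_hasDerivAt {F G : Type*} [NormedAddCommGroup F] [NormedSpace ℂ F] [NormedAddCommGroup G]
    [NormedSpace ℂ G] (T : F →L[ℂ] G) {f : ℝ → F} {f' : F} {t : ℝ} (h : HasDerivAt f f' t) :
    HasDerivAt (fun t => T (f t)) (T f') t :=
  (T.restrictScalars ℝ).hasFDerivAt.comp_hasDerivAt t h

theorem Sys.cv_hasDerivAt (Λ : Finset (Fin d → ℤ)) {p : ℝ → (Fin d → ℤ) → E} {p' : (Fin d → ℤ) → E} {t : ℝ}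
    (h : ∀ η ∈ Λ, HasDerivAt (fun t => p t η) (p' η) t) (ξ) :
    HasDerivAt (fun t => S.cv Λ (p t) ξ) (S.cv Λ p' ξ) t := by
  unfold Sys.cv
  exact HasDerivAt.fun_sum fun η hη => clm_hasDerivAt _ (h η hη)

/-- lifted gradient -/
def Sys.pf (n : Euc d) (u : (Fin d → ℤ) → ℝ → W) (t : ℝ) (ξ : Fin d → ℤ) : E :=
  S.pv n ξ (u ξ t) (deriv (u ξ) t)

/-- conormal flux -/
def Sys.rf (n : Euc d) (Λ : Finset (Fin d → ℤ)) (u : (Fin d → ℤ) → ℝ → W) (t : ℝ) (ξ : Fin d → ℤ) : W :=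
  S.τa n (S.cv Λ (S.pf n u t) ξ)

/-- Galerkin solutions -/
structure Sys.Sol (n : Euc d) (Λ : Finset (Fin d → ℤ)) (u : (Fin d → ℤ) → ℝ → W) : Prop where
  smooth : ∀ ξ, ContDiff ℝ (⊤ : ℕ∞) (u ξ)
  eqn : ∀ ξ ∈ Λ, ∀ t, HasDerivAt (fun t => S.rf n Λ u t ξ) (tpi • S.τa (zvec ξ) (S.cv Λ (S.pf n u t) ξ)) t

theorem smooth_hasDerivAt {F : Type*} [NormedAddCommGroup F] [NormedSpace ℝ F] {f : ℝ → F}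
    (h : ContDiff ℝ (⊤ : ℕ∞) f) (t : ℝ) : HasDerivAt f (deriv f t) t :=
  (h.differentiable (by simp) t).hasDerivAt

theorem smooth_deriv {F : Type*} [NormedAddCommGroup F] [NormedSpace ℝ F] {f : ℝ → F}
    (h : ContDiff ℝ (⊤ : ℕ∞) f) : ContDiff ℝ (⊤ : ℕ∞) (deriv f) := by
  have h' : ContDiff ℝ ((⊤ : ℕ∞) + 1) f := by simpa using h
  exact (contDiff_succ_iff_deriv.1 h').2.2

theorem Sys.pf_hasDerivAt (n : Euc d) {u : (Fin d → ℤ) → ℝ → W} (ξ : Fin d → ℤ) (h : ContDiff ℝ (⊤ : ℕ∞) (u ξ)) (t : ℝ) :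
    HasDerivAt (fun t => S.pf n u t ξ) (S.pf n (fun ξ => deriv (u ξ)) t ξ) t := by
  unfold Sys.pf Sys.pv
  exact (((clm_hasDerivAt _ (smooth_hasDerivAt h t)).const_smul tpi)).sub
    (clm_hasDerivAt _ (smooth_hasDerivAt (smooth_deriv h) t))

theorem Sys.rf_hasDerivAt {n : Euc d} {Λ : Finset (Fin d → ℤ)} {u : (Fin d → ℤ) → ℝ → W}
    (h : ∀ ξ, ContDiff ℝ (⊤ : ℕ∞) (u ξ)) (t : ℝ) (ξ) :
    HasDerivAt (fun t => S.rf n Λ u t ξ) (S.rf n Λ (fun ξ => deriv (u ξ)) t ξ) t := by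
  unfold Sys.rf
  exact clm_hasDerivAt _ (S.cv_hasDerivAt Λ (fun η _ => S.pf_hasDerivAt n η (h η) t) ξ)

theorem Sys.Sol.eqn' {n : Euc d} {Λ : Finset (Fin d → ℤ)} {u : (Fin d → ℤ) → ℝ → W} (h : S.Sol n Λ u)
    (ξ) (hξ : ξ ∈ Λ) (t : ℝ) :
    S.rf n Λ (fun ξ => deriv (u ξ)) t ξ = tpi • S.τa (zvec ξ) (S.cv Λ (S.pf n u t) ξ) :=
  (S.rf_hasDerivAt h.smooth t ξ).unique (h.eqn ξ hξ t)

theorem Sys.Sol.deriv {n : Euc d} {Λ : Finset (Fin d → ℤ)} {u : (Fin d → ℤ) → ℝ → W} (h : S.Sol n Λ u) :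
    S.Sol n Λ (fun ξ => deriv (u ξ)) := by
  refine ⟨fun ξ => smooth_deriv (h.smooth ξ), fun ξ hξ t => ?_⟩
  have e : (fun t => S.rf n Λ (fun ξ => _root_.deriv (u ξ)) t ξ) =
     fun t => tpi • S.τa (zvec ξ) (S.cv Λ (S.pf n u t) ξ) := funext fun t => h.eqn' S ξ hξ t
  rw [e]
  exact (clm_hasDerivAt _ (S.cv_hasDerivAt Λ (fun η _ => S.pf_hasDerivAt n η (h.smooth η) t) ξ)).const_smul tpi

theorem Sys.Sol.iter {n : Euc d} {Λ : Finset (Fin d → ℤ)} {u : (Fin d → ℤ) → ℝ → W} (h : S.Sol n Λ u) (j : ℕ) :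
    S.Sol n Λ (fun ξ => iteratedDeriv j (u ξ)) := by
  induction j with
  | zero => simpa using h
  | succ j ih => simpa only [iteratedDeriv_succ] using ih.deriv

/-- energy identity -/
theorem Sys.Sol.energy {n : Euc d} {Λ : Finset (Fin d → ℤ)} {u : (Fin d → ℤ) → ℝ → W} (h : S.Sol n Λ u)
    (w : (Fin d → ℤ) → ℝ) (t : ℝ) :
    HasDerivAt (fun t => (∑ ξ ∈ Λ, (w ξ : ℂ) * inner ℂ (u ξ t) (S.rf n Λ u t ξ)).re)
      (-(∑ ξ ∈ Λ, (w ξ : ℂ) * inner ℂ (S.pf n u t ξ) (S.cv Λ (S.pf n u t) ξ)).re) t := by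
  have h1 : HasDerivAt (fun t => (∑ ξ ∈ Λ, (w ξ : ℂ) * inner ℂ (u ξ t) (S.rf n Λ u t ξ)))
      (-(∑ ξ ∈ Λ, (w ξ : ℂ) * inner ℂ (S.pf n u t ξ) (S.cv Λ (S.pf n u t) ξ))) t := by
    rw [← Finset.sum_neg_distrib]
    refine HasDerivAt.fun_sum fun ξ hξ => ?_
    refine (((smooth_hasDerivAt (h.smooth ξ) t).inner ℂ (h.eqn ξ hξ t)).const_mul (w ξ : ℂ)).congr_deriv ?_
    rw [← mul_neg]
    congr 1
    unfold Sys.rf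
    rw [inner_smul_right, S.inner_τa, S.inner_τa]
    conv_rhs => unfold Sys.pf Sys.pv
    rw [inner_sub_left, inner_smul_left, conj_tpi]
    unfold Sys.pf Sys.pv
    ring
  have h2 := Complex.reCLM.hasFDerivAt.comp_hasDerivAt t h1
  exact h2.congr_deriv (by rw [Complex.reCLM_apply, Complex.neg_re])
end

end

section
open scoped Pointwise
set_option linter.all false

theorem lin_flow {Y : Type*} [NormedAddCommGroup Y] [NormedSpace ℂ Y] [FiniteDimensional ℂ Y] (A : Y →ₗ[ℂ] Y) :
    ∃ Fl : ℝ → Y →ₗ[ℂ] Y, (∀ y, Fl 0 y = y) ∧ ∀ y t, HasDerivAt (fun t => Fl t y) (A (Fl t y)) t := by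
  have : CompleteSpace Y := FiniteDimensional.complete ℂ Y
  set B : Y →L[ℂ] Y := LinearMap.toContinuousLinearMap A with hB
  refine ⟨fun t => (NormedSpace.exp ((t : ℂ) • B)).toLinearMap, fun y => by simp, fun y t => ?_⟩
  have h := (hasDerivAt_exp_smul_const' (𝕂 := ℂ) B (t : ℂ)).scomp t Complex.ofRealCLM.hasDerivAt
  have h2 := ((ContinuousLinearMap.apply ℂ Y y).restrictScalars ℝ).hasFDerivAt.comp_hasDerivAt t h
  refine h2.congr_deriv ?_
  simp
  rfl

theorem flow_smooth {Y : Type*} [NormedAddCommGroup Y] [NormedSpace ℂ Y] [FiniteDimensional ℂ Y] (A : Y →ₗ[ℂ] Y)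
    (y : ℝ → Y) (h : ∀ t, HasDerivAt y (A (y t)) t) : ContDiff ℝ (⊤ : ℕ∞) y := by
  rw [contDiff_infty]
  intro k
  have e : deriv y = fun t => A (y t) := funext fun t => (h t).deriv
  have hd : Differentiable ℝ y := fun t => (h t).differentiableAt
  induction k with
  | zero => exact contDiff_zero.2 hd.continuous
  | succ k ih =>
    have : ContDiff ℝ ((k : WithTop ℕ∞) + 1) y := by
      rw [contDiff_succ_iff_deriv]
      refine ⟨hd, by simp, ?_⟩
      rw [e]
      exact ((LinearMap.toContinuousLinearMap A).restrictScalars ℝ).contDiff.comp ih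
    exact_mod_cast this

section
variable {d : ℕ} {W E : Type} [NormedAddCommGroup W] [InnerProductSpace ℂ W] [FiniteDimensional ℂ W]
    [NormedAddCommGroup E] [InnerProductSpace ℂ E] [FiniteDimensional ℂ E] (S : Sys d W E)

/-- extension by zero -/
def ext0 (Λ : Finset (Fin d → ℤ)) (v : Λ → W) (ξ : Fin d → ℤ) : W :=
  if h : ξ ∈ Λ then v ⟨ξ, h⟩ else 0

theorem ext0_mem {Λ : Finset (Fin d → ℤ)} (v : Λ → W) {ξ : Fin d → ℤ} (h : ξ ∈ Λ) : ext0 Λ v ξ = v ⟨ξ, h⟩ := by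
  simp [ext0, h]

theorem ext0_add (Λ : Finset (Fin d → ℤ)) (v w : Λ → W) (ξ) : ext0 Λ (v + w) ξ = ext0 Λ v ξ + ext0 Λ w ξ := by
  unfold ext0; split_ifs <;> simp
theorem ext0_smul (Λ : Finset (Fin d → ℤ)) (c : ℂ) (w : Λ → W) (ξ) : ext0 Λ (c • w) ξ = c • ext0 Λ w ξ := by
  unfold ext0; split_ifs <;> simp

/-- the conormal map -/
def Sys.Em (n : Euc d) (Λ : Finset (Fin d → ℤ)) : (Λ → W) →ₗ[ℂ] (Λ → W) where
  toFun z ξ := S.τa n (S.cv Λ (fun η => S.τ n (ext0 Λ z η)) ξ)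
  map_add' x y := by
    ext ξ; simp only [ext0_add, map_add, S.cv_add, Pi.add_apply]
  map_smul' c x := by
    ext ξ; simp only [ext0_smul, map_smul, S.cv_smul, Pi.smul_apply, RingHom.id_apply]

/-- the tangential map -/
def Sys.Bm (n : Euc d) (Λ : Finset (Fin d → ℤ)) : (Λ → W) →ₗ[ℂ] (Λ → W) where
  toFun z ξ := S.τa n (S.cv Λ (fun η => tpi • S.τ (zvec η) (ext0 Λ z η)) ξ)
  map_add' x y := by
    ext ξ; simp only [ext0_add, map_add, S.cv_add, Pi.add_apply, smul_add]
  map_smul' c x := by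
    ext ξ; simp only [ext0_smul, map_smul, smul_comm tpi c, S.cv_smul, Pi.smul_apply, RingHom.id_apply]

/-- the divergence map -/
def Sys.Dm (n : Euc d) (Λ : Finset (Fin d → ℤ)) : (Λ → W) × (Λ → W) →ₗ[ℂ] (Λ → W) where
  toFun y ξ := tpi • S.τa (zvec ξ.1) (S.cv Λ (fun η => S.pv n η (ext0 Λ y.1 η) (ext0 Λ y.2 η)) ξ)
  map_add' x y := by
    ext ξ; simp only [Sys.pv, Prod.fst_add, Prod.snd_add, ext0_add, map_add, S.cv_add, S.cv_sub, Pi.add_apply, smul_add, smul_sub, map_sub]; abel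
  map_smul' c x := by
    ext ξ
    simp only [Sys.pv, Prod.smul_fst, Prod.smul_snd, ext0_smul, map_smul, S.cv_smul, S.cv_sub, map_sub, Pi.smul_apply, RingHom.id_apply, smul_sub]
    rw [smul_comm tpi c, smul_comm tpi c, smul_comm tpi c]

theorem Ns_zero_iff {F : Type*} [NormedAddCommGroup F] {Λ : Finset (Fin d → ℤ)} {p : (Fin d → ℤ) → F}
    (h : Ns Λ 0 p ≤ 0) : ∀ ξ ∈ Λ, p ξ = 0 := by
  intro ξ hξ
  unfold Ns at h
  have h0 := (Finset.sum_eq_zero_iff_of_nonneg (fun ξ _ => by have := jb_pos ξ; positivity)).1 (le_antisymm h (Ns_nonneg Λ 0 p)) ξ hξ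
  simpa using h0

theorem Sys.Em_inj (n : Euc d) (hn : ‖n‖ = 1) (Λ : Finset (Fin d → ℤ)) : Function.Injective (S.Em n Λ) := by
  rw [← LinearMap.ker_eq_bot, LinearMap.ker_eq_bot']
  intro z hz
  obtain ⟨C, hC, h⟩ := S.ncoer 0
  have h1 := h n hn Λ (ext0 Λ z)
  have h2 : Ns Λ 0 (fun ξ => S.τa n (S.cv Λ (fun η => S.τ n (ext0 Λ z η)) ξ)) = 0 := by
    unfold Ns
    refine Finset.sum_eq_zero fun ξ hξ => ?_
    have : S.τa n (S.cv Λ (fun η => S.τ n (ext0 Λ z η)) ξ) = 0 := congrFun hz ⟨ξ, hξ⟩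
    show _ * ‖S.τa n (S.cv Λ (fun η => S.τ n (ext0 Λ z η)) ξ)‖ ^ 2 = 0
    rw [this]; simp
  rw [h2, mul_zero] at h1
  ext ξ
  have := Ns_zero_iff h1 ξ.1 ξ.2
  rw [ext0_mem _ ξ.2] at this
  simpa using this

/-- first step: trivial kernel by energy -/
theorem Sys.Sol.zero {n : Euc d} (hn : ‖n‖ = 1) {Λ : Finset (Fin d → ℤ)} {u : (Fin d → ℤ) → ℝ → W}
    (h : S.Sol n Λ u) {L : ℝ} (hL : 0 < L)
    (h0 : ∀ ξ ∈ Λ, inner ℂ (u ξ 0) (S.rf n Λ u 0 ξ) = (0 : ℂ)) (h1 : ∀ ξ ∈ Λ, S.rf n Λ u L ξ = 0) :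
    ∀ ξ ∈ Λ, S.pf n u 0 ξ = 0 := by
  obtain ⟨w, c, C, hc, hC, hw, hco⟩ := S.wcoer 0
  set J := fun t => (∑ ξ ∈ Λ, (w ξ : ℂ) * inner ℂ (u ξ t) (S.rf n Λ u t ξ)).re with hJ
  have hJd := fun t => h.energy S w t
  have hanti : Antitone J := antitone_of_deriv_nonpos (fun t => (hJd t).differentiableAt) (fun t => by
    rw [(hJd t).deriv]
    have h2 := hco Λ (S.pf n u t)
    have h3 := Ns_nonneg Λ 0 (S.pf n u t)
    have : 0 ≤ c * Ns Λ 0 (S.pf n u t) := by positivity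
    linarith)
  have e0 : J 0 = 0 := by
    simp only [hJ]; rw [Finset.sum_eq_zero (fun ξ hξ => by rw [h0 ξ hξ, mul_zero])]; simp
  have e1 : J L = 0 := by
    simp only [hJ]; rw [Finset.sum_eq_zero (fun ξ hξ => by rw [h1 ξ hξ, inner_zero_right, mul_zero])]; simp
  have hz : Set.EqOn J (fun _ => 0) (Set.Icc 0 L) := fun t ht => by
    have a := hanti ht.1
    have b := hanti ht.2
    simp only at *
    linarith
  have hd : HasDerivWithinAt J 0 (Set.Icc 0 L) 0 :=
    (hasDerivWithinAt_const _ _ _).congr hz (hz ⟨le_rfl, hL.le⟩)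
  have hu := (uniqueDiffOn_Icc hL 0 ⟨le_rfl, hL.le⟩).eq_deriv _ hd (hJd 0).hasDerivWithinAt
  have h2 := hco Λ (S.pf n u 0)
  refine Ns_zero_iff ?_
  have : c * Ns Λ 0 (S.pf n u 0) ≤ c * 0 := by linarith
  exact le_of_mul_le_mul_left this hc

theorem Sys.Sol.mode_zero {n : Euc d} {Λ : Finset (Fin d → ℤ)} (hΛ : 0 ∈ Λ) {u : (Fin d → ℤ) → ℝ → W}
    (h : S.Sol n Λ u) (s t : ℝ) : S.rf n Λ u s 0 = S.rf n Λ u t 0 := by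
  refine is_const_of_deriv_eq_zero (fun t => (h.eqn 0 hΛ t).differentiableAt) (fun t => ?_) s t
  rw [(h.eqn 0 hΛ t).deriv]
  have : zvec (0 : Fin d → ℤ) = 0 := by ext i; simp [zvec_apply]
  rw [this]
  simp [Sys.τa]

theorem Sys.galerkin (n : Euc d) (hn : ‖n‖ = 1) (hp : ∀ ξ, ξ ≠ 0 → perp n ξ ≠ 0) (Λ : Finset (Fin d → ℤ))
    (hΛ : 0 ∈ Λ) (L : ℝ) (hL : 0 < L) (g : (Fin d → ℤ) → W) (hg : g 0 = 0) :
    ∃ u : (Fin d → ℤ) → ℝ → W, S.Sol n Λ u ∧ (∀ ξ ∈ Λ, S.rf n Λ u 0 ξ = g ξ) ∧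
      (∀ ξ ∈ Λ, S.rf n Λ u L ξ = 0) ∧ u 0 0 = 0 := by
  set Ee := LinearEquiv.ofInjectiveEndo (S.Em n Λ) (S.Em_inj n hn Λ) with hEe
  -- derivative map
  set Z : (Λ → W) × (Λ → W) →ₗ[ℂ] (Λ → W) :=
    Ee.symm.toLinearMap ∘ₗ ((S.Bm n Λ) ∘ₗ LinearMap.fst ℂ _ _ - LinearMap.snd ℂ _ _) with hZ
  set A : (Λ → W) × (Λ → W) →ₗ[ℂ] (Λ → W) × (Λ → W) :=
    Z.prod ((S.Dm n Λ) ∘ₗ ((LinearMap.fst ℂ _ _).prod Z)) with hA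
  obtain ⟨Fl, hF0, hF⟩ := lin_flow A
  -- basic facts about a trajectory
  have hEZ : ∀ y, S.Em n Λ (Z y) = S.Bm n Λ y.1 - y.2 := fun y => by
    have : S.Em n Λ (Z y) = Ee (Ee.symm (S.Bm n Λ y.1 - y.2)) := rfl
    rw [this, LinearEquiv.apply_symm_apply]
  have key : ∀ y0, ∃ u : (Fin d → ℤ) → ℝ → W, S.Sol n Λ u ∧ (∀ ξ (hξ : ξ ∈ Λ) t, u ξ t = (Fl t y0).1 ⟨ξ, hξ⟩) ∧
      ∀ ξ (hξ : ξ ∈ Λ) t, S.rf n Λ u t ξ = (Fl t y0).2 ⟨ξ, hξ⟩ := by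
    intro y0
    have hsm := flow_smooth A (fun t => Fl t y0) (hF y0)
    set u : (Fin d → ℤ) → ℝ → W := fun ξ t => ext0 Λ (Fl t y0).1 ξ with hu
    have husm : ∀ ξ, ContDiff ℝ (⊤ : ℕ∞) (u ξ) := by
      intro ξ
      by_cases h : ξ ∈ Λ
      · have : u ξ = fun t => (Fl t y0).1 ⟨ξ, h⟩ := funext fun t => ext0_mem _ h
        rw [this]
        exact contDiff_pi.1 (contDiff_fst.comp hsm) ⟨ξ, h⟩
      · have : u ξ = fun t => 0 := funext fun t => by simp [hu, ext0, h]
        rw [this]; exact contDiff_const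
    have hd1 : ∀ t, HasDerivAt (fun t => (Fl t y0).1) (Z (Fl t y0)) t := fun t =>
      (ContinuousLinearMap.fst ℝ (Λ → W) (Λ → W)).hasFDerivAt.comp_hasDerivAt t (hF y0 t)
    have hd2 : ∀ t, HasDerivAt (fun t => (Fl t y0).2) (S.Dm n Λ ((Fl t y0).1, Z (Fl t y0))) t := fun t =>
      (ContinuousLinearMap.snd ℝ (Λ → W) (Λ → W)).hasFDerivAt.comp_hasDerivAt t (hF y0 t)
    have hud : ∀ ξ ∈ Λ, ∀ t, deriv (u ξ) t = ext0 Λ (Z (Fl t y0)) ξ := by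
      intro ξ h t
      have : u ξ = fun t => (Fl t y0).1 ⟨ξ, h⟩ := funext fun t => ext0_mem _ h
      rw [this, ext0_mem _ h]
      exact (hasDerivAt_pi.1 (hd1 t) ⟨ξ, h⟩).deriv
    have hr : ∀ ξ (hξ : ξ ∈ Λ) t, S.rf n Λ u t ξ = (Fl t y0).2 ⟨ξ, hξ⟩ := by
      intro ξ hξ t
      have e1 : S.rf n Λ u t ξ = S.Bm n Λ (Fl t y0).1 ⟨ξ, hξ⟩ - S.Em n Λ (Z (Fl t y0)) ⟨ξ, hξ⟩ := by
        show S.τa n _ = S.τa n _ - S.τa n _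
        rw [← map_sub, ← S.cv_sub]
        congr 1
        refine S.cv_congr (fun η hη => ?_) ξ
        simp only [Sys.pf, Sys.pv, hud η hη]; rfl
      rw [e1, hEZ]; simp
    refine ⟨u, ⟨husm, fun ξ hξ t => ?_⟩, fun ξ hξ t => ext0_mem _ hξ, hr⟩
    have e2 : (fun t => S.rf n Λ u t ξ) = fun t => (Fl t y0).2 ⟨ξ, hξ⟩ := funext (hr ξ hξ)
    rw [e2]
    refine (hasDerivAt_pi.1 (hd2 t) ⟨ξ, hξ⟩).congr_deriv ?_
    show tpi • S.τa (zvec ξ) _ = tpi • S.τa (zvec ξ) _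
    congr 2
    refine S.cv_congr (fun η hη => ?_) ξ
    simp only [Sys.pf, Sys.pv, hud η hη]; rfl
  -- boundary map
  set Ψ : (Λ → W) × (Λ → W) →ₗ[ℂ] (Λ → W) × (Λ → W) :=
    (LinearMap.snd ℂ _ _ + (LinearMap.single ℂ (fun _ : Λ => W) (⟨0, hΛ⟩ : Λ)) ∘ₗ (LinearMap.proj (⟨0, hΛ⟩ : Λ)) ∘ₗ LinearMap.fst ℂ _ _).prod
      (LinearMap.snd ℂ _ _ ∘ₗ Fl L) with hΨ
  have hΨ1 : ∀ y0 ξ, (Ψ y0).1 ξ = y0.2 ξ + if ξ = ⟨0, hΛ⟩ then y0.1 ⟨0, hΛ⟩ else 0 := by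
    intro y0 ξ
    simp only [hΨ, LinearMap.prod_apply, Function.prod, LinearMap.add_apply, LinearMap.snd_apply, LinearMap.comp_apply,
      LinearMap.fst_apply, LinearMap.proj_apply, LinearMap.single_apply, Pi.add_apply, Pi.single_apply]
  have hΨ2 : ∀ y0, (Ψ y0).2 = (Fl L y0).2 := fun y0 => rfl
  have hinj : Function.Injective Ψ := by
    rw [← LinearMap.ker_eq_bot, LinearMap.ker_eq_bot']
    intro y0 hy
    obtain ⟨u, hs, hu, hr⟩ := key y0
    have hrL : ∀ ξ ∈ Λ, S.rf n Λ u L ξ = 0 := fun ξ hξ => by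
      rw [hr ξ hξ, ← hΨ2, hy]; rfl
    have hr00 : S.rf n Λ u 0 0 = 0 := by rw [hs.mode_zero S hΛ 0 L, hrL 0 hΛ]
    have hB : ∀ ξ (hξ : ξ ∈ Λ), S.rf n Λ u 0 ξ + (if (⟨ξ, hξ⟩ : Λ) = ⟨0, hΛ⟩ then u 0 0 else 0) = 0 := fun ξ hξ => by
      have := hΨ1 y0 ⟨ξ, hξ⟩
      rw [hy] at this
      rw [hr ξ hξ, hu 0 hΛ, hF0, ← this]; rfl
    have hu00 : u 0 0 = 0 := by
      have := hB 0 hΛ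
      rw [hr00] at this; simpa using this
    have hr0 : ∀ ξ ∈ Λ, S.rf n Λ u 0 ξ = 0 := fun ξ hξ => by
      have := hB ξ hξ
      rw [hu00] at this; simpa using this
    have hp0 := hs.zero S hn hL (fun ξ hξ => by rw [hr0 ξ hξ, inner_zero_right]) hrL
    have hu0 : ∀ ξ ∈ Λ, u ξ 0 = 0 := by
      intro ξ hξ
      by_cases hz : ξ = 0
      · rw [hz]; exact hu00
      · have h1 := S.pv_norm1 n hn ξ (u ξ 0) (deriv (u ξ) 0)
        have h2 : S.pv n ξ (u ξ 0) (deriv (u ξ) 0) = 0 := hp0 ξ hξ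
        rw [h2, norm_zero] at h1
        have h3 := norm_pos_iff.2 (hp ξ hz)
        have := Real.pi_pos
        by_contra hne
        have h4 := norm_pos_iff.2 hne
        have : 0 < 2 * Real.pi * ‖perp n ξ‖ * ‖u ξ 0‖ := by positivity
        linarith
    refine Prod.ext (funext fun ξ => ?_) (funext fun ξ => ?_)
    · have := hu ξ.1 ξ.2 0
      rw [hF0, hu0 ξ.1 ξ.2] at this
      exact this.symm
    · have := hr ξ.1 ξ.2 0
      rw [hF0, hr0 ξ.1 ξ.2] at this
      exact this.symm
  obtain ⟨y0, hy0⟩ := LinearMap.injective_iff_surjective.1 hinj (fun ξ => g ξ.1, 0)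
  obtain ⟨u, hs, hu, hr⟩ := key y0
  have hrL : ∀ ξ ∈ Λ, S.rf n Λ u L ξ = 0 := fun ξ hξ => by
    rw [hr ξ hξ, ← hΨ2, hy0]; rfl
  have hr00 : S.rf n Λ u 0 0 = 0 := by rw [hs.mode_zero S hΛ 0 L, hrL 0 hΛ]
  have hB : ∀ ξ (hξ : ξ ∈ Λ), S.rf n Λ u 0 ξ + (if (⟨ξ, hξ⟩ : Λ) = ⟨0, hΛ⟩ then u 0 0 else 0) = g ξ := fun ξ hξ => by
    have := hΨ1 y0 ⟨ξ, hξ⟩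
    rw [hy0] at this
    rw [hr ξ hξ, hu 0 hΛ, hF0, ← this]
  have hu00 : u 0 0 = 0 := by
    have := hB 0 hΛ
    rw [hr00, hg] at this; simpa using this
  refine ⟨u, hs, fun ξ hξ => ?_, hrL, hu00⟩
  have := hB ξ hξ
  rw [hu00] at this; simpa using this
end

end

section
open scoped Pointwise
set_option linter.all false

theorem norm_perp_le {d : ℕ} (n : Euc d) (hn : ‖n‖ = 1) (ξ : Fin d → ℤ) : ‖perp n ξ‖ ≤ jb ξ := by
  have h1 : ‖perp n ξ‖ ^ 2 ≤ ‖zvec ξ‖ ^ 2 := by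
    have e : zvec ξ = perp n ξ + zdot ξ n • n := by unfold perp; abel
    have := @norm_add_sq_real _ _ _ (perp n ξ) (zdot ξ n • n)
    rw [← e, inner_smul_right, inner_perp n hn] at this
    nlinarith [sq_nonneg ‖zdot ξ n • n‖]
  have h2 : ‖zvec ξ‖ ≤ jb ξ := by
    have h3 : ‖zvec ξ‖ ^ 2 = zdot ξ (zvec ξ) := by
      rw [← inner_zvec, real_inner_self_eq_norm_sq]
    have h4 := zdot_le ξ (zvec ξ)
    have h5 := le_abs_self (zdot ξ (zvec ξ))
    have h6 := norm_nonneg (zvec ξ)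
    by_contra hc
    push Not at hc
    have := jb_pos ξ
    nlinarith
  exact (abs_le_of_sq_le_sq' h1 (norm_nonneg _)).2.trans h2

theorem zdot_n_le {d : ℕ} (n : Euc d) (hn : ‖n‖ = 1) (ξ : Fin d → ℤ) : |zdot ξ n| ≤ jb ξ := by
  have := zdot_le ξ n
  rwa [hn, mul_one] at this

section
variable {d : ℕ} {W E : Type} [NormedAddCommGroup W] [InnerProductSpace ℂ W] [FiniteDimensional ℂ W]
    [NormedAddCommGroup E] [InnerProductSpace ℂ E] [FiniteDimensional ℂ E] (S : Sys d W E)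

/-- Galerkin solution with data bounds -/
structure Sys.GS (n : Euc d) (κ : ℝ) (f : (Fin d → ℤ) → ℝ) (Λ : Finset (Fin d → ℤ)) (L : ℝ)
    (u : (Fin d → ℤ) → ℝ → W) : Prop where
  hn : ‖n‖ = 1
  κpos : 0 < κ
  dio : ∀ ξ, ξ ≠ 0 → κ ≤ jb ξ ^ 2 * ‖perp n ξ‖
  f0 : ∀ ξ, 0 ≤ f ξ
  hL : 1 ≤ L
  hΛ : 0 ∈ Λ
  sol : S.Sol n Λ u
  r0 : ∀ ξ ∈ Λ, ‖S.rf n Λ u 0 ξ‖ ≤ 2 * Real.pi * ‖perp n ξ‖ * f ξ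
  rL : ∀ ξ ∈ Λ, S.rf n Λ u L ξ = 0
  u00 : u 0 0 = 0

/-- tail energy -/
def Sys.Fs (n : Euc d) (Λ : Finset (Fin d → ℤ)) (L : ℝ) (u : (Fin d → ℤ) → ℝ → W) (s : ℕ) (t : ℝ) : ℝ :=
  ∫ τ in t..L, Ns Λ s (S.pf n u τ)

theorem Sys.Ns_cont {n : Euc d} {u : (Fin d → ℤ) → ℝ → W} (h : ∀ ξ, ContDiff ℝ (⊤ : ℕ∞) (u ξ))
    (Λ : Finset (Fin d → ℤ)) (s : ℕ) : Continuous (fun t => Ns Λ s (S.pf n u t)) := by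
  unfold Ns
  refine continuous_finsetSum _ fun ξ _ => continuous_const.mul ((Continuous.norm ?_).pow 2)
  exact continuous_iff_continuousAt.2 fun t => (S.pf_hasDerivAt n ξ (h ξ) t).continuousAt

theorem Sys.Fs_anti {n : Euc d} {u : (Fin d → ℤ) → ℝ → W} (h : ∀ ξ, ContDiff ℝ (⊤ : ℕ∞) (u ξ))
    (Λ : Finset (Fin d → ℤ)) (s : ℕ) {L a b : ℝ} (hab : a ≤ b) (hb : b ≤ L) :
    (∫ τ in a..b, Ns Λ s (S.pf n u τ)) ≤ S.Fs n Λ L u s a ∧ S.Fs n Λ L u s b ≤ S.Fs n Λ L u s a := by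
  have hc := S.Ns_cont (n := n) h Λ s
  have e := intervalIntegral.integral_add_adjacent_intervals (hc.intervalIntegrable (μ := volume) a b) (hc.intervalIntegrable b L)
  have h1 : 0 ≤ ∫ τ in a..b, Ns Λ s (S.pf n u τ) :=
    intervalIntegral.integral_nonneg hab fun _ _ => Ns_nonneg _ _ _
  have h2 : 0 ≤ ∫ τ in b..L, Ns Λ s (S.pf n u τ) :=
    intervalIntegral.integral_nonneg hb fun _ _ => Ns_nonneg _ _ _
  unfold Sys.Fs
  constructor <;> linarith

theorem Sys.Fs_nonneg (n : Euc d) (u : (Fin d → ℤ) → ℝ → W) 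
    (Λ : Finset (Fin d → ℤ)) (s : ℕ) {L a : ℝ} (ha : a ≤ L) : 0 ≤ S.Fs n Λ L u s a :=
  intervalIntegral.integral_nonneg ha fun _ _ => Ns_nonneg _ _ _

theorem Sys.GS.ei {s : ℕ} {w : (Fin d → ℤ) → ℝ} {c : ℝ}
    (hco : ∀ Λ (p : (Fin d → ℤ) → E), c * Ns Λ s p ≤ (∑ ξ ∈ Λ, (w ξ : ℂ) * inner ℂ (p ξ) (S.cv Λ p ξ)).re)
    {n κ f Λ L u} (h : S.GS n κ f Λ L u) {t : ℝ} (ht : t ≤ L) :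
    c * S.Fs n Λ L u s t ≤ (∑ ξ ∈ Λ, (w ξ : ℂ) * inner ℂ (u ξ t) (S.rf n Λ u t ξ)).re := by
  have hd := fun t => h.sol.energy S w t
  have hcp : ∀ ξ, Continuous fun t => S.pf n u t ξ := fun ξ =>
    continuous_iff_continuousAt.2 fun t => (S.pf_hasDerivAt n ξ (h.sol.smooth ξ) t).continuousAt
  have hcont : Continuous fun t => (∑ ξ ∈ Λ, (w ξ : ℂ) * inner ℂ (S.pf n u t ξ) (S.cv Λ (S.pf n u t) ξ)).re := by
    refine (Complex.continuous_re.comp (continuous_finsetSum _ fun ξ _ => continuous_const.mul ?_))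
    refine (hcp ξ).inner ?_
    unfold Sys.cv
    exact continuous_finsetSum _ fun η _ => (S.K (ξ - η)).continuous.comp (hcp η)
  have hF := intervalIntegral.integral_eq_sub_of_hasDerivAt (a := t) (b := L) (fun x _ => hd x) (hcont.neg.intervalIntegrable _ _)
  have eL : (∑ ξ ∈ Λ, (w ξ : ℂ) * inner ℂ (u ξ L) (S.rf n Λ u L ξ)).re = 0 := by
    rw [Finset.sum_eq_zero (fun ξ hξ => by rw [h.rL ξ hξ, inner_zero_right, mul_zero])]; simp
  rw [eL, intervalIntegral.integral_neg] at hF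
  have hm : ∫ τ in t..L, c * Ns Λ s (S.pf n u τ) ≤
      ∫ τ in t..L, (∑ ξ ∈ Λ, (w ξ : ℂ) * inner ℂ (S.pf n u τ ξ) (S.cv Λ (S.pf n u τ) ξ)).re :=
    intervalIntegral.integral_mono_on ht ((continuous_const.mul (S.Ns_cont h.sol.smooth Λ s)).intervalIntegrable _ _)
      (hcont.intervalIntegrable _ _) (fun τ _ => hco Λ _)
  rw [intervalIntegral.integral_const_mul] at hm
  unfold Sys.Fs
  linarith

theorem Sys.GS.E1 (s : ℕ) : ∃ C : ℝ, 0 < C ∧ ∀ n κ f Λ L u, S.GS n κ f Λ L u →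
    S.Fs n Λ L u s 0 ≤ C * Ns Λ (s + 1) f := by
  obtain ⟨w, c, C, hc, hC, hw, hco⟩ := S.wcoer s
  refine ⟨(8 * C) ^ 2 / c ^ 2, by positivity, fun n κ f Λ L u h => ?_⟩
  have hei := h.ei S hco (t := 0) (by linarith [h.hL])
  set g := S.rf n Λ u 0 with hg
  -- rotated coefficient
  set a : (Fin d → ℤ) → ℝ → W := fun ξ t => Complex.exp (-(tpi * zdot ξ n) * t) • u ξ t with ha
  set a' : (Fin d → ℤ) → ℝ → W := fun ξ t =>
    Complex.exp (-(tpi * zdot ξ n) * t) • (deriv (u ξ) t - (tpi * zdot ξ n) • u ξ t) with ha'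
  have hexp : ∀ ξ (t : ℝ), ‖Complex.exp (-(tpi * zdot ξ n) * t)‖ = 1 := fun ξ t => by
    have : -(tpi * zdot ξ n) * t = ((-(2 * Real.pi * zdot ξ n * t) : ℝ) : ℂ) * Complex.I := by
      unfold tpi; push_cast; ring
    rw [this, Complex.norm_exp_ofReal_mul_I]
  have had : ∀ ξ t, HasDerivAt (a ξ) (a' ξ t) t := fun ξ t => by
    have h1 : HasDerivAt (fun t : ℝ => Complex.exp (-(tpi * zdot ξ n) * t))
        (Complex.exp (-(tpi * zdot ξ n) * t) * (-(tpi * zdot ξ n))) t := by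
      have := ((hasDerivAt_id (t : ℂ)).const_mul (-(tpi * zdot ξ n))).cexp.comp_ofReal
      simpa using this
    refine (h1.smul (smooth_hasDerivAt (h.sol.smooth ξ) t)).congr_deriv ?_
    simp only [ha']
    rw [smul_sub, smul_smul]
    simp only [mul_neg, neg_smul]; abel
  have hb1 : ∀ ξ ∈ Λ, ∀ t, ‖(inner ℂ (a ξ t) (g ξ) : ℂ)‖ ≤ f ξ * ‖S.pf n u t ξ‖ := fun ξ hξ t => by
    refine (norm_inner_le_norm _ _).trans ?_
    simp only [ha]
    rw [norm_smul, hexp, one_mul]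
    have h1 := h.r0 ξ hξ
    have h2 := S.pv_norm1 n h.hn ξ (u ξ t) (deriv (u ξ) t)
    have h3 := h.f0 ξ
    calc ‖u ξ t‖ * ‖g ξ‖ ≤ ‖u ξ t‖ * (2 * Real.pi * ‖perp n ξ‖ * f ξ) := by gcongr
      _ = f ξ * (2 * Real.pi * ‖perp n ξ‖ * ‖u ξ t‖) := by ring
      _ ≤ _ := by gcongr; exact h2
  have hb2 : ∀ ξ ∈ Λ, ∀ t, ‖(inner ℂ (a' ξ t) (g ξ) : ℂ)‖ ≤ 7 * jb ξ * f ξ * ‖S.pf n u t ξ‖ := fun ξ hξ t => by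
    refine (norm_inner_le_norm _ _).trans ?_
    simp only [ha']
    rw [norm_smul, hexp, one_mul]
    have h1 := h.r0 ξ hξ
    have h2 := S.pv_norm2 n h.hn ξ (u ξ t) (deriv (u ξ) t)
    have h3 := h.f0 ξ
    have h4 := norm_perp_le n h.hn ξ
    have h5 := Real.pi_lt_d2
    have := Real.pi_pos
    have := jb_pos ξ
    calc _ ≤ ‖S.pf n u t ξ‖ * (2 * Real.pi * ‖perp n ξ‖ * f ξ) := by gcongr; exact h2
      _ ≤ ‖S.pf n u t ξ‖ * (2 * 3.5 * jb ξ * f ξ) := by gcongr; linarith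
      _ = _ := by ring
  set Hf : ℝ → ℝ := fun t => (1 - t) * (∑ ξ ∈ Λ, (w ξ : ℂ) * inner ℂ (a ξ t) (g ξ)).re with hHf
  set H' : ℝ → ℝ := fun t => (-1) * (∑ ξ ∈ Λ, (w ξ : ℂ) * inner ℂ (a ξ t) (g ξ)).re
    + (1 - t) * (∑ ξ ∈ Λ, (w ξ : ℂ) * inner ℂ (a' ξ t) (g ξ)).re with hH'
  have hHd : ∀ t, HasDerivAt Hf (H' t) t := fun t => by
    refine ((hasDerivAt_id t).const_sub 1).mul ?_
    have : HasDerivAt (fun t => ∑ ξ ∈ Λ, (w ξ : ℂ) * inner ℂ (a ξ t) (g ξ)) (∑ ξ ∈ Λ, (w ξ : ℂ) * inner ℂ (a' ξ t) (g ξ)) t := by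
      refine HasDerivAt.fun_sum fun ξ _ => HasDerivAt.const_mul (w ξ : ℂ) ?_
      refine ((had ξ t).inner ℂ (hasDerivAt_const t (g ξ))).congr_deriv ?_
      rw [inner_zero_right, zero_add]
    exact Complex.reCLM.hasFDerivAt.comp_hasDerivAt t this
  have hcu : ∀ ξ, Continuous (u ξ) := fun ξ => (h.sol.smooth ξ).continuous
  have hcu' : ∀ ξ, Continuous (deriv (u ξ)) := fun ξ => (smooth_deriv (h.sol.smooth ξ)).continuous
  have hca : ∀ ξ, Continuous (a ξ) := fun ξ => continuous_iff_continuousAt.2 fun t => (had ξ t).continuousAt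
  have hca' : ∀ ξ, Continuous (a' ξ) := fun ξ => by
    simp only [ha']
    have := hcu ξ
    have := hcu' ξ
    fun_prop
  have hH'c : Continuous H' := by
    refine (continuous_const.mul (Complex.continuous_re.comp (continuous_finsetSum _ fun ξ _ => continuous_const.mul ((hca ξ).inner continuous_const)))).add
      ((continuous_const.sub continuous_id).mul (Complex.continuous_re.comp (continuous_finsetSum _ fun ξ _ => continuous_const.mul ((hca' ξ).inner continuous_const))))
  have hbound : ∀ t ∈ Set.Icc (0:ℝ) 1, - H' t ≤ c / 2 * Ns Λ s (S.pf n u t) + (8 * C) ^ 2 / (2 * c) * Ns Λ (s + 1) f := by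
    intro t ht
    have hR1 : ‖∑ ξ ∈ Λ, (w ξ : ℂ) * inner ℂ (a ξ t) (g ξ)‖ ≤ ∑ ξ ∈ Λ, w ξ * (f ξ * ‖S.pf n u t ξ‖) := by
      refine (norm_sum_le _ _).trans (Finset.sum_le_sum fun ξ hξ => ?_)
      rw [norm_mul, Complex.norm_real, Real.norm_of_nonneg (hw ξ).1.le]
      exact mul_le_mul_of_nonneg_left (hb1 ξ hξ t) (hw ξ).1.le
    have hR2 : ‖∑ ξ ∈ Λ, (w ξ : ℂ) * inner ℂ (a' ξ t) (g ξ)‖ ≤ ∑ ξ ∈ Λ, w ξ * (7 * jb ξ * f ξ * ‖S.pf n u t ξ‖) := by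
      refine (norm_sum_le _ _).trans (Finset.sum_le_sum fun ξ hξ => ?_)
      rw [norm_mul, Complex.norm_real, Real.norm_of_nonneg (hw ξ).1.le]
      exact mul_le_mul_of_nonneg_left (hb2 ξ hξ t) (hw ξ).1.le
    have hr1 := Complex.re_le_norm (∑ ξ ∈ Λ, (w ξ : ℂ) * inner ℂ (a ξ t) (g ξ))
    have hr2 := Complex.abs_re_le_norm (∑ ξ ∈ Λ, (w ξ : ℂ) * inner ℂ (a' ξ t) (g ξ))
    have hr3 : -((1 - t) * (∑ ξ ∈ Λ, (w ξ : ℂ) * inner ℂ (a' ξ t) (g ξ)).re) ≤ 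
        |(∑ ξ ∈ Λ, (w ξ : ℂ) * inner ℂ (a' ξ t) (g ξ)).re| := by
      refine (neg_le_abs _).trans ?_
      rw [abs_mul, abs_of_nonneg (by linarith [ht.2])]
      exact mul_le_of_le_one_left (abs_nonneg _) (by linarith [ht.1])
    have hA : - H' t ≤ ∑ ξ ∈ Λ, (w ξ * (f ξ * ‖S.pf n u t ξ‖) + w ξ * (7 * jb ξ * f ξ * ‖S.pf n u t ξ‖)) := by
      rw [Finset.sum_add_distrib]
      simp only [hH']
      linarith
    refine hA.trans ?_
    unfold Ns
    rw [Finset.mul_sum, Finset.mul_sum, ← Finset.sum_add_distrib]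
    refine Finset.sum_le_sum fun ξ _ => ?_
    have hj := jb_one_le ξ
    have hj0 := jb_pos ξ
    have hf := h.f0 ξ
    rw [Real.norm_of_nonneg hf]
    have e1 : w ξ * (f ξ * ‖S.pf n u t ξ‖) + w ξ * (7 * jb ξ * f ξ * ‖S.pf n u t ξ‖) ≤
        (C * jb ξ ^ (2 * s)) * (8 * jb ξ * f ξ * ‖S.pf n u t ξ‖) := by
      rw [← mul_add]
      have h0 := (hw ξ).1
      refine mul_le_mul (hw ξ).2 ?_ (by positivity) (by positivity)
      have : f ξ * ‖S.pf n u t ξ‖ ≤ jb ξ * (f ξ * ‖S.pf n u t ξ‖) := le_mul_of_one_le_left (by positivity) hj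
      linarith
    refine e1.trans ?_
    have e : c / 2 * (jb ξ ^ (2 * s) * ‖S.pf n u t ξ‖ ^ 2) + (8 * C) ^ 2 / (2 * c) * (jb ξ ^ (2 * (s + 1)) * f ξ ^ 2) -
        (C * jb ξ ^ (2 * s)) * (8 * jb ξ * f ξ * ‖S.pf n u t ξ‖) =
        jb ξ ^ (2 * s) * ((c * ‖S.pf n u t ξ‖ - 8 * C * jb ξ * f ξ) ^ 2 / (2 * c)) := by
      field_simp; ring
    have : 0 ≤ jb ξ ^ (2 * s) * ((c * ‖S.pf n u t ξ‖ - 8 * C * jb ξ * f ξ) ^ 2 / (2 * c)) := by positivity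
    linarith
  have hI := intervalIntegral.integral_eq_sub_of_hasDerivAt (a := 0) (b := 1) (fun x _ => hHd x) (hH'c.intervalIntegrable _ _)
  have hcN := S.Ns_cont (n := n) h.sol.smooth Λ s
  have hcN2 : Continuous (fun t => c / 2 * Ns Λ s (S.pf n u t)) := continuous_const.mul hcN
  have hI2 : ∫ t in (0:ℝ)..1, - H' t ≤ ∫ t in (0:ℝ)..1, (c / 2 * Ns Λ s (S.pf n u t) + (8 * C) ^ 2 / (2 * c) * Ns Λ (s + 1) f) :=
    intervalIntegral.integral_mono_on zero_le_one (hH'c.neg.intervalIntegrable _ _)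
      (((continuous_const.mul hcN).add continuous_const).intervalIntegrable _ _) hbound
  rw [intervalIntegral.integral_neg, hI, intervalIntegral.integral_add (hcN2.intervalIntegrable _ _)
    (continuous_const.intervalIntegrable _ _), intervalIntegral.integral_const_mul] at hI2
  simp only [intervalIntegral.integral_const, sub_zero, one_smul] at hI2
  have hH1 : Hf 1 = 0 := by simp [hHf]
  have hH0 : Hf 0 = (∑ ξ ∈ Λ, (w ξ : ℂ) * inner ℂ (u ξ 0) (g ξ)).re := by
    simp only [hHf, ha]; simp
  have hF := (S.Fs_anti (n := n) h.sol.smooth Λ s (a := 0) (b := 1) (L := L) zero_le_one h.hL).1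
  rw [hH1, hH0] at hI2
  have hF' : c / 2 * ∫ τ in (0:ℝ)..1, Ns Λ s (S.pf n u τ) ≤ c / 2 * S.Fs n Λ L u s 0 := by gcongr
  have hfin : c * S.Fs n Λ L u s 0 ≤ c * ((8 * C) ^ 2 / c ^ 2 * Ns Λ (s + 1) f) := by
    have e : c * ((8 * C) ^ 2 / c ^ 2 * Ns Λ (s + 1) f) = 2 * ((8 * C) ^ 2 / (2 * c) * Ns Λ (s + 1) f) := by
      field_simp
    rw [e]; linarith
  exact le_of_mul_le_mul_left hfin hc
end

end

section
open scoped Pointwise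
set_option linter.all false

section
variable {d : ℕ} {W E : Type} [NormedAddCommGroup W] [InnerProductSpace ℂ W] [FiniteDimensional ℂ W]
    [NormedAddCommGroup E] [InnerProductSpace ℂ E] [FiniteDimensional ℂ E] (S : Sys d W E)

theorem Sys.GS.u_le {n κ f Λ L u} (h : S.GS n κ f Λ L u) (ξ : Fin d → ℤ) (hξ : ξ ≠ 0) (a b : W) :
    κ * ‖a‖ ≤ jb ξ ^ 2 * ‖S.pv n ξ a b‖ := by
  have h1 := S.pv_norm1 n h.hn ξ a b
  have h2 := h.dio ξ hξ
  have := jb_pos ξ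
  have h3 := Real.pi_gt_three
  calc κ * ‖a‖ ≤ (jb ξ ^ 2 * ‖perp n ξ‖) * ‖a‖ := by gcongr
    _ = jb ξ ^ 2 * (1 * ‖perp n ξ‖ * ‖a‖) := by ring
    _ ≤ jb ξ ^ 2 * (2 * Real.pi * ‖perp n ξ‖ * ‖a‖) := by gcongr; linarith
    _ ≤ _ := by gcongr

theorem Sys.GS.E2 (s : ℕ) : ∃ C : ℝ, 0 < C ∧ ∀ n κ f Λ L u, S.GS n κ f Λ L u → ∀ t ≤ L,
    κ * S.Fs n Λ L u s t ≤ C * Ns Λ (s + 1) (S.pf n u t) := by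
  obtain ⟨w, c, C, hc, hC, hw, hco⟩ := S.wcoer s
  obtain ⟨C2, hC2, hcv⟩ := S.cv_bound (s + 1)
  refine ⟨C * (1 + C2) / c, by positivity, fun n κ f Λ L u h t ht => ?_⟩
  have hei := h.ei S hco ht
  have hκ := h.κpos
  have h1 : κ * (∑ ξ ∈ Λ, (w ξ : ℂ) * inner ℂ (u ξ t) (S.rf n Λ u t ξ)).re ≤
      ∑ ξ ∈ Λ, C * (jb ξ ^ (2 * (s + 1)) * ‖S.pf n u t ξ‖ ^ 2 + jb ξ ^ (2 * (s + 1)) * ‖S.cv Λ (S.pf n u t) ξ‖ ^ 2) := by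
    refine (mul_le_mul_of_nonneg_left ((Complex.re_le_norm _).trans (norm_sum_le _ _)) hκ.le).trans ?_
    rw [Finset.mul_sum]
    refine Finset.sum_le_sum fun ξ hξ => ?_
    have hj := jb_pos ξ
    by_cases hz : ξ = 0
    · subst hz
      rw [h.sol.mode_zero S h.hΛ t L, h.rL 0 h.hΛ]
      simp only [inner_zero_right, mul_zero, norm_zero]
      positivity
    rw [norm_mul, Complex.norm_real, Real.norm_of_nonneg (hw ξ).1.le]
    have h2 : ‖(inner ℂ (u ξ t) (S.rf n Λ u t ξ) : ℂ)‖ ≤ ‖u ξ t‖ * ‖S.cv Λ (S.pf n u t) ξ‖ := by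
      refine (norm_inner_le_norm _ _).trans ?_
      gcongr
      have := S.norm_τa_le n (S.cv Λ (S.pf n u t) ξ)
      rwa [h.hn, one_mul] at this
    have h3 : κ * ‖u ξ t‖ ≤ jb ξ ^ 2 * ‖S.pf n u t ξ‖ := h.u_le S ξ hz _ _
    have h4 := (hw ξ).2
    have h5 := (hw ξ).1
    calc κ * (w ξ * ‖(inner ℂ (u ξ t) (S.rf n Λ u t ξ) : ℂ)‖)
        ≤ κ * ((C * jb ξ ^ (2 * s)) * (‖u ξ t‖ * ‖S.cv Λ (S.pf n u t) ξ‖)) := by gcongr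
      _ = (C * jb ξ ^ (2 * s)) * ((κ * ‖u ξ t‖) * ‖S.cv Λ (S.pf n u t) ξ‖) := by ring
      _ ≤ (C * jb ξ ^ (2 * s)) * ((jb ξ ^ 2 * ‖S.pf n u t ξ‖) * ‖S.cv Λ (S.pf n u t) ξ‖) := by gcongr
      _ = C * jb ξ ^ (2 * (s + 1)) * (‖S.pf n u t ξ‖ * ‖S.cv Λ (S.pf n u t) ξ‖) := by ring
      _ ≤ C * jb ξ ^ (2 * (s + 1)) * (‖S.pf n u t ξ‖ ^ 2 + ‖S.cv Λ (S.pf n u t) ξ‖ ^ 2) := by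
          gcongr
          nlinarith [sq_nonneg (‖S.pf n u t ξ‖ - ‖S.cv Λ (S.pf n u t) ξ‖), sq_nonneg ‖S.pf n u t ξ‖, sq_nonneg ‖S.cv Λ (S.pf n u t) ξ‖]
      _ = _ := by ring
  rw [← Finset.mul_sum, Finset.sum_add_distrib] at h1
  have h6 : κ * (c * S.Fs n Λ L u s t) ≤ C * (Ns Λ (s + 1) (S.pf n u t) + C2 * Ns Λ (s + 1) (S.pf n u t)) := by
    refine (mul_le_mul_of_nonneg_left hei hκ.le).trans (h1.trans ?_)
    have := hcv Λ (S.pf n u t)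
    unfold Ns at this ⊢
    gcongr
  have h7 : c * (κ * S.Fs n Λ L u s t) ≤ c * (C * (1 + C2) / c * Ns Λ (s + 1) (S.pf n u t)) := by
    have e : c * (C * (1 + C2) / c * Ns Λ (s + 1) (S.pf n u t)) = C * (Ns Λ (s + 1) (S.pf n u t) + C2 * Ns Λ (s + 1) (S.pf n u t)) := by
      field_simp
    rw [e]; linarith
  exact le_of_mul_le_mul_left h7 hc

theorem Sys.GS.E3 (ℓ : ℕ) : ∀ s, ∃ C : ℝ, 0 < C ∧ ∀ n κ f Λ L u, S.GS n κ f Λ L u → ∀ t, 0 ≤ t → t ≤ L →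
    (κ * t) ^ ℓ * S.Fs n Λ L u s t ≤ C * Ns Λ (s + ℓ + 1) f := by
  induction ℓ with
  | zero =>
    intro s
    obtain ⟨C, hC, h1⟩ := Sys.GS.E1 S s
    refine ⟨C, hC, fun n κ f Λ L u h t ht htL => ?_⟩
    rw [pow_zero, one_mul]
    exact (S.Fs_anti h.sol.smooth Λ s ht htL).2.trans (h1 n κ f Λ L u h)
  | succ ℓ ih =>
    intro s
    obtain ⟨C, hC, h1⟩ := ih (s + 1)
    obtain ⟨C2, hC2, h2⟩ := Sys.GS.E2 S s
    refine ⟨2 * C2 * 2 ^ ℓ * C, by positivity, fun n κ f Λ L u h t ht htL => ?_⟩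
    have hκ := h.κpos
    have hh : t / 2 ≤ t := by linarith
    have h3 : ∫ τ in (t/2)..t, κ * S.Fs n Λ L u s t ≤ ∫ τ in (t/2)..t, C2 * Ns Λ (s + 1) (S.pf n u τ) := by
      refine intervalIntegral.integral_mono_on hh (continuous_const.intervalIntegrable _ _)
        ((continuous_const.mul (S.Ns_cont h.sol.smooth Λ (s+1))).intervalIntegrable _ _) fun τ hτ => ?_
      refine le_trans ?_ (h2 n κ f Λ L u h τ (hτ.2.trans htL))
      gcongr
      exact (S.Fs_anti h.sol.smooth Λ s hτ.2 htL).2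
    rw [intervalIntegral.integral_const, intervalIntegral.integral_const_mul, smul_eq_mul] at h3
    have h4 := (S.Fs_anti (n := n) h.sol.smooth Λ (s + 1) hh htL).1
    have h5 := h1 n κ f Λ L u h (t / 2) (by linarith) (by linarith)
    have h6 : (t - t / 2) * (κ * S.Fs n Λ L u s t) ≤ C2 * S.Fs n Λ L u (s + 1) (t / 2) :=
      h3.trans (by gcongr)
    have h7 : κ * t * S.Fs n Λ L u s t ≤ 2 * C2 * S.Fs n Λ L u (s + 1) (t / 2) := by linarith
    have hx : 0 ≤ κ * t := by positivity
    calc (κ * t) ^ (ℓ + 1) * S.Fs n Λ L u s t = (κ * t) ^ ℓ * (κ * t * S.Fs n Λ L u s t) := by ring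
      _ ≤ (κ * t) ^ ℓ * (2 * C2 * S.Fs n Λ L u (s + 1) (t / 2)) := by gcongr
      _ = 2 * C2 * 2 ^ ℓ * ((κ * (t / 2)) ^ ℓ * S.Fs n Λ L u (s + 1) (t / 2)) := by
          rw [show κ * (t / 2) = (κ * t) / 2 by ring, div_pow]; field_simp
      _ ≤ 2 * C2 * 2 ^ ℓ * (C * Ns Λ (s + 1 + ℓ + 1) f) := by gcongr
      _ = _ := by rw [show s + (ℓ + 1) + 1 = s + 1 + ℓ + 1 by ring]; ring

theorem Sys.E4 (s : ℕ) : ∃ C : ℝ, 0 < C ∧ ∀ n Λ u, ‖n‖ = 1 → S.Sol n Λ u → ∀ t,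
    Ns Λ s (S.pf n (fun ξ => deriv (u ξ)) t) ≤ C * Ns Λ (s + 1) (S.pf n u t) := by
  obtain ⟨C1, hC1, hn1⟩ := S.ncoer s
  obtain ⟨C2, hC2, hcv⟩ := S.cv_bound s
  obtain ⟨C3, hC3, hcv1⟩ := S.cv_bound (s + 1)
  set P := (4 * Real.pi) ^ 2 with hP
  have hP0 : 0 < P := by have := Real.pi_pos; positivity
  refine ⟨2 * (P + C1 * (2 * (C2 * P + (2 * Real.pi) ^ 2 * C3))), by positivity, fun n Λ u hn h t => ?_⟩
  set X : (Fin d → ℤ) → E := fun ξ => S.τ (perp n ξ) (tpi • deriv (u ξ) t) with hX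
  set z : (Fin d → ℤ) → W := fun ξ => deriv (deriv (u ξ)) t - (tpi * zdot ξ n) • deriv (u ξ) t with hz
  have e1 : S.pf n (fun ξ => deriv (u ξ)) t = fun ξ => X ξ - S.τ n (z ξ) := funext fun ξ => by
    unfold Sys.pf; rw [S.pv_eq]
  have hXb : Ns Λ s X ≤ P * Ns Λ (s + 1) (S.pf n u t) := by
    refine Ns_le_of fun ξ _ => ?_
    simp only [hX]
    rw [S.norm_τ, norm_smul, norm_tpi, pow_one]
    set D := deriv (u ξ) t - (tpi * zdot ξ n) • u ξ t with hD
    have hDp : ‖D‖ ≤ ‖S.pf n u t ξ‖ := S.pv_norm2 n hn ξ _ _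
    have hup : 2 * Real.pi * ‖perp n ξ‖ * ‖u ξ t‖ ≤ ‖S.pf n u t ξ‖ := S.pv_norm1 n hn ξ _ _
    have hu' : ‖deriv (u ξ) t‖ ≤ ‖D‖ + 2 * Real.pi * |zdot ξ n| * ‖u ξ t‖ := by
      have : deriv (u ξ) t = D + (tpi * zdot ξ n) • u ξ t := by rw [hD]; abel
      rw [this]
      refine (norm_add_le _ _).trans ?_
      rw [norm_smul, norm_mul, norm_tpi, Complex.norm_real, Real.norm_eq_abs, hD]
    have hpe := norm_perp_le n hn ξ
    have hzd := zdot_n_le n hn ξ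
    have := Real.pi_pos
    have := jb_pos ξ
    calc ‖perp n ξ‖ * (2 * Real.pi * ‖deriv (u ξ) t‖)
        ≤ ‖perp n ξ‖ * (2 * Real.pi * (‖D‖ + 2 * Real.pi * |zdot ξ n| * ‖u ξ t‖)) := by gcongr
      _ = 2 * Real.pi * (‖perp n ξ‖ * ‖D‖) + 2 * Real.pi * (|zdot ξ n| * (2 * Real.pi * ‖perp n ξ‖ * ‖u ξ t‖)) := by ring
      _ ≤ 2 * Real.pi * (jb ξ * ‖S.pf n u t ξ‖) + 2 * Real.pi * (jb ξ * ‖S.pf n u t ξ‖) := by gcongr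
      _ = _ := by ring
  have e2 : ∀ ξ ∈ Λ, S.τa n (S.cv Λ (fun η => S.τ n (z η)) ξ) =
      S.τa n (S.cv Λ X ξ) - tpi • S.τa (zvec ξ) (S.cv Λ (S.pf n u t) ξ) := fun ξ hξ => by
    rw [← h.eqn' S ξ hξ t]
    unfold Sys.rf
    rw [e1, S.cv_sub, map_sub]; abel
  have hzb : Ns Λ s z ≤ C1 * (2 * (C2 * P + (2 * Real.pi) ^ 2 * C3) * Ns Λ (s + 1) (S.pf n u t)) := by
    refine (hn1 n hn Λ z).trans ?_
    gcongr
    have e3 : Ns Λ s (fun ξ => S.τa n (S.cv Λ (fun η => S.τ n (z η)) ξ)) =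
        Ns Λ s (fun ξ => S.τa n (S.cv Λ X ξ) - tpi • S.τa (zvec ξ) (S.cv Λ (S.pf n u t) ξ)) := by
      unfold Ns
      exact Finset.sum_congr rfl fun ξ hξ => by dsimp only; rw [e2 ξ hξ]
    rw [e3]
    refine (Ns_sub_le _ _ _ _).trans ?_
    have h1 : Ns Λ s (fun ξ => S.τa n (S.cv Λ X ξ)) ≤ 1 ^ 2 * Ns Λ (s + 0) (S.cv Λ X) := by
      refine Ns_le_of fun ξ _ => ?_
      have := S.norm_τa_le n (S.cv Λ X ξ)
      rw [hn] at this
      simpa using this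
    have h2 : Ns Λ s (fun ξ => tpi • S.τa (zvec ξ) (S.cv Λ (S.pf n u t) ξ)) ≤ (2 * Real.pi) ^ 2 * Ns Λ (s + 1) (S.cv Λ (S.pf n u t)) := by
      refine Ns_le_of fun ξ _ => ?_
      rw [norm_smul, norm_tpi, pow_one]
      have := Real.pi_pos
      gcongr
      refine (S.norm_τa_le _ _).trans ?_
      gcongr
      have := norm_perp_le (0 : Euc d)
      have h3 : ‖zvec ξ‖ ^ 2 = zdot ξ (zvec ξ) := by
        rw [← inner_zvec, real_inner_self_eq_norm_sq]
      have h4 := zdot_le ξ (zvec ξ)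
      have h5 := le_abs_self (zdot ξ (zvec ξ))
      have h6 := norm_nonneg (zvec ξ)
      by_contra hc
      push Not at hc
      have := jb_pos ξ
      nlinarith
    have h3 := hcv Λ X
    have h4 := hcv1 Λ (S.pf n u t)
    have h5 : C2 * Ns Λ s X ≤ C2 * (P * Ns Λ (s + 1) (S.pf n u t)) := by gcongr
    have h6 : (2 * Real.pi) ^ 2 * Ns Λ (s + 1) (S.cv Λ (S.pf n u t)) ≤ (2 * Real.pi) ^ 2 * (C3 * Ns Λ (s + 1) (S.pf n u t)) := by gcongr
    rw [add_zero, one_pow, one_mul] at h1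
    linarith
  rw [e1]
  refine (Ns_sub_le _ _ _ _).trans ?_
  have h7 : Ns Λ s (fun ξ => S.τ n (z ξ)) = Ns Λ s z := by
    unfold Ns; exact Finset.sum_congr rfl fun ξ _ => by rw [S.norm_τ, hn, one_mul]
  rw [h7]
  linarith

theorem Sys.E4j (j : ℕ) : ∀ s, ∃ C : ℝ, 0 < C ∧ ∀ n Λ u, ‖n‖ = 1 → S.Sol n Λ u → ∀ t,
    Ns Λ s (S.pf n (fun ξ => iteratedDeriv j (u ξ)) t) ≤ C * Ns Λ (s + j) (S.pf n u t) := by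
  induction j with
  | zero => exact fun s => ⟨1, one_pos, fun n Λ u hn h t => by simp⟩
  | succ j ih =>
    intro s
    obtain ⟨C1, hC1, h1⟩ := S.E4 s
    obtain ⟨C2, hC2, h2⟩ := ih (s + 1)
    refine ⟨C1 * C2, by positivity, fun n Λ u hn h t => ?_⟩
    have h3 := h1 n Λ _ hn (h.iter S j) t
    simp only [iteratedDeriv_succ]
    refine h3.trans ?_
    rw [mul_assoc, show s + (j + 1) = s + 1 + j by ring]
    gcongr
    exact h2 n Λ u hn h t

theorem Sys.E5 (s : ℕ) : ∃ C : ℝ, 0 < C ∧ ∀ n Λ u L, ‖n‖ = 1 → S.Sol n Λ u → ∀ t, t + 1 ≤ L →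
    Ns Λ s (S.pf n u t) ≤ C * S.Fs n Λ L u (s + 1) t := by
  obtain ⟨C1, hC1, h1⟩ := S.E4 s
  refine ⟨2 + C1, by positivity, fun n Λ u L hn h t ht => ?_⟩
  set N' : ℝ → ℝ := fun τ => ∑ ξ ∈ Λ, jb ξ ^ (2 * s) * (2 * (inner ℂ (S.pf n u τ ξ) (S.pf n (fun ξ => deriv (u ξ)) τ ξ) : ℂ).re) with hN'
  have hNd : ∀ τ, HasDerivAt (fun τ => Ns Λ s (S.pf n u τ)) (N' τ) τ := fun τ => by
    unfold Ns
    refine HasDerivAt.fun_sum fun ξ _ => HasDerivAt.const_mul _ ?_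
    have hp := S.pf_hasDerivAt n ξ (h.smooth ξ) τ
    have h2 := Complex.reCLM.hasFDerivAt.comp_hasDerivAt τ (hp.inner ℂ hp)
    have e : (fun τ => ‖S.pf n u τ ξ‖ ^ 2) = Complex.reCLM ∘ fun τ => inner ℂ (S.pf n u τ ξ) (S.pf n u τ ξ) := by
      ext τ
      simp only [Function.comp, Complex.reCLM_apply]
      exact (inner_self_eq_norm_sq (𝕜 := ℂ) _).symm
    rw [e]
    refine h2.congr_deriv ?_
    rw [Complex.reCLM_apply, Complex.add_re]
    have : (inner ℂ (S.pf n (fun ξ => deriv (u ξ)) τ ξ) (S.pf n u τ ξ) : ℂ).re = (inner ℂ (S.pf n u τ ξ) (S.pf n (fun ξ => deriv (u ξ)) τ ξ) : ℂ).re :=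
      inner_re_symm (𝕜 := ℂ) _ _
    rw [this]; ring
  have hN'b : ∀ τ, |N' τ| ≤ (1 + C1) * Ns Λ (s + 1) (S.pf n u τ) := fun τ => by
    have h3 := h1 n Λ u hn h τ
    have h4 := Ns_mono Λ (Nat.le_succ s) (S.pf n u τ)
    have h5 : |N' τ| ≤ Ns Λ s (S.pf n u τ) + Ns Λ s (S.pf n (fun ξ => deriv (u ξ)) τ) := by
      unfold Ns
      rw [← Finset.sum_add_distrib]
      refine (Finset.abs_sum_le_sum_abs _ _).trans (Finset.sum_le_sum fun ξ _ => ?_)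
      have := jb_pos ξ
      rw [abs_mul, abs_of_pos (by positivity), ← mul_add, abs_mul, abs_two]
      gcongr
      have h6 := (Complex.abs_re_le_norm _).trans (norm_inner_le_norm (𝕜 := ℂ) (S.pf n u τ ξ) (S.pf n (fun ξ => deriv (u ξ)) τ ξ))
      nlinarith [sq_nonneg (‖S.pf n u τ ξ‖ - ‖S.pf n (fun ξ => deriv (u ξ)) τ ξ‖)]
    linarith
  have hN'c : Continuous N' := by
    refine continuous_finsetSum _ fun ξ _ => continuous_const.mul (continuous_const.mul (Complex.continuous_re.comp ?_))
    exact (continuous_iff_continuousAt.2 fun t => (S.pf_hasDerivAt n ξ (h.smooth ξ) t).continuousAt).inner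
      (continuous_iff_continuousAt.2 fun t => (S.pf_hasDerivAt n ξ (smooth_deriv (h.smooth ξ)) t).continuousAt)
  have hNc := S.Ns_cont (n := n) h.smooth Λ s
  have hHd : ∀ τ, HasDerivAt (fun τ => (1 - (τ - t)) * Ns Λ s (S.pf n u τ))
      ((-1) * Ns Λ s (S.pf n u τ) + (1 - (τ - t)) * N' τ) τ := fun τ => by
    have := (((hasDerivAt_id τ).sub_const t).const_sub 1).mul (hNd τ)
    exact this
  have hHc : Continuous fun τ => ((-1) * Ns Λ s (S.pf n u τ) + (1 - (τ - t)) * N' τ) := by fun_prop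
  have hI := intervalIntegral.integral_eq_sub_of_hasDerivAt (a := t) (b := t + 1) (fun x _ => hHd x) (hHc.intervalIntegrable _ _)
  have hI2 : ∫ τ in t..(t+1), -((-1) * Ns Λ s (S.pf n u τ) + (1 - (τ - t)) * N' τ) ≤
      ∫ τ in t..(t+1), (2 + C1) * Ns Λ (s + 1) (S.pf n u τ) := by
    refine intervalIntegral.integral_mono_on (by linarith) (hHc.neg.intervalIntegrable _ _)
      ((continuous_const.mul (S.Ns_cont h.smooth Λ (s + 1))).intervalIntegrable _ _) fun τ hτ => ?_
    have h3 := hN'b τ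
    have h4 := Ns_mono Λ (Nat.le_succ s) (S.pf n u τ)
    have h5 : -((1 - (τ - t)) * N' τ) ≤ |N' τ| := by
      refine (neg_le_abs _).trans ?_
      rw [abs_mul, abs_of_nonneg (by linarith [hτ.2])]
      exact mul_le_of_le_one_left (abs_nonneg _) (by linarith [hτ.1])
    linarith
  rw [intervalIntegral.integral_neg, hI, intervalIntegral.integral_const_mul] at hI2
  have h6 := (S.Fs_anti (n := n) h.smooth Λ (s + 1) (show t ≤ t + 1 by linarith) ht).1
  have h7 : (2 + C1) * ∫ τ in t..(t+1), Ns Λ (s + 1) (S.pf n u τ) ≤ (2 + C1) * S.Fs n Λ L u (s + 1) t := by gcongr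
  simp at hI2
  linarith

/-- main pointwise estimate for Galerkin solutions -/
theorem Sys.GS.main (s j ℓ : ℕ) : ∃ C : ℝ, 0 < C ∧ ∀ n κ f Λ L u, S.GS n κ f Λ L u → ∀ t, 0 ≤ t → t + 1 ≤ L →
    (1 + κ * t) ^ ℓ * Ns Λ s (S.pf n (fun ξ => iteratedDeriv j (u ξ)) t) ≤ C * Ns Λ (s + j + ℓ + 2) f := by
  obtain ⟨C1, hC1, h1⟩ := S.E4j j s
  obtain ⟨C2, hC2, h2⟩ := S.E5 (s + j)
  obtain ⟨C3, hC3, h3⟩ := Sys.GS.E3 S ℓ (s + j + 1)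
  obtain ⟨C4, hC4, h4⟩ := Sys.GS.E3 S 0 (s + j + 1)
  refine ⟨2 ^ ℓ * (C1 * C2 * (C4 + C3)), by positivity, fun n κ f Λ L u h t ht htL => ?_⟩
  have hκ := h.κpos
  have hx : 0 ≤ κ * t := by positivity
  have h5 : (1 + κ * t) ^ ℓ ≤ 2 ^ ℓ * (1 + (κ * t) ^ ℓ) := by
    have : (1 + κ * t) ≤ 2 * max 1 (κ * t) := by
      have := le_max_left 1 (κ * t); have := le_max_right 1 (κ * t); linarith
    refine (pow_le_pow_left₀ (by positivity) this ℓ).trans ?_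
    rw [mul_pow]
    gcongr
    rcases max_choice 1 (κ * t) with h | h <;> rw [h]
    · rw [one_pow]; have : 0 ≤ (κ * t) ^ ℓ := by positivity
      linarith
    · linarith
  have h6 : Ns Λ s (S.pf n (fun ξ => iteratedDeriv j (u ξ)) t) ≤ C1 * (C2 * S.Fs n Λ L u (s + j + 1) t) := by
    refine (h1 n Λ u h.hn h.sol t).trans ?_
    gcongr
    exact h2 n Λ u L h.hn h.sol t htL
  have hF0 := S.Fs_nonneg n u Λ (s + j + 1) (show t ≤ L by linarith)
  have h7 := h3 n κ f Λ L u h t ht (by linarith)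
  have h8 := h4 n κ f Λ L u h t ht (by linarith)
  rw [pow_zero, one_mul] at h8
  have h9 := Ns_mono Λ (show s + j + 1 + 0 + 1 ≤ s + j + ℓ + 2 by omega) f
  rw [show s + j + 1 + ℓ + 1 = s + j + ℓ + 2 by ring] at h7
  have h10 : C4 * Ns Λ (s + j + 1 + 0 + 1) f ≤ C4 * Ns Λ (s + j + ℓ + 2) f := by gcongr
  have hN0 := Ns_nonneg Λ s (S.pf n (fun ξ => iteratedDeriv j (u ξ)) t)
  calc (1 + κ * t) ^ ℓ * Ns Λ s (S.pf n (fun ξ => iteratedDeriv j (u ξ)) t)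
      ≤ (2 ^ ℓ * (1 + (κ * t) ^ ℓ)) * (C1 * (C2 * S.Fs n Λ L u (s + j + 1) t)) := by gcongr
    _ = 2 ^ ℓ * (C1 * C2 * (S.Fs n Λ L u (s + j + 1) t + (κ * t) ^ ℓ * S.Fs n Λ L u (s + j + 1) t)) := by ring
    _ ≤ 2 ^ ℓ * (C1 * C2 * (C4 * Ns Λ (s + j + ℓ + 2) f + C3 * Ns Λ (s + j + ℓ + 2) f)) := by
        gcongr; exact h8.trans h10
    _ = _ := by ring

/-- main integrated estimate -/
theorem Sys.GS.mainI (s j : ℕ) : ∃ C : ℝ, 0 < C ∧ ∀ n κ f Λ L u, S.GS n κ f Λ L u → ∀ t, 0 ≤ t → t ≤ L →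
    ∫ τ in (0:ℝ)..t, Ns Λ s (S.pf n (fun ξ => iteratedDeriv j (u ξ)) τ) ≤ C * Ns Λ (s + j + 1) f := by
  obtain ⟨C1, hC1, h1⟩ := S.E4j j s
  obtain ⟨C2, hC2, h2⟩ := Sys.GS.E1 S (s + j)
  refine ⟨C1 * C2, by positivity, fun n κ f Λ L u h t ht htL => ?_⟩
  have h3 : ∫ τ in (0:ℝ)..t, Ns Λ s (S.pf n (fun ξ => iteratedDeriv j (u ξ)) τ) ≤ ∫ τ in (0:ℝ)..t, C1 * Ns Λ (s + j) (S.pf n u τ) :=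
    intervalIntegral.integral_mono_on ht ((S.Ns_cont (h.sol.iter S j).smooth Λ s).intervalIntegrable _ _)
      ((continuous_const.mul (S.Ns_cont h.sol.smooth Λ (s + j))).intervalIntegrable _ _) fun τ _ => h1 n Λ u h.hn h.sol τ
  rw [intervalIntegral.integral_const_mul] at h3
  refine h3.trans ?_
  rw [mul_assoc]
  gcongr
  exact (S.Fs_anti h.sol.smooth Λ (s + j) ht htL).1.trans (h2 n κ f Λ L u h)
end

end

section
open scoped Pointwise
set_option linter.all false

/-- Taylor bound -/
theorem taylor_bd {F : Type*} [NormedAddCommGroup F] [NormedSpace ℝ F] {f f' : ℝ → F} {T B : ℝ}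
    (hf : ∀ x, HasDerivAt f (f' x) x)
    (hl : ∀ x ∈ Set.Icc 0 T, ∀ y ∈ Set.Icc 0 T, ‖f' x - f' y‖ ≤ B * |x - y|)
    {s t : ℝ} (hs : s ∈ Set.Icc 0 T) (ht : t ∈ Set.Icc 0 T) :
    ‖f s - f t - (s - t) • f' t‖ ≤ B * |s - t| ^ 2 := by
  have hd : ∀ x ∈ Set.uIcc t s, HasDerivWithinAt (fun x => f x - x • f' t) (f' x - f' t) (Set.uIcc t s) x := fun x _ => by
    have := (hf x).sub ((hasDerivAt_id x).smul_const (f' t))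
    rw [one_smul] at this
    exact this.hasDerivWithinAt
  have hB : ∀ x ∈ Set.uIcc t s, ‖f' x - f' t‖ ≤ B * |s - t| := fun x hx => by
    have hx' : x ∈ Set.Icc 0 T := Set.uIcc_subset_Icc ht hs hx
    have hxt : |x - t| ≤ |s - t| := Set.abs_sub_left_of_mem_uIcc hx
    by_cases h0 : x = t
    · subst h0
      have := hl x hx' s hs
      rw [sub_self, norm_zero]
      rw [abs_sub_comm]
      exact (norm_nonneg _).trans this
    · have h1 := hl x hx' t ht
      have h2 : 0 < |x - t| := abs_pos.2 (sub_ne_zero.2 h0)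
      have hB0 : 0 ≤ B := by
        by_contra hc
        push Not at hc
        have := norm_nonneg (f' x - f' t)
        nlinarith
      exact h1.trans (by gcongr)
  have := (convex_uIcc t s).norm_image_sub_le_of_norm_hasDerivWithin_le hd hB Set.left_mem_uIcc Set.right_mem_uIcc
  rw [Real.norm_eq_abs] at this
  calc _ = ‖f s - s • f' t - (f t - t • f' t)‖ := by congr 1; rw [sub_smul]; abel
    _ ≤ _ := this
    _ = _ := by ring

/-- limits of derivatives -/
theorem lim_deriv {ι F : Type*} [NormedAddCommGroup F] [NormedSpace ℝ F] (𝒰 : Filter ι) [𝒰.NeBot]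
    {f f' : ι → ℝ → F} {g g' : ℝ → F}
    (hf : ∀ R x, HasDerivAt (f R) (f' R x) x)
    (hl : ∀ T, ∃ B, ∀ᶠ R in 𝒰, ∀ x ∈ Set.Icc 0 T, ∀ y ∈ Set.Icc 0 T, ‖f' R x - f' R y‖ ≤ B * |x - y|)
    (hg : ∀ t, 0 ≤ t → Filter.Tendsto (fun R => f R t) 𝒰 (𝓝 (g t)))
    (hg' : ∀ t, 0 ≤ t → Filter.Tendsto (fun R => f' R t) 𝒰 (𝓝 (g' t))) (t : ℝ) (ht : 0 ≤ t) :
    HasDerivWithinAt g (g' t) (Set.Ici 0) t := by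
  obtain ⟨B, hB⟩ := hl (t + 1)
  have key : ∀ s ∈ Set.Icc 0 (t + 1), ‖g s - g t - (s - t) • g' t‖ ≤ B * |s - t| ^ 2 := fun s hs => by
    refine le_of_tendsto (((hg s hs.1).sub (hg t ht)).sub ((hg' t ht).const_smul (s - t))).norm ?_
    filter_upwards [hB] with R hR
    exact taylor_bd (hf R) hR hs ⟨ht, by linarith⟩
  rw [hasDerivWithinAt_iff_isLittleO]
  have h1 : (fun s => g s - g t - (s - t) • g' t) =O[𝓝[Set.Ici 0] t] fun s => (s - t) ^ 2 := by
    refine Asymptotics.IsBigO.of_bound B ?_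
    have : Set.Iio (t + 1) ∈ 𝓝[Set.Ici 0] t := mem_nhdsWithin_of_mem_nhds (Iio_mem_nhds (by linarith))
    filter_upwards [this, self_mem_nhdsWithin] with s hs1 hs2
    have := key s ⟨hs2, (Set.mem_Iio.1 hs1).le⟩
    rwa [Real.norm_eq_abs, abs_pow]
  refine h1.trans_isLittleO ?_
  have h2 : (fun s : ℝ => (s - t) ^ 2) =o[𝓝 t] fun s => s - t := by
    have := (Asymptotics.isLittleO_pow_id (𝕜 := ℝ) (n := 2) (by norm_num))
    have h3 : Filter.Tendsto (fun s : ℝ => s - t) (𝓝 t) (𝓝 0) := by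
      have : Continuous fun s : ℝ => s - t := by fun_prop
      simpa using this.tendsto t
    exact this.comp_tendsto h3
  exact h2.mono nhdsWithin_le_nhds

theorem ultra_lim {ι F : Type*} [NormedAddCommGroup F] [ProperSpace F] (𝒰 : Ultrafilter ι)
    {f : ι → F} {B : ℝ} (h : ∀ᶠ R in (𝒰 : Filter ι), ‖f R‖ ≤ B) : ∃ x, Filter.Tendsto f 𝒰 (𝓝 x) := by
  obtain ⟨x, _, hx⟩ := (isCompact_closedBall (0 : F) B).ultrafilter_le_nhds' (𝒰.map f) (by
    show ∀ᶠ R in (𝒰 : Filter ι), f R ∈ Metric.closedBall 0 B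
    simpa using h)
  exact ⟨x, hx⟩

/-- limits of a jet of functions -/
theorem jet_lim {ι F : Type*} [NormedAddCommGroup F] [NormedSpace ℝ F] [ProperSpace F] (𝒰 : Ultrafilter ι)
    {f : ι → ℕ → ℝ → F} (hf : ∀ R j x, HasDerivAt (f R j) (f R (j + 1) x) x)
    (hb : ∀ j T, ∃ B, ∀ᶠ R in (𝒰 : Filter ι), ∀ t ∈ Set.Icc 0 T, ‖f R j t‖ ≤ B) :
    ∃ G : ℕ → ℝ → F, (∀ j t, 0 ≤ t → Filter.Tendsto (fun R => f R j t) 𝒰 (𝓝 (G j t))) ∧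
      ∀ j t, 0 ≤ t → HasDerivWithinAt (G j) (G (j + 1) t) (Set.Ici 0) t := by
  have h1 : ∀ j t, ∃ x, 0 ≤ t → Filter.Tendsto (fun R => f R j t) 𝒰 (𝓝 x) := fun j t => by
    by_cases ht : 0 ≤ t
    · obtain ⟨B, hB⟩ := hb j t
      obtain ⟨x, hx⟩ := ultra_lim 𝒰 (f := fun R => f R j t) (hB.mono fun R h => h t ⟨ht, le_rfl⟩)
      exact ⟨x, fun _ => hx⟩
    · exact ⟨0, fun h => absurd h ht⟩
  choose G hG using h1
  refine ⟨G, hG, fun j t ht => ?_⟩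
  refine lim_deriv (𝒰 : Filter ι) (fun R => hf R j) (fun T => ?_) (hG j) (hG (j + 1)) t ht
  obtain ⟨B, hB⟩ := hb (j + 2) T
  refine ⟨B, hB.mono fun R h x hx y hy => ?_⟩
  rw [← Real.norm_eq_abs]
  exact (convex_Icc 0 T).norm_image_sub_le_of_norm_hasDerivWithin_le
    (fun z _ => (hf R (j + 1) z).hasDerivWithinAt) (fun z hz => h z hz) hy hx

section
variable {d : ℕ} {W E : Type} [NormedAddCommGroup W] [InnerProductSpace ℂ W] [FiniteDimensional ℂ W]
    [NormedAddCommGroup E] [InnerProductSpace ℂ E] [FiniteDimensional ℂ E] (S : Sys d W E)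

/-- constants -/
def Sys.Cm (s j ℓ : ℕ) : ℝ := Classical.choose (Sys.GS.main S s j ℓ)
theorem Sys.Cm_pos (s j ℓ : ℕ) : 0 < S.Cm s j ℓ := (Classical.choose_spec (Sys.GS.main S s j ℓ)).1
theorem Sys.Cm_spec (s j ℓ : ℕ) : ∀ n κ f Λ L u, S.GS n κ f Λ L u → ∀ t, 0 ≤ t → t + 1 ≤ L →
    (1 + κ * t) ^ ℓ * Ns Λ s (S.pf n (fun ξ => iteratedDeriv j (u ξ)) t) ≤ S.Cm s j ℓ * Ns Λ (s + j + ℓ + 2) f :=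
  (Classical.choose_spec (Sys.GS.main S s j ℓ)).2
/-- constants -/
def Sys.Ci (s j : ℕ) : ℝ := Classical.choose (Sys.GS.mainI S s j)
theorem Sys.Ci_pos (s j : ℕ) : 0 < S.Ci s j := (Classical.choose_spec (Sys.GS.mainI S s j)).1
theorem Sys.Ci_spec (s j : ℕ) : ∀ n κ f Λ L u, S.GS n κ f Λ L u → ∀ t, 0 ≤ t → t ≤ L →
    ∫ τ in (0:ℝ)..t, Ns Λ s (S.pf n (fun ξ => iteratedDeriv j (u ξ)) τ) ≤ S.Ci s j * Ns Λ (s + j + 1) f :=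
  (Classical.choose_spec (Sys.GS.mainI S s j)).2

theorem Sys.K_summable (ξ : Fin d → ℤ) : Summable fun η => ‖S.K (ξ - η)‖ := by
  obtain ⟨C, hC⟩ := S.decay (2 * d)
  have h1 : Summable fun ζ => ‖S.K ζ‖ := summable_of_rapid (b := fun ζ => S.K ζ) hC
  exact h1.comp_injective (sub_right_injective)

theorem le_Ns {F : Type*} [NormedAddCommGroup F] {Λ : Finset (Fin d → ℤ)} {ξ} (h : ξ ∈ Λ) (s : ℕ)
    (p : (Fin d → ℤ) → F) : jb ξ ^ (2 * s) * ‖p ξ‖ ^ 2 ≤ Ns Λ s p :=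
  Finset.single_le_sum (f := fun ξ => jb ξ ^ (2 * s) * ‖p ξ‖ ^ 2) (fun ξ _ => by have := jb_pos ξ; positivity) h
end

end

section
open scoped Pointwise
set_option linter.all false

section
variable {d : ℕ} {W E : Type} [NormedAddCommGroup W] [InnerProductSpace ℂ W] [FiniteDimensional ℂ W]
    [NormedAddCommGroup E] [InnerProductSpace ℂ E] [FiniteDimensional ℂ E] (S : Sys d W E)

theorem Ns_subset {F : Type*} [NormedAddCommGroup F] {Λ Λ' : Finset (Fin d → ℤ)} (h : Λ ⊆ Λ') (s : ℕ)
    (p : (Fin d → ℤ) → F) : Ns Λ s p ≤ Ns Λ' s p :=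
  Finset.sum_le_sum_of_subset_of_nonneg h fun ξ _ _ => by have := jb_pos ξ; positivity

/-- gradient of a jet -/
def Sys.pj (n : Euc d) (G : ℕ → (Fin d → ℤ) → ℝ → W) (j : ℕ) (t : ℝ) (ξ : Fin d → ℤ) : E :=
  S.pv n ξ (G j ξ t) (G (j + 1) ξ t)

/-- limit solutions -/
structure Sys.LS (n : Euc d) (κ : ℝ) (f : (Fin d → ℤ) → ℝ) (g : (Fin d → ℤ) → W)
    (G : ℕ → (Fin d → ℤ) → ℝ → W) : Prop where
  hn : ‖n‖ = 1
  κpos : 0 < κ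
  dio : ∀ ξ, ξ ≠ 0 → κ ≤ jb ξ ^ 2 * ‖perp n ξ‖
  hf : ∀ s, ∃ B, ∀ Λ, Ns Λ s f ≤ B
  der : ∀ ξ j t, 0 ≤ t → HasDerivWithinAt (G j ξ) (G (j + 1) ξ t) (Set.Ici 0) t
  bd : ∀ s j ℓ B, (∀ Λ, Ns Λ (s + j + ℓ + 2) f ≤ B) → ∀ Λ t, 0 ≤ t →
    (1 + κ * t) ^ ℓ * Ns Λ s (S.pj n G j t) ≤ S.Cm s j ℓ * B
  bi : ∀ s j B, (∀ Λ, Ns Λ (s + j + 1) f ≤ B) → ∀ Λ t, 0 ≤ t →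
    ∫ τ in (0:ℝ)..t, Ns Λ s (S.pj n G j τ) ≤ S.Ci s j * B
  eqn : ∀ ξ t, 0 ≤ t → S.τa n (∑' η, S.K (ξ - η) (S.pj n G 1 t η)) =
    tpi • S.τa (zvec ξ) (∑' η, S.K (ξ - η) (S.pj n G 0 t η))
  bc : ∀ ξ, S.τa n (∑' η, S.K (ξ - η) (S.pj n G 0 0 η)) = g ξ
  G00 : G 0 0 0 = 0

theorem smooth_iter {F : Type*} [NormedAddCommGroup F] [NormedSpace ℝ F] {f : ℝ → F}
    (h : ContDiff ℝ (⊤ : ℕ∞) f) (j : ℕ) : ContDiff ℝ (⊤ : ℕ∞) (iteratedDeriv j f) := by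
  induction j with
  | zero => simpa using h
  | succ j ih => rw [iteratedDeriv_succ]; exact smooth_deriv ih

theorem Sys.pv_cont (n : Euc d) (ξ : Fin d → ℤ) : Continuous fun x : W × W => S.pv n ξ x.1 x.2 := by
  unfold Sys.pv
  have h1 := (S.τ (zvec ξ)).continuous
  have h2 := (S.τ n).continuous
  fun_prop

/-- existence of limit solutions -/
theorem Sys.limit (n : Euc d) (hn : ‖n‖ = 1) (κ : ℝ) (κpos : 0 < κ)
    (dio : ∀ ξ, ξ ≠ 0 → κ ≤ jb ξ ^ 2 * ‖perp n ξ‖) (f : (Fin d → ℤ) → ℝ) (f0 : ∀ ξ, 0 ≤ f ξ)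
    (hf : ∀ s, ∃ B, ∀ Λ, Ns Λ s f ≤ B) (g : (Fin d → ℤ) → W) (g0 : g 0 = 0)
    (hg : ∀ ξ, ‖g ξ‖ ≤ 2 * Real.pi * ‖perp n ξ‖ * f ξ) : ∃ G, S.LS n κ f g G := by
  haveI : ProperSpace W := FiniteDimensional.proper ℂ W
  haveI : ProperSpace E := FiniteDimensional.proper ℂ E
  have hp : ∀ ξ, ξ ≠ 0 → perp n ξ ≠ 0 := fun ξ hξ h => by
    have := dio ξ hξ
    rw [h, norm_zero, mul_zero] at this
    linarith
  have hex := fun R : Finset (Fin d → ℤ) × ℕ => S.galerkin n hn hp (insert 0 R.1) (Finset.mem_insert_self _ _)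
    ((R.2 : ℝ) + 1) (by positivity) g g0
  choose u hu using hex
  have hGS : ∀ R : Finset (Fin d → ℤ) × ℕ, S.GS n κ f (insert 0 R.1) ((R.2 : ℝ) + 1) (u R) := fun R =>
    ⟨hn, κpos, dio, f0, by simp, Finset.mem_insert_self _ _, (hu R).1,
      fun ξ hξ => by rw [(hu R).2.1 ξ hξ]; exact hg ξ, (hu R).2.2.1, (hu R).2.2.2⟩
  set 𝒰 : Ultrafilter (Finset (Fin d → ℤ) × ℕ) := Ultrafilter.of Filter.atTop with h𝒰
  have hle : (𝒰 : Filter (Finset (Fin d → ℤ) × ℕ)) ≤ Filter.atTop := Ultrafilter.of_le _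
  have evΛ : ∀ Λ : Finset (Fin d → ℤ), ∀ T : ℝ, ∀ᶠ R in (𝒰 : Filter (Finset (Fin d → ℤ) × ℕ)), Λ ⊆ R.1 ∧ T ≤ R.2 := fun Λ T => by
    refine hle ?_
    filter_upwards [Filter.eventually_ge_atTop ((Λ, ⌈T⌉₊) : Finset (Fin d → ℤ) × ℕ)] with R hR
    exact ⟨hR.1, (Nat.le_ceil T).trans (by exact_mod_cast hR.2)⟩
  choose Bf hBf using hf
  have hBf0 : ∀ s, 0 ≤ Bf s := fun s => (Ns_nonneg ∅ s f).trans (hBf s ∅)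
  -- uniform bound on p
  set Pb : ℕ → ℝ := fun j => Real.sqrt (S.Cm 0 j 0 * Bf (j + 2)) with hPb
  have hpb : ∀ (R : Finset (Fin d → ℤ) × ℕ) (j : ℕ) (t : ℝ), 0 ≤ t → t ≤ R.2 → ∀ ξ ∈ insert 0 R.1,
      ‖S.pf n (fun ξ => iteratedDeriv j (u R ξ)) t ξ‖ ≤ Pb j := fun R j t ht htR ξ hξ => by
    refine Real.le_sqrt_of_sq_le ?_
    have h1 := S.Cm_spec 0 j 0 n κ f _ _ _ (hGS R) t ht (by linarith)
    have h2 := le_Ns hξ 0 (S.pf n (fun ξ => iteratedDeriv j (u R ξ)) t)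
    simp only [pow_zero, one_mul, mul_zero, zero_add, add_zero] at h1 h2
    refine (h2.trans h1).trans ?_
    have := S.Cm_pos 0 j 0
    gcongr
    exact hBf _ _
  have hub : ∀ ξ j T, ∃ B, ∀ᶠ R in (𝒰 : Filter (Finset (Fin d → ℤ) × ℕ)), ∀ t ∈ Set.Icc 0 T, ‖iteratedDeriv j (u R ξ) t‖ ≤ B := by
    intro ξ j T
    by_cases hξ : ξ = 0
    · subst hξ
      have hz : ∀ (R : Finset (Fin d → ℤ) × ℕ) (j : ℕ) (t : ℝ), 0 ≤ t → t ≤ R.2 → ‖iteratedDeriv (j + 1) (u R 0) t‖ ≤ Pb j := fun R j t ht htR => by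
        have h1 := hpb R j t ht htR 0 (Finset.mem_insert_self _ _)
        have h2 := S.pv_norm2 n hn 0 (iteratedDeriv j (u R 0) t) (deriv (iteratedDeriv j (u R 0)) t)
        rw [zdot_zero_left, Complex.ofReal_zero, mul_zero, zero_smul, sub_zero] at h2
        rw [iteratedDeriv_succ]
        exact h2.trans h1
      rcases j with _ | j
      · refine ⟨Pb 0 * T, (evΛ ∅ T).mono fun R hR t ht => ?_⟩
        have h3 := (convex_Icc 0 T).norm_image_sub_le_of_norm_hasDerivWithin_le (f := u R 0) (f' := deriv (u R 0)) (C := Pb 0)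
          (fun z _ => (smooth_hasDerivAt ((hGS R).sol.smooth 0) z).hasDerivWithinAt)
          (fun z hz' => by
            have := hz R 0 z hz'.1 (hz'.2.trans hR.2)
            rwa [zero_add, iteratedDeriv_one] at this)
          (⟨le_rfl, ht.1.trans ht.2⟩ : (0:ℝ) ∈ Set.Icc 0 T) ht
        rw [(hGS R).u00, sub_zero, sub_zero, Real.norm_eq_abs, abs_of_nonneg ht.1] at h3
        rw [iteratedDeriv_zero]
        refine h3.trans ?_
        gcongr
        exact ht.2
      · exact ⟨Pb j, (evΛ ∅ T).mono fun R hR t ht => hz R j t ht.1 (ht.2.trans hR.2)⟩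
    · refine ⟨(jb ξ ^ 2 * Pb j) / κ, (evΛ {ξ} T).mono fun R hR t ht => ?_⟩
      have h1 := hpb R j t ht.1 (ht.2.trans hR.2) ξ (Finset.mem_insert_of_mem (hR.1 (Finset.mem_singleton_self _)))
      have h2 := (hGS R).u_le S ξ hξ (iteratedDeriv j (u R ξ) t) (deriv (iteratedDeriv j (u R ξ)) t)
      rw [le_div_iff₀ κpos, mul_comm]
      refine h2.trans ?_
      have := jb_pos ξ
      gcongr
      exact h1
  have hjet := fun ξ => jet_lim 𝒰 (f := fun R j => iteratedDeriv j (u R ξ))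
    (fun R j x => by
      have := smooth_hasDerivAt (smooth_iter ((hGS R).sol.smooth ξ) j) x
      rwa [← iteratedDeriv_succ] at this) (hub ξ)
  choose G hG using hjet
  have hGt : ∀ ξ j t, 0 ≤ t → Filter.Tendsto (fun R => iteratedDeriv j (u R ξ) t) 𝒰 (𝓝 (G ξ j t)) := fun ξ => (hG ξ).1
  have hpt : ∀ ξ j t, 0 ≤ t → Filter.Tendsto (fun R => S.pf n (fun ξ => iteratedDeriv j (u R ξ)) t ξ) 𝒰
      (𝓝 (S.pj n (fun j ξ => G ξ j) j t ξ)) := fun ξ j t ht => by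
    have h1 := (hGt ξ j t ht).prodMk_nhds (hGt ξ (j + 1) t ht)
    have h2 := ((S.pv_cont n ξ).tendsto _).comp h1
    refine h2.congr fun R => ?_
    simp only [Function.comp, iteratedDeriv_succ]
    rfl
  have hNt : ∀ Λ s j t, 0 ≤ t → Filter.Tendsto (fun R => Ns Λ s (S.pf n (fun ξ => iteratedDeriv j (u R ξ)) t)) 𝒰
      (𝓝 (Ns Λ s (S.pj n (fun j ξ => G ξ j) j t))) := fun Λ s j t ht =>
    tendsto_finsetSum _ fun ξ _ => ((hpt ξ j t ht).norm.pow 2).const_mul _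
  have hcv : ∀ ξ j t, 0 ≤ t → Filter.Tendsto (fun R => S.cv (insert 0 R.1) (S.pf n (fun ξ => iteratedDeriv j (u R ξ)) t) ξ) 𝒰
      (𝓝 (∑' η, S.K (ξ - η) (S.pj n (fun j ξ => G ξ j) j t η))) := fun ξ j t ht => by
    classical
    have e : ∀ R : Finset (Fin d → ℤ) × ℕ, S.cv (insert 0 R.1) (S.pf n (fun ξ => iteratedDeriv j (u R ξ)) t) ξ =
        ∑' η, if η ∈ insert 0 R.1 then S.K (ξ - η) (S.pf n (fun ξ => iteratedDeriv j (u R ξ)) t η) else 0 := fun R => by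
      rw [tsum_eq_sum (s := insert 0 R.1) (fun η hη => if_neg hη)]
      exact Finset.sum_congr rfl fun η hη => (if_pos hη).symm
    simp only [e]
    refine tendsto_tsum_of_dominated_convergence (bound := fun η => ‖S.K (ξ - η)‖ * Pb j) ((S.K_summable ξ).mul_right _) (fun η => ?_) ?_
    · have h1 := ((S.K (ξ - η)).continuous.tendsto _).comp (hpt η j t ht)
      refine h1.congr' ?_
      filter_upwards [evΛ {η} 0] with R hR
      rw [if_pos (Finset.mem_insert_of_mem (hR.1 (Finset.mem_singleton_self _)))]
      rfl
    · filter_upwards [evΛ ∅ t] with R hR η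
      split_ifs with hη
      · refine ((S.K (ξ - η)).le_opNorm _).trans ?_
        gcongr
        exact hpb R j t ht hR.2 η hη
      · rw [norm_zero]
        exact mul_nonneg (norm_nonneg _) (Real.sqrt_nonneg _)
  refine ⟨fun j ξ => G ξ j, hn, κpos, dio, fun s => ⟨_, hBf s⟩, fun ξ => (hG ξ).2, ?_, ?_, ?_, ?_, ?_⟩
  · intro s j ℓ B hB Λ t ht
    refine le_of_tendsto ((hNt Λ s j t ht).const_mul ((1 + κ * t) ^ ℓ)) ?_
    filter_upwards [evΛ Λ t] with R hR
    have h1 := S.Cm_spec s j ℓ n κ f _ _ _ (hGS R) t ht (by linarith [hR.2])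
    have h2 := Ns_subset (hR.1.trans (Finset.subset_insert 0 _)) s (S.pf n (fun ξ => iteratedDeriv j (u R ξ)) t)
    have := S.Cm_pos s j ℓ
    calc _ ≤ _ := mul_le_mul_of_nonneg_left h2 (by positivity)
      _ ≤ _ := h1
      _ ≤ _ := by gcongr; exact hB _
  · intro s j B hB Λ t ht
    set Nf : Finset (Fin d → ℤ) × ℕ → ℝ → ℝ := fun R τ => Ns Λ s (S.pf n (fun ξ => iteratedDeriv j (u R ξ)) τ) with hNf
    have hNc : ∀ R, Continuous (Nf R) := fun R => S.Ns_cont ((hGS R).sol.iter S j).smooth Λ s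
    have hIle : ∀ T, 0 ≤ T → ∀ᶠ R in (𝒰 : Filter (Finset (Fin d → ℤ) × ℕ)), ‖∫ τ in (0:ℝ)..T, Nf R τ‖ ≤ S.Ci s j * B := fun T hT => by
      filter_upwards [evΛ Λ T] with R hR
      rw [Real.norm_eq_abs, abs_of_nonneg (intervalIntegral.integral_nonneg hT fun τ _ => Ns_nonneg _ _ _)]
      have h1 := S.Ci_spec s j n κ f _ _ _ (hGS R) T hT (by linarith [hR.2])
      refine (intervalIntegral.integral_mono_on hT ((hNc R).intervalIntegrable _ _)
        ((S.Ns_cont ((hGS R).sol.iter S j).smooth _ s).intervalIntegrable _ _) fun τ _ =>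
          Ns_subset (hR.1.trans (Finset.subset_insert 0 _)) s _).trans (h1.trans ?_)
      have := S.Ci_pos s j
      gcongr
      exact hB _
    have hIl : ∀ T, ∃ x, 0 ≤ T → Filter.Tendsto (fun R => ∫ τ in (0:ℝ)..T, Nf R τ) 𝒰 (𝓝 x) := fun T => by
      by_cases hT : 0 ≤ T
      · obtain ⟨x, hx⟩ := ultra_lim 𝒰 (hIle T hT)
        exact ⟨x, fun _ => hx⟩
      · exact ⟨0, fun h => absurd h hT⟩
    choose H hH using hIl
    have hHd : ∀ T, 0 ≤ T → HasDerivWithinAt H (Ns Λ s (S.pj n (fun j ξ => G ξ j) j T)) (Set.Ici 0) T := by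
      intro T hT
      refine lim_deriv (𝒰 : Filter (Finset (Fin d → ℤ) × ℕ)) (f := fun R T => ∫ τ in (0:ℝ)..T, Nf R τ) (f' := Nf)
        (g' := fun T => Ns Λ s (S.pj n (fun j ξ => G ξ j) j T))
        (fun R x => (hNc R).integral_hasStrictDerivAt 0 x |>.hasDerivAt) (fun T => ?_) hH (hNt Λ s j) T hT
      refine ⟨∑ ξ ∈ Λ, jb ξ ^ (2 * s) * (2 * Pb j * Pb (j + 1)), ?_⟩
      filter_upwards [evΛ Λ T] with R hR x hx y hy
      simp only [hNf]
      unfold Ns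
      rw [← Finset.sum_sub_distrib, Finset.sum_mul]
      refine (norm_sum_le _ _).trans (Finset.sum_le_sum fun ξ hξ => ?_)
      have hξ' : ξ ∈ insert 0 R.1 := Finset.mem_insert_of_mem (hR.1 hξ)
      rw [← mul_sub, norm_mul, Real.norm_of_nonneg (by have := jb_pos ξ; positivity), mul_assoc]
      have := jb_pos ξ
      gcongr
      set P := fun τ => S.pf n (fun ξ => iteratedDeriv j (u R ξ)) τ ξ with hP
      have h1 : ‖P x‖ ≤ Pb j := hpb R j x hx.1 (hx.2.trans hR.2) ξ hξ'
      have h2 : ‖P y‖ ≤ Pb j := hpb R j y hy.1 (hy.2.trans hR.2) ξ hξ'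
      have h3 : ‖P x - P y‖ ≤ Pb (j + 1) * ‖x - y‖ := by
        refine (convex_Icc 0 T).norm_image_sub_le_of_norm_hasDerivWithin_le
          (fun z _ => (S.pf_hasDerivAt n ξ (((hGS R).sol.iter S j).smooth ξ) z).hasDerivWithinAt) (fun z hz => ?_) hy hx
        have := hpb R (j + 1) z hz.1 (hz.2.trans hR.2) ξ hξ'
        simpa only [iteratedDeriv_succ] using this
      have h4 := abs_norm_sub_norm_le (P x) (P y)
      rw [Real.norm_eq_abs] at h3 ⊢
      have e : ‖P x‖ ^ 2 - ‖P y‖ ^ 2 = (‖P x‖ + ‖P y‖) * (‖P x‖ - ‖P y‖) := by ring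
      show |‖P x‖ ^ 2 - ‖P y‖ ^ 2| ≤ _
      rw [e, abs_mul, abs_of_nonneg (by positivity)]
      have hPb0 : 0 ≤ Pb j := Real.sqrt_nonneg _
      calc _ ≤ (Pb j + Pb j) * (Pb (j + 1) * |x - y|) := by gcongr; exact h4.trans h3
        _ = _ := by ring
    have hcont : ContinuousOn (fun τ => Ns Λ s (S.pj n (fun j ξ => G ξ j) j τ)) (Set.Ici 0) := by
      unfold Ns
      refine continuousOn_finsetSum _ fun ξ _ => continuousOn_const.mul (ContinuousOn.pow (ContinuousOn.norm ?_) 2)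
      have h1 : ContinuousOn (G ξ j) (Set.Ici 0) := fun τ hτ => ((hG ξ).2 j τ hτ).continuousWithinAt
      have h2 : ContinuousOn (G ξ (j + 1)) (Set.Ici 0) := fun τ hτ => ((hG ξ).2 (j + 1) τ hτ).continuousWithinAt
      exact (S.pv_cont n ξ).comp_continuousOn (h1.prodMk h2)
    have hsub : Set.uIcc 0 t ⊆ Set.Ici 0 := by
      rw [Set.uIcc_of_le ht]; exact Set.Icc_subset_Ici_self
    have hFTC := intervalIntegral.integral_eq_sub_of_hasDeriv_right (a := 0) (b := t) (f := H)
      (f' := fun τ => Ns Λ s (S.pj n (fun j ξ => G ξ j) j τ))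
      (fun τ hτ => ((hHd τ (hsub hτ)).mono hsub).continuousWithinAt)
      (fun τ hτ => (hHd τ (by rw [min_eq_left ht] at hτ; exact hτ.1.le)).mono (fun z hz => by
        rw [min_eq_left ht] at hτ; exact hτ.1.le.trans (le_of_lt hz)))
      (hcont.mono hsub).intervalIntegrable
    rw [hFTC]
    have hH0 : H 0 = 0 := by
      refine tendsto_nhds_unique (hH 0 le_rfl) ?_
      simp
    rw [hH0, sub_zero]
    refine le_of_tendsto (hH t ht) ((hIle t ht).mono fun R h => (le_abs_self _).trans h)
  · intro ξ t ht
    have h1 := ((S.τa n).continuous.tendsto _).comp (hcv ξ 1 t ht)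
    have h2 := (((S.τa (zvec ξ)).continuous.tendsto _).comp (hcv ξ 0 t ht)).const_smul tpi
    refine tendsto_nhds_unique h1 (h2.congr' ?_)
    filter_upwards [evΛ {ξ} 0] with R hR
    have := (hGS R).sol.eqn' S ξ (Finset.mem_insert_of_mem (hR.1 (Finset.mem_singleton_self _))) t
    unfold Sys.rf at this
    simp only [Function.comp, iteratedDeriv_zero, iteratedDeriv_one]
    exact this.symm
  · intro ξ
    have h1 := ((S.τa n).continuous.tendsto _).comp (hcv ξ 0 0 le_rfl)
    refine tendsto_nhds_unique h1 (tendsto_const_nhds.congr' ?_)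
    filter_upwards [evΛ {ξ} 0] with R hR
    have := (hu R).2.1 ξ (Finset.mem_insert_of_mem (hR.1 (Finset.mem_singleton_self _)))
    unfold Sys.rf at this
    simp only [Function.comp, iteratedDeriv_zero]
    exact this.symm
  · refine tendsto_nhds_unique (hGt 0 0 0 le_rfl) (tendsto_const_nhds.congr fun R => ?_)
    rw [iteratedDeriv_zero, (hGS R).u00]
end

end

section
open scoped Pointwise
set_option linter.all false

/-- decay of a function from decay of its derivative -/
theorem decay_int {F : Type*} [NormedAddCommGroup F] [NormedSpace ℝ F] {h h' : ℝ → F} {κ D : ℝ} (hκ : 0 < κ) (hD : 0 ≤ D)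
    (ℓ : ℕ) (hd : ∀ t, 0 ≤ t → HasDerivWithinAt h (h' t) (Set.Ici 0) t)
    (hb : ∀ t, 0 ≤ t → (1 + κ * t) ^ (ℓ + 2) * ‖h' t‖ ≤ D) {s t : ℝ} (ht : 0 ≤ t) (hs : t ≤ s) :
    κ * ‖h s - h t‖ ≤ D * ((1 + κ * t) ^ (ℓ + 1))⁻¹ := by
  have hp : ∀ x, 0 ≤ x → 0 < 1 + κ * x := fun x hx => by positivity
  have hB : ∀ x, 0 < 1 + κ * x → HasDerivAt (fun x => D / κ * (((1 + κ * t) ^ (ℓ + 1))⁻¹ - ((1 + κ * x) ^ (ℓ + 1))⁻¹))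
      (D * (ℓ + 1) * ((1 + κ * x) ^ (ℓ + 2))⁻¹) x := fun x hx => by
    have h1 : HasDerivAt (fun x => 1 + κ * x) κ x := by
      simpa using ((hasDerivAt_id x).const_mul κ).const_add 1
    have h2 := ((h1.fun_pow (ℓ + 1)).fun_inv (by positivity)).const_sub (((1 + κ * t) ^ (ℓ + 1))⁻¹) |>.const_mul (D / κ)
    refine h2.congr_deriv ?_
    push_cast
    field_simp
    try simp
    try ring
  have key : ∀ x ∈ Set.Icc t s, ‖h x - h t‖ ≤ D / κ * (((1 + κ * t) ^ (ℓ + 1))⁻¹ - ((1 + κ * x) ^ (ℓ + 1))⁻¹) := by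
    refine image_norm_le_of_norm_deriv_right_le_deriv_boundary' (f := fun x => h x - h t) (f' := h')
      (B' := fun x => D * (ℓ + 1) * ((1 + κ * x) ^ (ℓ + 2))⁻¹) ?_ ?_ ?_ ?_ ?_ ?_
    · refine ContinuousOn.sub (fun x hx => ?_) continuousOn_const
      exact ((hd x (ht.trans hx.1)).continuousWithinAt).mono fun y hy => ht.trans hy.1
    · intro x hx
      exact ((hd x (ht.trans hx.1)).mono (fun y hy => (ht.trans hx.1).trans hy)).sub_const _
    · simp
    · exact fun x hx => (hB x (hp x (ht.trans hx.1))).continuousAt.continuousWithinAt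
    · exact fun x hx => (hB x (hp x (ht.trans hx.1))).hasDerivWithinAt
    · intro x hx
      have h0 := hp x (ht.trans hx.1)
      have h1 := hb x (ht.trans hx.1)
      rw [← div_eq_mul_inv, le_div_iff₀ (by positivity), mul_comm]
      refine h1.trans ?_
      have : (0:ℝ) ≤ ℓ := by positivity
      nlinarith
  have h1 := key s ⟨hs, le_rfl⟩
  have h2 : 0 ≤ ((1 + κ * s) ^ (ℓ + 1))⁻¹ := by have := hp s (ht.trans hs); positivity
  calc κ * ‖h s - h t‖ ≤ κ * (D / κ * (((1 + κ * t) ^ (ℓ + 1))⁻¹ - ((1 + κ * s) ^ (ℓ + 1))⁻¹)) := by gcongr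
    _ = D * (((1 + κ * t) ^ (ℓ + 1))⁻¹ - ((1 + κ * s) ^ (ℓ + 1))⁻¹) := by field_simp
    _ ≤ _ := by gcongr; linarith

theorem decay_lim {F : Type*} [NormedAddCommGroup F] [NormedSpace ℝ F] [CompleteSpace F] {h h' : ℝ → F} {κ : ℝ} (hκ : 0 < κ)
    (hd : ∀ t, 0 ≤ t → HasDerivWithinAt h (h' t) (Set.Ici 0) t)
    (hb0 : ∃ D, ∀ t, 0 ≤ t → (1 + κ * t) ^ (0 + 2) * ‖h' t‖ ≤ D) :
    ∃ w, ∀ ℓ D, 0 ≤ D → (∀ t, 0 ≤ t → (1 + κ * t) ^ (ℓ + 2) * ‖h' t‖ ≤ D) →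
      ∀ t, 0 ≤ t → κ * ‖h t - w‖ ≤ D * ((1 + κ * t) ^ (ℓ + 1))⁻¹ := by
  obtain ⟨D, hD⟩ := hb0
  have hD0 : 0 ≤ D := by
    have := hD 0 le_rfl
    simp at this
    exact (norm_nonneg _).trans this
  have hc : CauchySeq fun N : ℕ => h N := by
    have hinv : Filter.Tendsto (fun N : ℕ => 2 * (D / κ * (1 + κ * N)⁻¹)) Filter.atTop (𝓝 0) := by
      have h1 : Filter.Tendsto (fun N : ℕ => 1 + κ * (N:ℝ)) Filter.atTop Filter.atTop :=
        Filter.tendsto_atTop_add_const_left _ _ (tendsto_natCast_atTop_atTop.const_mul_atTop hκ)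
      have := (h1.inv_tendsto_atTop.const_mul (D / κ)).const_mul 2
      simpa using this
    refine cauchySeq_of_le_tendsto_0 _ (fun a b N ha hb => ?_) hinv
    have h1 : ∀ a : ℕ, N ≤ a → ‖h a - h N‖ ≤ D / κ * (1 + κ * N)⁻¹ := fun a ha => by
      have := decay_int hκ hD0 0 hd hD (s := a) (t := N) (by positivity) (by exact_mod_cast ha)
      rw [zero_add, pow_one] at this
      rw [div_mul_eq_mul_div, le_div_iff₀ hκ, mul_comm]; exact this
    rw [dist_eq_norm]
    calc ‖h a - h b‖ = ‖(h a - h N) - (h b - h N)‖ := by congr 1; abel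
      _ ≤ _ := norm_sub_le _ _
      _ ≤ _ := by linarith [h1 a ha, h1 b hb]
  obtain ⟨w, hw⟩ := cauchySeq_tendsto_of_complete hc
  refine ⟨w, fun ℓ D hD0 hD t ht => ?_⟩
  rw [norm_sub_rev]
  refine le_of_tendsto ((hw.sub_const (h t)).norm.const_mul κ) ?_
  filter_upwards [Filter.eventually_ge_atTop ⌈t⌉₊] with N hN
  exact decay_int hκ hD0 ℓ hd hD ht ((Nat.le_ceil t).trans (by exact_mod_cast hN))

section
variable {d : ℕ} {W E : Type} [NormedAddCommGroup W] [InnerProductSpace ℂ W] [FiniteDimensional ℂ W]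
    [NormedAddCommGroup E] [InnerProductSpace ℂ E] [FiniteDimensional ℂ E] (S : Sys d W E)

/-- pointwise bound for the gradient jet -/
theorem Sys.LS.pb {n κ f g G} (h : S.LS n κ f g G) (s j ℓ : ℕ) {B : ℝ} (hB : ∀ Λ, Ns Λ (s + j + 2 * ℓ + 2) f ≤ B)
    (ξ) (t : ℝ) (ht : 0 ≤ t) : (1 + κ * t) ^ ℓ * (jb ξ ^ s * ‖S.pj n G j t ξ‖) ≤ Real.sqrt (S.Cm s j (2 * ℓ) * B) := by
  refine Real.le_sqrt_of_sq_le ?_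
  have h1 := h.bd s j (2 * ℓ) B hB {ξ} t ht
  unfold Ns at h1
  rw [Finset.sum_singleton] at h1
  refine le_trans (le_of_eq ?_) h1
  ring

theorem Sys.LS.ub {n κ f g G} (h : S.LS n κ f g G) (ξ : Fin d → ℤ) (hξ : ξ ≠ 0) (j : ℕ) (t : ℝ) :
    κ * ‖G j ξ t‖ ≤ jb ξ ^ 2 * ‖S.pj n G j t ξ‖ := by
  have h1 := S.pv_norm1 n h.hn ξ (G j ξ t) (G (j + 1) ξ t)
  have h2 := h.dio ξ hξ
  have := jb_pos ξ
  have h3 := Real.pi_gt_three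
  calc κ * ‖G j ξ t‖ ≤ (jb ξ ^ 2 * ‖perp n ξ‖) * ‖G j ξ t‖ := by gcongr
    _ = jb ξ ^ 2 * (1 * ‖perp n ξ‖ * ‖G j ξ t‖) := by ring
    _ ≤ jb ξ ^ 2 * (2 * Real.pi * ‖perp n ξ‖ * ‖G j ξ t‖) := by gcongr; linarith
    _ ≤ _ := by gcongr; exact h1

theorem Sys.LS.u0 {n κ f g G} (h : S.LS n κ f g G) (j : ℕ) (t : ℝ) :
    ‖G (j + 1) 0 t‖ ≤ ‖S.pj n G j t 0‖ := by
  have h2 := S.pv_norm2 n h.hn 0 (G j 0 t) (G (j + 1) 0 t)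
  rw [zdot_zero_left, Complex.ofReal_zero, mul_zero, zero_smul, sub_zero] at h2
  exact h2

theorem Sys.LS.inf {n κ f g G} (h : S.LS n κ f g G) : ∃ w : W, ∀ (ℓ : ℕ) B, (∀ Λ, Ns Λ (0 + 0 + 2 * (ℓ + 2) + 2) f ≤ B) →
    ∀ t, 0 ≤ t → κ * ‖G 0 0 t - w‖ ≤ Real.sqrt (S.Cm 0 0 (2 * (ℓ + 2)) * B) * ((1 + κ * t) ^ (ℓ + 1))⁻¹ := by
  haveI : CompleteSpace W := FiniteDimensional.complete ℂ W
  have hb : ∀ (ℓ : ℕ) B, (∀ Λ, Ns Λ (0 + 0 + 2 * (ℓ + 2) + 2) f ≤ B) → ∀ t, 0 ≤ t → (1 + κ * t) ^ (ℓ + 2) * ‖G 1 0 t‖ ≤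
      Real.sqrt (S.Cm 0 0 (2 * (ℓ + 2)) * B) := fun ℓ B hB t ht => by
    have h1 := h.pb S 0 0 (ℓ + 2) hB 0 t ht
    rw [pow_zero, one_mul] at h1
    refine le_trans ?_ h1
    have := h.κpos
    gcongr
    exact h.u0 S 0 t
  obtain ⟨B, hB⟩ := h.hf (0 + 0 + 2 * (0 + 2) + 2)
  obtain ⟨w, hw⟩ := decay_lim h.κpos (h.der 0 0) ⟨_, hb 0 B hB⟩
  exact ⟨w, fun ℓ B hB t ht => hw ℓ _ (Real.sqrt_nonneg _) (hb ℓ B hB) t ht⟩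

theorem Sys.LS.bdd {n κ f g G} (h : S.LS n κ f g G) (k j : ℕ) : ∃ C, ∀ ξ t, 0 ≤ t → jb ξ ^ k * ‖G j ξ t‖ ≤ C := by
  have hκ := h.κpos
  obtain ⟨B, hB⟩ := h.hf (k + 2 + j + 2 * 0 + 2)
  have h1 : ∀ ξ, ξ ≠ 0 → ∀ t, 0 ≤ t → jb ξ ^ k * ‖G j ξ t‖ ≤ Real.sqrt (S.Cm (k + 2) j (2 * 0) * B) / κ := fun ξ hξ t ht => by
    have h2 := h.pb S (k + 2) j 0 hB ξ t ht
    rw [pow_zero, one_mul] at h2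
    have := jb_pos ξ
    rw [le_div_iff₀ hκ]
    refine le_trans ?_ h2
    calc _ = jb ξ ^ k * (κ * ‖G j ξ t‖) := by ring
      _ ≤ jb ξ ^ k * (jb ξ ^ 2 * ‖S.pj n G j t ξ‖) :=
          mul_le_mul_of_nonneg_left (h.ub S ξ hξ j t) (by positivity)
      _ = _ := by ring
  have h0 : ∃ C, ∀ t, 0 ≤ t → ‖G j 0 t‖ ≤ C := by
    rcases j with _ | j
    · obtain ⟨w, hw⟩ := h.inf
      obtain ⟨B, hB⟩ := h.hf (0 + 0 + 2 * (0 + 2) + 2)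
      refine ⟨Real.sqrt (S.Cm 0 0 (2 * (0 + 2)) * B) / κ + ‖w‖, fun t ht => ?_⟩
      have h2 := hw 0 B hB t ht
      have h3 : ((1 + κ * t) ^ (0 + 1))⁻¹ ≤ 1 := by
        rw [zero_add, pow_one]; apply inv_le_one_of_one_le₀
        have : 0 ≤ κ * t := by positivity
        linarith
      have h4 : ‖G 0 0 t - w‖ ≤ Real.sqrt (S.Cm 0 0 (2 * (0 + 2)) * B) / κ := by
        rw [le_div_iff₀ hκ, mul_comm]
        exact h2.trans (mul_le_of_le_one_right (Real.sqrt_nonneg _) h3)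
      have h5 := norm_add_le (G 0 0 t - w) w
      rw [sub_add_cancel] at h5
      linarith
    · obtain ⟨B, hB⟩ := h.hf (0 + j + 2 * 0 + 2)
      refine ⟨Real.sqrt (S.Cm 0 j (2 * 0) * B), fun t ht => (h.u0 S j t).trans ?_⟩
      · have h2 := h.pb S 0 j 0 hB 0 t ht
        rwa [pow_zero, one_mul, pow_zero, one_mul] at h2
  obtain ⟨C0, hC0⟩ := h0
  refine ⟨max (Real.sqrt (S.Cm (k + 2) j (2 * 0) * B) / κ) C0, fun ξ t ht => ?_⟩
  by_cases hξ : ξ = 0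
  · subst hξ
    rw [jb_zero, one_pow, one_mul]
    exact (hC0 t ht).trans (le_max_right _ _)
  · exact (h1 ξ hξ t ht).trans (le_max_left _ _)
end

end

section
open scoped Pointwise
set_option linter.all false

/-- cut-off monomials -/
theorem cutmono (j : ℕ) : ∃ h : ℝ → ℝ, ContDiff ℝ (⊤ : ℕ∞) h ∧ (∀ i, iteratedDeriv i h 0 = if i = j then 1 else 0) ∧
    ∀ i, ∃ B, 0 ≤ B ∧ ∀ x, |iteratedDeriv i h x| ≤ B := by
  let χ : ContDiffBump (0 : ℝ) := ⟨1, 2, by norm_num, by norm_num⟩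
  have hχ : ContDiff ℝ (⊤ : ℕ∞) χ := χ.contDiff
  have hs : ContDiff ℝ (⊤ : ℕ∞) fun x => ((j.factorial : ℝ))⁻¹ * (x ^ j) * χ x := by fun_prop
  have hcs : HasCompactSupport fun x => ((j.factorial : ℝ))⁻¹ * (x ^ j) * χ x := χ.hasCompactSupport.mul_left
  refine ⟨_, hs, fun i => ?_, fun i => ?_⟩
  · have h1 : (fun x => ((j.factorial : ℝ))⁻¹ * (x ^ j) * χ x) =ᶠ[𝓝 0] fun x => ((j.factorial : ℝ))⁻¹ * (x ^ j) := by
      filter_upwards [χ.eventuallyEq_one] with x hx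
      rw [hx]; simp
    rw [h1.iteratedDeriv_eq, iteratedDeriv_const_mul_field, iteratedDeriv_fun_pow_zero]
    split_ifs with h
    · subst h; field_simp
    · simp
  · have h1 : HasCompactSupport (iteratedDeriv i fun x => ((j.factorial : ℝ))⁻¹ * (x ^ j) * χ x) := by
      induction i with
      | zero => simpa using hcs
      | succ i ih => rw [iteratedDeriv_succ]; exact ih.deriv
    obtain ⟨B, hB⟩ := h1.exists_bound_of_continuous (smooth_iter hs i).continuous
    exact ⟨B, (norm_nonneg _).trans (hB 0), hB⟩

/-- Borel lemma with parameters -/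
theorem borel_ext {d : ℕ} {F : Type*} [NormedAddCommGroup F] [NormedSpace ℝ F] [CompleteSpace F]
    (c : ℕ → (Fin d → ℤ) → F) (hc : ∀ j k : ℕ, ∃ C, ∀ ξ, jb ξ ^ k * ‖c j ξ‖ ≤ C) :
    ∃ G : ℕ → (Fin d → ℤ) → ℝ → F, (∀ i ξ t, HasDerivAt (G i ξ) (G (i + 1) ξ t) t) ∧ (∀ i ξ, G i ξ 0 = c i ξ) ∧
      ∀ k i : ℕ, ∃ C, ∀ ξ t, jb ξ ^ k * ‖G i ξ t‖ ≤ C := by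
  choose h hs h0 hB using cutmono
  choose H hH0 hH using hB
  choose C hC using hc
  have hC0 : ∀ j k, 0 ≤ C j k := fun j k => by
    have := hC j k 0
    have h2 := jb_pos (0 : Fin d → ℤ)
    exact le_trans (by positivity) this
  set A : ℕ → ℝ := fun j => ∑ i ∈ Finset.range (j + 1), ∑ k ∈ Finset.range (j + 1), H j i * C j k with hA
  have hA0 : ∀ j, 0 ≤ A j := fun j => Finset.sum_nonneg fun i _ => Finset.sum_nonneg fun k _ => mul_nonneg (hH0 j i) (hC0 j k)
  have hAle : ∀ j i k, i ≤ j → k ≤ j → H j i * C j k ≤ A j := fun j i k hi hk => by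
    have h1 : ∑ k ∈ Finset.range (j + 1), H j i * C j k ≤ A j :=
      Finset.single_le_sum (f := fun i => ∑ k ∈ Finset.range (j + 1), H j i * C j k)
        (fun i _ => Finset.sum_nonneg fun k _ => mul_nonneg (hH0 j i) (hC0 j k)) (Finset.mem_range.2 (by omega))
    exact (Finset.single_le_sum (f := fun k => H j i * C j k) (fun k _ => mul_nonneg (hH0 j i) (hC0 j k))
      (Finset.mem_range.2 (by omega))).trans h1
  set L : ℕ → ℝ := fun j => 1 + 2 ^ j * A j with hL
  have hL1 : ∀ j, 1 ≤ L j := fun j => by have := hA0 j; simp only [hL]; have : 0 ≤ 2 ^ j * A j := by positivity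
                                         linarith
  have hLp : ∀ j, 0 < L j := fun j => by linarith [hL1 j]
  set v : ℕ → ℕ → ℕ → ℝ := fun i k j => L j ^ i * (L j ^ j)⁻¹ * H j i * C j k with hv
  have hv0 : ∀ i k j, 0 ≤ v i k j := fun i k j => by
    have := hLp j; have := hH0 j i; have := hC0 j k; simp only [hv]; positivity
  have hvs : ∀ i k, Summable (v i k) := fun i k => by
    refine Summable.of_norm_bounded_eventually_nat (g := fun j => (1 / 2 : ℝ) ^ j) summable_geometric_two ?_
    filter_upwards [Filter.eventually_ge_atTop (max i k + 1)] with j hj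
    rw [Real.norm_of_nonneg (hv0 i k j)]
    have hij : i + 1 ≤ j := by have := le_max_left i k; omega
    have hkj : k ≤ j := by have := le_max_right i k; omega
    have h1 := hAle j i k (by omega) hkj
    have h2 : L j ^ i * (L j ^ j)⁻¹ ≤ (L j)⁻¹ := by
      have := hLp j
      rw [← div_eq_mul_inv, div_le_iff₀ (by positivity), inv_mul_eq_div, le_div_iff₀ this, ← pow_succ]
      exact pow_le_pow_right₀ (hL1 j) hij
    have h3 : (L j)⁻¹ * A j ≤ (1 / 2 : ℝ) ^ j := by
      rw [inv_mul_eq_div, div_le_iff₀ (hLp j)]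
      simp only [hL]
      have : (1 / 2 : ℝ) ^ j * 2 ^ j = 1 := by rw [← mul_pow]; norm_num
      have h5 : (0:ℝ) ≤ (1 / 2) ^ j := by positivity
      calc A j = (1 / 2 : ℝ) ^ j * 2 ^ j * A j := by rw [this, one_mul]
        _ ≤ _ := by rw [mul_add, ← mul_assoc]; linarith
    calc v i k j = (L j ^ i * (L j ^ j)⁻¹) * (H j i * C j k) := by simp only [hv]; ring
      _ ≤ (L j)⁻¹ * A j := mul_le_mul h2 h1 (mul_nonneg (hH0 j i) (hC0 j k)) (inv_nonneg.2 (hLp j).le)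
      _ ≤ _ := h3
  set g : ℕ → (Fin d → ℤ) → ℕ → ℝ → F := fun i ξ j t => (L j ^ i * (L j ^ j)⁻¹ * iteratedDeriv i (h j) (L j * t)) • c j ξ with hg
  have hgb : ∀ i k ξ j t, jb ξ ^ k * ‖g i ξ j t‖ ≤ v i k j := fun i k ξ j t => by
    simp only [hg]
    have hl := hLp j
    rw [norm_smul, norm_mul, Real.norm_of_nonneg (by positivity), Real.norm_eq_abs]
    have := jb_pos ξ
    have h6 := hH0 j i
    calc _ = L j ^ i * (L j ^ j)⁻¹ * |iteratedDeriv i (h j) (L j * t)| * (jb ξ ^ k * ‖c j ξ‖) := by ring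
      _ ≤ L j ^ i * (L j ^ j)⁻¹ * H j i * C j k := by gcongr; exact hH j i _; exact hC j k ξ
  have hgb0 : ∀ i ξ j t, ‖g i ξ j t‖ ≤ v i 0 j := fun i ξ j t => by simpa using hgb i 0 ξ j t
  have hgs : ∀ i ξ t, Summable fun j => g i ξ j t := fun i ξ t => Summable.of_norm_bounded (hvs i 0) fun j => hgb0 i ξ j t
  refine ⟨fun i ξ t => ∑' j, g i ξ j t, fun i ξ t => ?_, fun i ξ => ?_, fun k i => ⟨∑' j, v i k j, fun ξ t => ?_⟩⟩
  · refine hasDerivAt_tsum (hvs (i + 1) 0) (fun j y => ?_) (fun j y => hgb0 (i + 1) ξ j y) (hgs i ξ 0) t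
    simp only [hg]
    have h1 : HasDerivAt (fun t => iteratedDeriv i (h j) (L j * t)) (iteratedDeriv (i + 1) (h j) (L j * y) * L j) y := by
      have h2 := smooth_hasDerivAt (smooth_iter (hs j) i) (L j * y)
      rw [← iteratedDeriv_succ] at h2
      exact h2.comp y (by simpa using (hasDerivAt_id y).const_mul (L j))
    refine ((h1.const_mul (L j ^ i * (L j ^ j)⁻¹)).smul_const (c j ξ)).congr_deriv ?_
    congr 1
    ring
  · show ∑' j, g i ξ j 0 = c i ξ
    rw [tsum_eq_single i]
    · simp only [hg, mul_zero, h0, if_true]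
      have := hLp i
      rw [mul_inv_cancel₀ (by positivity)]
      simp
    · intro j hj
      simp only [hg, mul_zero, h0, if_neg (Ne.symm hj)]
      simp
  · have hk := jb_pos ξ
    have h1 : Summable fun j => ‖g i ξ j t‖ := Summable.of_nonneg_of_le (fun _ => norm_nonneg _) (fun j => hgb0 i ξ j t) (hvs i 0)
    calc jb ξ ^ k * ‖∑' j, g i ξ j t‖ ≤ jb ξ ^ k * ∑' j, ‖g i ξ j t‖ := by gcongr; exact norm_tsum_le_tsum_norm h1
      _ = ∑' j, jb ξ ^ k * ‖g i ξ j t‖ := tsum_mul_left.symm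
      _ ≤ _ := (h1.mul_left _).tsum_le_tsum (fun j => hgb i k ξ j t) (hvs i k)

/-- extension of one-sided jets -/
theorem jet_ext {d : ℕ} {F : Type*} [NormedAddCommGroup F] [NormedSpace ℝ F] [CompleteSpace F]
    (G : ℕ → (Fin d → ℤ) → ℝ → F) (hd : ∀ ξ j t, 0 ≤ t → HasDerivWithinAt (G j ξ) (G (j + 1) ξ t) (Set.Ici 0) t)
    (hb : ∀ k j : ℕ, ∃ C, ∀ ξ t, 0 ≤ t → jb ξ ^ k * ‖G j ξ t‖ ≤ C) :
    ∃ G' : ℕ → (Fin d → ℤ) → ℝ → F, (∀ i ξ t, HasDerivAt (G' i ξ) (G' (i + 1) ξ t) t) ∧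
      (∀ i ξ t, 0 ≤ t → G' i ξ t = G i ξ t) ∧ ∀ k i : ℕ, ∃ C, ∀ ξ t, jb ξ ^ k * ‖G' i ξ t‖ ≤ C := by
  obtain ⟨E, hE, hE0, hEb⟩ := borel_ext (fun j ξ => G j ξ 0) (fun j k => by
    obtain ⟨C, hC⟩ := hb k j
    exact ⟨C, fun ξ => hC ξ 0 le_rfl⟩)
  refine ⟨fun i ξ t => if 0 ≤ t then G i ξ t else E i ξ t, fun i ξ t => ?_, fun i ξ t ht => if_pos ht, fun k i => ?_⟩
  · have hr : ∀ i, Set.EqOn (fun t => if 0 ≤ t then G i ξ t else E i ξ t) (G i ξ) (Set.Ici 0) := fun i t ht => if_pos ht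
    have hl : ∀ i, Set.EqOn (fun t => if 0 ≤ t then G i ξ t else E i ξ t) (E i ξ) (Set.Iic 0) := fun i t ht => by
      rcases eq_or_lt_of_le (Set.mem_Iic.1 ht) with h | h
      · subst h
        show (if (0:ℝ) ≤ 0 then G i ξ 0 else E i ξ 0) = _
        rw [if_pos le_rfl, hE0]
      · exact if_neg (not_le.2 h)
    have hR : 0 ≤ t → HasDerivWithinAt (fun t => if 0 ≤ t then G i ξ t else E i ξ t) (if 0 ≤ t then G (i + 1) ξ t else E (i + 1) ξ t) (Set.Ici 0) t := fun ht => by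
      have := (hd ξ i t ht).congr (hr i) (hr i ht)
      rwa [if_pos ht]
    have hL : t ≤ 0 → HasDerivWithinAt (fun t => if 0 ≤ t then G i ξ t else E i ξ t) (if 0 ≤ t then G (i + 1) ξ t else E (i + 1) ξ t) (Set.Iic 0) t := fun ht => by
      have := (hE i ξ t).hasDerivWithinAt.congr (hl i) (hl i ht)
      have e := hl (i + 1) ht
      dsimp only at e
      rwa [e]
    rcases lt_trichotomy t 0 with h | h | h
    · exact (hL h.le).hasDerivAt (Iic_mem_nhds h)
    · have := (hL h.le).union (hR h.ge)
      rw [Set.Iic_union_Ici] at this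
      exact hasDerivWithinAt_univ.1 this
    · exact (hR h.le).hasDerivAt (Ici_mem_nhds h)
  · obtain ⟨C, hC⟩ := hb k i
    obtain ⟨C', hC'⟩ := hEb k i
    refine ⟨max C C', fun ξ t => ?_⟩
    dsimp only
    split_ifs with h
    · exact (hC ξ t h).trans (le_max_left _ _)
    · exact (hC' ξ t).trans (le_max_right _ _)

end

section
open scoped Pointwise
set_option linter.all false

/-- A rapidly decaying family of Fourier coefficients depending smoothly on `t`, with its jets. -/
structure Jet {d : ℕ} (b : ℕ → (Fin d → ℤ) → ℝ → ℂ) : Prop where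
  der : ∀ j ξ t, HasDerivAt (b j ξ) (b (j+1) ξ t) t
  bd : ∀ k j, ∃ C, ∀ ξ t, jb ξ ^ k * ‖b j ξ t‖ ≤ C

/-- Synthesis of the Fourier series. -/
def syn {d : ℕ} (b : ℕ → (Fin d → ℤ) → ℝ → ℂ) (j : ℕ) (θ : Euc d) (t : ℝ) : ℂ := ∑' ξ, b j ξ t * ec ξ θ

/-- multiplication of the coefficients by a symbol -/
def cmulj {d : ℕ} (c : (Fin d → ℤ) → ℂ) (b : ℕ → (Fin d → ℤ) → ℝ → ℂ) : ℕ → (Fin d → ℤ) → ℝ → ℂ :=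
  fun j ξ t => c ξ * b j ξ t

/-- the symbol of a partial derivative -/
def dsym {d : ℕ} (i : Fin d) : (Fin d → ℤ) → ℂ := fun ξ => tpi * (ξ i : ℝ)

theorem dsym_le {d : ℕ} (i : Fin d) (ξ : Fin d → ℤ) : ‖dsym i ξ‖ ≤ 2 * Real.pi * jb ξ := by
  unfold dsym
  rw [norm_mul, norm_tpi, Complex.norm_real, Real.norm_eq_abs]
  have := jb_abs_le ξ i
  have := Real.pi_pos
  gcongr; linarith

variable {d : ℕ} {b : ℕ → (Fin d → ℤ) → ℝ → ℂ}

theorem Jet.shift (h : Jet b) : Jet (fun j => b (j+1)) := ⟨fun j => h.der (j+1), fun k j => h.bd k (j+1)⟩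

theorem Jet.cmul (h : Jet b) {c : (Fin d → ℤ) → ℂ} {r : ℕ} {C : ℝ} (hC : 0 ≤ C) (hc : ∀ ξ, ‖c ξ‖ ≤ C * jb ξ ^ r) :
    Jet (cmulj c b) := by
  refine ⟨fun j ξ t => (h.der j ξ t).const_mul _, fun k j => ?_⟩
  obtain ⟨B, hB⟩ := h.bd (k + r) j
  refine ⟨C * B, fun ξ t => ?_⟩
  unfold cmulj
  rw [norm_mul]
  have := jb_pos ξ
  calc jb ξ ^ k * (‖c ξ‖ * ‖b j ξ t‖) ≤ jb ξ ^ k * ((C * jb ξ ^ r) * ‖b j ξ t‖) := by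
        gcongr; exact hc ξ
    _ = C * (jb ξ ^ (k+r) * ‖b j ξ t‖) := by ring
    _ ≤ C * B := mul_le_mul_of_nonneg_left (hB ξ t) hC

theorem Jet.dsym (h : Jet b) (i : Fin d) : Jet (cmulj (dsym i) b) :=
  h.cmul (r := 1) (C := 2 * Real.pi) (by positivity) (by intro ξ; rw [pow_one]; exact dsym_le i ξ)

theorem Jet.summ (h : Jet b) (j : ℕ) (t : ℝ) : Summable fun ξ => ‖b j ξ t‖ := by
  obtain ⟨C, hC⟩ := h.bd (2 * d) j
  exact summable_of_rapid fun ξ => hC ξ t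

theorem Jet.unif (h : Jet b) (j : ℕ) : ∃ u : (Fin d → ℤ) → ℝ, Summable u ∧ ∀ ξ t, ‖b j ξ t‖ ≤ u ξ := by
  obtain ⟨C, hC⟩ := h.bd (2 * d) j
  refine ⟨fun ξ => C * (jb ξ ^ (2 * d))⁻¹, jb_summable0.mul_left C, fun ξ t => ?_⟩
  have := jb_pos ξ
  dsimp only
  rw [← div_eq_mul_inv, le_div_iff₀ (by positivity), mul_comm]; exact hC ξ t

theorem Jet.summ' (h : Jet b) (j : ℕ) (θ : Euc d) (t : ℝ) : Summable fun ξ => b j ξ t * ec ξ θ := by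
  refine Summable.of_norm ?_
  simpa [norm_ec] using h.summ j t

theorem syn_per (j : ℕ) (t : ℝ) : Per (fun θ => syn b j θ t) := by
  unfold syn; exact fser_per

/-- the total derivative of a single mode -/
def modeD (b : ℕ → (Fin d → ℤ) → ℝ → ℂ) (F : ℕ → (ℕ → (Fin d → ℤ) → ℝ → ℂ) → ℂ) (j : ℕ) : (Euc d × ℝ) →L[ℝ] ℂ :=
  (∑ i : Fin d, ((EuclideanSpace.proj i : Euc d →L[ℝ] ℝ).comp (ContinuousLinearMap.fst ℝ (Euc d) ℝ)).smulRight
      (F j (cmulj (dsym i) b)))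
    + (ContinuousLinearMap.snd ℝ (Euc d) ℝ).smulRight (F (j+1) b)

theorem modeD_apply (F : ℕ → (ℕ → (Fin d → ℤ) → ℝ → ℂ) → ℂ) (j : ℕ) (v : Euc d) (s : ℝ) :
    modeD b F j (v, s) = (∑ i, v i • F j (cmulj (dsym i) b)) + s • F (j+1) b := by
  simp [modeD]

theorem Jet.hasFDerivAt (h : Jet b) (j : ℕ) (p : Euc d × ℝ) :
    HasFDerivAt (fun p : Euc d × ℝ => syn b j p.1 p.2) (modeD b (fun j b => syn b j p.1 p.2) j) p := by
  have hmode : ∀ (ξ : Fin d → ℤ) (p : Euc d × ℝ), HasFDerivAt (fun p : Euc d × ℝ => b j ξ p.2 * ec ξ p.1)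
      (modeD b (fun j b => b j ξ p.2 * ec ξ p.1) j) p := by
    intro ξ p
    have h1 : HasFDerivAt (fun p : Euc d × ℝ => b j ξ p.2)
        ((ContinuousLinearMap.snd ℝ (Euc d) ℝ).smulRight (b (j+1) ξ p.2)) p := by
      have := (h.der j ξ p.2).hasFDerivAt.comp p (hasFDerivAt_snd (𝕜 := ℝ) (E := Euc d) (F := ℝ) (p := p))
      refine this.congr_fderiv ?_
      ext <;> simp
    have h2 : HasFDerivAt (fun p : Euc d × ℝ => ec ξ p.1) ((fderiv ℝ (ec ξ) p.1).comp (ContinuousLinearMap.fst ℝ (Euc d) ℝ)) p :=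
      ((ec_contDiff ξ (n := 1)).differentiable (by simp) p.1).hasFDerivAt.comp p hasFDerivAt_fst
    refine (h1.mul h2).congr_fderiv ?_
    refine ContinuousLinearMap.ext fun ⟨v, s⟩ => ?_
    rw [modeD_apply]
    simp only [_root_.add_apply, _root_.smul_apply, ContinuousLinearMap.comp_apply, ContinuousLinearMap.coe_fst', ContinuousLinearMap.smulRight_apply, ContinuousLinearMap.coe_snd',
      ec_hasFDerivAt, smul_eq_mul, Complex.real_smul, cmulj, _root_.dsym, tpi]
    have : (zdot ξ v : ℂ) = ∑ i, (ξ i : ℂ) * (v i : ℂ) := by simp [zdot]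
    rw [this, Finset.mul_sum, Finset.sum_mul, Finset.mul_sum]
    congr 1
    · refine Finset.sum_congr rfl fun i _ => ?_
      push_cast; ring
    · ring
  have hun : ∀ i : Fin d, ∃ u : (Fin d → ℤ) → ℝ, Summable u ∧ ∀ ξ t, ‖cmulj (_root_.dsym i) b j ξ t‖ ≤ u ξ := fun i => (h.dsym i).unif j
  choose u hu hub using hun
  obtain ⟨u', hu', hub'⟩ := h.unif (j+1)
  have hsm : ∀ (L : Euc d × ℝ →L[ℝ] ℝ) (z : ℂ), ‖L.smulRight z‖ = ‖L‖ * ‖z‖ := fun L z => ContinuousLinearMap.norm_smulRight_apply L z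
  have key := hasFDerivAt_tsum (𝕜 := ℝ) (f := fun ξ (p : Euc d × ℝ) => b j ξ p.2 * ec ξ p.1)
    (f' := fun ξ p => modeD b (fun j b => b j ξ p.2 * ec ξ p.1) j)
    (u := fun ξ => (∑ i, ‖(EuclideanSpace.proj i : Euc d →L[ℝ] ℝ).comp (ContinuousLinearMap.fst ℝ (Euc d) ℝ)‖ * u i ξ)
      + ‖ContinuousLinearMap.snd ℝ (Euc d) ℝ‖ * u' ξ)
    ((summable_sum fun i _ => (hu i).mul_left _).add (hu'.mul_left _)) hmode ?_ (h.summ' j p.1 p.2) p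
  · refine key.congr_fderiv ?_
    unfold modeD syn
    have hS : ∀ (L : Euc d × ℝ →L[ℝ] ℝ) (c : (Fin d → ℤ) → ℂ), Summable c → HasSum (fun ξ => L.smulRight (c ξ)) (L.smulRight (∑' ξ, c ξ)) := by
      intro L c hc
      exact (ContinuousLinearMap.smulRightL ℝ (Euc d × ℝ) ℂ L).hasSum hc.hasSum
    refine HasSum.tsum_eq (HasSum.add (hasSum_sum fun i _ => ?_) ?_)
    · exact hS _ _ ((h.dsym i).summ' j p.1 p.2)
    · exact hS _ _ (h.summ' (j+1) p.1 p.2)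
  · intro ξ p
    unfold modeD
    refine (norm_add_le _ _).trans (add_le_add ((norm_sum_le _ _).trans (Finset.sum_le_sum fun i _ => ?_)) ?_)
    · rw [hsm, norm_mul, norm_ec, mul_one]
      exact mul_le_mul_of_nonneg_left (hub i ξ p.2) (norm_nonneg _)
    · rw [hsm, norm_mul, norm_ec, mul_one]
      exact mul_le_mul_of_nonneg_left (hub' ξ p.2) (norm_nonneg _)

theorem Jet.cont (h : Jet b) (j : ℕ) : Continuous (fun p : Euc d × ℝ => syn b j p.1 p.2) :=
  continuous_iff_continuousAt.2 fun p => (h.hasFDerivAt j p).continuousAt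

theorem Jet.contDiffN (N : ℕ) : ∀ {b : ℕ → (Fin d → ℤ) → ℝ → ℂ}, Jet b → ∀ j, ContDiff ℝ N (fun p : Euc d × ℝ => syn b j p.1 p.2) := by
  induction N with
  | zero => intro b h j; exact contDiff_zero.2 (h.cont j)
  | succ N ih =>
    intro b h j
    have := contDiff_succ_iff_hasFDerivAt (𝕜 := ℝ) (n := N) (f := fun p : Euc d × ℝ => syn b j p.1 p.2)
    push_cast
    refine this.2 ⟨_, ?_, h.hasFDerivAt j⟩
    unfold modeD
    refine ContDiff.add (ContDiff.sum fun i _ => ?_) ?_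
    · exact contDiff_const.smulRight (ih (h.dsym i) j)
    · exact contDiff_const.smulRight (ih h (j+1))

theorem Jet.contDiff (h : Jet b) (j : ℕ) : ContDiff ℝ (⊤ : ℕ∞) (fun p : Euc d × ℝ => syn b j p.1 p.2) :=
  contDiff_infty.2 fun N => Jet.contDiffN N h j

theorem Jet.hasDerivAt (h : Jet b) (j : ℕ) (θ : Euc d) (t : ℝ) : HasDerivAt (fun s => syn b j θ s) (syn b (j+1) θ t) t := by
  have h1 : HasDerivAt (fun s : ℝ => ((θ, s) : Euc d × ℝ)) (0, 1) t := (hasDerivAt_const t θ).prodMk (hasDerivAt_id t)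
  have := (h.hasFDerivAt j (θ, t)).comp_hasDerivAt t h1
  refine this.congr_deriv ?_
  rw [modeD_apply]; simp

theorem Jet.hasFDerivAt_θ (h : Jet b) (j : ℕ) (θ : Euc d) (t : ℝ) :
    HasFDerivAt (fun x => syn b j x t) ((modeD b (fun j b => syn b j θ t) j).comp (ContinuousLinearMap.inl ℝ (Euc d) ℝ)) θ := by
  have h1 : HasFDerivAt (fun x : Euc d => ((x, t) : Euc d × ℝ)) (ContinuousLinearMap.inl ℝ (Euc d) ℝ) θ := hasFDerivAt_prodMk_left θ t
  exact (h.hasFDerivAt j (θ, t)).comp θ h1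

theorem Jet.re_dt (h : Jet b) (j : ℕ) (θ : Euc d) (t : ℝ) : HasDerivAt (fun s => (syn b j θ s).re) ((syn b (j+1) θ t).re) t :=
  Complex.reCLM.hasFDerivAt.comp_hasDerivAt t (h.hasDerivAt j θ t)

theorem Jet.re_pder (h : Jet b) (j : ℕ) (i : Fin d) (θ : Euc d) (t : ℝ) :
    pder i (fun x => (syn b j x t).re) θ = (syn (cmulj (_root_.dsym i) b) j θ t).re := by
  have := Complex.reCLM.hasFDerivAt.comp θ (h.hasFDerivAt_θ j θ t)
  unfold pder
  have e : fderiv ℝ (fun x => (syn b j x t).re) θ = _ := this.fderiv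
  rw [e]
  simp only [ContinuousLinearMap.comp_apply, ContinuousLinearMap.inl_apply, modeD_apply]
  rw [Finset.sum_eq_single i]
  · simp
  · intro k _ hk; simp [hk]
  · simp

/-- the symbol of `∂^l` -/
def lsym {d : ℕ} (l : List (Fin d)) (ξ : Fin d → ℤ) : ℂ := (l.map fun i => _root_.dsym i ξ).prod

theorem lsym_le {d : ℕ} (l : List (Fin d)) (ξ : Fin d → ℤ) : ‖lsym l ξ‖ ≤ (2 * Real.pi) ^ l.length * jb ξ ^ l.length := by
  induction l with
  | nil => simp [lsym]
  | cons i l ih =>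
    have e : lsym (i :: l) ξ = _root_.dsym i ξ * lsym l ξ := by simp [lsym]
    rw [e, norm_mul, List.length_cons, pow_succ, pow_succ]
    have := jb_pos ξ
    have := Real.pi_pos
    calc _ ≤ (2 * Real.pi * jb ξ) * ((2 * Real.pi) ^ l.length * jb ξ ^ l.length) := by
          gcongr; exact dsym_le i ξ
      _ = _ := by ring

theorem Jet.lsym (h : Jet b) (l : List (Fin d)) : Jet (cmulj (_root_.lsym l) b) :=
  h.cmul (r := l.length) (C := (2 * Real.pi) ^ l.length) (by positivity) (lsym_le l)

theorem Jet.re_dtj (h : Jet b) (j i : ℕ) : dtj j (fun (θ : Euc d) t => (syn b i θ t).re) = fun θ t => (syn b (i + j) θ t).re := by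
  induction j with
  | zero => rfl
  | succ j ih =>
    funext θ t
    have e : dtj (j+1) (fun (θ : Euc d) t => (syn b i θ t).re) θ t = deriv (dtj j (fun (θ : Euc d) t => (syn b i θ t).re) θ) t := by
      unfold dtj; rw [Function.iterate_succ_apply']
    rw [e, ih]
    exact (h.re_dt (i + j) θ t).deriv

theorem Jet.re_dthMulti (h : Jet b) (l : List (Fin d)) (j : ℕ) :
    dthMulti l (fun (θ : Euc d) t => (syn b j θ t).re) = fun θ t => (syn (cmulj (_root_.lsym l) b) j θ t).re := by
  induction l with
  | nil => 
    have : cmulj (_root_.lsym ([] : List (Fin d))) b = b := by funext j ξ t; simp [cmulj, _root_.lsym]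
    rw [this]; rfl
  | cons i l ih =>
    funext θ t
    have e : dthMulti (i :: l) (fun (θ : Euc d) t => (syn b j θ t).re) = dth i (dthMulti l (fun (θ : Euc d) t => (syn b j θ t).re)) := rfl
    rw [e, ih]
    unfold dth
    rw [(h.lsym l).re_pder j i θ t]
    congr 2
    funext j ξ t
    simp [cmulj, _root_.lsym, mul_assoc]

theorem fc_mul_series {c : Euc d → ℂ} (hc : Continuous c) {b : (Fin d → ℤ) → ℂ} (hb : Summable (fun ξ => ‖b ξ‖))
    (hcb : ∃ C, ∀ θ, ‖c θ‖ ≤ C) (ξ : Fin d → ℤ) :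
    fc (fun θ => c θ * ∑' η, b η * ec η θ) ξ = ∑' η, fc c (ξ - η) * b η := by
  unfold fc
  have e : ∀ θ, ec (-ξ) θ * (c θ * (∑' η, b η * ec η θ)) = ∑' η, (ec (-(ξ - η)) θ * c θ) * b η := by
    intro θ
    rw [← tsum_mul_left, ← tsum_mul_left]
    refine tsum_congr fun η => ?_
    rw [show -(ξ - η) = -ξ + η by ring, ec_add_left]; ring
  simp_rw [e]
  obtain ⟨C, hC⟩ := hcb
  have hs := hasSum_integral_of_summable_integral_norm (μ := volume.restrict (unitCell d))
    (F := fun η θ => (ec (-(ξ - η)) θ * c θ) * b η)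
    (fun η => cell_integrable (((ec_continuous _).mul hc).mul continuous_const))
    (by
      refine Summable.of_nonneg_of_le (fun η => integral_nonneg fun θ => norm_nonneg _) (fun η => ?_) (hb.mul_left C)
      have := integral_mono (μ := volume.restrict (unitCell d)) (f := fun θ => ‖(ec (-(ξ - η)) θ * c θ) * b η‖) (g := fun θ => C * ‖b η‖)
        (cell_integrable (((ec_continuous _).mul hc).mul continuous_const).norm) (integrable_const _) (fun θ => by
          simp only [norm_mul, norm_ec, one_mul]
          exact mul_le_mul_of_nonneg_right (hC θ) (norm_nonneg _))
      simpa using this)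
  rw [← hs.tsum_eq]
  refine tsum_congr fun η => ?_
  rw [integral_mul_const]

end

section
open scoped Pointwise
set_option linter.all false

section
variable {d : ℕ} {W E : Type} [NormedAddCommGroup W] [InnerProductSpace ℂ W] [FiniteDimensional ℂ W]
    [NormedAddCommGroup E] [InnerProductSpace ℂ E] [FiniteDimensional ℂ E] (S : Sys d W E)

/-- two-sided limit solutions -/
theorem Sys.limit2 (n : Euc d) (hn : ‖n‖ = 1) (κ : ℝ) (κpos : 0 < κ)
    (dio : ∀ ξ, ξ ≠ 0 → κ ≤ jb ξ ^ 2 * ‖perp n ξ‖) (f : (Fin d → ℤ) → ℝ) (f0 : ∀ ξ, 0 ≤ f ξ)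
    (hf : ∀ s, ∃ B, ∀ Λ, Ns Λ s f ≤ B) (g : (Fin d → ℤ) → W) (g0 : g 0 = 0)
    (hg : ∀ ξ, ‖g ξ‖ ≤ 2 * Real.pi * ‖perp n ξ‖ * f ξ) : ∃ u, S.LS n κ f g u ∧
      (∀ i ξ t, HasDerivAt (u i ξ) (u (i + 1) ξ t) t) ∧ ∀ k i : ℕ, ∃ C, ∀ ξ t, jb ξ ^ k * ‖u i ξ t‖ ≤ C := by
  haveI : CompleteSpace W := FiniteDimensional.complete ℂ W
  obtain ⟨G, hG⟩ := S.limit n hn κ κpos dio f f0 hf g g0 hg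
  obtain ⟨u, h1, h2, h3⟩ := jet_ext G hG.der (hG.bdd S)
  have e : ∀ j t, 0 ≤ t → S.pj n u j t = S.pj n G j t := by
    intro j t ht; funext ξ; unfold Sys.pj; rw [h2 _ _ _ ht, h2 _ _ _ ht]
  refine ⟨u, ⟨hn, κpos, dio, hf, fun ξ j t ht => (h1 j ξ t).hasDerivWithinAt, ?_, ?_, ?_, ?_, ?_⟩, h1, h3⟩
  · intro s j ℓ B hB Λ t ht
    rw [e j t ht]; exact hG.bd s j ℓ B hB Λ t ht
  · intro s j B hB Λ t ht
    refine le_trans (le_of_eq ?_) (hG.bi s j B hB Λ t ht)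
    refine intervalIntegral.integral_congr fun τ hτ => ?_
    rw [Set.uIcc_of_le ht] at hτ
    rw [e j τ hτ.1]
  · intro ξ t ht
    rw [e 1 t ht, e 0 t ht]; exact hG.eqn ξ t ht
  · intro ξ
    rw [e 0 0 le_rfl]; exact hG.bc ξ
  · rw [h2 0 0 0 le_rfl]; exact hG.G00

/-- twisted jets -/
def tw (n : Euc d) (u : ℕ → (Fin d → ℤ) → ℝ → W) : ℕ → ℕ → (Fin d → ℤ) → ℝ → W
  | 0 => u
  | j+1 => fun i ξ t => tw n u j (i+1) ξ t - (tpi * zdot ξ n) • tw n u j i ξ t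

theorem tw_der (n : Euc d) {u : ℕ → (Fin d → ℤ) → ℝ → W} (hu : ∀ i ξ t, HasDerivAt (u i ξ) (u (i + 1) ξ t) t) (j : ℕ) :
    ∀ i ξ t, HasDerivAt (tw n u j i ξ) (tw n u j (i + 1) ξ t) t := by
  induction j with
  | zero => exact hu
  | succ j ih => intro i ξ t; exact (ih (i+1) ξ t).sub ((ih i ξ t).const_smul (tpi * (zdot ξ n : ℂ)))

theorem norm_tz (n : Euc d) (hn : ‖n‖ = 1) (ξ : Fin d → ℤ) : ‖tpi * (zdot ξ n : ℂ)‖ ≤ 2 * Real.pi * jb ξ := by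
  rw [norm_mul, norm_tpi, Complex.norm_real, Real.norm_eq_abs]
  have := zdot_le ξ n
  rw [hn, mul_one] at this
  have := Real.pi_pos
  gcongr

theorem tw_bd (n : Euc d) (hn : ‖n‖ = 1) {u : ℕ → (Fin d → ℤ) → ℝ → W} (hu : ∀ k i : ℕ, ∃ C, ∀ ξ t, jb ξ ^ k * ‖u i ξ t‖ ≤ C) (j : ℕ) :
    ∀ k i : ℕ, ∃ C, ∀ ξ t, jb ξ ^ k * ‖tw n u j i ξ t‖ ≤ C := by
  induction j with
  | zero => exact hu
  | succ j ih =>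
    intro k i
    obtain ⟨C, hC⟩ := ih k (i+1)
    obtain ⟨C', hC'⟩ := ih (k+1) i
    refine ⟨C + 2 * Real.pi * C', fun ξ t => ?_⟩
    have h1 : ‖tw n u (j+1) i ξ t‖ ≤ ‖tw n u j (i+1) ξ t‖ + 2 * Real.pi * jb ξ * ‖tw n u j i ξ t‖ := by
      refine (norm_sub_le _ _).trans ?_
      rw [norm_smul]
      gcongr
      exact norm_tz n hn ξ
    have := jb_pos ξ
    have := Real.pi_pos
    calc _ ≤ jb ξ ^ k * (‖tw n u j (i+1) ξ t‖ + 2 * Real.pi * jb ξ * ‖tw n u j i ξ t‖) := by gcongr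
      _ = jb ξ ^ k * ‖tw n u j (i+1) ξ t‖ + 2 * Real.pi * (jb ξ ^ (k+1) * ‖tw n u j i ξ t‖) := by ring
      _ ≤ _ := add_le_add (hC ξ t) (mul_le_mul_of_nonneg_left (hC' ξ t) (by positivity))

theorem Sys.tw_pj (n : Euc d) (u : ℕ → (Fin d → ℤ) → ℝ → W) (j i : ℕ) (t : ℝ) (ξ : Fin d → ℤ) :
    S.pj n (tw n u (j+1)) i t ξ = S.pj n (tw n u j) (i+1) t ξ - (tpi * (zdot ξ n : ℂ)) • S.pj n (tw n u j) i t ξ := by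
  simp only [Sys.pj, Sys.pv, tw, map_sub, map_smul, smul_sub]
  rw [smul_comm tpi]; abel

theorem Sys.tw_le (n : Euc d) (hn : ‖n‖ = 1) (u : ℕ → (Fin d → ℤ) → ℝ → W) (j : ℕ) : ∀ (i : ℕ) (t : ℝ) (ξ : Fin d → ℤ),
    ‖S.pj n (tw n u j) i t ξ‖ ≤ (1 + 2 * Real.pi) ^ j * ∑ r ∈ Finset.range (j+1), jb ξ ^ (j - r) * ‖S.pj n u (i + r) t ξ‖ := by
  have hpi := Real.pi_pos
  induction j with
  | zero => intro i t ξ; simp [tw]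
  | succ j ih =>
    intro i t ξ
    have hj := jb_pos ξ
    have h1 : ∑ r ∈ Finset.range (j+1), jb ξ ^ (j - r) * ‖S.pj n u (i + 1 + r) t ξ‖ ≤
        ∑ r ∈ Finset.range (j+2), jb ξ ^ (j + 1 - r) * ‖S.pj n u (i + r) t ξ‖ := by
      rw [Finset.sum_range_succ' _ (j+1)]
      refine le_trans (le_of_eq ?_) (le_add_of_nonneg_right (by positivity))
      refine Finset.sum_congr rfl fun r _ => ?_
      rw [show j + 1 - (r + 1) = j - r by omega, show i + 1 + r = i + (r + 1) by ring]
    have h2 : jb ξ * ∑ r ∈ Finset.range (j+1), jb ξ ^ (j - r) * ‖S.pj n u (i + r) t ξ‖ ≤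
        ∑ r ∈ Finset.range (j+2), jb ξ ^ (j + 1 - r) * ‖S.pj n u (i + r) t ξ‖ := by
      rw [Finset.sum_range_succ _ (j+1), Finset.mul_sum]
      refine le_trans (le_of_eq ?_) (le_add_of_nonneg_right (by positivity))
      refine Finset.sum_congr rfl fun r hr => ?_
      rw [Finset.mem_range] at hr
      rw [show j + 1 - r = (j - r) + 1 by omega, pow_succ]; ring
    rw [S.tw_pj]
    refine (norm_sub_le _ _).trans ?_
    rw [norm_smul]
    calc _ ≤ (1 + 2 * Real.pi) ^ j * (∑ r ∈ Finset.range (j+1), jb ξ ^ (j - r) * ‖S.pj n u (i + 1 + r) t ξ‖) +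
          (2 * Real.pi * jb ξ) * ((1 + 2 * Real.pi) ^ j * ∑ r ∈ Finset.range (j+1), jb ξ ^ (j - r) * ‖S.pj n u (i + r) t ξ‖) := by
          refine add_le_add (ih (i+1) t ξ) (mul_le_mul (norm_tz n hn ξ) (ih i t ξ) (norm_nonneg _) (by positivity))
      _ = (1 + 2 * Real.pi) ^ j * ((∑ r ∈ Finset.range (j+1), jb ξ ^ (j - r) * ‖S.pj n u (i + 1 + r) t ξ‖) +
          (2 * Real.pi) * (jb ξ * ∑ r ∈ Finset.range (j+1), jb ξ ^ (j - r) * ‖S.pj n u (i + r) t ξ‖)) := by ring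
      _ ≤ (1 + 2 * Real.pi) ^ j * ((∑ r ∈ Finset.range (j+2), jb ξ ^ (j + 1 - r) * ‖S.pj n u (i + r) t ξ‖) +
          (2 * Real.pi) * (∑ r ∈ Finset.range (j+2), jb ξ ^ (j + 1 - r) * ‖S.pj n u (i + r) t ξ‖)) := by
          refine mul_le_mul_of_nonneg_left (add_le_add h1 (mul_le_mul_of_nonneg_left h2 (by positivity))) (by positivity)
      _ = _ := by ring

/-- constant -/
def twc (j : ℕ) : ℝ := (1 + 2 * Real.pi) ^ (2 * j) * (j + 1 : ℕ)

theorem twc_pos (j : ℕ) : 0 < twc j := by unfold twc; have := Real.pi_pos; positivity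

theorem Sys.tw_Ns (n : Euc d) (hn : ‖n‖ = 1) (u : ℕ → (Fin d → ℤ) → ℝ → W) (s j : ℕ) (t : ℝ) (Λ : Finset (Fin d → ℤ)) :
    Ns Λ s (S.pj n (tw n u j) 0 t) ≤ twc j * ∑ r ∈ Finset.range (j+1), Ns Λ (s + (j - r)) (S.pj n u r t) := by
  unfold Ns
  rw [Finset.sum_comm, Finset.mul_sum]
  refine Finset.sum_le_sum fun ξ _ => ?_
  have hj := jb_pos ξ
  have hpi := Real.pi_pos
  have h1 := S.tw_le n hn u j 0 t ξ
  have h2 : (∑ r ∈ Finset.range (j+1), jb ξ ^ (j - r) * ‖S.pj n u (0 + r) t ξ‖) ^ 2 ≤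
      (j + 1 : ℕ) * ∑ r ∈ Finset.range (j+1), (jb ξ ^ (j - r) * ‖S.pj n u r t ξ‖) ^ 2 := by
    have := sq_sum_le_card_mul_sum_sq (s := Finset.range (j+1)) (f := fun r => jb ξ ^ (j - r) * ‖S.pj n u r t ξ‖)
    simpa using this
  calc jb ξ ^ (2 * s) * ‖S.pj n (tw n u j) 0 t ξ‖ ^ 2 ≤ jb ξ ^ (2 * s) * ((1 + 2 * Real.pi) ^ j * ∑ r ∈ Finset.range (j+1), jb ξ ^ (j - r) * ‖S.pj n u (0 + r) t ξ‖) ^ 2 := by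
        gcongr
    _ = jb ξ ^ (2 * s) * (1 + 2 * Real.pi) ^ (2 * j) * (∑ r ∈ Finset.range (j+1), jb ξ ^ (j - r) * ‖S.pj n u (0 + r) t ξ‖) ^ 2 := by ring
    _ ≤ jb ξ ^ (2 * s) * (1 + 2 * Real.pi) ^ (2 * j) * ((j + 1 : ℕ) * ∑ r ∈ Finset.range (j+1), (jb ξ ^ (j - r) * ‖S.pj n u r t ξ‖) ^ 2) := 
        mul_le_mul_of_nonneg_left h2 (by positivity)
    _ = _ := by
        unfold twc
        rw [Finset.mul_sum, Finset.mul_sum, Finset.mul_sum]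
        refine Finset.sum_congr rfl fun r _ => ?_
        ring

/-- constants for the twisted jets -/
def Sys.Cm' (s j ℓ : ℕ) : ℝ := twc j * ∑ r ∈ Finset.range (j+1), S.Cm (s + (j - r)) r ℓ

/-- constants for the twisted jets -/
def Sys.Ci' (s j : ℕ) : ℝ := twc j * ∑ r ∈ Finset.range (j+1), S.Ci (s + (j - r)) r

theorem Sys.Cm'_pos (s j ℓ : ℕ) : 0 < S.Cm' s j ℓ := 
  mul_pos (twc_pos j) (Finset.sum_pos (fun r _ => S.Cm_pos _ _ _) (by simp))

theorem Sys.Ci'_pos (s j : ℕ) : 0 < S.Ci' s j := 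
  mul_pos (twc_pos j) (Finset.sum_pos (fun r _ => S.Ci_pos _ _) (by simp))

theorem Sys.LS.tbd {n κ f g u} (h : S.LS n κ f g u) (s j ℓ : ℕ) {B : ℝ} (hB : ∀ Λ, Ns Λ (s + j + ℓ + 2) f ≤ B)
    (Λ) (t : ℝ) (ht : 0 ≤ t) : (1 + κ * t) ^ ℓ * Ns Λ s (S.pj n (tw n u j) 0 t) ≤ S.Cm' s j ℓ * B := by
  have hκ := h.κpos
  have := twc_pos j
  calc _ ≤ (1 + κ * t) ^ ℓ * (twc j * ∑ r ∈ Finset.range (j+1), Ns Λ (s + (j - r)) (S.pj n u r t)) := by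
        gcongr; exact S.tw_Ns n h.hn u s j t Λ
    _ = twc j * ∑ r ∈ Finset.range (j+1), (1 + κ * t) ^ ℓ * Ns Λ (s + (j - r)) (S.pj n u r t) := by
        rw [Finset.mul_sum, Finset.mul_sum, Finset.mul_sum]
        refine Finset.sum_congr rfl fun r _ => ?_
        ring
    _ ≤ twc j * ∑ r ∈ Finset.range (j+1), S.Cm (s + (j - r)) r ℓ * B := by
        refine mul_le_mul_of_nonneg_left (Finset.sum_le_sum fun r hr => ?_) this.le
        rw [Finset.mem_range] at hr
        refine h.bd _ _ _ B ?_ Λ t ht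
        rwa [show s + (j - r) + r + ℓ + 2 = s + j + ℓ + 2 by omega]
    _ = _ := by rw [← Finset.sum_mul, Sys.Cm', mul_assoc]

theorem Sys.pj_cont (n : Euc d) {u : ℕ → (Fin d → ℤ) → ℝ → W} (hu : ∀ i ξ t, HasDerivAt (u i ξ) (u (i + 1) ξ t) t)
    (j : ℕ) (ξ : Fin d → ℤ) : Continuous fun t => S.pj n u j t ξ := by
  have h1 : ∀ i, Continuous (u i ξ) := fun i => continuous_iff_continuousAt.2 fun t => (hu i ξ t).continuousAt
  exact (S.pv_cont n ξ).comp ((h1 j).prodMk (h1 (j+1)))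

theorem Sys.Nsj_cont (n : Euc d) {u : ℕ → (Fin d → ℤ) → ℝ → W} (hu : ∀ i ξ t, HasDerivAt (u i ξ) (u (i + 1) ξ t) t)
    (s j : ℕ) (Λ : Finset (Fin d → ℤ)) : Continuous fun t => Ns Λ s (S.pj n u j t) := by
  unfold Ns
  exact continuous_finsetSum _ fun ξ _ => continuous_const.mul ((S.pj_cont n hu j ξ).norm.pow 2)

theorem Sys.LS.tbi {n κ f g u} (h : S.LS n κ f g u) (hu : ∀ i ξ t, HasDerivAt (u i ξ) (u (i + 1) ξ t) t)
    (s j : ℕ) {B : ℝ} (hB : ∀ Λ, Ns Λ (s + j + 1) f ≤ B)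
    (Λ) (t : ℝ) (ht : 0 ≤ t) : ∫ τ in (0:ℝ)..t, Ns Λ s (S.pj n (tw n u j) 0 τ) ≤ S.Ci' s j * B := by
  have := twc_pos j
  calc _ ≤ ∫ τ in (0:ℝ)..t, (twc j * ∑ r ∈ Finset.range (j+1), Ns Λ (s + (j - r)) (S.pj n u r τ)) := by
        refine intervalIntegral.integral_mono_on ht ?_ ?_ fun τ _ => S.tw_Ns n h.hn u s j τ Λ
        · exact (S.Nsj_cont n (tw_der n hu j) s 0 Λ).intervalIntegrable _ _
        · exact (continuous_const.mul (continuous_finsetSum _ fun r _ => S.Nsj_cont n hu _ r Λ)).intervalIntegrable _ _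
    _ = twc j * ∑ r ∈ Finset.range (j+1), ∫ τ in (0:ℝ)..t, Ns Λ (s + (j - r)) (S.pj n u r τ) := by
        rw [intervalIntegral.integral_const_mul, intervalIntegral.integral_finset_sum]
        exact fun r _ => (S.Nsj_cont n hu _ r Λ).intervalIntegrable _ _
    _ ≤ twc j * ∑ r ∈ Finset.range (j+1), S.Ci (s + (j - r)) r * B := by
        refine mul_le_mul_of_nonneg_left (Finset.sum_le_sum fun r hr => ?_) this.le
        rw [Finset.mem_range] at hr
        refine h.bi _ _ B ?_ Λ t ht
        rwa [show s + (j - r) + r + 1 = s + j + 1 by omega]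
    _ = _ := by rw [← Finset.sum_mul, Sys.Ci', mul_assoc]

theorem Sys.LS.tpb {n κ f g u} (h : S.LS n κ f g u) (s j ℓ : ℕ) {B : ℝ} (hB : ∀ Λ, Ns Λ (s + j + 2 * ℓ + 2) f ≤ B)
    (ξ) (t : ℝ) (ht : 0 ≤ t) : (1 + κ * t) ^ ℓ * (jb ξ ^ s * ‖S.pj n (tw n u j) 0 t ξ‖) ≤ Real.sqrt (S.Cm' s j (2 * ℓ) * B) := by
  refine Real.le_sqrt_of_sq_le ?_
  have h1 := h.tbd S s j (2 * ℓ) hB {ξ} t ht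
  unfold Ns at h1
  rw [Finset.sum_singleton] at h1
  refine le_trans (le_of_eq ?_) h1
  ring

/-- the coefficients of the lifted solution -/
def twa (n : Euc d) (u : ℕ → (Fin d → ℤ) → ℝ → W) (j : ℕ) (ξ : Fin d → ℤ) (t : ℝ) : W :=
  ec ξ (-(t • n)) • tw n u j 0 ξ t

theorem norm_twa (n : Euc d) (u : ℕ → (Fin d → ℤ) → ℝ → W) (j : ℕ) (ξ : Fin d → ℤ) (t : ℝ) : ‖twa n u j ξ t‖ = ‖tw n u j 0 ξ t‖ := by
  unfold twa; rw [norm_smul, norm_ec, one_mul]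

theorem ec_line (n : Euc d) (ξ : Fin d → ℤ) (t : ℝ) : HasDerivAt (fun t : ℝ => ec ξ (-(t • n))) (-(tpi * (zdot ξ n : ℂ)) * ec ξ (-(t • n))) t := by
  have h0 : HasDerivAt (fun s : ℝ => -(s • n)) (-n) t := by
    exact (((hasDerivAt_id t).smul_const n).neg).congr_deriv (by simp)
  have hd : DifferentiableAt ℝ (ec ξ) (-(t • n)) := (ec_contDiff ξ (n := 1)).differentiable (by simp) _
  refine (hd.hasFDerivAt.comp_hasDerivAt t h0).congr_deriv ?_
  rw [map_neg, ec_hasFDerivAt]; unfold tpi; ring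

theorem twa_der (n : Euc d) {u : ℕ → (Fin d → ℤ) → ℝ → W} (hu : ∀ i ξ t, HasDerivAt (u i ξ) (u (i + 1) ξ t) t) (j : ℕ) (ξ) (t : ℝ) :
    HasDerivAt (twa n u j ξ) (twa n u (j+1) ξ t) t := by
  refine ((ec_line n ξ t).smul (tw_der n hu j 0 ξ t)).congr_deriv ?_
  simp only [twa, tw]
  module

theorem Sys.twa_1 (n : Euc d) (hn : ‖n‖ = 1) (u : ℕ → (Fin d → ℤ) → ℝ → W) (j : ℕ) (ξ) (t : ℝ) :
    2 * Real.pi * ‖perp n ξ‖ * ‖twa n u j ξ t‖ ≤ ‖S.pj n (tw n u j) 0 t ξ‖ := by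
  rw [norm_twa]; exact S.pv_norm1 n hn ξ _ _

theorem Sys.twa_2 (n : Euc d) (hn : ‖n‖ = 1) (u : ℕ → (Fin d → ℤ) → ℝ → W) (j : ℕ) (ξ) (t : ℝ) :
    ‖twa n u (j+1) ξ t‖ ≤ ‖S.pj n (tw n u j) 0 t ξ‖ := by
  rw [norm_twa]; exact S.pv_norm2 n hn ξ _ _
end

end

section
open scoped Pointwise
set_option linter.all false

/-- the space of values -/
abbrev CW (m : ℕ) := EuclideanSpace ℂ (Fin m)
/-- the space of gradients -/
abbrev CE (d m : ℕ) := EuclideanSpace ℂ (Fin d × Fin m)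

/-- tensor product map -/
def tauL (d m : ℕ) : Euc d →ₗ[ℝ] CW m →L[ℂ] CE d m where
  toFun v := LinearMap.toContinuousLinearMap
    { toFun := fun w => WithLp.toLp 2 fun x => (v x.1 : ℂ) * w x.2
      map_add' := fun w w' => by ext x; simp [mul_add]
      map_smul' := fun c w => by ext x; simp; ring }
  map_add' v v' := by ext w x; simp [add_mul]
  map_smul' c v := by ext w x; simp [mul_assoc]

theorem tauL_apply {d m : ℕ} (v : Euc d) (w : CW m) (i : Fin d) (α : Fin m) : tauL d m v w (i, α) = (v i : ℂ) * w α := rfl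

/-- matrix operator -/
def matop {d m : ℕ} (c : Fin d → Fin d → Fin m → Fin m → ℂ) : CE d m →L[ℂ] CE d m :=
  LinearMap.toContinuousLinearMap
    { toFun := fun e => WithLp.toLp 2 fun x => ∑ j, ∑ β, c x.1 j x.2 β * e (j, β)
      map_add' := fun w w' => by ext x; simp [mul_add, Finset.sum_add_distrib]
      map_smul' := fun a w => by 
        ext x; simp only [PiLp.smul_apply, smul_eq_mul, RingHom.id_apply, Finset.mul_sum]
        refine Finset.sum_congr rfl fun j _ => Finset.sum_congr rfl fun β _ => by ring }

theorem matop_apply {d m : ℕ} (c : Fin d → Fin d → Fin m → Fin m → ℂ) (e : CE d m) (i : Fin d) (α : Fin m) :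
    matop c e (i, α) = ∑ j, ∑ β, c i j α β * e (j, β) := rfl

theorem inner_matop {d m : ℕ} (c : Fin d → Fin d → Fin m → Fin m → ℂ) (p q : CE d m) :
    inner ℂ p (matop c q) = ∑ i, ∑ j, ∑ α, ∑ β, c i j α β * ((starRingEnd ℂ) (p (i, α)) * q (j, β)) := by
  rw [PiLp.inner_apply, Fintype.sum_prod_type]
  refine Finset.sum_congr rfl fun i _ => ?_
  rw [Finset.sum_comm]
  refine Finset.sum_congr rfl fun α _ => ?_
  rw [matop_apply, RCLike.inner_apply, Finset.sum_mul]
  refine Finset.sum_congr rfl fun j _ => ?_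
  rw [Finset.sum_mul]
  refine Finset.sum_congr rfl fun β _ => by ring

theorem norm_coord_le {ι : Type*} [Fintype ι] (e : EuclideanSpace ℂ ι) (x : ι) : ‖e x‖ ≤ ‖e‖ := PiLp.norm_apply_le e x

theorem norm_le_sum {ι : Type*} [Fintype ι] (e : EuclideanSpace ℂ ι) : ‖e‖ ≤ ∑ x, ‖e x‖ := by
  classical
  rw [EuclideanSpace.norm_eq]
  refine Real.sqrt_le_iff.2 ⟨Finset.sum_nonneg fun _ _ => norm_nonneg _, ?_⟩
  exact Finset.sum_sq_le_sq_sum_of_nonneg fun i _ => norm_nonneg _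

theorem norm_matop {d m : ℕ} (c : Fin d → Fin d → Fin m → Fin m → ℂ) :
    ‖matop c‖ ≤ ∑ i, ∑ α, ∑ j, ∑ β, ‖c i j α β‖ := by
  refine ContinuousLinearMap.opNorm_le_bound _ (by positivity) fun e => ?_
  refine (norm_le_sum _).trans ?_
  rw [Fintype.sum_prod_type, Finset.sum_mul]
  refine Finset.sum_le_sum fun i _ => ?_
  rw [Finset.sum_mul]
  refine Finset.sum_le_sum fun α _ => ?_
  rw [matop_apply, Finset.sum_mul]
  refine (norm_sum_le _ _).trans (Finset.sum_le_sum fun j _ => ?_)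
  rw [Finset.sum_mul]
  refine (norm_sum_le _ _).trans (Finset.sum_le_sum fun β _ => ?_)
  rw [norm_mul]
  exact mul_le_mul_of_nonneg_left (norm_coord_le e _) (norm_nonneg _)

/-- complexified coefficients -/
def cA {d m : ℕ} (A : Coeffs d m) (i j : Fin d) (α β : Fin m) (y : Euc d) : ℂ := (astar A i j α β y : ℂ)

section
variable {d m : ℕ} (A : Coeffs d m)

theorem astar_smooth (i j : Fin d) (α β : Fin m) : ContDiff ℝ (⊤ : ℕ∞) (astar A i j α β) := A.smooth j i β α

theorem astar_per (i j : Fin d) (α β : Fin m) : Per (astar A i j α β) := fun x z => A.periodic j i β α x z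

theorem cA_smooth (i j : Fin d) (α β : Fin m) : ContDiff ℝ (⊤ : ℕ∞) (cA A i j α β) :=
  Complex.ofRealCLM.contDiff.comp (astar_smooth A i j α β)

theorem cA_per (i j : Fin d) (α β : Fin m) : Per (cA A i j α β) := fun x z => by
  unfold cA; rw [astar_per A i j α β x z]

theorem cA_cont (i j : Fin d) (α β : Fin m) : Continuous (cA A i j α β) := (cA_smooth A i j α β).continuous

theorem astar_low (x : Euc d) (ξ : Fin d → Fin m → ℝ) :
    A.lam * (∑ i, ∑ α, ξ i α ^ 2) ≤ ∑ i, ∑ j, ∑ α, ∑ β, astar A i j α β x * (ξ i α * ξ j β) := by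
  have := A.ell_low x (fun α i => ξ i α)
  rw [Finset.sum_comm]
  refine this.trans (le_of_eq ?_)
  rw [Finset.sum_comm]
  refine Finset.sum_congr rfl fun i _ => Finset.sum_congr rfl fun j _ => ?_
  rw [Finset.sum_comm]
  refine Finset.sum_congr rfl fun α _ => Finset.sum_congr rfl fun β _ => ?_
  unfold astar; ring

theorem inner_mat_re (y : Euc d) (p : CE d m) :
    A.lam * ‖p‖ ^ 2 ≤ (inner ℂ p (matop (fun i j α β => cA A i j α β y) p)).re := by
  have h1 := astar_low A y (fun i α => (p (i, α)).re)
  have h2 := astar_low A y (fun i α => (p (i, α)).im)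
  have e : (inner ℂ p (matop (fun i j α β => cA A i j α β y) p)).re =
      (∑ i, ∑ j, ∑ α, ∑ β, astar A i j α β y * ((p (i, α)).re * (p (j, β)).re)) +
      (∑ i, ∑ j, ∑ α, ∑ β, astar A i j α β y * ((p (i, α)).im * (p (j, β)).im)) := by
    rw [inner_matop]
    simp only [Complex.re_sum, ← Finset.sum_add_distrib, cA, Complex.mul_re, Complex.ofReal_re, Complex.ofReal_im, zero_mul, sub_zero, Complex.conj_re, Complex.conj_im]
    refine Finset.sum_congr rfl fun i _ => Finset.sum_congr rfl fun j _ => Finset.sum_congr rfl fun α _ => Finset.sum_congr rfl fun β _ => by ring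
  rw [e]
  refine le_trans (le_of_eq ?_) (add_le_add h1 h2)
  rw [EuclideanSpace.norm_sq_eq, Fintype.sum_prod_type, ← mul_add]
  simp only [← Finset.sum_add_distrib]
  congr 1
  refine Finset.sum_congr rfl fun i _ => Finset.sum_congr rfl fun α _ => ?_
  rw [← Complex.normSq_eq_norm_sq, Complex.normSq_apply]; ring

theorem fc_matop (ζ : Fin d → ℤ) (p q : CE d m) :
    ∫ y in unitCell d, ec (-ζ) y * inner ℂ p (matop (fun i j α β => cA A i j α β y) q) =
      inner ℂ p (matop (fun i j α β => fc (cA A i j α β) ζ) q) := by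
  simp only [inner_matop, Finset.mul_sum]
  have hc : ∀ (i j : Fin d) (α β : Fin m), Continuous fun y => ec (-ζ) y * (cA A i j α β y * ((starRingEnd ℂ) (p (i, α)) * q (j, β))) :=
    fun i j α β => (ec_continuous _).mul ((cA_cont A i j α β).mul continuous_const)
  rw [integral_finset_sum _ fun i _ => cell_integrable (by fun_prop)]
  refine Finset.sum_congr rfl fun i _ => ?_
  rw [integral_finset_sum _ fun i _ => cell_integrable (by fun_prop)]
  refine Finset.sum_congr rfl fun j _ => ?_
  rw [integral_finset_sum _ fun i _ => cell_integrable (by fun_prop)]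
  refine Finset.sum_congr rfl fun α _ => ?_
  rw [integral_finset_sum _ fun i _ => cell_integrable (by fun_prop)]
  refine Finset.sum_congr rfl fun β _ => ?_
  unfold fc
  rw [← integral_mul_const]
  congr 1; funext y; ring

theorem cont_matop (p q : CE d m) : Continuous fun y => inner ℂ p (matop (fun i j α β => cA A i j α β y) q) := by
  simp only [inner_matop]
  have := cA_cont A
  fun_prop

/-- the concrete system -/
def conS (d m : ℕ) (A : Coeffs d m) : Sys d (CW m) (CE d m) where
  τ := tauL d m
  K ζ := matop fun i j α β => fc (cA A i j α β) ζ
  lam := A.lam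
  lam_pos := A.lam_pos
  hτ v v' w w' := by
    rw [PiLp.inner_apply, Fintype.sum_prod_type, PiLp.inner_apply, PiLp.inner_apply]
    rw [Complex.ofReal_sum, Finset.sum_mul]
    refine Finset.sum_congr rfl fun i _ => ?_
    rw [Finset.mul_sum]
    refine Finset.sum_congr rfl fun α _ => ?_
    simp only [RCLike.inner_apply, tauL_apply, map_mul, Complex.conj_ofReal]
    simp; ring
  decay k := by
    have h : ∀ i j α β, ∃ C, ∀ ζ, jb ζ ^ k * ‖fc (cA A i j α β) ζ‖ ≤ C := fun i j α β => fc_rapid (cA_smooth A i j α β) (cA_per A i j α β) k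
    choose C hC using h
    refine ⟨∑ i, ∑ α, ∑ j, ∑ β, C i j α β, fun ζ => ?_⟩
    have := jb_pos ζ
    calc _ ≤ jb ζ ^ k * ∑ i, ∑ α, ∑ j, ∑ β, ‖fc (cA A i j α β) ζ‖ := by gcongr; exact norm_matop _
      _ = ∑ i, ∑ α, ∑ j, ∑ β, jb ζ ^ k * ‖fc (cA A i j α β) ζ‖ := by simp only [Finset.mul_sum]
      _ ≤ _ := Finset.sum_le_sum fun i _ => Finset.sum_le_sum fun α _ => Finset.sum_le_sum fun j _ => Finset.sum_le_sum fun β _ => hC i j α β ζ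
  coer Λ p := by
    have hP : ∀ (L : Euc d → CE d m →L[ℂ] CE d m) (y : Euc d), inner ℂ (∑ η ∈ Λ, ec η y • p η) (L y (∑ η ∈ Λ, ec η y • p η)) =
        ∑ ξ ∈ Λ, ∑ η ∈ Λ, ec (-(ξ - η)) y * inner ℂ (p ξ) (L y (p η)) := by
      intro L y
      rw [sum_inner]
      refine Finset.sum_congr rfl fun ξ _ => ?_
      rw [map_sum, inner_sum]
      refine Finset.sum_congr rfl fun η _ => ?_
      rw [map_smul, inner_smul_left, inner_smul_right, ← ec_neg, show -(ξ - η) = -ξ + η by ring, ec_add_left]; ring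
    have hcP : Continuous fun y : Euc d => ∑ η ∈ Λ, ec η y • p η := by
      have := fun η : Fin d → ℤ => ec_continuous η
      fun_prop
    have hI : ∫ y in unitCell d, inner ℂ (∑ η ∈ Λ, ec η y • p η) (matop (fun i j α β => cA A i j α β y) (∑ η ∈ Λ, ec η y • p η)) =
        ∑ ξ ∈ Λ, ∑ η ∈ Λ, inner ℂ (p ξ) (matop (fun i j α β => fc (cA A i j α β) (ξ - η)) (p η)) := by
      have := fun y => hP (fun y => matop (fun i j α β => cA A i j α β y)) y
      simp only [this]
      have hc := fun p q => cont_matop A p q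
      have he := fun η : Fin d → ℤ => ec_continuous η
      rw [integral_finset_sum _ fun i _ => cell_integrable (by fun_prop)]
      refine Finset.sum_congr rfl fun ξ _ => ?_
      rw [integral_finset_sum _ fun i _ => cell_integrable (by fun_prop)]
      exact Finset.sum_congr rfl fun η _ => fc_matop A _ _ _
    have hN : ∫ y in unitCell d, inner ℂ (∑ η ∈ Λ, ec η y • p η) (∑ η ∈ Λ, ec η y • p η) = ((∑ ξ ∈ Λ, ‖p ξ‖ ^ 2 : ℝ) : ℂ) := by
      have := fun y => hP (fun y => ContinuousLinearMap.id ℂ _) y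
      simp only [ContinuousLinearMap.id_apply] at this
      simp only [this]
      have he := fun η : Fin d → ℤ => ec_continuous η
      rw [integral_finset_sum _ fun i _ => cell_integrable (by fun_prop), Complex.ofReal_sum]
      refine Finset.sum_congr rfl fun ξ hξ => ?_
      rw [integral_finset_sum _ fun i _ => cell_integrable (by fun_prop), Finset.sum_eq_single ξ]
      · rw [integral_mul_const, cell_ec]
        simp [inner_self_eq_norm_sq_to_K]
      · intro η _ hη
        rw [integral_mul_const, cell_ec, if_neg, zero_mul]
        simpa [sub_eq_zero] using hη
      · exact fun h => absurd hξ h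
    have hcI : Continuous fun y : Euc d => inner ℂ (∑ η ∈ Λ, ec η y • p η) (matop (fun i j α β => cA A i j α β y) (∑ η ∈ Λ, ec η y • p η)) := by
      have := fun y => hP (fun y => matop (fun i j α β => cA A i j α β y)) y
      simp only [this]
      have hc := fun p q => cont_matop A p q
      have he := fun η : Fin d → ℤ => ec_continuous η
      fun_prop
    have hcN : Continuous fun y : Euc d => ‖∑ η ∈ Λ, ec η y • p η‖ ^ 2 := hcP.norm.pow 2
    have e1 : ∫ y in unitCell d, ‖∑ η ∈ Λ, ec η y • p η‖ ^ 2 = ∑ ξ ∈ Λ, ‖p ξ‖ ^ 2 := by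
      have h := hN
      simp only [inner_self_eq_norm_sq_to_K] at h
      have h3 : (fun y : Euc d => (RCLike.ofReal ‖∑ η ∈ Λ, ec η y • p η‖ : ℂ) ^ 2) = fun y => ((‖∑ η ∈ Λ, ec η y • p η‖ ^ 2 : ℝ) : ℂ) := by
        funext y; push_cast; rfl
      rw [h3] at h
      exact Complex.ofReal_injective ((integral_ofReal (𝕜 := ℂ)).symm.trans h)
    rw [← hI, ← e1, ← integral_const_mul]
    have := integral_re (𝕜 := ℂ) (cell_integrable hcI)
    simp only [RCLike.re_to_complex] at this
    rw [← this]
    refine integral_mono (cell_integrable (continuous_const.mul hcN)) (cell_integrable (Complex.continuous_re.comp hcI)) fun y => ?_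
    exact inner_mat_re A y _
end

end

section
open scoped Pointwise
set_option linter.all false

section
variable {d m : ℕ} {φ : Euc d → Fin m → ℝ}

/-- complexified component -/
def cphi (φ : Euc d → Fin m → ℝ) (α : Fin m) (θ : Euc d) : ℂ := (φ θ α : ℂ)

/-- Fourier coefficients of the data -/
def phat (φ : Euc d → Fin m → ℝ) (ξ : Fin d → ℤ) : CW m := WithLp.toLp 2 fun α => fc (cphi φ α) ξ

theorem cphi_smooth (hφ : ContDiff ℝ (⊤ : ℕ∞) φ) (α : Fin m) : ContDiff ℝ (⊤ : ℕ∞) (cphi φ α) :=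
  Complex.ofRealCLM.contDiff.comp (contDiff_pi.1 hφ α)

theorem cphi_per (hp : Per φ) (α : Fin m) : Per (cphi φ α) := fun θ z => by
  unfold cphi; rw [hp θ z]

theorem CkNorm_term (hφ : ContDiff ℝ (⊤ : ℕ∞) φ) (hp : Per φ) {j k : ℕ} (hj : j ≤ k) (x : Euc d) :
    ‖iteratedFDeriv ℝ j φ x‖ ≤ CkNorm k φ := by
  have hb : BddAbove (Set.range fun x : Euc d => ‖iteratedFDeriv ℝ j φ x‖) := by
    have h1 : Continuous (iteratedFDeriv ℝ j φ) := hφ.continuous_iteratedFDeriv (by exact_mod_cast le_top)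
    have h2 : Per (iteratedFDeriv ℝ j φ) := fun θ z => by
      have := iteratedFDeriv_comp_add_right (𝕜 := ℝ) (f := φ) j (zvec z) θ
      rw [← this]
      congr 1
      funext y; exact hp y z
    obtain ⟨C, hC⟩ := per_bdd h1 h2
    exact ⟨C, by rintro _ ⟨x, rfl⟩; exact hC x⟩
  refine (le_ciSup hb x).trans ?_
  unfold CkNorm
  exact Finset.single_le_sum (f := fun j => ⨆ x : Euc d, ‖iteratedFDeriv ℝ j φ x‖) (fun i _ => Real.iSup_nonneg fun x => norm_nonneg _) (Finset.mem_range.2 (by omega))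

theorem CkNorm_nonneg (k : ℕ) (φ : Euc d → Fin m → ℝ) : 0 ≤ CkNorm k φ :=
  Finset.sum_nonneg fun i _ => Real.iSup_nonneg fun x => norm_nonneg _

theorem CkNorm_mono (φ : Euc d → Fin m → ℝ) {k k' : ℕ} (h : k ≤ k') : CkNorm k φ ≤ CkNorm k' φ :=
  Finset.sum_le_sum_of_subset_of_nonneg (Finset.range_subset_range.2 (by omega)) fun i _ _ => Real.iSup_nonneg fun x => norm_nonneg _

theorem cphi_iter (hφ : ContDiff ℝ (⊤ : ℕ∞) φ) (α : Fin m) (k : ℕ) (x : Euc d) :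
    ‖iteratedFDeriv ℝ k (cphi φ α) x‖ ≤ ‖iteratedFDeriv ℝ k φ x‖ := by
  let L : (Fin m → ℝ) →L[ℝ] ℂ := Complex.ofRealCLM.comp (ContinuousLinearMap.proj (R := ℝ) α)
  have hL : ‖L‖ ≤ 1 := by
    refine ContinuousLinearMap.opNorm_le_bound _ zero_le_one fun v => ?_
    simp only [L, ContinuousLinearMap.comp_apply, ContinuousLinearMap.proj_apply, Complex.ofRealCLM_apply, Complex.norm_real, one_mul]
    exact norm_le_pi_norm v α
  have h := L.norm_iteratedFDeriv_comp_left (f := φ) (x := x) (n := k) hφ.contDiffAt (by exact_mod_cast le_top)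
  refine le_trans h ?_
  exact mul_le_of_le_one_left (norm_nonneg _) hL

/-- constant -/
def cdat (d m k : ℕ) : ℝ := m * ((d:ℝ) + 1) ^ (2 * k + 1) + 1

theorem cdat_pos (d m k : ℕ) : 0 < cdat d m k := by unfold cdat; positivity

theorem phat_Ns (hφ : ContDiff ℝ (⊤ : ℕ∞) φ) (hp : Per φ) (k : ℕ) (Λ : Finset (Fin d → ℤ)) :
    Ns Λ k (fun ξ => ‖phat φ ξ‖) ≤ cdat d m k * CkNorm k φ ^ 2 := by
  unfold Ns
  have h1 : ∀ α, ∑ ξ ∈ Λ, jb ξ ^ (2 * k) * ‖fc (cphi φ α) ξ‖ ^ 2 ≤ ((d:ℝ) + 1) ^ (2 * k + 1) * CkNorm k φ ^ 2 := by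
    intro α
    refine fc_sobolev (cphi_smooth hφ α) (cphi_per hp α) k (CkNorm k φ) (fun θ => ?_) (fun θ => ?_) Λ
    · have h2 := (cphi_iter hφ α 0 θ).trans (CkNorm_term hφ hp (Nat.zero_le k) θ)
      simpa using h2
    · exact (cphi_iter hφ α k θ).trans (CkNorm_term hφ hp le_rfl θ)
  calc _ = ∑ α, ∑ ξ ∈ Λ, jb ξ ^ (2 * k) * ‖fc (cphi φ α) ξ‖ ^ 2 := by
        rw [Finset.sum_comm]
        refine Finset.sum_congr rfl fun ξ _ => ?_
        rw [norm_norm, EuclideanSpace.norm_sq_eq, Finset.mul_sum]; rfl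
    _ ≤ ∑ α : Fin m, ((d:ℝ) + 1) ^ (2 * k + 1) * CkNorm k φ ^ 2 := Finset.sum_le_sum fun α _ => h1 α
    _ = m * ((d:ℝ) + 1) ^ (2 * k + 1) * CkNorm k φ ^ 2 := by simp; ring
    _ ≤ _ := by
        unfold cdat
        have := sq_nonneg (CkNorm k φ)
        nlinarith

/-- the Neumann data on the Fourier side -/
def gdat (φ : Euc d → Fin m → ℝ) (T : Euc d) (ξ : Fin d → ℤ) : CW m := (tpi * (zdot ξ T : ℂ)) • phat φ ξ

theorem gdat_zero (T : Euc d) : gdat φ T 0 = 0 := by simp [gdat, zdot_zero_left]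

theorem euc_norm_sq (v : Euc d) : ‖v‖ ^ 2 = ∑ i, v i ^ 2 := by
  rw [EuclideanSpace.norm_sq_eq]; simp

theorem zdot_tan (n T : Euc d) (hT : dotp T n = 0) (hT1 : (∑ i, T i ^ 2) ≤ 1) (ξ : Fin d → ℤ) : |zdot ξ T| ≤ ‖perp n ξ‖ := by
  have h1 : zdot ξ T = inner ℝ T (perp n ξ) := by
    have h0 : inner ℝ T n = 0 := by
      rw [PiLp.inner_apply, ← hT]; unfold dotp
      refine Finset.sum_congr rfl fun i _ => ?_
      simp; ring
    unfold perp
    rw [inner_sub_right, inner_smul_right, inner_zvec, h0]; ring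
  have h2 : ‖T‖ ≤ 1 := by
    rw [← euc_norm_sq] at hT1
    nlinarith [norm_nonneg T]
  rw [h1]
  exact (abs_real_inner_le_norm _ _).trans (mul_le_of_le_one_left (norm_nonneg _) h2)

theorem gdat_le (n T : Euc d) (hT : dotp T n = 0) (hT1 : (∑ i, T i ^ 2) ≤ 1) (ξ : Fin d → ℤ) :
    ‖gdat φ T ξ‖ ≤ 2 * Real.pi * ‖perp n ξ‖ * ‖phat φ ξ‖ := by
  unfold gdat
  rw [norm_smul, norm_mul, norm_tpi, Complex.norm_real, Real.norm_eq_abs]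
  have := zdot_tan n T hT hT1 ξ
  have := Real.pi_pos
  gcongr

theorem gdat_fc (hφ : ContDiff ℝ (⊤ : ℕ∞) φ) (hp : Per φ) (T : Euc d) (ξ : Fin d → ℤ) (α : Fin m) :
    fc (fun θ => fderiv ℝ (cphi φ α) θ T) ξ = gdat φ T ξ α := by
  rw [fc_fderiv ((cphi_smooth hφ α).of_le (by exact_mod_cast le_top)) (cphi_per hp α)]
  rfl

theorem dio_of (n : Euc d) {κ : ℝ} (h : IsDioph n κ) (ξ : Fin d → ℤ) (hξ : ξ ≠ 0) : κ ≤ jb ξ ^ 2 * ‖perp n ξ‖ := by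
  have h1 := h.2 ξ hξ
  have e : ∑ i, ((ξ i : ℝ) - (∑ j, (ξ j : ℝ) * n j) * n i) ^ 2 = ‖perp n ξ‖ ^ 2 := by
    rw [euc_norm_sq]
    refine Finset.sum_congr rfl fun i _ => ?_
    simp [perp, zvec_apply, zdot]
  rw [e] at h1
  have hs : ∑ i, (ξ i : ℝ) ^ 2 ≤ jb ξ ^ 2 := by
    have h2 : ∑ i, |(ξ i : ℝ)| ^ 2 ≤ (∑ i, |(ξ i : ℝ)|) ^ 2 := Finset.sum_sq_le_sq_sum_of_nonneg fun i _ => abs_nonneg _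
    simp only [sq_abs] at h2
    have h3 : 0 ≤ ∑ i, |(ξ i : ℝ)| := Finset.sum_nonneg fun i _ => abs_nonneg _
    unfold jb
    nlinarith
  have hpos : 0 < ∑ i, (ξ i : ℝ) ^ 2 := by
    obtain ⟨i, hi⟩ := Function.ne_iff.1 hξ
    refine Finset.sum_pos' (fun i _ => sq_nonneg _) ⟨i, Finset.mem_univ _, ?_⟩
    have : (ξ i : ℝ) ≠ 0 := by exact_mod_cast hi
    positivity
  have h4 : κ ≤ (∑ i, (ξ i : ℝ) ^ 2) * ‖perp n ξ‖ := by
    refine abs_le_of_sq_le_sq' ?_ (by positivity) |>.2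
    rw [mul_pow]
    rw [← div_eq_mul_inv, div_le_iff₀ (by positivity)] at h1
    linarith
  refine h4.trans ?_
  gcongr
end

end

section
open scoped Pointwise
set_option linter.all false

section
variable {d m : ℕ} {hd : 0 < d} {n : Euc d} {M : Fin d → Fin d → ℝ}

/-- the vector representing the lifted derivative -/
def vk (hd : 0 < d) (M : Fin d → Fin d → ℝ) (k : Fin d) : Euc d × ℝ :=
  if k = lastIdx d hd then (0, 1) else (∑ i, M i k • EuclideanSpace.single i 1, 0)

/-- the rotated direction -/
def wv (n : Euc d) (j : Fin d) : Euc d × ℝ := (EuclideanSpace.single j 1 - n j • n, - n j)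

theorem ortho_row (hM : IsOrtho M) (i j : Fin d) : ∑ k, M i k * M j k = if i = j then (1:ℝ) else 0 := by
  let A : Matrix (Fin d) (Fin d) ℝ := Matrix.of M
  have h : A.transpose * A = 1 := by
    ext k l
    rw [Matrix.mul_apply, Matrix.one_apply, ← hM k l]; rfl
  have h2 := mul_eq_one_comm.1 h
  have := congrFun (congrFun h2 i) j
  rw [Matrix.mul_apply, Matrix.one_apply] at this
  exact this

theorem sum_vk (hM : IsOrtho M) (hl : LastColNeg hd n M) (j : Fin d) : ∑ k, M j k • vk hd M k = wv n j := by
  classical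
  have h1 : ∀ k, M j k • vk hd M k = (M j k • ∑ i, M i k • (EuclideanSpace.single i 1 : Euc d), (0:ℝ)) +
      (if k = lastIdx d hd then (-(M j k • ∑ i, M i k • (EuclideanSpace.single i 1 : Euc d)), M j k) else 0) := by
    intro k
    unfold vk
    split_ifs with h
    · ext <;> simp
    · ext <;> simp
  rw [Finset.sum_congr rfl fun k _ => h1 k, Finset.sum_add_distrib, Finset.sum_ite_eq' Finset.univ]
  simp only [Finset.mem_univ, if_true]
  have e1 : ∑ k, ((M j k • ∑ i, M i k • (EuclideanSpace.single i 1 : Euc d), (0:ℝ)) : Euc d × ℝ) = (EuclideanSpace.single j 1, 0) := by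
    refine Prod.ext ?_ ?_
    · rw [Prod.fst_sum]
      ext r
      simp only [WithLp.ofLp_sum, WithLp.ofLp_smul, Finset.sum_apply, Pi.smul_apply, PiLp.single_apply, smul_eq_mul, mul_ite, mul_one, mul_zero,
        Finset.sum_ite_eq, Finset.mem_univ, if_true]
      rw [ortho_row hM]
      simp [eq_comm]
    · rw [Prod.snd_sum]; simp
  have e2 : ∑ i, M i (lastIdx d hd) • (EuclideanSpace.single i 1 : Euc d) = - n := by
    ext r
    simp only [WithLp.ofLp_sum, WithLp.ofLp_smul, Finset.sum_apply, Pi.smul_apply, PiLp.single_apply, smul_eq_mul, mul_ite, mul_one, mul_zero,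
        Finset.sum_ite_eq, Finset.mem_univ, if_true]
    rw [hl r]; rfl
  rw [e1, e2, hl j]
  unfold wv
  ext <;> simp; ring

theorem liftD_eq {f : Euc d → ℝ → ℝ} {F : Euc d × ℝ → ℝ} (hf : ∀ a b, f a b = F (a, b)) (k : Fin d) (θ : Euc d) (t : ℝ)
    (hF : DifferentiableAt ℝ F (θ, t)) : liftD hd M k f θ t = fderiv ℝ F (θ, t) (vk hd M k) := by
  have e : f = fun a b => F (a, b) := by funext a b; exact hf a b
  subst e
  unfold liftD vk
  split_ifs with h
  · have h1 : HasDerivAt (fun s : ℝ => ((θ, s) : Euc d × ℝ)) (0, 1) t := (hasDerivAt_const t θ).prodMk (hasDerivAt_id t)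
    exact (hF.hasFDerivAt.comp_hasDerivAt t h1).deriv
  · have h1 : HasFDerivAt (fun x : Euc d => ((x, t) : Euc d × ℝ)) (ContinuousLinearMap.inl ℝ (Euc d) ℝ) θ := hasFDerivAt_prodMk_left θ t
    have h2 := (hF.hasFDerivAt.comp θ h1).fderiv
    unfold pder
    have h3 : ∀ i, fderiv ℝ (fun θ' => F (θ', t)) θ (EuclideanSpace.single i 1) = fderiv ℝ F (θ, t) (EuclideanSpace.single i 1, 0) := by
      intro i
      have : fderiv ℝ (fun θ' => F (θ', t)) θ = (fderiv ℝ F (θ, t)).comp (ContinuousLinearMap.inl ℝ (Euc d) ℝ) := h2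
      rw [this]; rfl
    simp only [h3]
    have h4 : ((∑ i, M i k • (EuclideanSpace.single i 1 : Euc d), (0:ℝ)) : Euc d × ℝ) = ∑ i, M i k • ((EuclideanSpace.single i 1, 0) : Euc d × ℝ) := by
      refine Prod.ext ?_ ?_
      · rw [Prod.fst_sum]; rfl
      · rw [Prod.snd_sum]; simp
    rw [h4, map_sum]
    simp only [map_smul, smul_eq_mul]

theorem sum_liftD (hM : IsOrtho M) (hl : LastColNeg hd n M) {f : Euc d → ℝ → ℝ} {F : Euc d × ℝ → ℝ} (hf : ∀ a b, f a b = F (a, b)) (j : Fin d) (θ : Euc d) (t : ℝ)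
    (hF : DifferentiableAt ℝ F (θ, t)) : ∑ k, M j k * liftD hd M k f θ t = fderiv ℝ F (θ, t) (wv n j) := by
  rw [← sum_vk hM hl, map_sum]
  refine Finset.sum_congr rfl fun k _ => ?_
  rw [liftD_eq hf k θ t hF, map_smul, smul_eq_mul]

/-- the unrotated flux -/
def Rf (A : Coeffs d m) (n : Euc d) (F : Fin m → Euc d × ℝ → ℝ) (i : Fin d) (α : Fin m) (p : Euc d × ℝ) : ℝ :=
  ∑ j, ∑ β, astar A i j α β (p.1 - p.2 • n) * fderiv ℝ (F β) p (wv n j)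

theorem flux_eq (A : Coeffs d m) (hM : IsOrtho M) (hl : LastColNeg hd n M) {V : Euc d → ℝ → Fin m → ℝ} {F : Fin m → Euc d × ℝ → ℝ}
    (hV : ∀ a b β, V a b β = F β (a, b)) (hF : ∀ β, ContDiff ℝ (⊤ : ℕ∞) (F β)) (k : Fin d) (α : Fin m) (θ : Euc d) (t : ℝ) :
    ∑ l, ∑ β, liftB A n M k l α β θ t * liftD hd M l (fun a' b' => V a' b' β) θ t = ∑ i, M i k * Rf A n F i α (θ, t) := by
  have h1 : ∀ j β, fderiv ℝ (F β) (θ, t) (wv n j) = ∑ l, M j l * liftD hd M l (fun a' b' => V a' b' β) θ t := fun j β =>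
    (sum_liftD hM hl (fun a b => hV a b β) j θ t ((hF β).differentiable (by simp) _)).symm
  unfold Rf liftB
  simp only [h1, Finset.mul_sum, Finset.sum_mul]
  rw [Finset.sum_comm]
  simp only [← Finset.univ_product_univ, ← Finset.sum_product']
  refine Finset.sum_bij' (fun x _ => (x.2.2.1, x.2.2.2, x.1, x.2.1)) (fun x _ => (x.2.2.1, x.2.2.2, x.1, x.2.1)) ?_ ?_ ?_ ?_ ?_ <;> simp
  intros; ring

theorem wv_smooth_Rf (A : Coeffs d m) {F : Fin m → Euc d × ℝ → ℝ} (hF : ∀ β, ContDiff ℝ (⊤ : ℕ∞) (F β)) (i : Fin d) (α : Fin m) :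
    ContDiff ℝ (⊤ : ℕ∞) (Rf A n F i α) := by
  unfold Rf
  refine ContDiff.sum fun j _ => ContDiff.sum fun β _ => ?_
  refine ContDiff.mul ((astar_smooth A i j α β).comp (by fun_prop)) ?_
  exact ((hF β).fderiv_right (m := (⊤ : ℕ∞)) (by norm_cast)).clm_apply contDiff_const

theorem liftOp_eq (A : Coeffs d m) (hM : IsOrtho M) (hl : LastColNeg hd n M) {V : Euc d → ℝ → Fin m → ℝ} {F : Fin m → Euc d × ℝ → ℝ}
    (hV : ∀ a b β, V a b β = F β (a, b)) (hF : ∀ β, ContDiff ℝ (⊤ : ℕ∞) (F β)) (α : Fin m) (θ : Euc d) (t : ℝ) :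
    liftOp hd A n M V α θ t = ∑ i, fderiv ℝ (Rf A n F i α) (θ, t) (wv n i) := by
  unfold liftOp
  have hd' : ∀ i, DifferentiableAt ℝ (Rf A n F i α) (θ, t) := fun i => (wv_smooth_Rf A hF i α).differentiable (by simp) _
  have h1 : ∀ k, liftD hd M k (fun a b => ∑ l, ∑ β, liftB A n M k l α β a b * liftD hd M l (fun a' b' => V a' b' β) a b) θ t
      = ∑ i, M i k * fderiv ℝ (Rf A n F i α) (θ, t) (vk hd M k) := by
    intro k
    rw [liftD_eq (F := fun p => ∑ i, M i k * Rf A n F i α p) (fun a b => flux_eq A hM hl hV hF k α a b) k θ t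
      (DifferentiableAt.fun_sum fun i _ => (hd' i).const_mul _)]
    have h2 : HasFDerivAt (fun p => ∑ i, M i k * Rf A n F i α p) (∑ i, M i k • fderiv ℝ (Rf A n F i α) (θ, t)) (θ, t) :=
      HasFDerivAt.fun_sum fun i _ => (hd' i).hasFDerivAt.const_mul _
    rw [h2.fderiv]
    simp
  simp only [h1]
  rw [Finset.sum_comm]
  refine Finset.sum_congr rfl fun i _ => ?_
  rw [← sum_vk hM hl, map_sum]
  simp only [map_smul, smul_eq_mul]
end

end

section
open scoped Pointwise
set_option linter.all false

section
variable {d m : ℕ}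

/-- component jets -/
def ujet (u : ℕ → (Fin d → ℤ) → ℝ → CW m) (β : Fin m) : ℕ → (Fin d → ℤ) → ℝ → ℂ := fun j ξ t => u j ξ t β

/-- component jets of the gradient -/
def pjet (n : Euc d) (u : ℕ → (Fin d → ℤ) → ℝ → CW m) (k : Fin d) (β : Fin m) : ℕ → (Fin d → ℤ) → ℝ → ℂ :=
  fun j ξ t => cmulj (dsym k) (ujet u β) j ξ t + cmulj (fun _ => -(n k : ℂ)) (fun j => ujet u β (j+1)) j ξ t

theorem Jet.add {b c : ℕ → (Fin d → ℤ) → ℝ → ℂ} (hb : Jet b) (hc : Jet c) : Jet (fun j ξ t => b j ξ t + c j ξ t) := by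
  refine ⟨fun j ξ t => (hb.der j ξ t).add (hc.der j ξ t), fun k j => ?_⟩
  obtain ⟨B, hB⟩ := hb.bd k j
  obtain ⟨C, hC⟩ := hc.bd k j
  refine ⟨B + C, fun ξ t => ?_⟩
  have := jb_pos ξ
  calc _ ≤ jb ξ ^ k * (‖b j ξ t‖ + ‖c j ξ t‖) := by gcongr; exact norm_add_le _ _
    _ ≤ B + C := by have := hB ξ t; have := hC ξ t; linarith

theorem coord_hasDerivAt {f : ℝ → CW m} {f' : CW m} {t : ℝ} (h : HasDerivAt f f' t) (β : Fin m) : HasDerivAt (fun t => f t β) (f' β) t := by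
  have := ((EuclideanSpace.proj β : CW m →L[ℂ] ℂ).restrictScalars ℝ).hasFDerivAt.comp_hasDerivAt t h
  exact this

theorem ujet_jet {u : ℕ → (Fin d → ℤ) → ℝ → CW m} (h1 : ∀ i ξ t, HasDerivAt (u i ξ) (u (i + 1) ξ t) t)
    (h2 : ∀ k i : ℕ, ∃ C, ∀ ξ t, jb ξ ^ k * ‖u i ξ t‖ ≤ C) (β : Fin m) : Jet (ujet u β) := by
  refine ⟨fun j ξ t => coord_hasDerivAt (h1 j ξ t) β, fun k j => ?_⟩
  obtain ⟨C, hC⟩ := h2 k j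
  refine ⟨C, fun ξ t => le_trans ?_ (hC ξ t)⟩
  have := jb_pos ξ
  gcongr
  exact norm_coord_le _ _

theorem pjet_jet (n : Euc d) {u : ℕ → (Fin d → ℤ) → ℝ → CW m} (h : ∀ β, Jet (ujet u β)) (k : Fin d) (β : Fin m) : Jet (pjet n u k β) := by
  refine ((h β).dsym k).add ((h β).shift.cmul (r := 0) (C := ‖(n k : ℂ)‖) (norm_nonneg _) fun ξ => ?_)
  simp

theorem pjet_eq (A : Coeffs d m) (n : Euc d) (u : ℕ → (Fin d → ℤ) → ℝ → CW m) (k : Fin d) (β : Fin m) (j : ℕ) (ξ) (t : ℝ) :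
    pjet n u k β j ξ t = (conS d m A).pj n u j t ξ (k, β) := by
  have e : (conS d m A).pj n u j t ξ (k, β) = tpi * (((zvec ξ k : ℝ) : ℂ) * u j ξ t β) - (n k : ℂ) * u (j+1) ξ t β := rfl
  rw [e, zvec_apply]
  simp only [pjet, cmulj, dsym, ujet]; push_cast; ring

theorem syn_pjet (n : Euc d) {u : ℕ → (Fin d → ℤ) → ℝ → CW m} (h : ∀ β, Jet (ujet u β)) (k : Fin d) (β : Fin m) (r : ℕ) (p : Euc d × ℝ) :
    fderiv ℝ (fun p : Euc d × ℝ => syn (ujet u β) r p.1 p.2) p (EuclideanSpace.single k 1, - n k) = syn (pjet n u k β) r p.1 p.2 := by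
  rw [((h β).hasFDerivAt r p).fderiv, modeD_apply]
  have e : ∑ i, ((EuclideanSpace.single k 1 : Euc d) i) • syn (cmulj (dsym i) (ujet u β)) r p.1 p.2 = syn (cmulj (dsym k) (ujet u β)) r p.1 p.2 := by
    rw [Finset.sum_eq_single k]
    · simp
    · intro i _ hi; simp [hi]
    · simp
  rw [e]
  have h1 := ((h β).dsym k).summ' r p.1 p.2
  have h2 := ((h β).summ' (r+1) p.1 p.2).mul_left (-(n k : ℂ))
  unfold syn at *
  rw [Complex.real_smul, ← tsum_mul_left]
  push_cast
  rw [← h1.tsum_add h2]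
  refine tsum_congr fun ξ => ?_
  simp only [pjet, cmulj]; ring

/-- complex flux -/
def QC (A : Coeffs d m) (n : Euc d) (u : ℕ → (Fin d → ℤ) → ℝ → CW m) (r : ℕ) (i : Fin d) (α : Fin m) (p : Euc d × ℝ) : ℂ :=
  ∑ k, ∑ β, cA A i k α β p.1 * syn (pjet n u k β) r p.1 p.2

theorem QC_smooth (A : Coeffs d m) (n : Euc d) {u : ℕ → (Fin d → ℤ) → ℝ → CW m} (h : ∀ β, Jet (ujet u β)) (r : ℕ) (i : Fin d) (α : Fin m) :
    ContDiff ℝ (⊤ : ℕ∞) (QC A n u r i α) := by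
  unfold QC
  refine ContDiff.sum fun j _ => ContDiff.sum fun β _ => ?_
  exact ((cA_smooth A i j α β).comp contDiff_fst).mul ((pjet_jet n h j β).contDiff r)

theorem QC_per (A : Coeffs d m) (n : Euc d) (u : ℕ → (Fin d → ℤ) → ℝ → CW m) (r : ℕ) (i : Fin d) (α : Fin m) (t : ℝ) :
    Per (fun y => QC A n u r i α (y, t)) := by
  intro θ z
  unfold QC
  simp only
  refine Finset.sum_congr rfl fun k _ => Finset.sum_congr rfl fun β _ => ?_
  have e : syn (pjet n u k β) r (θ + zvec z) t = syn (pjet n u k β) r θ t := syn_per r t θ z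
  rw [cA_per A i k α β θ z, e]

theorem fc_QC (A : Coeffs d m) (n : Euc d) {u : ℕ → (Fin d → ℤ) → ℝ → CW m} (h : ∀ β, Jet (ujet u β)) (r : ℕ) (i : Fin d) (α : Fin m) (t : ℝ) (ξ) :
    fc (fun y => QC A n u r i α (y, t)) ξ = (∑' η, (conS d m A).K (ξ - η) ((conS d m A).pj n u r t η)) (i, α) := by
  have hc : ∀ k β, Continuous fun y => syn (pjet n u k β) r y t := fun k β =>
    ((pjet_jet n h k β).cont r).comp (by fun_prop : Continuous fun y : Euc d => (y, t))
  have hcA := cA_cont A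
  have hJ : ∀ k β, Summable fun ξ => ‖pjet n u k β r ξ t‖ := fun k β => (pjet_jet n h k β).summ r t
  have h1 : fc (fun y => QC A n u r i α (y, t)) ξ = ∑ k, ∑ β, ∑' η, fc (cA A i k α β) (ξ - η) * pjet n u k β r η t := by
    have h2 : ∀ k β, fc (fun y => cA A i k α β y * syn (pjet n u k β) r y t) ξ = ∑' η, fc (cA A i k α β) (ξ - η) * pjet n u k β r η t := fun k β =>
      fc_mul_series (hcA i k α β) (hJ k β) (per_bdd (hcA i k α β) (cA_per A i k α β)) ξ
    simp only [← h2]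
    unfold fc QC
    simp only [Finset.mul_sum]
    have hec := ec_continuous (-ξ)
    rw [integral_finset_sum _ fun k _ => cell_integrable (by fun_prop)]
    refine Finset.sum_congr rfl fun k _ => ?_
    rw [integral_finset_sum _ fun k _ => cell_integrable (by fun_prop)]
  have hpS : Summable fun η => ‖(conS d m A).pj n u r t η‖ := by
    refine Summable.of_nonneg_of_le (fun _ => norm_nonneg _) (fun η => norm_le_sum _) ?_
    refine summable_sum fun x _ => ?_
    have := hJ x.1 x.2
    simpa only [pjet_eq A] using this
  obtain ⟨C, hC⟩ := (conS d m A).decay 0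
  have hKb : ∀ ζ, ‖(conS d m A).K ζ‖ ≤ C := fun ζ => by simpa using hC ζ
  have hS : Summable fun η => (conS d m A).K (ξ - η) ((conS d m A).pj n u r t η) := by
    refine Summable.of_norm_bounded (hpS.mul_left C) fun η => ?_
    refine (ContinuousLinearMap.le_opNorm _ _).trans ?_
    exact mul_le_mul_of_nonneg_right (hKb _) (norm_nonneg _)
  have h3 := (EuclideanSpace.proj (i, α) : CE d m →L[ℂ] ℂ).map_tsum hS
  have h4 : (∑' η, (conS d m A).K (ξ - η) ((conS d m A).pj n u r t η)) (i, α) =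
      ∑' η, ((conS d m A).K (ξ - η) ((conS d m A).pj n u r t η)) (i, α) := h3
  rw [h1, h4]
  have hfb : ∀ k β, ∃ C, ∀ ζ, ‖fc (cA A i k α β) ζ‖ ≤ C := fun k β => by
    obtain ⟨C, hC⟩ := fc_rapid (cA_smooth A i k α β) (cA_per A i k α β) 0
    exact ⟨C, fun ζ => by simpa using hC ζ⟩
  have hs : ∀ k β, Summable fun η => fc (cA A i k α β) (ξ - η) * pjet n u k β r η t := fun k β => by
    obtain ⟨C, hC⟩ := hfb k β
    refine Summable.of_norm_bounded ((hJ k β).mul_left C) fun η => ?_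
    rw [norm_mul]
    exact mul_le_mul_of_nonneg_right (hC _) (norm_nonneg _)
  have h5 : ∀ η, ((conS d m A).K (ξ - η) ((conS d m A).pj n u r t η)) (i, α) = ∑ k, ∑ β, fc (cA A i k α β) (ξ - η) * pjet n u k β r η t := by
    intro η
    simp only [pjet_eq A]
    rfl
  simp only [h5]
  rw [Summable.tsum_finsetSum fun k _ => summable_sum fun β _ => hs k β]
  refine Finset.sum_congr rfl fun k _ => ?_
  rw [Summable.tsum_finsetSum fun β _ => hs k β]

theorem QC_fderiv (A : Coeffs d m) (n : Euc d) {u : ℕ → (Fin d → ℤ) → ℝ → CW m} (h : ∀ β, Jet (ujet u β)) (r : ℕ) (i : Fin d) (α : Fin m)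
    (y : Euc d) (t : ℝ) (v : Euc d) (s : ℝ) : fderiv ℝ (QC A n u r i α) (y, t) (v, s) =
      fderiv ℝ (fun y => QC A n u r i α (y, t)) y v + s • QC A n u (r+1) i α (y, t) := by
  have hd : DifferentiableAt ℝ (QC A n u r i α) (y, t) := (QC_smooth A n h r i α).differentiable (by simp) _
  have h1 : HasFDerivAt (fun x : Euc d => ((x, t) : Euc d × ℝ)) (ContinuousLinearMap.inl ℝ (Euc d) ℝ) y := hasFDerivAt_prodMk_left y t
  have h2 : fderiv ℝ (fun y => QC A n u r i α (y, t)) y = (fderiv ℝ (QC A n u r i α) (y, t)).comp (ContinuousLinearMap.inl ℝ (Euc d) ℝ) :=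
    (HasFDerivAt.comp (g := QC A n u r i α) y hd.hasFDerivAt h1).fderiv
  have h3 : HasDerivAt (fun s : ℝ => ((y, s) : Euc d × ℝ)) (0, 1) t := (hasDerivAt_const t y).prodMk (hasDerivAt_id t)
  have h4 : HasDerivAt (fun s : ℝ => QC A n u r i α (y, s)) (fderiv ℝ (QC A n u r i α) (y, t) (0, 1)) t := hd.hasFDerivAt.comp_hasDerivAt t h3
  have h5 : HasDerivAt (fun s : ℝ => QC A n u r i α (y, s)) (QC A n u (r+1) i α (y, t)) t := by
    unfold QC
    exact HasDerivAt.fun_sum fun k _ => HasDerivAt.fun_sum fun β _ => ((pjet_jet n h k β).hasDerivAt r y t).const_mul (cA A i k α β y)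
  have h6 := h4.unique h5
  rw [h2, ← h6, ← map_smul]
  rw [ContinuousLinearMap.comp_apply, ← map_add]
  congr 1
  ext <;> simp

theorem tauA_apply (A : Coeffs d m) (v : Euc d) (e : CE d m) (α : Fin m) : (conS d m A).τa v e α = ∑ i, (v i : ℂ) * e (i, α) := by
  classical
  have h := (conS d m A).inner_τa v (EuclideanSpace.single α 1) e
  rw [EuclideanSpace.inner_single_left] at h
  simp only [map_one, one_mul] at h
  rw [h]
  rw [PiLp.inner_apply, Fintype.sum_prod_type]
  refine Finset.sum_congr rfl fun i _ => ?_
  have e1 : ∀ β, ((conS d m A).τ v (EuclideanSpace.single α 1)) (i, β) = (v i : ℂ) * (EuclideanSpace.single α (1:ℂ) : CW m) β := fun β => rfl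
  simp only [e1]
  rw [Finset.sum_eq_single α]
  · simp [mul_comm]
  · intro β _ hβ; simp [hβ]
  · simp

theorem fc_eq_zero {f : Euc d → ℂ} (hf : Continuous f) (hp : Per f) (h : ∀ ξ, fc f ξ = 0) (θ : Euc d) : f θ = 0 := by
  have h1 := fourier_inversion hf hp (by simp only [h]; exact summable_zero) θ
  simp only [h, zero_mul] at h1
  exact h1.unique hasSum_zero

theorem fc_add' {f g : Euc d → ℂ} (hf : Continuous f) (hg : Continuous g) (c : ℂ) (ξ) : fc (fun θ => f θ + c * g θ) ξ = fc f ξ + c * fc g ξ := by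
  unfold fc
  have := ec_continuous (-ξ)
  have e : ∀ θ, ec (-ξ) θ * (f θ + c * g θ) = ec (-ξ) θ * f θ + c * (ec (-ξ) θ * g θ) := fun θ => by ring
  simp only [e]
  rw [integral_add (cell_integrable (by fun_prop)) (cell_integrable (by fun_prop)), integral_const_mul]

theorem fc_sum' {ι : Type*} [Fintype ι] {f : ι → Euc d → ℂ} (hf : ∀ i, Continuous (f i)) (c : ι → ℂ) (ξ) : fc (fun θ => ∑ i, c i * f i θ) ξ = ∑ i, c i * fc (f i) ξ := by
  unfold fc
  have := ec_continuous (-ξ)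
  have e : ∀ θ, ec (-ξ) θ * (∑ i, c i * f i θ) = ∑ i, c i * (ec (-ξ) θ * f i θ) := fun θ => by
    rw [Finset.mul_sum]; exact Finset.sum_congr rfl fun i _ => by ring
  simp only [e]
  rw [integral_finset_sum _ fun i _ => cell_integrable (by have := hf i; fun_prop)]
  simp only [integral_const_mul]

theorem div_QC (A : Coeffs d m) (n : Euc d) {u : ℕ → (Fin d → ℤ) → ℝ → CW m} (h : ∀ β, Jet (ujet u β)) {κ f g} (hL : (conS d m A).LS n κ f g u)
    (α : Fin m) (y : Euc d) (t : ℝ) (ht : 0 ≤ t) : ∑ i, fderiv ℝ (QC A n u 0 i α) (y, t) (EuclideanSpace.single i 1, - n i) = 0 := by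
  have hsm : ∀ i r, ContDiff ℝ (⊤ : ℕ∞) (fun y => QC A n u r i α (y, t)) := fun i r => (QC_smooth A n h r i α).comp (by fun_prop)
  have hcf : ∀ i, Continuous fun y => fderiv ℝ (fun y => QC A n u 0 i α (y, t)) y (EuclideanSpace.single i 1) := fun i =>
    (((hsm i 0).continuous_fderiv (by simp)).clm_apply continuous_const)
  have hc1 : ∀ i, Continuous fun y => QC A n u 1 i α (y, t) := fun i => (hsm i 1).continuous
  have key : ∀ y, (∑ i, (1:ℂ) * fderiv ℝ (fun y => QC A n u 0 i α (y, t)) y (EuclideanSpace.single i 1)) + (-1:ℂ) * (∑ i, (n i : ℂ) * QC A n u 1 i α (y, t)) = 0 := by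
    refine fc_eq_zero (by fun_prop) ?_ ?_
    · intro θ z
      have h1 : ∀ i, fderiv ℝ (fun y => QC A n u 0 i α (y, t)) (θ + zvec z) = fderiv ℝ (fun y => QC A n u 0 i α (y, t)) θ := fun i =>
        per_fderiv (QC_per A n u 0 i α t) θ z
      have h2 : ∀ i, QC A n u 1 i α (θ + zvec z, t) = QC A n u 1 i α (θ, t) := fun i => QC_per A n u 1 i α t θ z
      simp only [h1, h2]
    · intro ξ
      rw [fc_add' (by fun_prop) (by fun_prop), fc_sum' hcf, fc_sum' hc1]
      have h1 : ∀ i, fc (fun y => fderiv ℝ (fun y => QC A n u 0 i α (y, t)) y (EuclideanSpace.single i 1)) ξ =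
          tpi * ((ξ i : ℝ) : ℂ) * fc (fun y => QC A n u 0 i α (y, t)) ξ := fun i => by
        rw [fc_fderiv ((hsm i 0).of_le (by exact_mod_cast le_top)) (QC_per A n u 0 i α t)]
        have : zdot ξ (EuclideanSpace.single i 1) = (ξ i : ℝ) := by simp [zdot]
        rw [this]; rfl
      simp only [h1, fc_QC A n h]
      have h2 := congrArg (fun w : CW m => w α) (hL.eqn ξ t ht)
      simp only [PiLp.smul_apply, smul_eq_mul, tauA_apply, zvec_apply] at h2
      rw [h2, Finset.mul_sum, neg_one_mul, ← sub_eq_add_neg, sub_eq_zero]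
      refine Finset.sum_congr rfl fun i _ => by ring
  rw [← key y, Finset.mul_sum, ← Finset.sum_add_distrib]
  refine Finset.sum_congr rfl fun i _ => ?_
  rw [QC_fderiv A n h, Complex.real_smul]
  push_cast
  ring

theorem bc_QC (A : Coeffs d m) (n : Euc d) {u : ℕ → (Fin d → ℤ) → ℝ → CW m} (h : ∀ β, Jet (ujet u β)) {κ f T} {φ : Euc d → Fin m → ℝ}
    (hφ : ContDiff ℝ (⊤ : ℕ∞) φ) (hp : Per φ) (hL : (conS d m A).LS n κ f (gdat φ T) u)
    (α : Fin m) (y : Euc d) : ∑ i, (n i : ℂ) * QC A n u 0 i α (y, 0) = fderiv ℝ (cphi φ α) y T := by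
  have hsm : ∀ i r, ContDiff ℝ (⊤ : ℕ∞) (fun y => QC A n u r i α (y, 0)) := fun i r => (QC_smooth A n h r i α).comp (by fun_prop)
  have hc1 : ∀ i, Continuous fun y => QC A n u 0 i α (y, 0) := fun i => (hsm i 0).continuous
  have hc2 : Continuous fun y => fderiv ℝ (cphi φ α) y T := ((cphi_smooth hφ α).continuous_fderiv (by simp)).clm_apply continuous_const
  have key : ∀ y, (∑ i, (n i : ℂ) * QC A n u 0 i α (y, 0)) + (-1:ℂ) * fderiv ℝ (cphi φ α) y T = 0 := by
    refine fc_eq_zero (by fun_prop) ?_ ?_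
    · intro θ z
      have h2 : ∀ i, QC A n u 0 i α (θ + zvec z, 0) = QC A n u 0 i α (θ, 0) := fun i => QC_per A n u 0 i α 0 θ z
      simp only [h2, per_fderiv (cphi_per hp α) θ z]
    · intro ξ
      rw [fc_add' (by fun_prop) (by fun_prop), fc_sum' hc1, gdat_fc hφ hp]
      simp only [fc_QC A n h]
      have h2 := congrArg (fun w : CW m => w α) (hL.bc ξ)
      simp only [tauA_apply] at h2
      rw [h2]; ring
  have := key y
  linear_combination this
end

end

section
open scoped Pointwise
set_option linter.all false

section
variable {d m : ℕ}

/-- the shear -/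
def shL (n : Euc d) : (Euc d × ℝ) →L[ℝ] (Euc d × ℝ) :=
  (ContinuousLinearMap.fst ℝ (Euc d) ℝ - (ContinuousLinearMap.snd ℝ (Euc d) ℝ).smulRight n).prod (ContinuousLinearMap.snd ℝ (Euc d) ℝ)

theorem shL_apply (n : Euc d) (p : Euc d × ℝ) : shL n p = (p.1 - p.2 • n, p.2) := by
  ext <;> simp [shL]

theorem shL_wv (n : Euc d) (j : Fin d) : shL n (wv n j) = (EuclideanSpace.single j 1, - n j) := by
  rw [shL_apply]; unfold wv; ext <;> simp

/-- the jets of the lifted solution -/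
def ajet (n : Euc d) (u : ℕ → (Fin d → ℤ) → ℝ → CW m) (β : Fin m) : ℕ → (Fin d → ℤ) → ℝ → ℂ := fun j ξ t => twa n u j ξ t β

theorem ajet_jet (n : Euc d) (hn : ‖n‖ = 1) {u : ℕ → (Fin d → ℤ) → ℝ → CW m} (h1 : ∀ i ξ t, HasDerivAt (u i ξ) (u (i + 1) ξ t) t)
    (h2 : ∀ k i : ℕ, ∃ C, ∀ ξ t, jb ξ ^ k * ‖u i ξ t‖ ≤ C) (β : Fin m) : Jet (ajet n u β) := by
  refine ⟨fun j ξ t => coord_hasDerivAt (twa_der n h1 j ξ t) β, fun k j => ?_⟩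
  obtain ⟨C, hC⟩ := tw_bd n hn h2 j k 0
  refine ⟨C, fun ξ t => le_trans ?_ (hC ξ t)⟩
  have := jb_pos ξ
  rw [← norm_twa]
  gcongr
  exact norm_coord_le _ _

theorem syn_ajet (n : Euc d) (u : ℕ → (Fin d → ℤ) → ℝ → CW m) (β : Fin m) (p : Euc d × ℝ) :
    syn (ajet n u β) 0 p.1 p.2 = syn (ujet u β) 0 (shL n p).1 (shL n p).2 := by
  rw [shL_apply]
  unfold syn
  refine tsum_congr fun ξ => ?_
  simp only [ajet, ujet, twa, tw]
  rw [sub_eq_add_neg, ec_add_right, PiLp.smul_apply, smul_eq_mul]; ring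

/-- the solution -/
def Fsol (n : Euc d) (u : ℕ → (Fin d → ℤ) → ℝ → CW m) (β : Fin m) (p : Euc d × ℝ) : ℝ := (syn (ajet n u β) 0 p.1 p.2).re

theorem re_comp_fderiv {F : Euc d × ℝ → ℂ} (n : Euc d) {G : Euc d × ℝ → ℝ} (hG : ∀ p, G p = (F (shL n p)).re) (hF : Differentiable ℝ F) (p v : Euc d × ℝ) :
    fderiv ℝ G p v = (fderiv ℝ F (shL n p) (shL n v)).re := by
  have e : G = fun p => Complex.reCLM (F (shL n p)) := funext hG
  rw [e]
  have h1 : HasFDerivAt (fun p => F (shL n p)) ((fderiv ℝ F (shL n p)).comp (shL n)) p := HasFDerivAt.comp (g := F) p (hF _).hasFDerivAt (shL n).hasFDerivAt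
  have h2 := Complex.reCLM.hasFDerivAt.comp p h1
  have h3 := h2.fderiv
  have h4 : fderiv ℝ (fun p => Complex.reCLM (F (shL n p))) p = Complex.reCLM.comp ((fderiv ℝ F (shL n p)).comp (shL n)) := h3
  rw [h4]; rfl

theorem Fsol_wv (n : Euc d) {u : ℕ → (Fin d → ℤ) → ℝ → CW m} (h : ∀ β, Jet (ujet u β)) (k : Fin d) (β : Fin m) (p : Euc d × ℝ) :
    fderiv ℝ (Fsol n u β) p (wv n k) = (syn (pjet n u k β) 0 (shL n p).1 (shL n p).2).re := by
  have hd : Differentiable ℝ (fun p : Euc d × ℝ => syn (ujet u β) 0 p.1 p.2) := fun p => ((h β).hasFDerivAt 0 p).differentiableAt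
  rw [re_comp_fderiv (F := fun p => syn (ujet u β) 0 p.1 p.2) n (fun p => by unfold Fsol; rw [syn_ajet]) hd, shL_wv, syn_pjet n h]

theorem Rf_sol (A : Coeffs d m) (n : Euc d) {u : ℕ → (Fin d → ℤ) → ℝ → CW m} (h : ∀ β, Jet (ujet u β)) (i : Fin d) (α : Fin m) (p : Euc d × ℝ) :
    Rf A n (Fsol n u) i α p = (QC A n u 0 i α (shL n p)).re := by
  unfold Rf QC
  simp only [Complex.re_sum]
  refine Finset.sum_congr rfl fun k _ => Finset.sum_congr rfl fun β _ => ?_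
  rw [Fsol_wv n h]
  unfold cA
  rw [Complex.re_ofReal_mul, shL_apply]

theorem sol_neu (A : Coeffs d m) {hd : 0 < d} (n : Euc d) (hn : ‖n‖ = 1) {M : Fin d → Fin d → ℝ} (hM : IsOrtho M) (hl : LastColNeg hd n M)
    {T : Euc d} {φ : Euc d → Fin m → ℝ} (hφ : ContDiff ℝ (⊤ : ℕ∞) φ) (hp : Per φ)
    {u : ℕ → (Fin d → ℤ) → ℝ → CW m} (h1 : ∀ i ξ t, HasDerivAt (u i ξ) (u (i + 1) ξ t) t)
    (h2 : ∀ k i : ℕ, ∃ C, ∀ ξ t, jb ξ ^ k * ‖u i ξ t‖ ≤ C) {κ f} (hL : (conS d m A).LS n κ f (gdat φ T) u) :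
    IsLiftedNeuSol hd A n M (fun θ α => ∑ i, T i * pder i (fun x => φ x α) θ) (fun θ t α => Fsol n u α (θ, t)) := by
  have hu : ∀ β, Jet (ujet u β) := ujet_jet h1 h2
  have ha : ∀ β, Jet (ajet n u β) := ajet_jet n hn h1 h2
  have hF : ∀ β, ContDiff ℝ (⊤ : ℕ∞) (Fsol n u β) := fun β => Complex.reCLM.contDiff.comp ((ha β).contDiff 0)
  refine ⟨contDiff_pi.2 fun β => hF β, ?_, ?_, ?_⟩
  · intro θ z t
    funext α
    have : syn (ajet n u α) 0 (θ + zvec z) t = syn (ajet n u α) 0 θ t := syn_per 0 t θ z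
    simp only [Fsol, this]
  · intro θ t ht α
    rw [liftOp_eq A hM hl (fun a b β => rfl) hF]
    have h3 : ∀ i, fderiv ℝ (Rf A n (Fsol n u) i α) (θ, t) (wv n i) = (fderiv ℝ (QC A n u 0 i α) (θ - t • n, t) (EuclideanSpace.single i 1, - n i)).re := fun i => by
      rw [re_comp_fderiv (F := QC A n u 0 i α) n (Rf_sol A n hu i α) ((QC_smooth A n hu 0 i α).differentiable (by simp)), shL_wv, shL_apply]
    simp only [h3]
    rw [← Complex.re_sum, div_QC A n hu hL α _ t ht.le]; rfl
  · intro θ α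
    rw [flux_eq A hM hl (fun a b β => rfl) hF]
    have h3 := congrArg Complex.re (bc_QC A n hu hφ hp hL α θ)
    have h4 : ∀ i, M i (lastIdx d hd) * Rf A n (Fsol n u) i α (θ, 0) = - ((n i : ℂ) * QC A n u 0 i α (θ, 0)).re := fun i => by
      rw [hl i, Rf_sol A n hu, shL_apply, Complex.re_ofReal_mul]; simp
    simp only [h4]
    rw [Finset.sum_neg_distrib, neg_neg, ← Complex.re_sum, h3]
    have h5 : HasFDerivAt (fun x => φ x α) (fderiv ℝ (fun x => φ x α) θ) θ := ((contDiff_pi.1 hφ α).differentiable (by simp) θ).hasFDerivAt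
    have h6 : fderiv ℝ (cphi φ α) θ = Complex.ofRealCLM.comp (fderiv ℝ (fun x => φ x α) θ) := (Complex.ofRealCLM.hasFDerivAt.comp θ h5).fderiv
    rw [h6]
    show (((fderiv ℝ (fun x => φ x α) θ T : ℝ) : ℂ)).re = _
    rw [Complex.ofReal_re]
    have h7 : T = ∑ i, T i • (EuclideanSpace.single i 1 : Euc d) := by
      ext r
      simp only [WithLp.ofLp_sum, WithLp.ofLp_smul, Finset.sum_apply, Pi.smul_apply, PiLp.single_apply, smul_eq_mul, mul_ite, mul_one, mul_zero,
        Finset.sum_ite_eq, Finset.mem_univ, if_true]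
    conv_lhs => rw [h7]
    rw [map_sum]
    simp only [map_smul, smul_eq_mul]; rfl
end

end

section
open scoped Pointwise
set_option linter.all false

section
variable {d m : ℕ}

/-- symbol of tangential derivative -/
def nsym (M : Fin d → Fin d → ℝ) (k : Fin d) (ξ : Fin d → ℤ) : ℂ := ∑ i, (M i k : ℂ) * dsym i ξ

theorem nsym_le {hd : 0 < d} {n : Euc d} {M : Fin d → Fin d → ℝ} (hM : IsOrtho M) (hl : LastColNeg hd n M) {k : Fin d} (hk : k ≠ lastIdx d hd) (ξ) :
    ‖nsym M k ξ‖ ≤ 2 * Real.pi * ‖perp n ξ‖ := by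
  let v : Euc d := WithLp.toLp 2 fun i => M i k
  have h1 : nsym M k ξ = tpi * ((zdot ξ v : ℝ) : ℂ) := by
    unfold nsym zdot dsym
    push_cast
    rw [Finset.mul_sum]
    refine Finset.sum_congr rfl fun i _ => ?_
    show _ = tpi * ((ξ i : ℂ) * ((M i k : ℝ) : ℂ))
    ring
  have h2 : dotp v n = 0 := by
    have := hM k (lastIdx d hd)
    rw [if_neg hk] at this
    simp only [hl _, mul_neg, Finset.sum_neg_distrib, neg_eq_zero] at this
    exact this
  have h3 : ∑ i, v i ^ 2 ≤ 1 := by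
    have := hM k k
    rw [if_pos rfl] at this
    rw [← this]
    exact le_of_eq (Finset.sum_congr rfl fun i _ => by show M i k ^ 2 = _; ring)
  rw [h1, norm_mul, norm_tpi, Complex.norm_real, Real.norm_eq_abs]
  have := zdot_tan n v h2 h3 ξ
  have := Real.pi_pos
  gcongr

theorem syn_nsym {M : Fin d → Fin d → ℝ} {b : ℕ → (Fin d → ℤ) → ℝ → ℂ} (h : Jet b) {hd : 0 < d} {k : Fin d} (hk : k ≠ lastIdx d hd) (j : ℕ) (θ : Euc d) (t : ℝ) :
    liftD hd M k (fun θ t => (syn b j θ t).re) θ t = (∑' ξ, (nsym M k ξ * b j ξ t) * ec ξ θ).re := by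
  unfold liftD
  rw [if_neg hk]
  simp only [h.re_pder]
  have h1 : ∀ i, M i k * (syn (cmulj (dsym i) b) j θ t).re = (∑' ξ, (M i k : ℂ) * (cmulj (dsym i) b j ξ t * ec ξ θ)).re := fun i => by
    rw [tsum_mul_left, Complex.re_ofReal_mul]; rfl
  simp only [h1]
  rw [← Complex.re_sum, ← Summable.tsum_finsetSum fun i _ => ((h.dsym i).summ' j θ t).mul_left _]
  congr 1
  refine tsum_congr fun ξ => ?_
  unfold nsym cmulj
  rw [Finset.sum_mul, Finset.sum_mul]
  exact Finset.sum_congr rfl fun i _ => by ring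

/-- the summation constant -/
def Zc (d : ℕ) : ℝ := ∑' ξ : Fin d → ℤ, (jb ξ ^ (2 * d))⁻¹

theorem Zc_nonneg (d : ℕ) : 0 ≤ Zc d := tsum_nonneg fun ξ => by have := jb_pos ξ; positivity

theorem ser_le {c : (Fin d → ℤ) → ℂ} {X : ℝ} (h : ∀ ξ, ‖c ξ‖ ≤ X * (jb ξ ^ (2 * d))⁻¹) (θ : Euc d) : |(∑' ξ, c ξ * ec ξ θ).re| ≤ X * Zc d := by
  refine (Complex.abs_re_le_norm _).trans ?_
  refine tsum_of_norm_bounded (jb_summable0.hasSum.mul_left X) fun ξ => ?_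
  rw [norm_mul, norm_ec, mul_one]; exact h ξ

theorem ser_sq {c : (Fin d → ℤ) → ℂ} (hc : Summable fun ξ => ‖c ξ‖) {Φ : (Fin d → ℤ) → ℝ} (hΦ : Summable Φ) (h : ∀ ξ, ‖c ξ‖ ^ 2 ≤ Φ ξ) :
    ∫ θ in unitCell d, ((∑' ξ, c ξ * ec ξ θ).re) ^ 2 ≤ ∑' ξ, Φ ξ := by
  have h1 := fser_parseval hc
  have hcont := fser_cont hc
  calc _ ≤ ∫ θ in unitCell d, ‖∑' η, c η * ec η θ‖ ^ 2 := by
        refine integral_mono (cell_integrable ((Complex.continuous_re.comp hcont).pow 2)) (cell_integrable (hcont.norm.pow 2)) fun θ => ?_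
        exact sq_le_sq' (by have := Complex.abs_re_le_norm (∑' ξ, c ξ * ec ξ θ); linarith [neg_abs_le (∑' ξ, c ξ * ec ξ θ).re])
          (Complex.re_le_norm _)
    _ = ∑' ξ, ‖c ξ‖ ^ 2 := h1.tsum_eq.symm
    _ ≤ _ := h1.summable.tsum_le_tsum h hΦ

theorem gen_int {ι : Type*} [Countable ι] {Φ : ι → ℝ → ℝ} (hc : ∀ ξ, Continuous (Φ ξ)) (h0 : ∀ ξ t, 0 ≤ Φ ξ t)
    (hs : ∀ t, 0 ≤ t → Summable fun ξ => Φ ξ t) {B : ℝ} (hB : ∀ (Λ : Finset ι) T, 0 ≤ T → ∫ t in (0:ℝ)..T, ∑ ξ ∈ Λ, Φ ξ t ≤ B)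
    {e : ℝ → ℝ} (he0 : ∀ t, 0 ≤ e t) (he : ∀ t, 0 < t → e t ≤ ∑' ξ, Φ ξ t) : ∫ t in Set.Ioi (0:ℝ), e t ≤ B := by
  have hB0 : 0 ≤ B := by simpa using hB ∅ 0 le_rfl
  by_cases hi : IntegrableOn e (Set.Ioi 0)
  swap
  · rw [integral_undef hi]; exact hB0
  have h1 : ∀ Λ : Finset ι, ∫⁻ t in Set.Ioi (0:ℝ), ENNReal.ofReal (∑ ξ ∈ Λ, Φ ξ t) ≤ ENNReal.ofReal B := by
    intro Λ
    have hcc : Continuous fun t => ∑ ξ ∈ Λ, Φ ξ t := continuous_finsetSum _ fun ξ _ => hc ξ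
    have hnn : ∀ t, 0 ≤ ∑ ξ ∈ Λ, Φ ξ t := fun t => Finset.sum_nonneg fun ξ _ => h0 ξ t
    have hI : IntegrableOn (fun t => ∑ ξ ∈ Λ, Φ ξ t) (Set.Ioi 0) := by
      refine integrableOn_Ioi_of_intervalIntegral_norm_bounded (l := Filter.atTop) (b := fun T : ℝ => T) B 0 (fun T => ?_) Filter.tendsto_id ?_
      · exact (hcc.integrableOn_Icc (a := 0) (b := T)).mono_set Set.Ioc_subset_Icc_self
      · filter_upwards [Filter.eventually_ge_atTop 0] with T hT
        simp only [Real.norm_eq_abs, abs_of_nonneg (hnn _)]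
        exact hB Λ T hT
    rw [← ofReal_integral_eq_lintegral_ofReal hI (Filter.Eventually.of_forall hnn)]
    refine ENNReal.ofReal_le_ofReal ?_
    refine le_of_tendsto (intervalIntegral_tendsto_integral_Ioi 0 hI Filter.tendsto_id) ?_
    filter_upwards [Filter.eventually_ge_atTop 0] with T hT
    exact hB Λ T hT
  have h2 : ∫⁻ t in Set.Ioi (0:ℝ), ENNReal.ofReal (e t) ≤ ENNReal.ofReal B := by
    calc _ ≤ ∫⁻ t in Set.Ioi (0:ℝ), ∑' ξ, ENNReal.ofReal (Φ ξ t) := by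
          refine setLIntegral_mono' measurableSet_Ioi fun t ht => ?_
          rw [← ENNReal.ofReal_tsum_of_nonneg (fun ξ => h0 ξ t) (hs t (le_of_lt ht))]
          exact ENNReal.ofReal_le_ofReal (he t ht)
      _ = ∑' ξ, ∫⁻ t in Set.Ioi (0:ℝ), ENNReal.ofReal (Φ ξ t) :=
          lintegral_tsum fun ξ => ((hc ξ).measurable.ennreal_ofReal).aemeasurable
      _ ≤ _ := by
          rw [ENNReal.tsum_eq_iSup_sum]
          refine iSup_le fun Λ => ?_
          rw [← lintegral_finsetSum' _ fun ξ _ => ((hc ξ).measurable.ennreal_ofReal).aemeasurable]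
          refine le_trans (le_of_eq ?_) (h1 Λ)
          refine lintegral_congr fun t => ?_
          rw [ENNReal.ofReal_sum_of_nonneg fun ξ _ => h0 ξ t]
  rw [← ofReal_integral_eq_lintegral_ofReal hi (Filter.Eventually.of_forall he0)] at h2
  exact (ENNReal.ofReal_le_ofReal_iff hB0).1 h2
end

end

section
open scoped Pointwise
set_option linter.all false

section
variable {d m : ℕ}

/-- context of estimates -/
structure Ctx (hd : 0 < d) (A : Coeffs d m) (n : Euc d) (κ : ℝ) (M : Fin d → Fin d → ℝ) (T : Euc d) (φ : Euc d → Fin m → ℝ)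
    (u : ℕ → (Fin d → ℤ) → ℝ → CW m) : Prop where
  hn : ‖n‖ = 1
  hM : IsOrtho M
  hl : LastColNeg hd n M
  hφ : ContDiff ℝ (⊤ : ℕ∞) φ
  hp : Per φ
  h1 : ∀ i ξ t, HasDerivAt (u i ξ) (u (i + 1) ξ t) t
  h2 : ∀ k i : ℕ, ∃ C, ∀ ξ t, jb ξ ^ k * ‖u i ξ t‖ ≤ C
  hL : (conS d m A).LS n κ (fun ξ => ‖phat φ ξ‖) (gdat φ T) u

variable {hd : 0 < d} {A : Coeffs d m} {n : Euc d} {κ : ℝ} {M : Fin d → Fin d → ℝ} {T : Euc d} {φ : Euc d → Fin m → ℝ}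
    {u : ℕ → (Fin d → ℤ) → ℝ → CW m}

theorem Ctx.aj (c : Ctx hd A n κ M T φ u) (α : Fin m) : Jet (ajet n u α) := ajet_jet n c.hn c.h1 c.h2 α

theorem Ctx.dt (c : Ctx hd A n κ M T φ u) (l : List (Fin d)) (j : ℕ) (α : Fin m) :
    dthMulti l (dtj j fun a b => Fsol n u α (a, b)) = fun θ t => (syn (cmulj (lsym l) (ajet n u α)) j θ t).re := by
  have h1 := (c.aj α).re_dtj j 0
  have h2 := (c.aj α).re_dthMulti l j
  rw [zero_add] at h1
  rw [← h2, ← h1]; rfl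

/-- the controlled quantity -/
def Dq (A : Coeffs d m) (n : Euc d) (u : ℕ → (Fin d → ℤ) → ℝ → CW m) (j : ℕ) (ξ : Fin d → ℤ) (t : ℝ) : ℝ := ‖(conS d m A).pj n (tw n u j) 0 t ξ‖

theorem Dq_nonneg (j ξ) (t : ℝ) : 0 ≤ Dq A n u j ξ t := norm_nonneg _

theorem Ctx.tan_coef (c : Ctx hd A n κ M T φ u) (l : List (Fin d)) (j : ℕ) (α : Fin m) {k : Fin d} (hk : k ≠ lastIdx d hd) (ξ) (t : ℝ) :
    ‖nsym M k ξ * cmulj (lsym l) (ajet n u α) j ξ t‖ ≤ (2 * Real.pi) ^ l.length * (jb ξ ^ l.length * Dq A n u j ξ t) := by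
  have h1 := nsym_le c.hM c.hl hk ξ
  have h2 := lsym_le l ξ
  have h3 := (conS d m A).twa_1 n c.hn u j ξ t
  have h4 : ‖ajet n u α j ξ t‖ ≤ ‖twa n u j ξ t‖ := norm_coord_le _ _
  have := jb_pos ξ
  have := Real.pi_pos
  unfold cmulj Dq
  rw [norm_mul, norm_mul]
  calc _ ≤ (2 * Real.pi * ‖perp n ξ‖) * (((2 * Real.pi) ^ l.length * jb ξ ^ l.length) * ‖twa n u j ξ t‖) := by gcongr
    _ = (2 * Real.pi) ^ l.length * (jb ξ ^ l.length * (2 * Real.pi * ‖perp n ξ‖ * ‖twa n u j ξ t‖)) := by ring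
    _ ≤ _ := by gcongr

theorem Ctx.t_coef (c : Ctx hd A n κ M T φ u) (l : List (Fin d)) (j : ℕ) (α : Fin m) (ξ) (t : ℝ) :
    ‖cmulj (lsym l) (ajet n u α) (j+1) ξ t‖ ≤ (2 * Real.pi) ^ l.length * (jb ξ ^ l.length * Dq A n u j ξ t) := by
  have h2 := lsym_le l ξ
  have h3 := (conS d m A).twa_2 n c.hn u j ξ t
  have h4 : ‖ajet n u α (j+1) ξ t‖ ≤ ‖twa n u (j+1) ξ t‖ := norm_coord_le _ _
  have := jb_pos ξ
  have := Real.pi_pos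
  unfold cmulj Dq
  rw [norm_mul]
  calc _ ≤ ((2 * Real.pi) ^ l.length * jb ξ ^ l.length) * ‖twa n u (j+1) ξ t‖ := by gcongr
    _ ≤ ((2 * Real.pi) ^ l.length * jb ξ ^ l.length) * ‖(conS d m A).pj n (tw n u j) 0 t ξ‖ := by gcongr
    _ = _ := by ring

theorem Ctx.data (c : Ctx hd A n κ M T φ u) {s k : ℕ} (hk : s ≤ k) (Λ) : Ns Λ s (fun ξ => ‖phat φ ξ‖) ≤ cdat d m s * CkNorm k φ ^ 2 := by
  refine (phat_Ns c.hφ c.hp s Λ).trans ?_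
  have := cdat_pos d m s
  have := CkNorm_mono φ hk
  have := CkNorm_nonneg s φ
  gcongr

/-- pointwise constant -/
def Cp (A : Coeffs d m) (s j ℓ : ℕ) : ℝ := Real.sqrt ((conS d m A).Cm' s j (2 * ℓ) * cdat d m (s + j + 2 * ℓ + 2))

theorem Cp_pos (s j ℓ : ℕ) : 0 < Cp A s j ℓ := Real.sqrt_pos.2 (mul_pos ((conS d m A).Cm'_pos _ _ _) (cdat_pos _ _ _))

theorem Ctx.Dq_le (c : Ctx hd A n κ M T φ u) (s j ℓ k : ℕ) (hk : s + j + 2 * ℓ + 2 ≤ k) (ξ) (t : ℝ) (ht : 0 ≤ t) :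
    jb ξ ^ s * Dq A n u j ξ t ≤ Cp A s j ℓ * CkNorm k φ * ((1 + κ * t) ^ ℓ)⁻¹ := by
  have h := c.hL.tpb (conS d m A) s j ℓ (fun Λ => c.data hk Λ) ξ t ht
  have hκ := c.hL.κpos
  rw [← mul_assoc ((conS d m A).Cm' s j (2 * ℓ)), Real.sqrt_mul' _ (sq_nonneg _), Real.sqrt_sq (CkNorm_nonneg _ _)] at h
  rw [← div_eq_mul_inv, le_div_iff₀ (by positivity), mul_comm]
  exact h

theorem Ctx.Dq_cont (c : Ctx hd A n κ M T φ u) (j ξ) : Continuous (Dq A n u j ξ) :=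
  ((conS d m A).pj_cont n (tw_der n c.h1 j) 0 ξ).norm

theorem Ctx.est1 (c : Ctx hd A n κ M T φ u) (l : List (Fin d)) (j : ℕ) :
    (∫ t in Set.Ioi (0:ℝ), ∫ θ in unitCell d,
              (∑ α, ∑ k ∈ tanIdx d hd,
                  (liftD hd M k (dthMulti l (dtj j fun a b => Fsol n u α (a, b))) θ t) ^ 2)
                + ∑ α, (dthMulti l (dtj (j + 1) fun a b => Fsol n u α (a, b)) θ t) ^ 2)
      ≤ (m * (d + 1) * (2 * Real.pi) ^ (2 * l.length) * (conS d m A).Ci' l.length j * cdat d m (l.length + j + 1)) * CkNorm (l.length + j + 1) φ ^ 2 := by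
  have hpi := Real.pi_pos
  set P : ℝ := (2 * Real.pi) ^ (2 * l.length) with hP
  have hP0 : 0 < P := by positivity
  let Φ : (Fin d → ℤ) → ℝ → ℝ := fun ξ t => P * (jb ξ ^ (2 * l.length) * Dq A n u j ξ t ^ 2)
  have hΦ0 : ∀ ξ t, 0 ≤ Φ ξ t := fun ξ t => by have := jb_pos ξ; positivity
  have hsq : ∀ ξ (t : ℝ) (x : ℂ), ‖x‖ ≤ (2 * Real.pi) ^ l.length * (jb ξ ^ l.length * Dq A n u j ξ t) → ‖x‖ ^ 2 ≤ Φ ξ t := by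
    intro ξ t x hx
    calc ‖x‖ ^ 2 ≤ ((2 * Real.pi) ^ l.length * (jb ξ ^ l.length * Dq A n u j ξ t)) ^ 2 := by gcongr
      _ = _ := by simp only [Φ, hP]; ring
  have hΦs : ∀ t, 0 ≤ t → Summable fun ξ => Φ ξ t := by
    intro t ht
    refine Summable.mul_left P ?_
    let C := Cp A (l.length + d) j 0 * CkNorm (l.length + d + j + 2 * 0 + 2) φ
    refine Summable.of_nonneg_of_le (fun ξ => by have := jb_pos ξ; positivity) (fun ξ => ?_) (jb_summable0.mul_left (C ^ 2))
    have h := c.Dq_le (l.length + d) j 0 _ le_rfl ξ t ht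
    rw [pow_zero, inv_one, mul_one] at h
    have hj := jb_pos ξ
    have hD := Dq_nonneg (A := A) (n := n) (u := u) j ξ t
    rw [← div_eq_mul_inv, le_div_iff₀ (by positivity)]
    calc _ = (jb ξ ^ (l.length + d) * Dq A n u j ξ t) ^ 2 := by ring
      _ ≤ C ^ 2 := by gcongr
  have hkey := gen_int (Φ := fun ξ t => (m * (d + 1)) * Φ ξ t) (B := (m * (d + 1) * P * (conS d m A).Ci' l.length j * cdat d m (l.length + j + 1)) * CkNorm (l.length + j + 1) φ ^ 2)
    (e := fun t => ∫ θ in unitCell d, (∑ α, ∑ k ∈ tanIdx d hd,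
                  (liftD hd M k (dthMulti l (dtj j fun a b => Fsol n u α (a, b))) θ t) ^ 2)
                + ∑ α, (dthMulti l (dtj (j + 1) fun a b => Fsol n u α (a, b)) θ t) ^ 2) ?_ ?_ ?_ ?_ ?_ ?_
  · exact hkey
  · intro ξ
    exact continuous_const.mul (continuous_const.mul (continuous_const.mul ((c.Dq_cont j ξ).pow 2)))
  · intro ξ t; have := hΦ0 ξ t; positivity
  · intro t ht; exact (hΦs t ht).mul_left _
  · intro Λ T hT
    have h1 := c.hL.tbi (conS d m A) c.h1 l.length j (fun Λ => c.data le_rfl Λ) Λ T hT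
    have e1 : ∀ t, ∑ ξ ∈ Λ, (m * (d + 1)) * Φ ξ t = ((m * (d + 1)) * P) * Ns Λ l.length ((conS d m A).pj n (tw n u j) 0 t) := fun t => by
      unfold Ns
      rw [Finset.mul_sum]
      exact Finset.sum_congr rfl fun ξ _ => by simp only [Φ, Dq]; ring
    simp only [e1]
    rw [intervalIntegral.integral_const_mul]
    calc _ ≤ (m * (d + 1)) * P * ((conS d m A).Ci' l.length j * (cdat d m (l.length + j + 1) * CkNorm (l.length + j + 1) φ ^ 2)) := by gcongr
      _ = _ := by ring
  · intro t
    exact integral_nonneg fun θ => by positivity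
  · intro t ht
    have hJ : ∀ α, Jet (cmulj (lsym l) (ajet n u α)) := fun α => (c.aj α).lsym l
    have e1 : ∀ θ, (∑ α, ∑ k ∈ tanIdx d hd, (liftD hd M k (dthMulti l (dtj j fun a b => Fsol n u α (a, b))) θ t) ^ 2)
                + ∑ α, (dthMulti l (dtj (j + 1) fun a b => Fsol n u α (a, b)) θ t) ^ 2 =
          (∑ α, ∑ k ∈ tanIdx d hd, ((∑' ξ, (nsym M k ξ * cmulj (lsym l) (ajet n u α) j ξ t) * ec ξ θ).re) ^ 2)
            + ∑ α, ((∑' ξ, cmulj (lsym l) (ajet n u α) (j+1) ξ t * ec ξ θ).re) ^ 2 := by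
      intro θ
      congr 1
      · refine Finset.sum_congr rfl fun α _ => Finset.sum_congr rfl fun k hk => ?_
        rw [c.dt l j α, syn_nsym (hJ α) (Finset.mem_filter.1 hk).2]
      · refine Finset.sum_congr rfl fun α _ => ?_
        rw [c.dt l (j+1) α]; rfl
    simp only [e1]
    have hs1 : ∀ α, ∀ k ∈ tanIdx d hd, Summable fun ξ => ‖nsym M k ξ * cmulj (lsym l) (ajet n u α) j ξ t‖ := by
      intro α k hk
      have : Jet (cmulj (nsym M k) (cmulj (lsym l) (ajet n u α))) := (hJ α).cmul (r := 1) (C := 2 * Real.pi) (by positivity) fun ξ => by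
        refine (nsym_le c.hM c.hl (Finset.mem_filter.1 hk).2 ξ).trans ?_
        rw [pow_one]
        have := norm_perp_le n c.hn ξ
        gcongr
      exact this.summ j t
    have hs2 : ∀ α, Summable fun ξ => ‖cmulj (lsym l) (ajet n u α) (j+1) ξ t‖ := fun α => (hJ α).summ (j+1) t
    have hi1 : ∀ α, ∀ k ∈ tanIdx d hd, IntegrableOn (fun θ : Euc d => ((∑' ξ, (nsym M k ξ * cmulj (lsym l) (ajet n u α) j ξ t) * ec ξ θ).re) ^ 2) (unitCell d) :=
      fun α k hk => cell_integrable ((Complex.continuous_re.comp (fser_cont (hs1 α k hk))).pow 2)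
    have hi2 : ∀ α, IntegrableOn (fun θ : Euc d => ((∑' ξ, cmulj (lsym l) (ajet n u α) (j+1) ξ t * ec ξ θ).re) ^ 2) (unitCell d) :=
      fun α => cell_integrable ((Complex.continuous_re.comp (fser_cont (hs2 α))).pow 2)
    rw [integral_add (integrable_finset_sum _ fun α _ => integrable_finset_sum _ fun k hk => hi1 α k hk) (integrable_finset_sum _ fun α _ => hi2 α)]
    rw [integral_finset_sum _ fun α _ => integrable_finset_sum _ fun k hk => hi1 α k hk, integral_finset_sum _ fun α _ => hi2 α]
    set Sg := ∑' ξ, Φ ξ t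
    have hSg : 0 ≤ Sg := tsum_nonneg fun ξ => hΦ0 ξ t
    have hS := hΦs t ht.le
    calc _ ≤ (∑ α : Fin m, (d:ℝ) * Sg) + ∑ α : Fin m, Sg := by
          refine add_le_add (Finset.sum_le_sum fun α _ => ?_) (Finset.sum_le_sum fun α _ => ?_)
          · rw [integral_finset_sum _ fun k hk => hi1 α k hk]
            refine (Finset.sum_le_sum (g := fun _ => Sg) fun k hk => ?_).trans ?_
            · exact ser_sq (hs1 α k hk) hS fun ξ => hsq ξ t _ (c.tan_coef l j α (Finset.mem_filter.1 hk).2 ξ t)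
            · rw [Finset.sum_const, nsmul_eq_mul]
              have : (tanIdx d hd).card ≤ d := (Finset.card_le_univ _).trans (by simp)
              have : ((tanIdx d hd).card : ℝ) ≤ d := by exact_mod_cast this
              gcongr
          · exact ser_sq (hs2 α) hS fun ξ => hsq ξ t _ (c.t_coef l j α ξ t)
      _ = m * (d + 1) * Sg := by simp; ring
      _ = _ := by rw [tsum_mul_left]
end

end

section
open scoped Pointwise
set_option linter.all false

section
variable {d m : ℕ}
variable {hd : 0 < d} {A : Coeffs d m} {n : Euc d} {κ : ℝ} {M : Fin d → Fin d → ℝ} {T : Euc d} {φ : Euc d → Fin m → ℝ}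
    {u : ℕ → (Fin d → ℤ) → ℝ → CW m}

/-- the jet of a constant -/
def cjet (w : ℂ) : ℕ → (Fin d → ℤ) → ℝ → ℂ := fun j ξ _ => if ξ = 0 ∧ j = 0 then -w else 0

theorem cjet_jet (w : ℂ) : Jet (cjet (d := d) w) := by
  refine ⟨fun j ξ t => ?_, fun k j => ⟨‖w‖, fun ξ t => ?_⟩⟩
  · have e : cjet (d := d) w (j+1) ξ t = 0 := by simp [cjet]
    rw [e]; exact hasDerivAt_const t _
  · unfold cjet
    split_ifs with h
    · rw [h.1, jb_zero]; simp
    · simp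

theorem syn_cjet (w : ℂ) (θ : Euc d) (t : ℝ) : syn (cjet (d := d) w) 0 θ t = -w := by
  unfold syn
  rw [tsum_eq_single 0 (fun ξ h => by simp [cjet, h])]
  simp [cjet, ec_zero]

theorem sqrt_sum_le {ι : Type*} (s : Finset ι) (f : ι → ℝ) {X N : ℝ} (hX : 0 ≤ X) (hN : (s.card : ℝ) ≤ N) (h : ∀ i ∈ s, |f i| ≤ X) :
    Real.sqrt (∑ i ∈ s, f i ^ 2) ≤ (N + 1) * X := by
  have hN0 : 0 ≤ N := (Nat.cast_nonneg _).trans hN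
  refine Real.sqrt_le_iff.2 ⟨by positivity, ?_⟩
  calc _ ≤ ∑ i ∈ s, X ^ 2 := Finset.sum_le_sum fun i hi => by
          have := h i hi
          rw [← sq_abs]; gcongr
    _ = s.card * X ^ 2 := by rw [Finset.sum_const, nsmul_eq_mul]
    _ ≤ N * X ^ 2 := by gcongr
    _ ≤ (N + 1) ^ 2 * X ^ 2 := by gcongr; nlinarith
    _ = _ := by ring

theorem sqrt_sum2_le {ι κ : Type*} (s : Finset ι) (r : Finset κ) (f : ι → κ → ℝ) {X N : ℝ} (hX : 0 ≤ X) (hN : ((s.card * r.card : ℕ) : ℝ) ≤ N) (h : ∀ i ∈ s, ∀ k ∈ r, |f i k| ≤ X) :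
    Real.sqrt (∑ i ∈ s, ∑ k ∈ r, f i k ^ 2) ≤ (N + 1) * X := by
  rw [← Finset.sum_product' s r fun i k => f i k ^ 2]
  exact sqrt_sum_le (s ×ˢ r) (fun p => f p.1 p.2) hX (by rw [Finset.card_product]; exact hN) fun p hp => h _ (Finset.mem_product.1 hp).1 _ (Finset.mem_product.1 hp).2

/-- first constant -/
def K1 (A : Coeffs d m) (a j ℓ : ℕ) : ℝ := (2 * Real.pi) ^ a * Cp A (a + 2 * d) j ℓ * Zc d
/-- mean constant -/
def K0 (A : Coeffs d m) (ℓ : ℕ) : ℝ := Real.sqrt ((conS d m A).Cm 0 0 (2 * (ℓ + 2)) * cdat d m (0 + 0 + 2 * (ℓ + 2) + 2))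
/-- third constant -/
def K3 (A : Coeffs d m) (a ℓ : ℕ) : ℝ := (2 * Real.pi) ^ a * (Cp A (a + 2 + 2 * d) 0 ℓ + K0 A ℓ) * Zc d

theorem K1_nonneg (a j ℓ : ℕ) : 0 ≤ K1 A a j ℓ := by
  have := Real.pi_pos
  have := Cp_pos (A := A) (a + 2 * d) j ℓ
  have := Zc_nonneg d
  unfold K1; positivity

theorem K3_nonneg (a ℓ : ℕ) : 0 ≤ K3 A a ℓ := by
  have := Real.pi_pos
  have := Cp_pos (A := A) (a + 2 + 2 * d) 0 ℓ
  have := Zc_nonneg d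
  have : 0 ≤ K0 A ℓ := Real.sqrt_nonneg _
  unfold K3; positivity

theorem Ctx.ser1 (c : Ctx hd A n κ M T φ u) {l : List (Fin d)} {j : ℕ} (ℓ k : ℕ) (hk : l.length + 2 * d + j + 2 * ℓ + 2 ≤ k) {t : ℝ} (ht : 0 ≤ t)
    {x : (Fin d → ℤ) → ℂ} (hx : ∀ ξ, ‖x ξ‖ ≤ (2 * Real.pi) ^ l.length * (jb ξ ^ l.length * Dq A n u j ξ t)) (θ : Euc d) :
    |(∑' ξ, x ξ * ec ξ θ).re| ≤ K1 A l.length j ℓ * CkNorm k φ * ((1 + κ * t) ^ ℓ)⁻¹ := by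
  have hpi := Real.pi_pos
  have := ser_le (c := x) (X := (2 * Real.pi) ^ l.length * (Cp A (l.length + 2 * d) j ℓ * CkNorm k φ * ((1 + κ * t) ^ ℓ)⁻¹)) (fun ξ => by
    have hj := jb_pos ξ
    have h1 := c.Dq_le (l.length + 2 * d) j ℓ k hk ξ t ht
    rw [← div_eq_mul_inv, le_div_iff₀ (by positivity)]
    calc _ ≤ ((2 * Real.pi) ^ l.length * (jb ξ ^ l.length * Dq A n u j ξ t)) * jb ξ ^ (2 * d) := by have := hx ξ; gcongr
      _ = (2 * Real.pi) ^ l.length * (jb ξ ^ (l.length + 2 * d) * Dq A n u j ξ t) := by ring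
      _ ≤ _ := by gcongr) θ
  refine this.trans (le_of_eq ?_)
  unfold K1; ring

theorem Ctx.ser3 (c : Ctx hd A n κ M T φ u) {w : CW m} {l : List (Fin d)} (ℓ k : ℕ) (hk : l.length + 2 * d + 2 * ℓ + 6 ≤ k) {t : ℝ} (ht : 0 ≤ t)
    (hw : κ * ‖u 0 0 t - w‖ ≤ K0 A ℓ * CkNorm k φ * ((1 + κ * t) ^ ℓ)⁻¹) (α : Fin m) (θ : Euc d) :
    κ * |dthMulti l (fun a b => Fsol n u α (a, b) - (w α).re) θ t| ≤ K3 A l.length ℓ * CkNorm k φ * ((1 + κ * t) ^ ℓ)⁻¹ := by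
  have hpi := Real.pi_pos
  have hκ := c.hL.κpos
  have hJ : Jet (fun j ξ t => ajet n u α j ξ t + cjet (w α) j ξ t) := (c.aj α).add (cjet_jet (w α))
  have e1 : (fun (a : Euc d) (b : ℝ) => Fsol n u α (a, b) - (w α).re) = fun a b => (syn (fun j ξ t => ajet n u α j ξ t + cjet (w α) j ξ t) 0 a b).re := by
    funext a b
    have : syn (fun j ξ t => ajet n u α j ξ t + cjet (w α) j ξ t) 0 a b = syn (ajet n u α) 0 a b + syn (cjet (w α)) 0 a b := by
      unfold syn
      rw [← Summable.tsum_add]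
      · exact tsum_congr fun ξ => by ring
      · exact ((c.aj α).summ' 0 a b)
      · exact ((cjet_jet (w α)).summ' 0 a b)
    rw [this, syn_cjet]
    simp [Fsol, sub_eq_add_neg]
  rw [e1, hJ.re_dthMulti l 0]
  have hCk := CkNorm_nonneg k φ
  have hD : 0 < (1 + κ * t) ^ ℓ := by positivity
  have hK0 : 0 ≤ K0 A ℓ := Real.sqrt_nonneg _
  have hCp := Cp_pos (A := A) (l.length + 2 + 2 * d) 0 ℓ
  have key := ser_le (c := fun ξ => (κ : ℂ) * cmulj (lsym l) (fun j ξ t => ajet n u α j ξ t + cjet (w α) j ξ t) 0 ξ t)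
    (X := (2 * Real.pi) ^ l.length * (Cp A (l.length + 2 + 2 * d) 0 ℓ + K0 A ℓ) * CkNorm k φ * ((1 + κ * t) ^ ℓ)⁻¹) (fun ξ => by
      have hj := jb_pos ξ
      have hl := lsym_le l ξ
      unfold cmulj
      rw [norm_mul, norm_mul, Complex.norm_real, Real.norm_of_nonneg hκ.le]
      rw [← div_eq_mul_inv _ (jb ξ ^ (2 * d)), le_div_iff₀ (by positivity)]
      by_cases h0 : ξ = 0
      · subst h0
        rw [jb_zero] at hl ⊢
        simp only [one_pow, mul_one] at hl ⊢
        have e2 : ‖ajet n u α 0 0 t + cjet (d := d) (w α) 0 0 t‖ ≤ ‖u 0 0 t - w‖ := by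
          refine le_trans (le_of_eq ?_) (norm_coord_le (u 0 0 t - w) α)
          simp [ajet, cjet, twa, tw, ec_zero, sub_eq_add_neg]
        calc _ ≤ κ * ((2 * Real.pi) ^ l.length * ‖u 0 0 t - w‖) := by gcongr
          _ = (2 * Real.pi) ^ l.length * (κ * ‖u 0 0 t - w‖) := by ring
          _ ≤ (2 * Real.pi) ^ l.length * (K0 A ℓ * CkNorm k φ * ((1 + κ * t) ^ ℓ)⁻¹) := by gcongr
          _ ≤ (2 * Real.pi) ^ l.length * ((Cp A (l.length + 2 + 2 * d) 0 ℓ + K0 A ℓ) * CkNorm k φ * ((1 + κ * t) ^ ℓ)⁻¹) := by gcongr; linarith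
          _ = _ := by ring
      · have e2 : ajet n u α 0 ξ t + cjet (w α) 0 ξ t = ajet n u α 0 ξ t := by simp [cjet, h0]
        dsimp only
        rw [e2]
        have h4 : ‖ajet n u α 0 ξ t‖ ≤ ‖u 0 ξ t‖ := (norm_coord_le _ _).trans (le_of_eq (norm_twa n u 0 ξ t))
        have h5 := c.hL.ub (conS d m A) ξ h0 0 t
        have h6 : ‖(conS d m A).pj n u 0 t ξ‖ = Dq A n u 0 ξ t := rfl
        rw [h6] at h5
        have h7 := c.Dq_le (l.length + 2 + 2 * d) 0 ℓ k (by omega) ξ t ht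
        calc _ ≤ κ * (((2 * Real.pi) ^ l.length * jb ξ ^ l.length) * ‖u 0 ξ t‖) * jb ξ ^ (2 * d) := by gcongr
          _ = (2 * Real.pi) ^ l.length * (jb ξ ^ l.length * jb ξ ^ (2 * d) * (κ * ‖u 0 ξ t‖)) := by ring
          _ ≤ (2 * Real.pi) ^ l.length * (jb ξ ^ l.length * jb ξ ^ (2 * d) * (jb ξ ^ 2 * Dq A n u 0 ξ t)) := by gcongr
          _ = (2 * Real.pi) ^ l.length * (jb ξ ^ (l.length + 2 + 2 * d) * Dq A n u 0 ξ t) := by ring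
          _ ≤ (2 * Real.pi) ^ l.length * (Cp A (l.length + 2 + 2 * d) 0 ℓ * CkNorm k φ * ((1 + κ * t) ^ ℓ)⁻¹) := by gcongr
          _ ≤ (2 * Real.pi) ^ l.length * ((Cp A (l.length + 2 + 2 * d) 0 ℓ + K0 A ℓ) * CkNorm k φ * ((1 + κ * t) ^ ℓ)⁻¹) := by gcongr; linarith
          _ = _ := by ring) θ
  have e3 : (∑' ξ, ((κ : ℂ) * cmulj (lsym l) (fun j ξ t => ajet n u α j ξ t + cjet (w α) j ξ t) 0 ξ t) * ec ξ θ).re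
      = κ * (syn (cmulj (lsym l) (fun j ξ t => ajet n u α j ξ t + cjet (w α) j ξ t)) 0 θ t).re := by
    unfold syn
    simp only [mul_assoc]
    rw [tsum_mul_left, Complex.re_ofReal_mul]
  rw [e3, abs_mul, abs_of_pos hκ] at key
  refine key.trans (le_of_eq ?_)
  unfold K3; ring

/-- the exponent -/
def kk (d a j ℓ : ℕ) : ℕ := a + 2 * d + j + 2 * ℓ + 8

/-- the constant -/
def CC (A : Coeffs d m) (a j ℓ : ℕ) : ℝ := (m * d + 1) * K1 A a j ℓ + (m + 1) * K1 A a j ℓ + (m + 1) * K3 A a ℓ + 1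

theorem CC_pos (a j ℓ : ℕ) : 0 < CC A a j ℓ := by
  have := K1_nonneg (A := A) a j ℓ
  have := K3_nonneg (A := A) a ℓ
  unfold CC; positivity

theorem Ctx.est2 (c : Ctx hd A n κ M T φ u) : ∃ Uinf : Fin m → ℝ, ∀ (l : List (Fin d)) (j ℓ : ℕ) (θ : Euc d) (t : ℝ), 0 < t →
          Real.sqrt (∑ α, ∑ k' ∈ tanIdx d hd,
              (liftD hd M k' (dthMulti l (dtj j fun a b => Fsol n u α (a, b))) θ t) ^ 2)
            + Real.sqrt (∑ α, (dthMulti l (dtj (j + 1) fun a b => Fsol n u α (a, b)) θ t) ^ 2)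
            + κ * Real.sqrt (∑ α, (dthMulti l (fun a b => Fsol n u α (a, b) - Uinf α) θ t) ^ 2)
          ≤ CC A l.length j ℓ * CkNorm (kk d l.length j ℓ) φ * ((1 + κ * t) ^ ℓ)⁻¹ := by
  obtain ⟨w, hw⟩ := c.hL.inf (conS d m A)
  refine ⟨fun α => (w α).re, fun l j ℓ θ t ht => ?_⟩
  have hκ := c.hL.κpos
  set k := kk d l.length j ℓ with hk
  have hCk := CkNorm_nonneg k φ
  have hD : 0 < (1 + κ * t) ^ ℓ := by positivity
  have hK1 := K1_nonneg (A := A) l.length j ℓ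
  have hK3 := K3_nonneg (A := A) l.length ℓ
  set Y := CkNorm k φ * ((1 + κ * t) ^ ℓ)⁻¹ with hY
  have hY0 : 0 ≤ Y := by positivity
  have b1 : Real.sqrt (∑ α, ∑ k' ∈ tanIdx d hd,
              (liftD hd M k' (dthMulti l (dtj j fun a b => Fsol n u α (a, b))) θ t) ^ 2) ≤ (m * d + 1) * (K1 A l.length j ℓ * Y) := by
    refine sqrt_sum2_le _ _ _ (by positivity) ?_ fun α _ k' hk' => ?_
    · have : (tanIdx d hd).card ≤ d := (Finset.card_le_univ _).trans (by simp)
      have : ((tanIdx d hd).card : ℝ) ≤ d := by exact_mod_cast this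
      rw [Finset.card_univ, Fintype.card_fin]; push_cast; gcongr
    · have hk2 := (Finset.mem_filter.1 hk').2
      rw [c.dt l j α, syn_nsym ((c.aj α).lsym l) hk2]
      have := c.ser1 (l := l) (j := j) ℓ k (by rw [hk]; unfold kk; omega) ht.le (fun ξ => c.tan_coef l j α hk2 ξ t) θ
      rw [mul_assoc] at this
      exact this
  have b2 : Real.sqrt (∑ α, (dthMulti l (dtj (j + 1) fun a b => Fsol n u α (a, b)) θ t) ^ 2) ≤ (m + 1) * (K1 A l.length j ℓ * Y) := by
    refine sqrt_sum_le _ _ (by positivity) (by simp) fun α _ => ?_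
    rw [c.dt l (j+1) α]
    have := c.ser1 (l := l) (j := j) ℓ k (by rw [hk]; unfold kk; omega) ht.le (fun ξ => c.t_coef l j α ξ t) θ
    rw [mul_assoc] at this
    exact this
  have hw' : κ * ‖u 0 0 t - w‖ ≤ K0 A ℓ * CkNorm k φ * ((1 + κ * t) ^ ℓ)⁻¹ := by
    have h := hw ℓ _ (fun Λ => c.data (k := k) (by rw [hk]; unfold kk; omega) Λ) t ht.le
    rw [← mul_assoc ((conS d m A).Cm 0 0 (2 * (ℓ + 2))), Real.sqrt_mul' _ (sq_nonneg _), Real.sqrt_sq hCk] at h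
    refine h.trans ?_
    have h1 : (1:ℝ) ≤ 1 + κ * t := by have := mul_pos hκ ht; linarith
    have hK0 : 0 ≤ K0 A ℓ := Real.sqrt_nonneg _
    show K0 A ℓ * CkNorm k φ * _ ≤ _
    gcongr
    omega
  have b3 : Real.sqrt (∑ α, (dthMulti l (fun a b => Fsol n u α (a, b) - (w α).re) θ t) ^ 2) ≤ (m + 1) * ((K3 A l.length ℓ * Y) / κ) := by
    refine sqrt_sum_le _ _ (by positivity) (by simp) fun α _ => ?_
    rw [le_div_iff₀ hκ, mul_comm]
    have := c.ser3 (l := l) ℓ k (by rw [hk]; unfold kk; omega) ht.le hw' α θ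
    rw [mul_assoc (K3 A l.length ℓ)] at this
    exact this
  have b3' : κ * Real.sqrt (∑ α, (dthMulti l (fun a b => Fsol n u α (a, b) - (w α).re) θ t) ^ 2) ≤ (m + 1) * (K3 A l.length ℓ * Y) := by
    calc _ ≤ κ * ((m + 1) * ((K3 A l.length ℓ * Y) / κ)) := by gcongr
      _ = _ := by field_simp
  refine (add_le_add (add_le_add b1 b2) b3').trans ?_
  rw [mul_assoc (CC A l.length j ℓ)]
  show _ ≤ CC A l.length j ℓ * Y
  unfold CC
  nlinarith
end

end

section
open scoped Pointwise
set_option linter.all false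

section
variable {d m : ℕ} {n : Euc d} {A : Coeffs d m}

theorem slice_fderiv {G : Euc d × ℝ → ℝ} (hG : Differentiable ℝ G) (θ v : Euc d) (t : ℝ) :
    fderiv ℝ (fun θ => G (θ, t)) θ v = fderiv ℝ G (θ, t) (v, 0) := by
  have h1 : HasFDerivAt (fun θ : Euc d => ((θ, t) : Euc d × ℝ)) (ContinuousLinearMap.inl ℝ (Euc d) ℝ) θ := by
    exact hasFDerivAt_prodMk_left θ t
  have h2 := HasFDerivAt.comp (g := G) θ (hG (θ, t)).hasFDerivAt h1
  have h3 : fderiv ℝ (fun θ => G (θ, t)) θ = _ := h2.fderiv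
  rw [h3]; rfl

theorem slice_deriv {G : Euc d × ℝ → ℝ} (hG : Differentiable ℝ G) (θ : Euc d) (t : ℝ) :
    HasDerivAt (fun t => G (θ, t)) (fderiv ℝ G (θ, t) (0, 1)) t := by
  have h1 : HasDerivAt (fun s : ℝ => ((θ, s) : Euc d × ℝ)) (0, 1) t := (hasDerivAt_const t θ).prodMk (hasDerivAt_id t)
  exact (hG (θ, t)).hasFDerivAt.comp_hasDerivAt t h1

/-- periodicity in the first variable -/
def Per2 (G : Euc d × ℝ → ℝ) : Prop := ∀ (θ : Euc d) (z : Fin d → ℤ) (t : ℝ), G (θ + zvec z, t) = G (θ, t)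

theorem Per2.fd {G : Euc d × ℝ → ℝ} (h : Per2 G) (v : Euc d × ℝ) : Per2 (fun p => fderiv ℝ G p v) := fun θ z t => by
  have e : (fun x : Euc d × ℝ => G (x + (zvec z, 0))) = G := by
    funext x
    have := h x.1 z x.2
    rw [← this]; congr 1; ext <;> simp
  have h2 := fderiv_comp_add_right (𝕜 := ℝ) (f := G) (x := (θ, t)) (zvec z, (0:ℝ))
  rw [e] at h2
  have e2 : ((θ, t) : Euc d × ℝ) + (zvec z, 0) = (θ + zvec z, t) := by ext <;> simp
  rw [e2] at h2
  show fderiv ℝ G (θ + zvec z, t) v = _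
  rw [← h2]

theorem Rf_per {F : Fin m → Euc d × ℝ → ℝ} (hp : ∀ β, Per2 (F β)) (i : Fin d) (α : Fin m) : Per2 (Rf A n F i α) := fun θ z t => by
  unfold Rf
  refine Finset.sum_congr rfl fun j _ => Finset.sum_congr rfl fun β _ => ?_
  have e : (θ + zvec z) - t • n = (θ - t • n) + zvec z := by abel
  have h1 := (hp β).fd (wv n j) θ z t
  dsimp only at h1 ⊢
  rw [h1, e, astar_per A i j α β]

/-- homogeneous solutions -/
structure Hom (A : Coeffs d m) (n : Euc d) (F : Fin m → Euc d × ℝ → ℝ) : Prop where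
  hn : ‖n‖ = 1
  hF : ∀ β, ContDiff ℝ (⊤ : ℕ∞) (F β)
  hp : ∀ β, Per2 (F β)
  eqn : ∀ θ t α, 0 < t → ∑ i, fderiv ℝ (Rf A n F i α) (θ, t) (wv n i) = 0
  bc : ∀ θ α, ∑ i, n i * Rf A n F i α (θ, 0) = 0

/-- the boundary density -/
def hden (A : Coeffs d m) (n : Euc d) (F : Fin m → Euc d × ℝ → ℝ) (p : Euc d × ℝ) : ℝ := ∑ i, ∑ α, (- n i) * (F α p * Rf A n F i α p)

/-- energy density -/
def eden (n : Euc d) (F : Fin m → Euc d × ℝ → ℝ) (p : Euc d × ℝ) : ℝ := ∑ j, ∑ β, (fderiv ℝ (F β) p (wv n j)) ^ 2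

/-- quadratic form density -/
def qden (A : Coeffs d m) (n : Euc d) (F : Fin m → Euc d × ℝ → ℝ) (p : Euc d × ℝ) : ℝ := ∑ i, ∑ α, fderiv ℝ (F α) p (wv n i) * Rf A n F i α p

theorem eden_nonneg (n : Euc d) (F : Fin m → Euc d × ℝ → ℝ) (p) : 0 ≤ eden n F p := by unfold eden; positivity

theorem fd_smooth {G : Euc d × ℝ → ℝ} (hG : ContDiff ℝ (⊤ : ℕ∞) G) (v) : ContDiff ℝ (⊤ : ℕ∞) (fun p => fderiv ℝ G p v) :=
  (hG.fderiv_right (m := (⊤ : ℕ∞)) (by norm_cast)).clm_apply contDiff_const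

theorem eden_cont {F : Fin m → Euc d × ℝ → ℝ} (hF : ∀ β, ContDiff ℝ (⊤ : ℕ∞) (F β)) : Continuous (eden n F) := by
  unfold eden
  exact continuous_finsetSum _ fun j _ => continuous_finsetSum _ fun β _ => (fd_smooth (hF β) _).continuous.pow 2

theorem qden_low (F : Fin m → Euc d × ℝ → ℝ) (p) : A.lam * eden n F p ≤ qden A n F p := by
  have h := astar_low A (p.1 - p.2 • n) (fun i α => fderiv ℝ (F α) p (wv n i))
  refine h.trans (le_of_eq ?_)
  unfold qden Rf
  refine Finset.sum_congr rfl fun i _ => ?_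
  rw [Finset.sum_comm]
  refine Finset.sum_congr rfl fun α _ => ?_
  rw [Finset.mul_sum]
  refine Finset.sum_congr rfl fun j _ => ?_
  rw [Finset.mul_sum]
  exact Finset.sum_congr rfl fun β _ => by ring

theorem Hom.hsm {F : Fin m → Euc d × ℝ → ℝ} (h : Hom A n F) : ContDiff ℝ (⊤ : ℕ∞) (hden A n F) := by
  unfold hden
  exact ContDiff.sum fun i _ => ContDiff.sum fun α _ => contDiff_const.mul ((h.hF α).mul (wv_smooth_Rf A h.hF i α))

theorem Hom.qcont {F : Fin m → Euc d × ℝ → ℝ} (h : Hom A n F) : Continuous (qden A n F) := by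
  unfold qden
  exact continuous_finsetSum _ fun i _ => continuous_finsetSum _ fun α _ => (fd_smooth (h.hF α) _).continuous.mul (wv_smooth_Rf A h.hF i α).continuous

theorem Hom.dJ {F : Fin m → Euc d × ℝ → ℝ} (h : Hom A n F) (t : ℝ) : 
    HasDerivAt (fun t => ∫ θ in unitCell d, hden A n F (θ, t)) (∫ θ in unitCell d, fderiv ℝ (hden A n F) (θ, t) (0, 1)) t := by
  have hs := h.hsm
  exact cell_hasDerivAt (fun θ t => hden A n F (θ, t)) (fun θ t => fderiv ℝ (hden A n F) (θ, t) (0, 1)) hs.continuous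
    (fd_smooth hs _).continuous (fun θ t => slice_deriv (hs.differentiable (by simp)) θ t) t

theorem Hom.dJ2 {F : Fin m → Euc d × ℝ → ℝ} (h : Hom A n F) {t : ℝ} (ht : 0 < t) : 
    ∫ θ in unitCell d, fderiv ℝ (hden A n F) (θ, t) (0, 1) = ∫ θ in unitCell d, qden A n F (θ, t) := by
  have hs := h.hsm
  let V : Fin d → Fin m → Euc d × ℝ → ℝ := fun i α p => F α p * Rf A n F i α p
  have hV : ∀ i α, ContDiff ℝ (⊤ : ℕ∞) (V i α) := fun i α => (h.hF α).mul (wv_smooth_Rf A h.hF i α)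
  have hVd : ∀ i α, Differentiable ℝ (V i α) := fun i α => (hV i α).differentiable (by simp)
  have hVp : ∀ i α, Per2 (V i α) := fun i α θ z t => by
    simp only [V]; rw [h.hp α θ z t, Rf_per h.hp i α θ z t]
  have e1 : ∀ p v, fderiv ℝ (hden A n F) p v = ∑ i, ∑ α, (- n i) * fderiv ℝ (V i α) p v := by
    intro p v
    have : HasFDerivAt (hden A n F) (∑ i, ∑ α, (- n i) • fderiv ℝ (V i α) p) p := by
      unfold hden
      exact HasFDerivAt.fun_sum fun i _ => HasFDerivAt.fun_sum fun α _ => (hVd i α p).hasFDerivAt.const_mul _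
    rw [this.fderiv]
    simp [ContinuousLinearMap.sum_apply]
  have e2 : ∀ θ, fderiv ℝ (hden A n F) (θ, t) (0, 1) = qden A n F (θ, t) - ∑ i, ∑ α, fderiv ℝ (fun θ => V i α (θ, t)) θ (EuclideanSpace.single i 1 - n i • n) := by
    intro θ
    have e3 : ∀ i α, (- n i) * fderiv ℝ (V i α) (θ, t) (0, 1) = fderiv ℝ (V i α) (θ, t) (wv n i) - fderiv ℝ (fun θ => V i α (θ, t)) θ (EuclideanSpace.single i 1 - n i • n) := by
      intro i α
      rw [slice_fderiv (hVd i α), ← map_sub, ← smul_eq_mul, ← map_smul]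
      congr 1
      unfold wv
      ext <;> simp
    have e4 : ∀ i α, fderiv ℝ (V i α) (θ, t) (wv n i) = F α (θ, t) * fderiv ℝ (Rf A n F i α) (θ, t) (wv n i) + fderiv ℝ (F α) (θ, t) (wv n i) * Rf A n F i α (θ, t) := by
      intro i α
      have h1 : HasFDerivAt (V i α) _ (θ, t) := (((h.hF α).differentiable (by simp)) (θ, t)).hasFDerivAt.mul (((wv_smooth_Rf A h.hF i α).differentiable (by simp)) (θ, t)).hasFDerivAt
      rw [h1.fderiv]
      simp; ring
    have e5 : ∑ i, ∑ α, F α (θ, t) * fderiv ℝ (Rf A n F i α) (θ, t) (wv n i) = 0 := by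
      rw [Finset.sum_comm]
      refine Finset.sum_eq_zero fun α _ => ?_
      rw [← Finset.mul_sum, h.eqn θ t α ht, mul_zero]
    rw [e1]
    simp only [e3, e4, Finset.sum_sub_distrib, Finset.sum_add_distrib]
    rw [e5, zero_add]; rfl
  simp only [e2]
  have hVs : ∀ i α, ContDiff ℝ 1 (fun θ => V i α (θ, t)) := fun i α => ((hV i α).of_le (by norm_cast)).comp (by fun_prop)
  have hi : ∀ i α, IntegrableOn (fun θ => fderiv ℝ (fun θ => V i α (θ, t)) θ (EuclideanSpace.single i 1 - n i • n)) (unitCell d) := fun i α =>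
    cell_integrable (((hVs i α).continuous_fderiv (by simp)).clm_apply continuous_const)
  have hq : IntegrableOn (fun θ => qden A n F (θ, t)) (unitCell d) := cell_integrable (h.qcont.comp (by fun_prop))
  rw [integral_sub hq (integrable_finset_sum _ fun i _ => integrable_finset_sum _ fun α _ => hi i α)]
  rw [integral_finset_sum _ fun i _ => integrable_finset_sum _ fun α _ => hi i α]
  have : ∀ i, ∫ θ in unitCell d, ∑ α, fderiv ℝ (fun θ => V i α (θ, t)) θ (EuclideanSpace.single i 1 - n i • n) = 0 := fun i => by
    rw [integral_finset_sum _ fun α _ => hi i α]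
    exact Finset.sum_eq_zero fun α _ => cell_fderiv_zero (hVs i α) (fun θ z => hVp i α θ z t) _
  simp only [this, Finset.sum_const_zero, sub_zero]

theorem cell_jensen {f : Euc d → ℝ} (hf : Continuous f) : (∫ θ in unitCell d, f θ) ^ 2 ≤ ∫ θ in unitCell d, f θ ^ 2 := by
  set J := ∫ θ in unitCell d, f θ with hJ
  have h0 : 0 ≤ ∫ θ in unitCell d, (f θ - J) ^ 2 := integral_nonneg fun θ => sq_nonneg _
  have e : ∀ θ, (f θ - J) ^ 2 = f θ ^ 2 - (2 * J * f θ - J ^ 2) := fun θ => by ring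
  simp only [e] at h0
  rw [integral_sub (cell_integrable (by fun_prop)) (cell_integrable (by fun_prop)), integral_sub (cell_integrable (by fun_prop)) (cell_integrable (by fun_prop)),
    integral_const_mul] at h0
  simp at h0
  rw [← hJ] at h0
  nlinarith

theorem Hom.hbd {F : Fin m → Euc d × ℝ → ℝ} (h : Hom A n F) {K : ℝ} (hK : ∀ β θ (t : ℝ), 0 ≤ t → |F β (θ, t)| ≤ K) :
    ∃ C, 0 < C ∧ ∀ θ (t : ℝ), 0 ≤ t → hden A n F (θ, t) ^ 2 ≤ C * eden n F (θ, t) := by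
  have hb : ∀ i j α β, ∃ C, ∀ θ, |astar A i j α β θ| ≤ C := fun i j α β => per_bdd (astar_smooth A i j α β).continuous (astar_per A i j α β)
  choose C hC using hb
  let c := fun i α j β => |n i| * K * C i j α β
  let X := fun j β (p : Euc d × ℝ) => fderiv ℝ (F β) p (wv n j)
  refine ⟨(∑ q : Fin d × Fin m, (∑ i, ∑ α, c i α q.1 q.2) ^ 2) + 1, by positivity, fun θ t ht => ?_⟩
  have h1 : |hden A n F (θ, t)| ≤ ∑ q : Fin d × Fin m, (∑ i, ∑ α, c i α q.1 q.2) * |X q.1 q.2 (θ, t)| := by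
    have h2 : ∀ i α, |(- n i) * (F α (θ, t) * Rf A n F i α (θ, t))| ≤ ∑ q : Fin d × Fin m, c i α q.1 q.2 * |X q.1 q.2 (θ, t)| := by
      intro i α
      have hF := hK α θ t ht
      have hK0 : 0 ≤ K := (abs_nonneg _).trans hF
      have hR : |Rf A n F i α (θ, t)| ≤ ∑ q : Fin d × Fin m, C i q.1 α q.2 * |X q.1 q.2 (θ, t)| := by
        unfold Rf
        rw [← Finset.univ_product_univ, Finset.sum_product]
        refine (Finset.abs_sum_le_sum_abs _ _).trans (Finset.sum_le_sum fun j _ => (Finset.abs_sum_le_sum_abs _ _).trans (Finset.sum_le_sum fun β _ => ?_))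
        rw [abs_mul]
        exact mul_le_mul_of_nonneg_right (hC i j α β _) (abs_nonneg _)
      rw [abs_mul, abs_mul, abs_neg]
      calc _ ≤ |n i| * (K * ∑ q : Fin d × Fin m, C i q.1 α q.2 * |X q.1 q.2 (θ, t)|) := by gcongr
        _ = _ := by
          rw [Finset.mul_sum, Finset.mul_sum]
          exact Finset.sum_congr rfl fun q _ => by simp only [c]; ring
    unfold hden
    calc _ ≤ ∑ i, ∑ α, ∑ q : Fin d × Fin m, c i α q.1 q.2 * |X q.1 q.2 (θ, t)| :=
          (Finset.abs_sum_le_sum_abs _ _).trans (Finset.sum_le_sum fun i _ => (Finset.abs_sum_le_sum_abs _ _).trans (Finset.sum_le_sum fun α _ => h2 i α))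
      _ = _ := by
        simp only [Finset.sum_mul]
        exact (Finset.sum_congr rfl fun i _ => Finset.sum_comm).trans Finset.sum_comm
  have h3 : eden n F (θ, t) = ∑ q : Fin d × Fin m, |X q.1 q.2 (θ, t)| ^ 2 := by
    unfold eden
    rw [← Finset.univ_product_univ, Finset.sum_product]
    simp only [sq_abs]; rfl
  rw [h3]
  calc hden A n F (θ, t) ^ 2 = |hden A n F (θ, t)| ^ 2 := (sq_abs _).symm
    _ ≤ (∑ q : Fin d × Fin m, (∑ i, ∑ α, c i α q.1 q.2) * |X q.1 q.2 (θ, t)|) ^ 2 := by gcongr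
    _ ≤ (∑ q : Fin d × Fin m, (∑ i, ∑ α, c i α q.1 q.2) ^ 2) * ∑ q : Fin d × Fin m, |X q.1 q.2 (θ, t)| ^ 2 := Finset.sum_mul_sq_le_sq_mul_sq _ _ _
    _ ≤ _ := by gcongr; linarith
end

end

section
open scoped Pointwise
set_option linter.all false

section
variable {d m : ℕ} {n : Euc d} {A : Coeffs d m}

theorem cell_zero {f : Euc d → ℝ} (hf : Continuous f) (hp : Per f) (h0 : ∫ θ in unitCell d, f θ ^ 2 = 0) (θ : Euc d) : f θ = 0 := by
  have h1 : (fun θ => f θ ^ 2) =ᵐ[volume.restrict (unitCell d)] 0 :=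
    (integral_eq_zero_iff_of_nonneg (fun θ => sq_nonneg _) (cell_integrable (hf.pow 2))).1 h0
  have h2 : ∀ ξ, fc (fun θ => (f θ : ℂ)) ξ = 0 := by
    intro ξ
    unfold fc
    rw [integral_congr_ae (g := fun _ => (0:ℂ))]
    · simp
    · filter_upwards [h1] with θ hθ
      have : f θ = 0 := by simpa using hθ
      simp [this]
  have := fc_eq_zero (f := fun θ => (f θ : ℂ)) (by fun_prop) (fun θ z => by dsimp only; rw [hp θ z]) h2 θ
  exact_mod_cast this

theorem Hom.zero {F : Fin m → Euc d × ℝ → ℝ} (h : Hom A n F) {K : ℝ} (hK : ∀ β θ (t : ℝ), 0 ≤ t → |F β (θ, t)| ≤ K)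
    (hfinE : ∫⁻ t in Set.Ioi (0:ℝ), ENNReal.ofReal (∫ θ in unitCell d, eden n F (θ, t)) < ⊤) {t : ℝ} (ht : 0 < t) (j : Fin d) (β : Fin m) (θ : Euc d) :
    fderiv ℝ (F β) (θ, t) (wv n j) = 0 := by
  obtain ⟨C, hC0, hC⟩ := h.hbd hK
  set J : ℝ → ℝ := fun t => ∫ θ in unitCell d, hden A n F (θ, t) with hJ
  set E : ℝ → ℝ := fun t => ∫ θ in unitCell d, eden n F (θ, t) with hE
  have hec : Continuous (eden n F) := eden_cont h.hF
  have hhc : Continuous (hden A n F) := h.hsm.continuous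
  have hqc : Continuous (qden A n F) := h.qcont
  have hE0 : ∀ t, 0 ≤ E t := fun t => integral_nonneg fun θ => eden_nonneg n F _
  have hJE : ∀ t, 0 ≤ t → J t ^ 2 ≤ C * E t := by
    intro t ht
    refine (cell_jensen (hhc.comp (by fun_prop))).trans ?_
    rw [hE, ← integral_const_mul]
    refine setIntegral_mono (cell_integrable ((hhc.comp (by fun_prop)).pow 2)) (cell_integrable (continuous_const.mul (hec.comp (by fun_prop)))) fun θ => hC θ t ht
  have hdJ : ∀ t, 0 < t → HasDerivAt J (∫ θ in unitCell d, qden A n F (θ, t)) t := fun t ht => by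
    have := h.dJ t
    rw [h.dJ2 ht] at this
    exact this
  have hq : ∀ t, A.lam * E t ≤ ∫ θ in unitCell d, qden A n F (θ, t) := by
    intro t
    rw [hE, ← integral_const_mul]
    exact setIntegral_mono (cell_integrable (continuous_const.mul (hec.comp (by fun_prop)))) (cell_integrable (hqc.comp (by fun_prop))) fun θ => qden_low F _
  have hJ0 : J 0 = 0 := by
    have : ∀ θ, hden A n F (θ, 0) = 0 := by
      intro θ
      unfold hden
      rw [Finset.sum_comm]
      refine Finset.sum_eq_zero fun α _ => ?_
      have e : ∀ i, -n i * (F α (θ, 0) * Rf A n F i α (θ, 0)) = -F α (θ, 0) * (n i * Rf A n F i α (θ, 0)) := fun i => by ring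
      simp only [e]
      rw [← Finset.mul_sum, h.bc θ α, mul_zero]
    simp [hJ, this]
  have hmono : MonotoneOn J (Set.Ici 0) := by
    refine monotoneOn_of_deriv_nonneg (convex_Ici 0) (fun t _ => (h.dJ t).continuousAt.continuousWithinAt) (fun t _ => (h.dJ t).differentiableAt.differentiableWithinAt) fun t ht => ?_
    rw [interior_Ici] at ht
    rw [(hdJ t ht).deriv]
    exact (mul_nonneg A.lam_pos.le (hE0 t)).trans (hq t)
  have hJz : ∀ t, 0 ≤ t → J t = 0 := by
    intro t0 ht0
    by_contra hne
    have hpos : 0 < J t0 := by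
      have := hmono (Set.mem_Ici.2 le_rfl) ht0 ht0
      rw [hJ0] at this
      exact lt_of_le_of_ne this (Ne.symm hne)
    have h1 : ∀ t ∈ Set.Ioi t0, ENNReal.ofReal (J t0 ^ 2 / C) ≤ ENNReal.ofReal (E t) := by
      intro t ht
      refine ENNReal.ofReal_le_ofReal ?_
      rw [div_le_iff₀ hC0, mul_comm]
      have ht' : t0 < t := ht
      have h2 := hmono ht0 (Set.mem_Ici.2 (ht0.trans ht'.le)) ht'.le
      exact (pow_le_pow_left₀ hpos.le h2 2).trans (hJE t (ht0.trans ht'.le))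
    have h2 : (⊤ : ENNReal) ≤ ∫⁻ t in Set.Ioi (0:ℝ), ENNReal.ofReal (E t) := by
      calc (⊤ : ENNReal) = ∫⁻ t in Set.Ioi t0, ENNReal.ofReal (J t0 ^ 2 / C) := by
            rw [setLIntegral_const, Real.volume_Ioi, ENNReal.mul_top]
            exact (ENNReal.ofReal_pos.2 (by positivity)).ne'
        _ ≤ ∫⁻ t in Set.Ioi t0, ENNReal.ofReal (E t) := setLIntegral_mono' measurableSet_Ioi h1
        _ ≤ _ := lintegral_mono_set (Set.Ioi_subset_Ioi ht0)
    exact absurd hfinE (not_lt.2 h2)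
  have hEz : E t = 0 := by
    have h1 : HasDerivAt J 0 t := by
      refine (hasDerivAt_const t (0:ℝ)).congr_of_eventuallyEq ?_
      filter_upwards [lt_mem_nhds ht] with s hs using hJz s hs.le
    have h2 := (hdJ t ht).unique h1
    have h3 := hq t
    rw [h2] at h3
    have := hE0 t
    have := A.lam_pos
    nlinarith
  refine cell_zero (f := fun θ => fderiv ℝ (F β) (θ, t) (wv n j)) ((fd_smooth (h.hF β) _).continuous.comp (by fun_prop)) (fun θ z => (h.hp β).fd _ θ z t) ?_ θ
  refine le_antisymm ?_ (integral_nonneg fun θ => sq_nonneg _)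
  rw [← hEz]
  refine setIntegral_mono (cell_integrable ((((fd_smooth (h.hF β) _).continuous).comp (by fun_prop)).pow 2)) (cell_integrable (hec.comp (by fun_prop))) fun θ => ?_
  show (fderiv ℝ (F β) (θ, t) (wv n j)) ^ 2 ≤ eden n F (θ, t)
  unfold eden
  refine le_trans ?_ (Finset.single_le_sum (f := fun j => ∑ β, (fderiv ℝ (F β) (θ, t) (wv n j)) ^ 2) (fun i _ => by positivity) (Finset.mem_univ j))
  exact Finset.single_le_sum (f := fun β => (fderiv ℝ (F β) (θ, t) (wv n j)) ^ 2) (fun i _ => by positivity) (Finset.mem_univ β)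

theorem const_of_dio {n : Euc d} {κ : ℝ} (hdio : IsDioph n κ) {f : Euc d → ℝ} (hf : ContDiff ℝ 1 f) (hp : Per f)
    (h : ∀ θ (j : Fin d), fderiv ℝ f θ (EuclideanSpace.single j 1 - n j • n) = 0) (θ : Euc d) : f θ = f 0 := by
  set f0 : ℝ := ∫ θ in unitCell d, f θ with hf0
  have hg : ContDiff ℝ 1 (fun θ => ((f θ - f0 : ℝ) : ℂ)) := Complex.ofRealCLM.contDiff.comp (hf.sub contDiff_const)
  have hgp : Per (fun θ => ((f θ - f0 : ℝ) : ℂ)) := fun θ z => by dsimp only; rw [hp θ z]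
  have hfd : ∀ θ v, fderiv ℝ (fun θ => ((f θ - f0 : ℝ) : ℂ)) θ v = ((fderiv ℝ f θ v : ℝ) : ℂ) := by
    intro θ v
    have h1 : HasFDerivAt (fun θ => f θ - f0) (fderiv ℝ f θ) θ := ((hf.differentiable (by simp)) θ).hasFDerivAt.sub_const f0
    have h2 : HasFDerivAt (fun θ => ((f θ - f0 : ℝ) : ℂ)) (Complex.ofRealCLM.comp (fderiv ℝ f θ)) θ := HasFDerivAt.comp (g := fun x : ℝ => (x : ℂ)) θ Complex.ofRealCLM.hasFDerivAt h1
    rw [h2.fderiv]; rfl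
  have hz : ∀ ξ, fc (fun θ => ((f θ - f0 : ℝ) : ℂ)) ξ = 0 := by
    intro ξ
    by_cases h0 : ξ = 0
    · subst h0
      unfold fc
      simp only [neg_zero, ec_zero, one_mul]
      refine Eq.trans (integral_ofReal (𝕜 := ℂ) (μ := volume.restrict (unitCell d)) (f := fun θ => f θ - f0)) ?_
      rw [integral_sub (cell_integrable hf.continuous) (cell_integrable continuous_const), ← hf0]
      simp
    · have hperp : perp n ξ ≠ 0 := by
        intro he
        have h1 := dio_of n hdio ξ h0
        rw [he, norm_zero, mul_zero] at h1
        exact absurd hdio.1 (not_lt.2 h1)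
      obtain ⟨j, hj⟩ : ∃ j, perp n ξ j ≠ 0 := by
        by_contra hc
        push Not at hc
        exact hperp (by ext j; exact hc j)
      have h1 := fc_fderiv hg hgp ξ (EuclideanSpace.single j 1 - n j • n)
      simp only [hfd, h] at h1
      have e : zdot ξ (EuclideanSpace.single j 1 - n j • n) = perp n ξ j := by
        rw [zdot_sub_right, zdot_smul_right]
        have : zdot ξ (EuclideanSpace.single j 1) = (ξ j : ℝ) := by simp [zdot]
        rw [this]
        simp [perp, zvec_apply]; ring
      rw [e] at h1
      have h2 : fc (fun θ : Euc d => ((0:ℝ):ℂ)) ξ = 0 := by unfold fc; simp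
      rw [h2] at h1
      have h3 : (2 * (Real.pi:ℂ) * Complex.I * (perp n ξ j : ℝ)) ≠ 0 := by
        have := Real.pi_ne_zero
        simp [this, hj]
      exact (mul_eq_zero.1 h1.symm).resolve_left h3
  have hc : ∀ θ, f θ = f0 := fun θ => by
    have := fc_eq_zero hg.continuous hgp hz θ
    have : f θ - f0 = 0 := by exact_mod_cast this
    linarith
  rw [hc θ, hc 0]

theorem Hom.const {F : Fin m → Euc d × ℝ → ℝ} (h : Hom A n F) {κ : ℝ} (hdio : IsDioph n κ) {K : ℝ} (hK : ∀ β θ (t : ℝ), 0 ≤ t → |F β (θ, t)| ≤ K)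
    (hfinE : ∫⁻ t in Set.Ioi (0:ℝ), ENNReal.ofReal (∫ θ in unitCell d, eden n F (θ, t)) < ⊤) {t : ℝ} (ht : 0 ≤ t) (β : Fin m) (θ : Euc d) :
    F β (θ, t) = F β (0, 0) := by
  have hX : ∀ (j : Fin d) (θ : Euc d) (t : ℝ), 0 ≤ t → fderiv ℝ (F β) (θ, t) (wv n j) = 0 := by
    intro j θ t ht
    have hcl : IsClosed {t : ℝ | fderiv ℝ (F β) (θ, t) (wv n j) = 0} :=
      isClosed_eq ((fd_smooth (h.hF β) _).continuous.comp (by fun_prop)) continuous_const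
    have hsub : closure (Set.Ioi (0:ℝ)) ⊆ {t : ℝ | fderiv ℝ (F β) (θ, t) (wv n j) = 0} :=
      hcl.closure_subset_iff.2 fun t ht => h.zero hK hfinE ht j β θ
    rw [closure_Ioi] at hsub
    exact hsub ht
  have hdf : Differentiable ℝ (F β) := (h.hF β).differentiable (by simp)
  have hT : ∀ (θ : Euc d) (t : ℝ), 0 ≤ t → fderiv ℝ (F β) (θ, t) (0, 1) = 0 := by
    intro θ t ht
    have e : ((0, 1) : Euc d × ℝ) = ∑ j, (- n j) • wv n j := by
      have hs : ∑ j, n j * n j = 1 := by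
        have := euc_norm_sq n
        rw [h.hn] at this
        simp only [pow_two] at this
        linarith
      have e1 : ∑ j, n j • (EuclideanSpace.single j 1 : Euc d) = n := by
        ext i
        simp [Finset.sum_apply, Pi.single_apply]
      refine Prod.ext ?_ ?_
      · rw [Prod.fst_sum]
        simp only [wv, neg_smul, Prod.fst_neg, Prod.smul_fst, smul_sub, smul_smul, Finset.sum_sub_distrib, Finset.sum_neg_distrib, e1]
        rw [← Finset.sum_smul, hs, one_smul]; simp
      · rw [Prod.snd_sum]
        simp [wv, hs]
    rw [e, map_sum]
    refine Finset.sum_eq_zero fun j _ => ?_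
    rw [map_smul, hX j θ t ht, smul_zero]
  have h1 : F β (θ, t) = F β (θ, 0) := by
    refine constant_of_has_deriv_right_zero (f := fun s => F β (θ, s)) (a := 0) (b := t) ?_ ?_ t ⟨ht, le_rfl⟩
    · exact ((h.hF β).continuous.comp (by fun_prop)).continuousOn
    · intro s hs
      have := slice_deriv hdf θ s
      rw [hT θ s hs.1] at this
      exact this.hasDerivWithinAt
  rw [h1]
  refine const_of_dio hdio (f := fun θ => F β (θ, 0)) (((h.hF β).of_le (by norm_cast)).comp (by fun_prop)) (fun θ z => h.hp β θ z 0) (fun θ j => ?_) θ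
  rw [slice_fderiv hdf]
  have h2 := hX j θ 0 le_rfl
  have h3 := hT θ 0 le_rfl
  have e : ((EuclideanSpace.single j 1 - n j • n, 0) : Euc d × ℝ) = wv n j + n j • ((0, 1) : Euc d × ℝ) := by
    unfold wv; ext <;> simp
  rw [e, map_add, map_smul, h2, h3]; simp
end

end

section
open scoped Pointwise
set_option linter.all false

section
variable {d m : ℕ} {n : Euc d} {A : Coeffs d m} {hd : 0 < d} {M : Fin d → Fin d → ℝ}

/-- full gradient density -/
def gden (F : Fin m → Euc d × ℝ → ℝ) (p : Euc d × ℝ) : ℝ :=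
  ∑ α, ((∑ i, (fderiv ℝ (F α) p (EuclideanSpace.single i 1, 0)) ^ 2) + (fderiv ℝ (F α) p (0, 1)) ^ 2)

theorem gden_nonneg (F : Fin m → Euc d × ℝ → ℝ) (p) : 0 ≤ gden F p := by unfold gden; positivity

theorem gden_cont {F : Fin m → Euc d × ℝ → ℝ} (hF : ∀ β, ContDiff ℝ (⊤ : ℕ∞) (F β)) : Continuous (gden F) := by
  unfold gden
  exact continuous_finsetSum _ fun α _ => (continuous_finsetSum _ fun i _ => (fd_smooth (hF α) _).continuous.pow 2).add ((fd_smooth (hF α) _).continuous.pow 2)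

theorem eden_le_gden (n : Euc d) : ∃ C : ℝ, 0 ≤ C ∧ ∀ (F : Fin m → Euc d × ℝ → ℝ) p, eden n F p ≤ C * gden F p := by
  classical
  let c : Fin d → Fin d → ℝ := fun j i => (EuclideanSpace.single j (1:ℝ) - n j • n : Euc d) i
  refine ⟨∑ j, (∑ i, c j i ^ 2 + (- n j) ^ 2), by positivity, fun F p => ?_⟩
  have e : ∀ j, wv n j = ∑ i, c j i • ((EuclideanSpace.single i 1, 0) : Euc d × ℝ) + (- n j) • ((0, 1) : Euc d × ℝ) := by
    intro j
    have e1 : ∀ v : Euc d, ∑ i, v i • (EuclideanSpace.single i 1 : Euc d) = v := by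
      intro v
      ext i
      simp [Finset.sum_apply, Pi.single_apply]
    refine Prod.ext ?_ ?_
    · rw [Prod.fst_add, Prod.fst_sum]
      simp only [Prod.smul_fst, smul_zero, add_zero]
      exact (e1 _).symm
    · rw [Prod.snd_add, Prod.snd_sum]
      simp [wv]
  have h1 : ∀ j β, (fderiv ℝ (F β) p (wv n j)) ^ 2 ≤ (∑ i, c j i ^ 2 + (- n j) ^ 2) * ((∑ i, (fderiv ℝ (F β) p (EuclideanSpace.single i 1, 0)) ^ 2) + (fderiv ℝ (F β) p (0, 1)) ^ 2) := by
    intro j β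
    rw [e j, map_add, map_sum, map_smul]
    simp only [map_smul, smul_eq_mul]
    have hcs := Finset.sum_mul_sq_le_sq_mul_sq Finset.univ (c j) (fun i => fderiv ℝ (F β) p (EuclideanSpace.single i 1, 0))
    set S := ∑ i, c j i * fderiv ℝ (F β) p (EuclideanSpace.single i 1, 0)
    set P := ∑ i, c j i ^ 2 with hP
    set Q := ∑ i, (fderiv ℝ (F β) p (EuclideanSpace.single i 1, 0)) ^ 2 with hQ
    have hP0 : 0 ≤ P := by rw [hP]; positivity
    have hQ0 : 0 ≤ Q := by rw [hQ]; positivity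
    set y := fderiv ℝ (F β) p (0, 1)
    set b := - n j
    -- two-term Cauchy inequality
    have hSs : |S| ≤ Real.sqrt P * Real.sqrt Q := by
      rw [← Real.sqrt_mul hP0]; exact Real.abs_le_sqrt hcs
    have h2 : 2 * S * (b * y) ≤ P * y ^ 2 + b ^ 2 * Q := by
      have h3 : 2 * S * (b * y) ≤ 2 * |S| * |b * y| := by
        have := le_abs_self (S * (b * y)); rw [abs_mul] at this; nlinarith
      have h4 : 2 * |S| * |b * y| ≤ 2 * (Real.sqrt P * Real.sqrt Q) * |b * y| := by gcongr
      rw [abs_mul] at h3 h4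
      have h5 := sq_nonneg (Real.sqrt P * |y| - Real.sqrt Q * |b|)
      have h6 := Real.sq_sqrt hP0
      have h7 := Real.sq_sqrt hQ0
      have h8 := sq_abs y
      have h9 := sq_abs b
      have h10 : (Real.sqrt P * |y| - Real.sqrt Q * |b|) ^ 2 = Real.sqrt P ^ 2 * |y| ^ 2 + Real.sqrt Q ^ 2 * |b| ^ 2 - 2 * (Real.sqrt P * Real.sqrt Q) * (|b| * |y|) := by ring
      rw [h10, h6, h7, h8, h9] at h5
      linarith
    nlinarith
  unfold eden
  rw [Finset.sum_mul]
  refine Finset.sum_le_sum fun j _ => ?_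
  unfold gden
  rw [Finset.mul_sum]
  exact Finset.sum_le_sum fun β _ => h1 j β

theorem eden_sub {F1 F2 : Fin m → Euc d × ℝ → ℝ} (h1 : ∀ β, Differentiable ℝ (F1 β)) (h2 : ∀ β, Differentiable ℝ (F2 β)) (p) :
    eden n (fun β p => F1 β p - F2 β p) p ≤ 2 * eden n F1 p + 2 * eden n F2 p := by
  unfold eden
  simp only [Finset.mul_sum, ← Finset.sum_add_distrib]
  refine Finset.sum_le_sum fun j _ => Finset.sum_le_sum fun β _ => ?_
  have : fderiv ℝ (fun p => F1 β p - F2 β p) p = fderiv ℝ (F1 β) p - fderiv ℝ (F2 β) p := fderiv_fun_sub (h1 β p) (h2 β p)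
  rw [this, ContinuousLinearMap.sub_apply]
  nlinarith [sq_nonneg (fderiv ℝ (F1 β) p (wv n j) + fderiv ℝ (F2 β) p (wv n j))]

theorem Rf_sub {F1 F2 : Fin m → Euc d × ℝ → ℝ} (h1 : ∀ β, Differentiable ℝ (F1 β)) (h2 : ∀ β, Differentiable ℝ (F2 β)) (i α) :
    Rf A n (fun β p => F1 β p - F2 β p) i α = fun p => Rf A n F1 i α p - Rf A n F2 i α p := by
  funext p
  unfold Rf
  simp only [← Finset.sum_sub_distrib]
  refine Finset.sum_congr rfl fun j _ => Finset.sum_congr rfl fun β _ => ?_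
  have : fderiv ℝ (fun p => F1 β p - F2 β p) p = fderiv ℝ (F1 β) p - fderiv ℝ (F2 β) p := fderiv_fun_sub (h1 β p) (h2 β p)
  rw [this, ContinuousLinearMap.sub_apply]; ring

theorem gden_lint {U : Euc d → ℝ → Fin m → ℝ} (hU : ∀ α, ContDiff ℝ (⊤ : ℕ∞) (fun p : Euc d × ℝ => U p.1 p.2 α)) (θ : Euc d) (t : ℝ) :
    (∑ α, ((∑ i, (dth i (fun a b => U a b α) θ t) ^ 2) + (deriv (fun b => U θ b α) t) ^ 2)) = gden (fun α p => U p.1 p.2 α) (θ, t) := by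
  unfold gden
  refine Finset.sum_congr rfl fun α _ => ?_
  have hdf := (hU α).differentiable (by simp)
  congr 1
  · refine Finset.sum_congr rfl fun i _ => ?_
    have := slice_fderiv hdf θ (EuclideanSpace.single i 1) t
    unfold dth pder
    rw [← this]
  · have := (slice_deriv hdf θ t).deriv
    rw [← this]

theorem hint_of {F1 F2 : Fin m → Euc d × ℝ → ℝ} (h1 : ∀ β, ContDiff ℝ (⊤ : ℕ∞) (F1 β)) (h2 : ∀ β, ContDiff ℝ (⊤ : ℕ∞) (F2 β))
    (i1 : ∫⁻ t in Set.Ioi (0:ℝ), ∫⁻ θ in unitCell d, ENNReal.ofReal (gden F1 (θ, t)) < ⊤)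
    (i2 : ∫⁻ t in Set.Ioi (0:ℝ), ∫⁻ θ in unitCell d, ENNReal.ofReal (gden F2 (θ, t)) < ⊤) :
    ∫⁻ t in Set.Ioi (0:ℝ), ENNReal.ofReal (∫ θ in unitCell d, eden n (fun β p => F1 β p - F2 β p) (θ, t)) < ⊤ := by
  obtain ⟨C, hC0, hC⟩ := eden_le_gden (m := m) n
  have hF : ∀ β, ContDiff ℝ (⊤ : ℕ∞) (fun p => F1 β p - F2 β p) := fun β => (h1 β).sub (h2 β)
  have hec := eden_cont (n := n) hF
  have hm : ∀ {F : Fin m → Euc d × ℝ → ℝ}, (∀ β, ContDiff ℝ (⊤ : ℕ∞) (F β)) → Measurable fun t => ∫⁻ θ in unitCell d, ENNReal.ofReal (gden F (θ, t)) := by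
    intro F hF
    have : Measurable fun q : ℝ × Euc d => ENNReal.ofReal (gden F (q.2, q.1)) :=
      ENNReal.measurable_ofReal.comp ((gden_cont hF).comp (by fun_prop)).measurable
    exact this.lintegral_prod_right'
  have hb : ∀ t, ENNReal.ofReal (∫ θ in unitCell d, eden n (fun β p => F1 β p - F2 β p) (θ, t)) ≤
      ENNReal.ofReal (2 * C) * ((∫⁻ θ in unitCell d, ENNReal.ofReal (gden F1 (θ, t))) + ∫⁻ θ in unitCell d, ENNReal.ofReal (gden F2 (θ, t))) := by
    intro t
    have hm1 : Measurable fun θ : Euc d => ENNReal.ofReal (gden F1 (θ, t)) := ENNReal.measurable_ofReal.comp ((gden_cont h1).comp (by fun_prop)).measurable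
    have hi : IntegrableOn (fun θ => eden n (fun β p => F1 β p - F2 β p) (θ, t)) (unitCell d) :=
      cell_integrable (hec.comp (by fun_prop))
    rw [ofReal_integral_eq_lintegral_ofReal hi (Filter.Eventually.of_forall fun θ => eden_nonneg _ _ _)]
    rw [← lintegral_add_left hm1, ← lintegral_const_mul' _ _ ENNReal.ofReal_ne_top]
    refine lintegral_mono fun θ => ?_
    rw [← ENNReal.ofReal_add (gden_nonneg _ _) (gden_nonneg _ _), ← ENNReal.ofReal_mul (by positivity)]
    refine ENNReal.ofReal_le_ofReal ?_
    have a1 := eden_sub (n := n) (fun β => (h1 β).differentiable (by simp)) (fun β => (h2 β).differentiable (by simp)) (θ, t)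
    have a2 := hC F1 (θ, t)
    have a3 := hC F2 (θ, t)
    linarith
  refine (lintegral_mono hb).trans_lt ?_
  rw [lintegral_const_mul' _ _ ENNReal.ofReal_ne_top, lintegral_add_left (hm h1)]
  exact ENNReal.mul_lt_top ENNReal.ofReal_lt_top (ENNReal.add_lt_top.2 ⟨i1, i2⟩)

theorem lifted_uniq (hn : ‖n‖ = 1) {κ : ℝ} (hdio : IsDioph n κ) (hM : IsOrtho M) (hl : LastColNeg hd n M) {g : Euc d → Fin m → ℝ}
    (U₁ U₂ : Euc d → ℝ → Fin m → ℝ) (s1 : IsLiftedNeuSol hd A n M g U₁) (s2 : IsLiftedNeuSol hd A n M g U₂)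
    (b1 : ∃ K : ℝ, ∀ (θ : Euc d) (t : ℝ) (α : Fin m), 0 ≤ t → |U₁ θ t α| ≤ K)
    (b2 : ∃ K : ℝ, ∀ (θ : Euc d) (t : ℝ) (α : Fin m), 0 ≤ t → |U₂ θ t α| ≤ K)
    (i1 : (∫⁻ t in Set.Ioi (0:ℝ), ∫⁻ θ in unitCell d, ENNReal.ofReal
            (∑ α, ((∑ i, (dth i (fun a b => U₁ a b α) θ t) ^ 2)
              + (deriv (fun b => U₁ θ b α) t) ^ 2)) < ⊤))
    (i2 : (∫⁻ t in Set.Ioi (0:ℝ), ∫⁻ θ in unitCell d, ENNReal.ofReal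
            (∑ α, ((∑ i, (dth i (fun a b => U₂ a b α) θ t) ^ 2)
              + (deriv (fun b => U₂ θ b α) t) ^ 2)) < ⊤)) :
    ∃ c : Fin m → ℝ, ∀ (θ : Euc d) (t : ℝ) (α : Fin m), 0 ≤ t → U₁ θ t α = U₂ θ t α + c α := by
  obtain ⟨K1, hK1⟩ := b1
  obtain ⟨K2, hK2⟩ := b2
  have f1 : ∀ α, ContDiff ℝ (⊤ : ℕ∞) (fun p : Euc d × ℝ => U₁ p.1 p.2 α) := fun α => contDiff_pi.1 s1.smooth α
  have f2 : ∀ α, ContDiff ℝ (⊤ : ℕ∞) (fun p : Euc d × ℝ => U₂ p.1 p.2 α) := fun α => contDiff_pi.1 s2.smooth α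
  simp only [gden_lint f1] at i1
  simp only [gden_lint f2] at i2
  have d1 : ∀ β, Differentiable ℝ (fun p : Euc d × ℝ => U₁ p.1 p.2 β) := fun β => (f1 β).differentiable (by simp)
  have d2 : ∀ β, Differentiable ℝ (fun p : Euc d × ℝ => U₂ p.1 p.2 β) := fun β => (f2 β).differentiable (by simp)
  have hH : Hom A n (fun α p => U₁ p.1 p.2 α - U₂ p.1 p.2 α) := by
    refine ⟨hn, fun α => (f1 α).sub (f2 α), fun β θ z t => ?_, fun θ t α ht => ?_, fun θ α => ?_⟩
    · dsimp only
      rw [s1.periodic θ z t, s2.periodic θ z t]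
    · have e1 := s1.eqn θ t ht α
      have e2 := s2.eqn θ t ht α
      rw [liftOp_eq A hM hl (F := fun α p => U₁ p.1 p.2 α) (fun a b β => rfl) f1] at e1
      rw [liftOp_eq A hM hl (F := fun α p => U₂ p.1 p.2 α) (fun a b β => rfl) f2] at e2
      have e3 : ∀ i, fderiv ℝ (Rf A n (fun α p => U₁ p.1 p.2 α - U₂ p.1 p.2 α) i α) (θ, t) (wv n i) =
          fderiv ℝ (Rf A n (fun α p => U₁ p.1 p.2 α) i α) (θ, t) (wv n i) - fderiv ℝ (Rf A n (fun α p => U₂ p.1 p.2 α) i α) (θ, t) (wv n i) := by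
        intro i
        rw [Rf_sub d1 d2 i α, fderiv_fun_sub ((wv_smooth_Rf A f1 i α).differentiable (by simp) _) ((wv_smooth_Rf A f2 i α).differentiable (by simp) _)]
        rfl
      simp only [e3, Finset.sum_sub_distrib]
      rw [e1, e2, sub_zero]
    · have e1 := s1.bc θ α
      have e2 := s2.bc θ α
      rw [flux_eq A hM hl (F := fun α p => U₁ p.1 p.2 α) (fun a b β => rfl) f1] at e1
      rw [flux_eq A hM hl (F := fun α p => U₂ p.1 p.2 α) (fun a b β => rfl) f2] at e2
      simp only [hl _, neg_mul, Finset.sum_neg_distrib, neg_neg] at e1 e2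
      simp only [Rf_sub d1 d2, mul_sub, Finset.sum_sub_distrib]
      rw [e1, e2, sub_self]
  have hfinE := hint_of (n := n) f1 f2 i1 i2
  refine ⟨fun α => U₁ 0 0 α - U₂ 0 0 α, fun θ t α ht => ?_⟩
  have := hH.const hdio (K := K1 + K2) (fun β θ t ht => (abs_sub _ _).trans (add_le_add (hK1 θ t β ht) (hK2 θ t β ht))) hfinE ht α θ
  dsimp only at this
  linarith
end

end

/-- For Diophantine `n`, tangential `T` and smooth periodic `φ`, the lifted
Neumann problem with data `T·∇_θφ` has a smooth solution `U`, unique up to an additive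
constant among bounded solutions with square-integrable gradient, satisfying (i) the energy
estimates and (ii) the pointwise decay estimates towards a constant vector `U∞`. -/
theorem stmt14 (d m : ℕ) (hd : 0 < d) (A : Coeffs d m) :
    ∃ (C₁ : ℕ → ℕ → ℝ) (k₂ : ℕ → ℕ → ℕ → ℕ) (C₂ : ℕ → ℕ → ℕ → ℝ),
      (∀ a b, 0 < C₁ a b) ∧ (∀ a b c, 0 < C₂ a b c) ∧
      ∀ (n : Euc d), (∑ i, n i ^ 2 = 1) → ∀ κ : ℝ, IsDioph n κ →
      ∀ M : Fin d → Fin d → ℝ, IsOrtho M → LastColNeg hd n M →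
      ∀ T : Euc d, dotp T n = 0 → (∑ i, T i ^ 2) ≤ 1 →
      ∀ φ : Euc d → Fin m → ℝ, ContDiff ℝ (⊤ : ℕ∞) φ →
        (∀ (θ : Euc d) (z : Fin d → ℤ), φ (θ + zvec z) = φ θ) →
      (∃ U : Euc d → ℝ → Fin m → ℝ,
        IsLiftedNeuSol hd A n M (fun θ α => ∑ i, T i * pder i (fun x => φ x α) θ) U ∧
        (∀ (l : List (Fin d)) (j : ℕ),
          (∫ t in Set.Ioi (0:ℝ), ∫ θ in unitCell d,
              (∑ α, ∑ k ∈ tanIdx d hd,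
                  (liftD hd M k (dthMulti l (dtj j fun a b => U a b α)) θ t) ^ 2)
                + ∑ α, (dthMulti l (dtj (j + 1) fun a b => U a b α) θ t) ^ 2)
            ≤ C₁ l.length j * CkNorm (l.length + j + 1) φ ^ 2) ∧
        (∃ Uinf : Fin m → ℝ, ∀ (l : List (Fin d)) (j ℓ : ℕ) (θ : Euc d) (t : ℝ), 0 < t →
          Real.sqrt (∑ α, ∑ k' ∈ tanIdx d hd,
              (liftD hd M k' (dthMulti l (dtj j fun a b => U a b α)) θ t) ^ 2)
            + Real.sqrt (∑ α, (dthMulti l (dtj (j + 1) fun a b => U a b α) θ t) ^ 2)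
            + κ * Real.sqrt (∑ α, (dthMulti l (fun a b => U a b α - Uinf α) θ t) ^ 2)
          ≤ C₂ l.length j ℓ * CkNorm (k₂ l.length j ℓ) φ * ((1 + κ * t) ^ ℓ)⁻¹)) ∧
      (∀ U₁ U₂ : Euc d → ℝ → Fin m → ℝ,
        IsLiftedNeuSol hd A n M (fun θ α => ∑ i, T i * pder i (fun x => φ x α) θ) U₁ →
        IsLiftedNeuSol hd A n M (fun θ α => ∑ i, T i * pder i (fun x => φ x α) θ) U₂ →
        (∃ K : ℝ, ∀ (θ : Euc d) (t : ℝ) (α : Fin m), 0 ≤ t → |U₁ θ t α| ≤ K) →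
        (∃ K : ℝ, ∀ (θ : Euc d) (t : ℝ) (α : Fin m), 0 ≤ t → |U₂ θ t α| ≤ K) →
        (∫⁻ t in Set.Ioi (0:ℝ), ∫⁻ θ in unitCell d, ENNReal.ofReal
            (∑ α, ((∑ i, (dth i (fun a b => U₁ a b α) θ t) ^ 2)
              + (deriv (fun b => U₁ θ b α) t) ^ 2)) < ⊤) →
        (∫⁻ t in Set.Ioi (0:ℝ), ∫⁻ θ in unitCell d, ENNReal.ofReal
            (∑ α, ((∑ i, (dth i (fun a b => U₂ a b α) θ t) ^ 2)
              + (deriv (fun b => U₂ θ b α) t) ^ 2)) < ⊤) →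
        ∃ c : Fin m → ℝ, ∀ (θ : Euc d) (t : ℝ) (α : Fin m), 0 ≤ t →
          U₁ θ t α = U₂ θ t α + c α) := by
  refine ⟨fun a b => (m * (d + 1) * (2 * Real.pi) ^ (2 * a) * (conS d m A).Ci' a b * cdat d m (a + b + 1)) + 1,
    kk d, CC A, ?_, fun a b c => CC_pos a b c, ?_⟩
  · intro a b
    have h1 := (conS d m A).Ci'_pos a b
    have h2 := cdat_pos d m (a + b + 1)
    have h3 := Real.pi_pos
    positivity
  intro n hn1 κ hκ M hM hl T hT hT1 φ hφ hp
  have hn : ‖n‖ = 1 := by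
    have h := euc_norm_sq n
    rw [hn1] at h
    have h0 := norm_nonneg n
    nlinarith
  refine ⟨?_, fun U₁ U₂ s1 s2 b1 b2 i1 i2 => lifted_uniq hn hκ hM hl U₁ U₂ s1 s2 b1 b2 i1 i2⟩
  obtain ⟨u, hL, h1, h2⟩ := (conS d m A).limit2 n hn κ hκ.1 (dio_of n hκ) (fun ξ => ‖phat φ ξ‖)
    (fun ξ => norm_nonneg _) (fun s => ⟨_, phat_Ns hφ hp s⟩) (gdat φ T) (gdat_zero T) (gdat_le n T hT hT1)
  have c : Ctx hd A n κ M T φ u := ⟨hn, hM, hl, hφ, hp, h1, h2, hL⟩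
  refine ⟨fun θ t α => Fsol n u α (θ, t), sol_neu A n hn hM hl hφ hp h1 h2 hL, fun l j => ?_, c.est2⟩
  refine (c.est1 l j).trans ?_
  have h := sq_nonneg (CkNorm (l.length + j + 1) φ)
  nlinarith
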